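/- For every real number x ≥ 1, the interval [x, x + x^(105/106)] contains at least one prime; that is, there exists a prime natural number p with x ≤ p ≤ x + x^(105/106). -/

import Mathlib

namespace PrimeGap

section

open Complex Filter Topology

/-- Removing a zero of finite order from an entire function. -/
theorem exists_eq_pow_mul_of_order {g : ℂ → ℂ} (hg : Differentiable ℂ g) (a : ℂ)
    (ha : analyticOrderAt g a ≠ ⊤) :
    ∃ k : ℂ → ℂ, Differentiable ℂ k ∧ k a ≠ 0 ∧
      ∀ z, g z = (z - a) ^ analyticOrderNatAt g a * k z := by
  obtain ⟨n, hn⟩ := ENat.ne_top_iff_exists.mp ha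
  have hn' : analyticOrderNatAt g a = n := by simp [analyticOrderNatAt, ← hn]
  rw [hn']
  obtain ⟨h, han, h0, hev⟩ := ((hg.analyticAt a).analyticOrderAt_eq_natCast (n := n)).mp hn.symm
  classical
  let k : ℂ → ℂ := fun z => if z = a then h a else g z / (z - a) ^ n
  have hk : k =ᶠ[𝓝 a] h := by
    filter_upwards [hev] with z hz
    by_cases hza : z = a
    · simp [k, hza]
    · have : (z - a) ^ n ≠ 0 := pow_ne_zero _ (sub_ne_zero.mpr hza)
      simp only [k, hza, if_false, hz, smul_eq_mul]
      field_simp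
  refine ⟨k, fun z => ?_, by simpa [k] using h0, fun z => ?_⟩
  · by_cases hza : z = a
    · subst hza
      exact (han.congr hk.symm).differentiableAt
    · have h1 : k =ᶠ[𝓝 z] fun z => g z / (z - a) ^ n := by
        filter_upwards [isOpen_ne.mem_nhds hza] with w hw
        have hw' : w ≠ a := hw
        simp [k, hw']
      refine DifferentiableAt.congr_of_eventuallyEq ?_ h1
      exact (hg z).div (by fun_prop) (pow_ne_zero _ (sub_ne_zero.mpr hza))
  · by_cases hza : z = a
    · subst hza
      have := hev.self_of_nhds
      simpa [k] using this
    · have : (z - a) ^ n ≠ 0 := pow_ne_zero _ (sub_ne_zero.mpr hza)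
      simp only [k, hza, if_false]
      field_simp

theorem exists_eq_prod_mul {f : ℂ → ℂ} (hf : Differentiable ℂ f)
    (hord : ∀ a, analyticOrderAt f a ≠ ⊤) (S : Finset ℂ) :
    ∃ g : ℂ → ℂ, Differentiable ℂ g ∧ (∀ a ∈ S, g a ≠ 0) ∧
      ∀ z, f z = (∏ a ∈ S, (z - a) ^ analyticOrderNatAt f a) * g z := by
  classical
  induction S using Finset.induction_on with
  | empty => exact ⟨f, hf, by simp, by simp⟩
  | insert a S ha ih =>
    obtain ⟨g, hg, hg0, hfg⟩ := ih
    set P : ℂ → ℂ := fun z => ∏ a ∈ S, (z - a) ^ analyticOrderNatAt f a with hP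
    have hPd : Differentiable ℂ P := by
      simp only [hP]; fun_prop
    have hPa : P a ≠ 0 := by
      simp only [hP]
      refine Finset.prod_ne_zero_iff.mpr fun b hb => pow_ne_zero _ (sub_ne_zero.mpr ?_)
      rintro rfl; exact ha hb
    have hfPg : f = P * g := by ext z; simp [hfg z, hP]
    have h1 : analyticOrderAt f a = analyticOrderAt g a := by
      rw [hfPg, analyticOrderAt_mul (hPd.analyticAt a) (hg.analyticAt a),
        (hPd.analyticAt a).analyticOrderAt_eq_zero.mpr hPa, zero_add]
    have h2 : analyticOrderNatAt f a = analyticOrderNatAt g a := by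
      simp [analyticOrderNatAt, h1]
    obtain ⟨k, hk, hka, hgk⟩ := exists_eq_pow_mul_of_order hg a (h1 ▸ hord a)
    refine ⟨k, hk, ?_, fun z => ?_⟩
    · intro b hb
      rcases Finset.mem_insert.mp hb with rfl | hb
      · exact hka
      · have := hg0 b hb
        rw [hgk b] at this
        exact right_ne_zero_of_mul this
    · rw [hfg z, hgk z, Finset.prod_insert ha, h2]; ring

/-- Quantitative comparison of the logarithmic derivative of an even entire function with the
partial fractions coming from the zeros in a disc. -/
theorem norm_logDeriv_sub_sum_le {f : ℂ → ℂ} (hf : Differentiable ℂ f) (heven : ∀ z, f (-z) = f z)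
    (hf0 : f 0 ≠ 0) {R M : ℝ} (hR : 0 < R) (hM : 0 < M)
    (hbound : ∀ z, ‖z‖ = 2 * R → ‖f z‖ ≤ ‖f 0‖ * Real.exp M)
    (S : Finset ℂ) (hS : ∀ a, a ∈ S ↔ f a = 0 ∧ ‖a‖ ≤ R)
    {z : ℂ} (hz : ‖z‖ ≤ R / 8) (hfz : f z ≠ 0) :
    ‖logDeriv f z - ∑ a ∈ S, (analyticOrderNatAt f a : ℂ) / (z - a)‖ ≤ 64 * M * ‖z‖ / R ^ 2 := by
  classical
  have hfan : AnalyticOnNhd ℂ f Set.univ := fun z _ => hf.analyticAt z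
  have hord : ∀ a, analyticOrderAt f a ≠ ⊤ := by
    intro a
    refine hfan.analyticOrderAt_ne_top_of_isPreconnected isPreconnected_univ
      (Set.mem_univ 0) (Set.mem_univ a) ?_
    rw [(hf.analyticAt 0).analyticOrderAt_eq_zero.mpr hf0]
    simp
  have hS0 : ∀ a ∈ S, a ≠ 0 := by
    rintro a ha rfl
    exact hf0 ((hS 0).mp ha).1
  obtain ⟨g, hg, hgS, hfg⟩ := exists_eq_prod_mul hf hord S
  set m := fun a => analyticOrderNatAt f a with hm
  -- the product without normalisation
  have hP0 : ∀ w, (∀ a ∈ S, w ≠ a) → (∏ a ∈ S, (w - a) ^ m a) ≠ 0 := fun w hw =>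
    Finset.prod_ne_zero_iff.mpr fun b hb => pow_ne_zero _ (sub_ne_zero.mpr (hw b hb))
  have hgne : ∀ w, ‖w‖ ≤ R → g w ≠ 0 := by
    intro w hw h0
    have h1 : f w = 0 := by rw [hfg w, h0, mul_zero]
    exact hgS w ((hS w).mpr ⟨h1, hw⟩) h0
  have hgle : ∀ w, ‖w‖ ≤ 2 * R → ‖g w‖ ≤ ‖g 0‖ * Real.exp M := by
    intro w hw
    have hfr : ∀ u ∈ frontier (Metric.ball (0 : ℂ) (2 * R)), ‖g u‖ ≤ ‖g 0‖ * Real.exp M := by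
      intro u hu
      rw [frontier_ball _ (by positivity)] at hu
      have hu' : ‖u‖ = 2 * R := by simpa using hu
      have h1 := hbound u hu'
      rw [hfg u, hfg 0, norm_mul, norm_mul] at h1
      have h2 : ‖∏ a ∈ S, ((0 : ℂ) - a) ^ m a‖ ≤ ‖∏ a ∈ S, (u - a) ^ m a‖ := by
        rw [norm_prod, norm_prod]
        refine Finset.prod_le_prod (fun _ _ => norm_nonneg _) fun a ha => ?_
        rw [norm_pow, norm_pow]
        refine pow_le_pow_left₀ (norm_nonneg _) ?_ _
        have h3 : ‖a‖ ≤ R := ((hS a).mp ha).2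
        have h4 : ‖u‖ - ‖a‖ ≤ ‖u - a‖ := norm_sub_norm_le u a
        rw [zero_sub, norm_neg]
        linarith
      have h5 : 0 < ‖∏ a ∈ S, ((0 : ℂ) - a) ^ m a‖ := by
        rw [norm_pos_iff]
        exact hP0 0 fun a ha => (hS0 a ha).symm
      have h6 : ‖∏ a ∈ S, ((0 : ℂ) - a) ^ m a‖ * ‖g u‖ ≤
          ‖∏ a ∈ S, ((0 : ℂ) - a) ^ m a‖ * (‖g 0‖ * Real.exp M) :=
        calc _ ≤ ‖∏ a ∈ S, (u - a) ^ m a‖ * ‖g u‖ := by gcongr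
          _ ≤ _ := by rw [← mul_assoc]; exact h1
      exact le_of_mul_le_mul_left h6 h5
    refine Complex.norm_le_of_forall_mem_frontier_norm_le Metric.isBounded_ball
      hg.diffContOnCl hfr ?_
    rw [closure_ball _ (by positivity)]
    simpa using hw
  -- the logarithm of `g`
  have hqd : DifferentiableOn ℂ (logDeriv g) (Metric.ball 0 R) := by
    intro w hw
    have hw' : ‖w‖ ≤ R := by simpa using (Metric.mem_ball.mp hw).le
    have : DifferentiableAt ℂ (fun w => deriv g w / g w) w :=
      ((hg.analyticAt w).deriv.differentiableAt).div (hg w) (hgne w hw')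
    exact this.differentiableWithinAt
  obtain ⟨h₀, hh₀⟩ := hqd.isExactOn_ball
  let h : ℂ → ℂ := fun w => h₀ w - h₀ 0
  have hh : ∀ w ∈ Metric.ball (0 : ℂ) R, HasDerivAt h (logDeriv g w) w := fun w hw =>
    (hh₀ w hw).sub_const _
  have hgexp : ∀ w ∈ Metric.ball (0 : ℂ) R, g w = g 0 * exp (h w) := by
    have hder : ∀ w ∈ Metric.ball (0 : ℂ) R,
        HasDerivAt (fun w => g w * exp (-h w)) 0 w := by
      intro w hw
      have hw' : ‖w‖ ≤ R := by simpa using (Metric.mem_ball.mp hw).le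
      have h1 : HasDerivAt (fun w => g w * exp (-h w))
          (deriv g w * exp (-h w) + g w * (exp (-h w) * -logDeriv g w)) w :=
        (hg w).hasDerivAt.mul ((hh w hw).neg.cexp)
      refine h1.congr_deriv ?_
      rw [logDeriv_apply]
      field_simp [hgne w hw']
      ring
    intro w hw
    have hc := (convex_ball (0 : ℂ) R).is_const_of_fderivWithin_eq_zero (𝕜 := ℂ)
      (f := fun w => g w * exp (-h w))
      (fun w hw => (hder w hw).differentiableAt.differentiableWithinAt)
      (fun w hw => by
        rw [fderivWithin_of_isOpen Metric.isOpen_ball hw]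
        ext; simp [(hder w hw).hasFDerivAt.fderiv]) hw (Metric.mem_ball_self hR)
    have h0 : h 0 = 0 := by simp [h]
    simp only [h0, neg_zero, exp_zero, mul_one, exp_neg] at hc
    rw [← hc]
    field_simp [exp_ne_zero]
  have hmaps : Set.MapsTo h (Metric.ball 0 R) {w | w.re ≤ M} := by
    intro w hw
    have hw' : ‖w‖ ≤ R := by simpa using (Metric.mem_ball.mp hw).le
    have h1 := hgle w (by linarith)
    rw [hgexp w hw, norm_mul, Complex.norm_exp] at h1
    have h2 : 0 < ‖g 0‖ := norm_pos_iff.mpr (hgne 0 (by simpa using hR.le))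
    exact Real.exp_le_exp.mp (le_of_mul_le_mul_left h1 h2)
  have hhd : DifferentiableOn ℂ h (Metric.ball 0 R) := fun w hw =>
    (hh w hw).differentiableAt.differentiableWithinAt
  have hBC : ∀ w, ‖w‖ ≤ R / 2 → ‖h w‖ ≤ 2 * M := by
    intro w hw
    have := Complex.borelCaratheodory_zero hM hhd hmaps hR
      (by simpa using lt_of_le_of_lt hw (by linarith)) (by simp [h] : h 0 = 0) (z := w)
    refine this.trans ?_
    rw [div_le_iff₀ (by linarith)]
    nlinarith
  have hcauchy : ∀ {φ : ℂ → ℂ} {r B : ℝ}, DifferentiableOn ℂ φ (Metric.ball 0 R) → 0 < r →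
      2 * r < R → (∀ w, ‖w‖ ≤ 2 * r → ‖φ w‖ ≤ B) → ∀ w, ‖w‖ ≤ r → ‖deriv φ w‖ ≤ B / r := by
    intro φ r B hφ hr hrR hB w hw
    have hu : ∀ u, ‖u - w‖ ≤ r → ‖u‖ ≤ 2 * r := fun u h1 => by
      have h2 : ‖u‖ ≤ ‖u - w‖ + ‖w‖ := by simpa using norm_add_le (u - w) w
      linarith
    refine Complex.norm_deriv_le_of_forall_mem_sphere_norm_le hr
      (hφ.mono (Metric.closure_ball_subset_closedBall.trans fun u h1 => ?_)).diffContOnCl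
      fun u h1 => hB u (hu u (mem_sphere_iff_norm.mp h1).le)
    simpa using (hu u (mem_closedBall_iff_norm.mp h1)).trans_lt hrR
  have hq1 : ∀ w, ‖w‖ ≤ R / 4 → ‖logDeriv g w‖ ≤ 8 * M / R := by
    intro w hw
    have hwb : w ∈ Metric.ball (0 : ℂ) R := by simpa using lt_of_le_of_lt hw (by linarith)
    rw [← (hh w hwb).deriv]
    refine (hcauchy hhd (by positivity) (by linarith) (fun w hw => hBC w (by linarith)) w hw).trans
      (le_of_eq ?_)
    field_simp
    norm_num
  have hq2 : ∀ w, ‖w‖ ≤ R / 8 → ‖deriv (logDeriv g) w‖ ≤ 64 * M / R ^ 2 := by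
    intro w hw
    refine (hcauchy hqd (by positivity) (by linarith) (fun w hw => hq1 w (by linarith)) w hw).trans
      (le_of_eq ?_)
    field_simp
    norm_num
  have hlip : ‖logDeriv g z - logDeriv g 0‖ ≤ 64 * M / R ^ 2 * ‖z - 0‖ := by
    refine (convex_closedBall (0 : ℂ) (R / 8)).norm_image_sub_le_of_norm_deriv_le ?_ ?_ ?_ ?_
    · intro u hu
      have hu' : ‖u‖ ≤ R / 8 := by simpa using hu
      exact hqd.differentiableAt (Metric.isOpen_ball.mem_nhds
        (by simpa using lt_of_le_of_lt hu' (by linarith)))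
    · intro u hu
      exact hq2 u (by simpa using hu)
    · simpa using by positivity
    · simpa using hz
  -- logarithmic derivative of the product
  have hlog : ∀ w, f w ≠ 0 → logDeriv f w = ∑ a ∈ S, (m a : ℂ) / (w - a) + logDeriv g w := by
    intro w hw
    have hne : ∀ a ∈ S, w - a ≠ 0 := by
      intro a ha h0
      rw [sub_eq_zero] at h0
      exact hw (h0 ▸ ((hS a).mp ha).1)
    have hgw : g w ≠ 0 := by
      intro h0; exact hw (by rw [hfg w, h0, mul_zero])
    have hfe : f = fun z => (∏ a ∈ S, (z - a) ^ m a) * g z := funext hfg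
    conv_lhs => rw [hfe]
    rw [logDeriv_mul w (hP0 w fun a ha => sub_ne_zero.mp (hne a ha)) hgw (by fun_prop) (hg w)]
    congr 1
    rw [logDeriv_prod (f := fun a z => (z - a) ^ m a)
      (fun a ha => pow_ne_zero _ (hne a ha)) (fun a ha => by fun_prop)]
    refine Finset.sum_congr rfl fun a ha => ?_
    rw [logDeriv_fun_pow (by fun_prop)]
    simp [logDeriv_apply, div_eq_mul_inv]
  have hsum0 : ∑ a ∈ S, (m a : ℂ) / (0 - a) = 0 := by
    have hmneg : ∀ a, m (-a) = m a := by
      intro a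
      have h1 : f ∘ (fun z => -z) = f := by ext z; simp [heven]
      have := analyticOrderAt_comp_of_deriv_ne_zero (f := f) (g := fun z : ℂ => -z) (z₀ := a)
        (by fun_prop) (by simp)
      rw [h1] at this
      simp [hm, analyticOrderNatAt, this]
    have hneg : ∑ a ∈ S, (m a : ℂ) / (0 - a) = ∑ a ∈ S, -((m a : ℂ) / (0 - a)) := by
      have hm' : ∀ a ∈ S, -a ∈ S := fun a ha => by rw [hS] at ha ⊢; simpa [heven] using ha
      refine Finset.sum_nbij' (fun a => -a) (fun a => -a) hm' hm' (by simp) (by simp) fun a _ => ?_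
      rw [hmneg]
      simp [div_neg]
    rw [Finset.sum_neg_distrib] at hneg
    exact self_eq_neg.mp hneg
  have hd0 : deriv f 0 = 0 := by
    have h1 : f = fun z => f (-z) := by ext z; simp [heven]
    have h2 := congrArg (fun F => deriv F 0) h1
    simp only [deriv_comp_neg, neg_zero] at h2
    exact self_eq_neg.mp h2
  have hq0 : logDeriv g 0 = 0 := by
    have := hlog 0 hf0
    rw [hsum0, logDeriv_apply, hd0, zero_div, zero_add] at this
    exact this.symm
  rw [hlog z hfz, add_sub_cancel_left]
  rw [hq0, sub_zero, sub_zero] at hlip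
  exact hlip.trans (le_of_eq (by ring))

end

section

open Complex Filter Topology MeasureTheory Set

/-- The function `t ↦ {t}` on `(1, ∞)`, extended by zero. -/
noncomputable def fractTail : ℝ → ℂ := (Ioi (1 : ℝ)).indicator fun t => ((Int.fract t : ℝ) : ℂ)

theorem norm_fractTail_le (t : ℝ) : ‖fractTail t‖ ≤ 1 := by
  by_cases ht : t ∈ Ioi (1 : ℝ)
  · rw [fractTail, indicator_of_mem ht, norm_real, Real.norm_of_nonneg (Int.fract_nonneg t)]
    exact (Int.fract_lt_one t).le
  · simp [fractTail, indicator_of_notMem ht]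

theorem measurable_fractTail : Measurable fractTail :=
  (Complex.measurable_ofReal.comp measurable_fract).indicator measurableSet_Ioi

/-- The integral `∫_1^∞ {t} t^{-s-1} dt`. -/
noncomputable def fractIntegral (s : ℂ) : ℂ :=
  ∫ t in Ioi (1 : ℝ), ((Int.fract t : ℝ) : ℂ) * (t : ℂ) ^ (-(s + 1))

theorem fractIntegral_eq_mellin (s : ℂ) : fractIntegral s = mellin fractTail (-s) := by
  have h : ∀ t : ℝ, (t : ℂ) ^ (-s - 1) • fractTail t =
      (Ioi (1 : ℝ)).indicator (fun t => ((Int.fract t : ℝ) : ℂ) * (t : ℂ) ^ (-(s + 1))) t := by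
    intro t
    by_cases ht : t ∈ Ioi (1 : ℝ)
    · rw [fractTail, indicator_of_mem ht, indicator_of_mem ht, smul_eq_mul, mul_comm]
      congr 2; ring
    · simp [fractTail, indicator_of_notMem ht]
  rw [mellin, fractIntegral]
  simp_rw [h]
  rw [setIntegral_indicator measurableSet_Ioi]
  congr 2
  ext t; simp

theorem differentiableAt_fractIntegral {s : ℂ} (hs : 0 < s.re) :
    DifferentiableAt ℂ fractIntegral s := by
  have h1 : fractIntegral = fun s => mellin fractTail (-s) := funext fractIntegral_eq_mellin
  rw [h1]
  have h2 : DifferentiableAt ℂ (mellin fractTail) (-s) := by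
    refine mellin_differentiableAt_of_isBigO_rpow (a := 0) (b := -s.re - 1) ?_ ?_ ?_ ?_ ?_
    · refine (LocallyIntegrable.locallyIntegrableOn ?_ _)
      refine (locallyIntegrable_const (1 : ℝ)).mono
        measurable_fractTail.aestronglyMeasurable (Eventually.of_forall fun t => ?_)
      simpa using norm_fractTail_le t
    · refine Asymptotics.IsBigO.of_bound 1 (Eventually.of_forall fun t => ?_)
      simpa using norm_fractTail_le t
    · simpa using hs
    · refine Asymptotics.IsBigO.of_bound 1 ?_
      filter_upwards [Ioo_mem_nhdsGT (zero_lt_one' ℝ)] with t ht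
      have : fractTail t = 0 := by
        rw [fractTail, indicator_of_notMem]; simpa using ht.2.le
      rw [this]; simp
    · simp
  exact h2.comp s differentiableAt_id.neg

theorem sub_one_mul_riemannZeta_eq_of_one_lt {s : ℂ} (hs : 1 < s.re) :
    (s - 1) * riemannZeta s = s - s * (s - 1) * fractIntegral s := by
  have h1 : riemannZeta s = s * ∫ t in Ioi (1 : ℝ),
      (∑ k ∈ Finset.Icc 1 ⌊t⌋₊, ((1 : ℝ) : ℂ)) * (t : ℂ) ^ (-(s + 1)) := by
    rw [← LSeries_one_eq_riemannZeta hs]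
    have := LSeries_eq_mul_integral_of_nonneg (fun _ => 1) (r := 1) zero_le_one hs ?_
      (fun _ => zero_le_one)
    · rw [← this]; congr 1
    · refine Asymptotics.IsBigO.of_bound 1 (Eventually.of_forall fun n => ?_)
      simp
  have hre : (-s).re < -1 := by simpa using hs
  have hint1 : IntegrableOn (fun t : ℝ => (t : ℂ) ^ (-s)) (Ioi 1) :=
    integrableOn_Ioi_cpow_of_lt hre zero_lt_one
  have hval : ∫ t in Ioi (1 : ℝ), (t : ℂ) ^ (-s) = 1 / (s - 1) := by
    rw [integral_Ioi_cpow_of_lt hre zero_lt_one]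
    simp only [ofReal_one, one_cpow]
    rw [neg_div, ← div_neg]; congr 1; ring
  have hint2 : IntegrableOn (fun t : ℝ => ((Int.fract t : ℝ) : ℂ) * (t : ℂ) ^ (-(s + 1))) (Ioi 1) := by
    have h0 : IntegrableOn (fun t : ℝ => (t : ℂ) ^ (-(s + 1))) (Ioi 1) :=
      integrableOn_Ioi_cpow_of_lt (by simp; linarith) zero_lt_one
    refine Integrable.mono h0 ?_ (Eventually.of_forall fun t => ?_)
    · exact ((Complex.measurable_ofReal.comp measurable_fract).aestronglyMeasurable).mul
        h0.aestronglyMeasurable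
    · rw [norm_mul, norm_real, Real.norm_of_nonneg (Int.fract_nonneg t)]
      exact mul_le_of_le_one_left (norm_nonneg _) (Int.fract_lt_one t).le
  have h2 : ∫ t in Ioi (1 : ℝ), (∑ k ∈ Finset.Icc 1 ⌊t⌋₊, ((1 : ℝ) : ℂ)) * (t : ℂ) ^ (-(s + 1)) =
      1 / (s - 1) - fractIntegral s := by
    rw [← hval, fractIntegral, ← integral_sub hint1 hint2]
    refine setIntegral_congr_fun measurableSet_Ioi fun t ht => ?_
    have ht0 : (0 : ℝ) < t := lt_trans zero_lt_one ht
    have htc : (t : ℂ) ≠ 0 := by exact_mod_cast ht0.ne'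
    have h3 : (∑ k ∈ Finset.Icc 1 ⌊t⌋₊, ((1 : ℝ) : ℂ)) = (t : ℂ) - ((Int.fract t : ℝ) : ℂ) := by
      have h4 : (⌊t⌋₊ : ℝ) = t - Int.fract t := by
        rw [natCast_floor_eq_intCast_floor ht0.le]; exact (Int.self_sub_fract t).symm
      simp only [ofReal_one, Finset.sum_const, Nat.card_Icc, Nat.add_sub_cancel, nsmul_eq_mul,
        mul_one]
      exact_mod_cast congrArg (fun x : ℝ => (x : ℂ)) h4
    rw [h3, sub_mul]
    congr 1
    rw [show -s = 1 + -(s + 1) by ring, cpow_add _ _ htc, cpow_one]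
  have hs1 : s - 1 ≠ 0 := by
    intro h; rw [sub_eq_zero] at h; rw [h] at hs; simp at hs
  rw [h1, h2]
  field_simp

theorem sub_one_mul_riemannZeta_eq {s : ℂ} (hs : 0 < s.re) (hs1 : s ≠ 1) :
    (s - 1) * riemannZeta s = s - s * (s - 1) * fractIntegral s := by
  set U : Set ℂ := {s | 0 < s.re}
  have hU : IsOpen U := isOpen_lt continuous_const Complex.continuous_re
  have hUc : IsPreconnected U := (convex_halfSpace_re_gt 0).isPreconnected
  have h1 : AnalyticOnNhd ℂ riemannZeta₁ U := fun z _ =>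
    differentiable_riemannZeta₁.analyticAt z
  have h2 : AnalyticOnNhd ℂ (fun s => s - s * (s - 1) * fractIntegral s) U := by
    refine DifferentiableOn.analyticOnNhd (fun z hz => ?_) hU
    have := differentiableAt_fractIntegral hz
    exact DifferentiableAt.differentiableWithinAt (by fun_prop)
  have h3 : EqOn riemannZeta₁ (fun s => s - s * (s - 1) * fractIntegral s) U := by
    refine h1.eqOn_of_preconnected_of_eventuallyEq h2 hUc (z₀ := 2) (by simp [U]) ?_
    have h4 : {s : ℂ | 1 < s.re} ∈ 𝓝 (2 : ℂ) :=
      (isOpen_lt continuous_const Complex.continuous_re).mem_nhds (by simp)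
    filter_upwards [h4] with z hz
    have hz1 : z ≠ 1 := by rintro rfl; simp at hz
    rw [← sub_one_mul_riemannZeta_eq_of_one_lt hz, riemannZeta_eq_inv_sub_mul hz1]
    field_simp [sub_ne_zero.mpr hz1]
  refine Eq.trans ?_ (h3 hs)
  rw [riemannZeta_eq_inv_sub_mul hs1]
  field_simp [sub_ne_zero.mpr hs1]

theorem norm_fractIntegral_le {s : ℂ} (hs : 0 < s.re) : ‖fractIntegral s‖ ≤ 1 / s.re := by
  have h0 : IntegrableOn (fun t : ℝ => t ^ (-s.re - 1)) (Ioi 1) :=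
    integrableOn_Ioi_rpow_of_lt (by linarith) zero_lt_one
  have h1 : ∫ t in Ioi (1 : ℝ), t ^ (-s.re - 1) = 1 / s.re := by
    rw [integral_Ioi_rpow_of_lt (by linarith) zero_lt_one]
    simp
  rw [← h1, fractIntegral]
  refine norm_integral_le_of_norm_le h0 ?_
  filter_upwards [ae_restrict_mem measurableSet_Ioi] with t ht
  have ht0 : (0 : ℝ) < t := lt_trans zero_lt_one ht
  rw [norm_mul, norm_real, Real.norm_of_nonneg (Int.fract_nonneg t),
    norm_cpow_eq_rpow_re_of_pos ht0]
  have : (-(s + 1)).re = -s.re - 1 := by simp; ring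
  rw [this]
  exact mul_le_of_le_one_left (Real.rpow_nonneg ht0.le _) (Int.fract_lt_one t).le

theorem norm_riemannZeta_le {s : ℂ} (hs : 0 < s.re) (hs1 : s ≠ 1) :
    ‖riemannZeta s‖ ≤ ‖s‖ / ‖s - 1‖ + ‖s‖ / s.re := by
  have h := sub_one_mul_riemannZeta_eq hs hs1
  have h1 : s - 1 ≠ 0 := sub_ne_zero.mpr hs1
  have h2 : riemannZeta s = s / (s - 1) - s * fractIntegral s := by
    field_simp
    linear_combination h
  rw [h2]
  refine (norm_sub_le _ _).trans ?_
  rw [norm_div, norm_mul, div_eq_mul_one_div ‖s‖ s.re]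
  gcongr
  exact norm_fractIntegral_le hs

/-- `ζ` does not vanish on the real interval `(0, 1)`. -/
theorem riemannZeta_ne_zero_of_real {x : ℝ} (h0 : 0 < x) (h1 : x < 1) : riemannZeta x ≠ 0 := by
  intro h
  have hx1 : (x : ℂ) ≠ 1 := by exact_mod_cast h1.ne
  have := sub_one_mul_riemannZeta_eq (s := x) (by simpa using h0) hx1
  have hJ : fractIntegral x = ((∫ t in Ioi (1 : ℝ), Int.fract t * t ^ (-(x + 1)) : ℝ) : ℂ) := by
    rw [fractIntegral]
    refine Eq.trans ?_ (integral_ofReal (𝕜 := ℂ))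
    refine setIntegral_congr_fun measurableSet_Ioi fun t ht => ?_
    have ht0 : (0 : ℝ) < t := lt_trans zero_lt_one ht
    rw [show (-((x : ℂ) + 1)) = ((-(x + 1) : ℝ) : ℂ) by push_cast; ring, ← ofReal_cpow ht0.le]
    exact (ofReal_mul _ _).symm
  have hJ0 : 0 ≤ ∫ t in Ioi (1 : ℝ), Int.fract t * t ^ (-(x + 1)) := by
    refine setIntegral_nonneg measurableSet_Ioi fun t ht => ?_
    have ht0 : (0 : ℝ) < t := lt_trans zero_lt_one ht
    exact mul_nonneg (Int.fract_nonneg t) (Real.rpow_nonneg ht0.le _)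
  rw [h, hJ, mul_zero] at this
  have h2 : (0 : ℝ) = x - x * (x - 1) * ∫ t in Ioi (1 : ℝ), Int.fract t * t ^ (-(x + 1)) := by
    exact_mod_cast this
  nlinarith [mul_nonneg (mul_nonneg h0.le (sub_nonneg.mpr h1.le)) hJ0]

end

section

open Complex hiding exp log exp_add exp_neg exp_zero
open Filter Topology MeasureTheory Set
open Real

theorem exists_norm_mellin_le {f : ℝ → ℂ} {a b : ℝ} (ha : MellinConvergent f a)
    (hb : MellinConvergent f b) :
    ∃ B : ℝ, ∀ z : ℂ, a ≤ z.re → z.re ≤ b → ‖mellin f z‖ ≤ B := by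
  have ha' : IntegrableOn (fun t : ℝ => ‖(t : ℂ) ^ ((a : ℂ) - 1) • f t‖) (Ioi 0) :=
    Integrable.norm ha
  have hb' : IntegrableOn (fun t : ℝ => ‖(t : ℂ) ^ ((b : ℂ) - 1) • f t‖) (Ioi 0) :=
    Integrable.norm hb
  refine ⟨∫ t in Ioi (0 : ℝ), (‖(t : ℂ) ^ ((a : ℂ) - 1) • f t‖ + ‖(t : ℂ) ^ ((b : ℂ) - 1) • f t‖),
    fun z hz1 hz2 => ?_⟩
  refine norm_integral_le_of_norm_le (ha'.add hb') ?_
  filter_upwards [ae_restrict_mem measurableSet_Ioi] with t ht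
  have ht0 : (0 : ℝ) < t := ht
  simp only [norm_smul, norm_cpow_eq_rpow_re_of_pos ht0, sub_re, one_re, ofReal_re]
  rw [← add_mul]
  refine mul_le_mul_of_nonneg_right ?_ (norm_nonneg _)
  rcases le_total t 1 with h1 | h1
  · have := rpow_le_rpow_of_exponent_ge ht0 h1 (show a - 1 ≤ z.re - 1 by linarith)
    have h2 := rpow_nonneg ht0.le (b - 1)
    linarith
  · have := rpow_le_rpow_of_exponent_le h1 (show z.re - 1 ≤ b - 1 by linarith)
    have h2 := rpow_nonneg ht0.le (a - 1)
    linarith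

theorem exists_norm_completedRiemannZeta₀_le (a b : ℝ) :
    ∃ B : ℝ, ∀ s : ℂ, a ≤ s.re → s.re ≤ b → ‖completedRiemannZeta₀ s‖ ≤ B := by
  set P := HurwitzZeta.hurwitzEvenFEPair 0
  have hconv : ∀ z : ℂ, MellinConvergent P.f_modif z := fun z =>
    (P.isStrongFEPair_toStrongFEPair.hasMellin z).1
  obtain ⟨B, hB⟩ := exists_norm_mellin_le (hconv (a / 2 : ℝ)) (hconv (b / 2 : ℝ))
  refine ⟨B / 2, fun s h1 h2 => ?_⟩
  have h3 : completedRiemannZeta₀ s = mellin P.f_modif (s / 2) / 2 := rfl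
  rw [h3, norm_div]
  have h4 : (s / 2).re = s.re / 2 := by simp
  have := hB (s / 2) (by rw [h4]; linarith) (by rw [h4]; linarith)
  simpa using div_le_div_of_nonneg_right this (by norm_num : (0 : ℝ) ≤ 2)

theorem norm_Gamma_le {z : ℂ} (hz : 0 < z.re) : ‖Gamma z‖ ≤ Real.Gamma z.re := by
  rw [Complex.Gamma_eq_integral hz, Real.Gamma_eq_integral hz, Complex.GammaIntegral]
  refine norm_integral_le_of_norm_le (Real.GammaIntegral_convergent hz) ?_
  filter_upwards [ae_restrict_mem measurableSet_Ioi] with t ht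
  have ht0 : (0 : ℝ) < t := ht
  rw [norm_mul, norm_cpow_eq_rpow_re_of_pos ht0, norm_real, norm_of_nonneg (exp_nonneg _)]
  simp

theorem Gamma_le_exp_rpow {x : ℝ} (hx : 2 ≤ x) :
    Real.Gamma x ≤ exp (2 * (1 + x) ^ (3 / 2 : ℝ)) := by
  set n := ⌈x⌉₊ with hn
  have hxn : x ≤ n := Nat.le_ceil x
  have hnx : (n : ℝ) ≤ 1 + x := by
    have := Nat.ceil_lt_add_one (show 0 ≤ x by linarith); linarith
  have h1 : Real.Gamma x ≤ Real.Gamma (n + 1) := by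
    refine Real.Gamma_strictMonoOn_Ici.monotoneOn hx ?_ (by linarith)
    simp only [mem_Ici]; linarith
  rw [Real.Gamma_nat_eq_factorial] at h1
  have h2 : (n.factorial : ℝ) ≤ (n : ℝ) ^ n := by exact_mod_cast Nat.factorial_le_pow n
  have hn0 : (0 : ℝ) < n := by linarith
  have h3 : (n : ℝ) ^ n = exp (n * log n) := by
    rw [mul_comm, ← rpow_def_of_pos hn0, rpow_natCast]
  have h4 : log n ≤ (n : ℝ) ^ (1 / 2 : ℝ) / (1 / 2) :=
    log_le_rpow_div hn0.le (by norm_num)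
  have h5 : (n : ℝ) * log n ≤ 2 * (1 + x) ^ (3 / 2 : ℝ) := by
    calc (n : ℝ) * log n ≤ n * ((n : ℝ) ^ (1 / 2 : ℝ) / (1 / 2)) := by gcongr
      _ = 2 * (n : ℝ) ^ (3 / 2 : ℝ) := by
        rw [show (3 / 2 : ℝ) = 1 + 1 / 2 by norm_num, rpow_add hn0, rpow_one]; ring
      _ ≤ _ := by gcongr
  calc Real.Gamma x ≤ (n : ℝ) ^ n := h1.trans h2
    _ ≤ _ := by rw [h3]; exact exp_le_exp.mpr h5

/-- The entire function `s (s - 1) Λ(s)`. -/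
noncomputable def xiFun (s : ℂ) : ℂ := 1 - s * (1 - s) * completedRiemannZeta₀ s

theorem differentiable_xiFun : Differentiable ℂ xiFun := by
  unfold xiFun
  have := differentiable_completedZeta₀
  fun_prop

theorem xiFun_one_sub (s : ℂ) : xiFun (1 - s) = xiFun s := by
  simp only [xiFun, completedRiemannZeta₀_one_sub]; ring

theorem xiFun_eq {s : ℂ} (h0 : s ≠ 0) (h1 : s ≠ 1) :
    xiFun s = s * (s - 1) * completedRiemannZeta s := by
  have h1' : 1 - s ≠ 0 := sub_ne_zero.mpr h1.symm
  rw [xiFun, completedRiemannZeta_eq]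
  field_simp
  ring

theorem xiFun_eq_Gammaℝ_mul {s : ℂ} (h0 : 0 < s.re) (h1 : s ≠ 1) :
    xiFun s = s * (s - 1) * (Gammaℝ s * riemannZeta s) := by
  have hs0 : s ≠ 0 := by rintro rfl; simp at h0
  rw [xiFun_eq hs0 h1, riemannZeta_def_of_ne_zero hs0]
  field_simp [Gammaℝ_ne_zero_of_re_pos h0]

theorem xiFun_zero : xiFun 0 = 1 := by simp [xiFun]

theorem xiFun_one : xiFun 1 = 1 := by simp [xiFun]

theorem xiFun_ne_zero_of_one_le_re {s : ℂ} (hs : 1 ≤ s.re) : xiFun s ≠ 0 := by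
  by_cases h1 : s = 1
  · rw [h1, xiFun_one]; exact one_ne_zero
  · have h0 : 0 < s.re := by linarith
    rw [xiFun_eq_Gammaℝ_mul h0 h1]
    have hs0 : s ≠ 0 := by rintro rfl; simp at h0
    exact mul_ne_zero (mul_ne_zero hs0 (sub_ne_zero.mpr h1))
      (mul_ne_zero (Gammaℝ_ne_zero_of_re_pos h0) (riemannZeta_ne_zero_of_one_le_re hs))

theorem re_lt_one_of_xiFun_eq_zero {s : ℂ} (hs : xiFun s = 0) : s.re < 1 := by
  by_contra! h; exact xiFun_ne_zero_of_one_le_re h hs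

theorem re_pos_of_xiFun_eq_zero {s : ℂ} (hs : xiFun s = 0) : 0 < s.re := by
  have := re_lt_one_of_xiFun_eq_zero (s := 1 - s) (by rw [xiFun_one_sub, hs])
  simp at this; exact this

theorem xiFun_eq_zero_iff {s : ℂ} (h0 : 0 < s.re) (h1 : s ≠ 1) :
    xiFun s = 0 ↔ riemannZeta s = 0 := by
  have hs0 : s ≠ 0 := by rintro rfl; simp at h0
  rw [xiFun_eq_Gammaℝ_mul h0 h1]
  simp [hs0, sub_ne_zero.mpr h1, Gammaℝ_ne_zero_of_re_pos h0]

theorem riemannZeta_eq_zero_of_xiFun {s : ℂ} (hs : xiFun s = 0) : riemannZeta s = 0 := by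
  refine (xiFun_eq_zero_iff (re_pos_of_xiFun_eq_zero hs) ?_).mp hs
  rintro rfl
  have := re_lt_one_of_xiFun_eq_zero hs
  simp at this

theorem xiFun_half_ne_zero : xiFun (1 / 2) ≠ 0 := by
  intro h
  have := riemannZeta_eq_zero_of_xiFun h
  refine riemannZeta_ne_zero_of_real (x := 1 / 2) (by norm_num) (by norm_num) ?_
  simpa using this

theorem exists_norm_completedRiemannZeta₀_le_exp : ∃ B : ℝ, 0 < B ∧ ∀ s : ℂ, 1 / 2 ≤ s.re →
      ‖completedRiemannZeta₀ s‖ ≤ B * (1 + ‖s‖) * exp (2 * (1 + ‖s‖) ^ (3 / 2 : ℝ)) := by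
  obtain ⟨B, hB⟩ := exists_norm_completedRiemannZeta₀_le (1 / 2) 4
  refine ⟨|B| + 4, by positivity, fun s hs => ?_⟩
  set r := 1 + ‖s‖ with hr
  have hr1 : 1 ≤ r := by rw [hr]; linarith [norm_nonneg s]
  have hE : 1 ≤ exp (2 * r ^ (3 / 2 : ℝ)) := one_le_exp (by positivity)
  have hrE : 1 ≤ r * exp (2 * r ^ (3 / 2 : ℝ)) := one_le_mul_of_one_le_of_one_le hr1 hE
  rcases le_total s.re 4 with h4 | h4
  · have h1 := hB s hs h4
    have h2 : B ≤ |B| := le_abs_self B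
    rw [mul_assoc]
    nlinarith [abs_nonneg B]
  · have hs0 : s ≠ 0 := by rintro rfl; simp at h4; linarith
    have hs1 : s ≠ 1 := by rintro rfl; norm_num at h4
    have h0 : 0 < s.re := by linarith
    have h1 : 1 - s ≠ 0 := sub_ne_zero.mpr hs1.symm
    have e1 : completedRiemannZeta₀ s = Gammaℝ s * riemannZeta s + 1 / s + 1 / (1 - s) := by
      rw [riemannZeta_def_of_ne_zero hs0, completedRiemannZeta_eq]
      field_simp [Gammaℝ_ne_zero_of_re_pos h0]
      ring
    have n1 : s.re ≤ ‖s‖ := Complex.re_le_norm s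
    have n2 : s.re - 1 ≤ ‖s - 1‖ := by simpa using Complex.re_le_norm (s - 1)
    have b1 : ‖(1 : ℂ) / s‖ ≤ 1 := by
      rw [norm_div, norm_one, div_le_one (by linarith)]; linarith
    have b2 : ‖(1 : ℂ) / (1 - s)‖ ≤ 1 := by
      rw [norm_div, norm_one, norm_sub_rev, div_le_one (by linarith)]; linarith
    have b3 : ‖riemannZeta s‖ ≤ 2 * r := by
      refine (norm_riemannZeta_le h0 hs1).trans ?_
      have c1 : ‖s‖ / ‖s - 1‖ ≤ ‖s‖ := div_le_self (norm_nonneg _) (by linarith)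
      have c2 : ‖s‖ / s.re ≤ ‖s‖ := div_le_self (norm_nonneg _) (by linarith)
      rw [hr]; linarith
    have b4 : ‖Gammaℝ s‖ ≤ exp (2 * r ^ (3 / 2 : ℝ)) := by
      rw [Gammaℝ_def, norm_mul]
      have c1 : ‖(π : ℂ) ^ (-s / 2)‖ ≤ 1 := by
        rw [norm_cpow_eq_rpow_re_of_pos pi_pos]
        refine rpow_le_one_of_one_le_of_nonpos (by linarith [pi_gt_three]) ?_
        simp; linarith
      have c2 : (s / 2).re = s.re / 2 := by simp
      have c3 : ‖Gamma (s / 2)‖ ≤ exp (2 * r ^ (3 / 2 : ℝ)) := by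
        refine (norm_Gamma_le (by rw [c2]; linarith)).trans ?_
        rw [c2]
        refine (Gamma_le_exp_rpow (by linarith)).trans (exp_le_exp.mpr ?_)
        gcongr
        rw [hr]; linarith
      calc _ ≤ 1 * exp (2 * r ^ (3 / 2 : ℝ)) := by gcongr
        _ = _ := one_mul _
    rw [e1]
    calc _ ≤ ‖Gammaℝ s‖ * ‖riemannZeta s‖ + ‖(1 : ℂ) / s‖ + ‖(1 : ℂ) / (1 - s)‖ := by
          rw [← norm_mul]; exact norm_add₃_le
      _ ≤ exp (2 * r ^ (3 / 2 : ℝ)) * (2 * r) + 1 + 1 := by gcongr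
      _ ≤ _ := by
        rw [mul_assoc]
        nlinarith [abs_nonneg B]

theorem exists_norm_xiFun_le_exp :
    ∃ A : ℝ, 0 < A ∧ ∀ s : ℂ, ‖xiFun s‖ ≤ exp (A * (2 + ‖s‖) ^ (3 / 2 : ℝ)) := by
  obtain ⟨B, hB0, hB⟩ := exists_norm_completedRiemannZeta₀_le_exp
  have key : ∀ s : ℂ, 1 / 2 ≤ s.re →
      ‖xiFun s‖ ≤ exp ((B + 6) * (1 + ‖s‖) ^ (3 / 2 : ℝ)) := by
    intro s hs
    have h := hB s hs
    set r := 1 + ‖s‖ with hr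
    have hr1 : 1 ≤ r := by rw [hr]; linarith [norm_nonneg s]
    set q := r ^ (3 / 2 : ℝ) with hq
    have hrq : r ≤ q := by
      have := rpow_le_rpow_of_exponent_le hr1 (show (1 : ℝ) ≤ 3 / 2 by norm_num)
      rwa [rpow_one] at this
    have hE : 1 ≤ exp (2 * q) := one_le_exp (by linarith)
    have h1 : ‖xiFun s‖ ≤ 1 + r * r * (B * r * exp (2 * q)) := by
      rw [xiFun]
      refine (norm_sub_le _ _).trans ?_
      rw [norm_one, norm_mul, norm_mul]
      have c1 : ‖s‖ ≤ r := by rw [hr]; linarith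
      have c2 : ‖1 - s‖ ≤ r := by
        have := norm_sub_le 1 s; rw [norm_one] at this; exact this
      gcongr
    have h3 : r ≤ exp q := by linarith [add_one_le_exp q]
    have h3' : r * r * r ≤ exp q * exp q * exp q := by gcongr
    have h4 : 1 + r * r * (B * r * exp (2 * q)) ≤
        (1 + B) * (exp q * exp q * exp q * exp (2 * q)) := by
      have d1 : 1 ≤ exp q * exp q * exp q * exp (2 * q) := by
        rw [← exp_add, ← exp_add, ← exp_add]
        exact one_le_exp (by linarith)
      have d2 : r * r * r * exp (2 * q) ≤
          exp q * exp q * exp q * exp (2 * q) := by gcongr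
      nlinarith
    have h5 : 1 + B ≤ exp (B * q) := by
      have : B ≤ B * q := le_mul_of_one_le_right hB0.le (by linarith)
      linarith [add_one_le_exp (B * q)]
    calc ‖xiFun s‖ ≤ (1 + B) * (exp q * exp q * exp q * exp (2 * q)) :=
          h1.trans h4
      _ ≤ exp (B * q) * (exp q * exp q * exp q * exp (2 * q)) := by
          gcongr
      _ = exp ((B + 5) * q) := by
          rw [← exp_add, ← exp_add, ← exp_add, ← exp_add]; ring_nf
      _ ≤ _ := exp_le_exp.mpr (by nlinarith)
  refine ⟨B + 6, by linarith, fun s => ?_⟩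
  rcases le_total (1 / 2) s.re with h | h
  · refine (key s h).trans (exp_le_exp.mpr ?_)
    gcongr; norm_num
  · rw [← xiFun_one_sub]
    refine (key (1 - s) (by simp; linarith)).trans (exp_le_exp.mpr ?_)
    have : ‖1 - s‖ ≤ 1 + ‖s‖ := by
      have := norm_sub_le 1 s; rw [norm_one] at this; exact this
    refine mul_le_mul_of_nonneg_left (rpow_le_rpow (by positivity) ?_ (by norm_num))
      (by linarith)
    linarith

end

section

open Complex hiding exp log exp_add
open Filter Topology MeasureTheory Set ComplexConjugate
open Real

theorem xiFun_conj (s : ℂ) : xiFun (conj s) = conj (xiFun s) := by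
  have h1 : AnalyticOnNhd ℂ (fun z => conj (xiFun (conj z))) univ :=
    DifferentiableOn.analyticOnNhd
      (fun z _ => (differentiableAt_conj_conj_iff.mpr
        (differentiable_xiFun _)).differentiableWithinAt) isOpen_univ
  have h2 : AnalyticOnNhd ℂ xiFun univ := fun z _ => differentiable_xiFun.analyticAt z
  have h3 : EqOn (fun z => conj (xiFun (conj z))) xiFun univ := by
    refine h1.eqOn_of_preconnected_of_eventuallyEq h2 isPreconnected_univ (mem_univ (2 : ℂ)) ?_
    have h4 : {s : ℂ | 1 < s.re} ∈ 𝓝 (2 : ℂ) :=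
      (isOpen_lt continuous_const Complex.continuous_re).mem_nhds (by simp)
    filter_upwards [h4] with z hz
    have hz' : 1 < z.re := hz
    have hz1 : z ≠ 1 := by rintro rfl; simp at hz'
    have hz1' : conj z ≠ 1 := by
      intro h
      have := congrArg Complex.re h
      simp at this; linarith
    rw [xiFun_eq_Gammaℝ_mul (by rw [conj_re]; linarith) hz1', xiFun_eq_Gammaℝ_mul (by linarith) hz1]
    have hG : Gammaℝ (conj z) = conj (Gammaℝ z) := by
      rw [Gammaℝ_def, Gammaℝ_def, map_mul, ← Gamma_conj, map_div₀, map_ofNat]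
      congr 1
      have harg : arg (π : ℂ) ≠ π := by
        rw [arg_ofReal_of_nonneg pi_pos.le]; exact pi_pos.ne
      have := cpow_conj (π : ℂ) (-z / 2) harg
      rw [conj_ofReal] at this
      rw [← this]
      simp [map_ofNat]
    rw [hG, riemannZeta_conj]
    simp
  have := h3 (mem_univ s)
  simp only at this
  rw [← this, conj_conj]

theorem analyticOrderAt_conj_conj {f : ℂ → ℂ} {a : ℂ} (hf : Differentiable ℂ f)
    (ha : analyticOrderAt f a ≠ ⊤) (hc : ∀ z, f (conj z) = conj (f z)) :
    analyticOrderAt f (conj a) = analyticOrderAt f a := by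
  obtain ⟨k, hk, hka, hfk⟩ := exists_eq_pow_mul_of_order hf a ha
  have h0 : analyticOrderAt f a = (analyticOrderNatAt f a : ℕ∞) := by
    rw [analyticOrderNatAt, ENat.natCast_toNat ha]
  rw [h0, (hf.analyticAt _).analyticOrderAt_eq_natCast]
  refine ⟨fun z => conj (k (conj z)), ?_, by simpa using hka, Eventually.of_forall fun z => ?_⟩
  · have : Differentiable ℂ (fun z => conj (k (conj z))) := fun z =>
      differentiableAt_conj_conj_iff.mpr (hk _)
    exact this.analyticAt _
  · have := hc (conj z)
    rw [conj_conj] at this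
    rw [this, hfk (conj z)]
    simp

theorem analyticOrderAt_xiFun_ne_top (a : ℂ) : analyticOrderAt xiFun a ≠ ⊤ := by
  have h : AnalyticOnNhd ℂ xiFun univ := fun z _ => differentiable_xiFun.analyticAt z
  refine h.analyticOrderAt_ne_top_of_isPreconnected isPreconnected_univ
    (mem_univ 0) (mem_univ a) ?_
  rw [(differentiable_xiFun.analyticAt 0).analyticOrderAt_eq_zero.mpr (by simp [xiFun_zero])]
  simp

/-- The nontrivial zeros of `ζ`, repeated according to multiplicity. -/
def ZetaZero : Type := Σ a : {a : ℂ // xiFun a = 0}, Fin (analyticOrderNatAt xiFun a.1)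

namespace ZetaZero

/-- The zero itself. -/
def val (i : ZetaZero) : ℂ := i.1.1

theorem xiFun_val (i : ZetaZero) : xiFun i.val = 0 := i.1.2

theorem re_pos (i : ZetaZero) : 0 < i.val.re := re_pos_of_xiFun_eq_zero i.xiFun_val

theorem re_lt_one (i : ZetaZero) : i.val.re < 1 := re_lt_one_of_xiFun_eq_zero i.xiFun_val

theorem riemannZeta_val (i : ZetaZero) : riemannZeta i.val = 0 :=
  riemannZeta_eq_zero_of_xiFun i.xiFun_val

theorem exists_val_eq {a : ℂ} (ha : xiFun a = 0) : ∃ i : ZetaZero, i.val = a := by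
  have h1 : analyticOrderNatAt xiFun a ≠ 0 := by
    rw [analyticOrderNatAt, Ne, ENat.toNat_eq_zero, not_or]
    exact ⟨(differentiable_xiFun.analyticAt a).analyticOrderAt_ne_zero.mpr ha,
      analyticOrderAt_xiFun_ne_top a⟩
  exact ⟨⟨⟨a, ha⟩, ⟨0, Nat.pos_of_ne_zero h1⟩⟩, rfl⟩

theorem xiFun_refl {a : ℂ} (ha : xiFun a = 0) : xiFun (1 - conj a) = 0 := by
  rw [xiFun_one_sub, xiFun_conj, ha, map_zero]

theorem analyticOrderNatAt_refl (a : ℂ) :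
    analyticOrderNatAt xiFun (1 - conj a) = analyticOrderNatAt xiFun a := by
  have h1 : analyticOrderAt xiFun (1 - conj a) = analyticOrderAt xiFun (conj a) := by
    have h2 : xiFun ∘ (fun z => 1 - z) = xiFun := by ext z; simp [xiFun_one_sub]
    have := analyticOrderAt_comp_of_deriv_ne_zero (f := xiFun) (g := fun z : ℂ => 1 - z)
      (z₀ := conj a) (by fun_prop) (by simp)
    rw [h2] at this
    exact this.symm
  rw [analyticOrderNatAt, h1, analyticOrderAt_conj_conj differentiable_xiFun
    (analyticOrderAt_xiFun_ne_top a) xiFun_conj, analyticOrderNatAt]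

/-- The involution `ρ ↦ 1 - conj ρ` of the zeros. -/
noncomputable def refl : ZetaZero ≃ ZetaZero :=
  Equiv.sigmaCongr
    { toFun := fun a => ⟨1 - conj a.1, xiFun_refl a.2⟩
      invFun := fun a => ⟨1 - conj a.1, xiFun_refl a.2⟩
      left_inv := fun a => by ext; simp
      right_inv := fun a => by ext; simp }
    (fun a => finCongr (analyticOrderNatAt_refl a.1).symm)

theorem val_refl (i : ZetaZero) : (refl i).val = 1 - conj i.val := rfl

end ZetaZero

theorem finite_zeros_closedBall (n : ℝ) :
    {a : {a : ℂ // xiFun a = 0} | ‖a.1 - 1 / 2‖ ≤ n}.Finite := by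
  have h1 : AnalyticOnNhd ℂ xiFun univ := fun z _ => differentiable_xiFun.analyticAt z
  have h2 : (xiFun ⁻¹' {0})ᶜ ∈ codiscrete ℂ :=
    h1.preimage_zero_mem_codiscrete (x := 0) (by simp [xiFun_zero])
  have h3 := mem_codiscrete'.mp h2
  rw [compl_compl] at h3
  have h4 : (Metric.closedBall (1 / 2 : ℂ) n ∩ xiFun ⁻¹' {0}).Finite := by
    refine ((isCompact_closedBall _ _).inter_right ?_).finite ?_
    · simpa using h3.1
    · exact h3.2.mono inter_subset_right
  refine (h4.preimage (f := fun a : {a : ℂ // xiFun a = 0} => a.1)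
    Subtype.val_injective.injOn).subset fun a ha => ?_
  exact ⟨by simpa [dist_eq_norm] using ha, a.2⟩

/-- The zeros in a disc about `1 / 2`, as a finset of indices. -/
noncomputable def zerosInBall (n : ℝ) : Finset ZetaZero :=
  (finite_zeros_closedBall n).toFinset.sigma fun _ => Finset.univ

theorem mem_zerosInBall {n : ℝ} {i : ZetaZero} : i ∈ zerosInBall n ↔ ‖i.val - 1 / 2‖ ≤ n := by
  refine Finset.mem_sigma.trans ?_
  simp [ZetaZero.val]

theorem tendsto_zerosInBall : Tendsto (fun n : ℕ => zerosInBall n) atTop atTop := by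
  refine tendsto_atTop_finset_of_monotone ?_ fun i => ?_
  · intro m n hmn i hi
    simp only [mem_zerosInBall] at *
    exact hi.trans (by exact_mod_cast hmn)
  · obtain ⟨n, hn⟩ := exists_nat_ge ‖i.val - 1 / 2‖
    exact ⟨n, mem_zerosInBall.mpr hn⟩

theorem sum_zerosInBall (n : ℝ) (g : ℂ → ℂ) : ∑ i ∈ zerosInBall n, g i.val =
      ∑ a ∈ (finite_zeros_closedBall n).toFinset, (analyticOrderNatAt xiFun a.1 : ℂ) * g a.1 := by
  rw [zerosInBall]
  refine (Finset.sum_sigma _ _ _).trans (Finset.sum_congr rfl fun a _ => ?_)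
  simp [ZetaZero.val]

theorem tendsto_sum_zerosInBall {s : ℂ} (hs : xiFun s ≠ 0) :
    Tendsto (fun n : ℕ => ∑ i ∈ zerosInBall n, 1 / (s - i.val)) atTop
      (𝓝 (logDeriv xiFun s)) := by
  classical
  set f : ℂ → ℂ := fun z => xiFun (1 / 2 + z) with hf
  have hfd : Differentiable ℂ f := differentiable_xiFun.comp (by fun_prop)
  have heven : ∀ z, f (-z) = f z := by
    intro z
    simp only [hf]
    rw [← xiFun_one_sub]; ring_nf
  have hf0 : f 0 ≠ 0 := by simpa [hf] using xiFun_half_ne_zero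
  obtain ⟨A, hA0, hA⟩ := exists_norm_xiFun_le_exp
  set z := s - 1 / 2 with hz
  have hfz : f z ≠ 0 := by simpa [hf, hz] using hs
  have hlog : logDeriv f z = logDeriv xiFun s := by
    have : f = xiFun ∘ fun z => 1 / 2 + z := rfl
    rw [this, logDeriv_comp (differentiable_xiFun _) (by fun_prop)]
    simp [hz]
  have horder : ∀ a, analyticOrderNatAt f (a - 1 / 2) = analyticOrderNatAt xiFun a := by
    intro a
    have := analyticOrderAt_comp_of_deriv_ne_zero (f := xiFun) (g := fun z : ℂ => 1 / 2 + z)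
      (z₀ := a - 1 / 2) (by fun_prop) (by simp)
    rw [show (1 / 2 + (a - 1 / 2) : ℂ) = a by ring] at this
    rw [analyticOrderNatAt, analyticOrderNatAt, ← this]
    rfl
  set M : ℝ → ℝ := fun R => A * (5 / 2 + 2 * R) ^ (3 / 2 : ℝ) + |log ‖f 0‖| + 1 with hM
  have hsum : ∀ n : ℕ, ∑ i ∈ zerosInBall n, 1 / (s - i.val) =
      ∑ a ∈ (finite_zeros_closedBall n).toFinset.map
        ⟨fun a : {a : ℂ // xiFun a = 0} => a.1 - 1 / 2,
          fun a b h => Subtype.ext (sub_left_injective h)⟩,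
        (analyticOrderNatAt f a : ℂ) / (z - a) := by
    intro n
    rw [sum_zerosInBall n (fun w => 1 / (s - w)), Finset.sum_map]
    refine Finset.sum_congr rfl fun a _ => ?_
    change (analyticOrderNatAt xiFun a.1 : ℂ) * (1 / (s - a.1)) =
      (analyticOrderNatAt f (a.1 - 1 / 2) : ℂ) / (s - 1 / 2 - (a.1 - 1 / 2))
    rw [horder, mul_one_div]; congr 1; ring
  have hbd : ∀ᶠ n : ℕ in atTop, ‖∑ i ∈ zerosInBall n, 1 / (s - i.val) - logDeriv xiFun s‖ ≤
      64 * M n * ‖z‖ / (n : ℝ) ^ 2 := by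
    filter_upwards [eventually_gt_atTop 0, eventually_ge_atTop ⌈8 * ‖z‖⌉₊] with n hn0 hn
    have hn' : 8 * ‖z‖ ≤ n := (Nat.le_ceil _).trans (by exact_mod_cast hn)
    have hn0' : (0 : ℝ) < n := by exact_mod_cast hn0
    rw [norm_sub_rev, hsum n, ← hlog]
    refine norm_logDeriv_sub_sum_le hfd heven hf0 hn0' (by positivity) ?_ _ ?_ (by linarith) hfz
    · intro w hw
      refine (hA _).trans ?_
      have h1 : ‖f 0‖ = exp (log ‖f 0‖) := (Real.exp_log (norm_pos_iff.mpr hf0)).symm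
      rw [h1, ← exp_add]
      refine exp_le_exp.mpr ?_
      have h2 : ‖(1 / 2 : ℂ) + w‖ ≤ 1 / 2 + 2 * n := by
        refine (norm_add_le _ _).trans ?_
        rw [hw]; norm_num
      have h3 : A * (2 + ‖(1 / 2 : ℂ) + w‖) ^ (3 / 2 : ℝ) ≤ A * (5 / 2 + 2 * n) ^ (3 / 2 : ℝ) := by
        refine mul_le_mul_of_nonneg_left (rpow_le_rpow (by positivity) ?_ (by norm_num)) hA0.le
        linarith
      have h4 := neg_abs_le (log ‖f 0‖)
      simp only [hM]
      linarith
    · intro a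
      simp only [Finset.mem_map, Set.Finite.mem_toFinset, mem_ofPred_eq]
      constructor
      · rintro ⟨b, hb, rfl⟩
        exact ⟨by simp [hf, b.2], hb⟩
      · rintro ⟨h1, h2⟩
        exact ⟨⟨1 / 2 + a, h1⟩, by simpa using h2, by simp⟩
  rw [tendsto_iff_norm_sub_tendsto_zero]
  refine squeeze_zero' (Eventually.of_forall fun _ => norm_nonneg _) hbd ?_
  have hlim1 : Tendsto (fun n : ℕ => (n : ℝ) ^ (-(1 / 2) : ℝ)) atTop (𝓝 0) :=
    (tendsto_rpow_neg_atTop (by norm_num)).comp tendsto_natCast_atTop_atTop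
  have hup : ∀ᶠ n : ℕ in atTop, 64 * M n * ‖z‖ / (n : ℝ) ^ 2 ≤
      (64 * ‖z‖ * (A * 27 + |log ‖f 0‖| + 1)) * (n : ℝ) ^ (-(1 / 2) : ℝ) := by
    filter_upwards [eventually_ge_atTop 1] with n hn
    have hn1 : (1 : ℝ) ≤ n := by exact_mod_cast hn
    have hn0' : (0 : ℝ) < n := by linarith
    have h1 : (5 / 2 + 2 * (n : ℝ)) ^ (3 / 2 : ℝ) ≤ 27 * (n : ℝ) ^ (3 / 2 : ℝ) := by
      have : (27 : ℝ) = 9 ^ (3 / 2 : ℝ) := by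
        rw [show (9 : ℝ) = 3 ^ (2 : ℝ) by norm_num, ← rpow_mul (by norm_num)]; norm_num
      rw [this, ← mul_rpow (by norm_num) hn0'.le]
      exact rpow_le_rpow (by positivity) (by linarith) (by norm_num)
    have h2 : 1 ≤ (n : ℝ) ^ (3 / 2 : ℝ) := one_le_rpow hn1 (by norm_num)
    have h3 : M n ≤ (A * 27 + |log ‖f 0‖| + 1) * (n : ℝ) ^ (3 / 2 : ℝ) := by
      simp only [hM]
      have := abs_nonneg (log ‖f 0‖)
      nlinarith
    have h4 : (n : ℝ) ^ (3 / 2 : ℝ) / (n : ℝ) ^ 2 = (n : ℝ) ^ (-(1 / 2) : ℝ) := by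
      rw [← rpow_natCast, ← rpow_sub hn0']; norm_num
    rw [← h4]
    calc 64 * M n * ‖z‖ / (n : ℝ) ^ 2 ≤ 64 * ((A * 27 + |log ‖f 0‖| + 1) *
          (n : ℝ) ^ (3 / 2 : ℝ)) * ‖z‖ / (n : ℝ) ^ 2 := by gcongr
      _ = _ := by ring
  refine squeeze_zero' (Eventually.of_forall fun n => ?_) hup ?_
  · positivity
  · simpa using hlim1.const_mul _

theorem one_div_sub_re (s a : ℂ) : (1 / (s - a)).re = (s.re - a.re) / normSq (s - a) := by
  rw [one_div, inv_re, sub_re]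

theorem one_div_sub_re_nonneg {s : ℂ} (hs : 1 ≤ s.re) (i : ZetaZero) :
    0 ≤ (1 / (s - i.val)).re := by
  rw [one_div_sub_re]
  exact div_nonneg (by linarith [i.re_lt_one]) (normSq_nonneg _)

theorem hasSum_re_zeros {s : ℂ} (hs : 1 ≤ s.re) :
    HasSum (fun i : ZetaZero => (1 / (s - i.val)).re) (logDeriv xiFun s).re := by
  have h1 := (continuous_re.tendsto _).comp
    (tendsto_sum_zerosInBall (xiFun_ne_zero_of_one_le_re hs))
  have h2 : Tendsto (fun n : ℕ => ∑ i ∈ zerosInBall n, (1 / (s - i.val)).re) atTop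
      (𝓝 (logDeriv xiFun s).re) := by
    refine h1.congr fun n => ?_
    simp only [Function.comp_apply, re_sum]
  have hnn : ∀ i : ZetaZero, 0 ≤ (1 / (s - i.val)).re := one_div_sub_re_nonneg hs
  have hmono : Monotone fun n : ℕ => ∑ i ∈ zerosInBall n, (1 / (s - i.val)).re := by
    intro m n hmn
    refine Finset.sum_le_sum_of_subset_of_nonneg ?_ fun i _ _ => hnn i
    intro i hi
    rw [mem_zerosInBall] at *
    exact hi.trans (by exact_mod_cast hmn)
  have hsum : Summable fun i : ZetaZero => (1 / (s - i.val)).re := by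
    refine summable_of_sum_le hnn (c := (logDeriv xiFun s).re) fun u => ?_
    obtain ⟨n, hn⟩ := (tendsto_zerosInBall.eventually (eventually_ge_atTop u)).exists
    exact (Finset.sum_le_sum_of_subset_of_nonneg hn fun i _ _ => hnn i).trans
      (hmono.ge_of_tendsto h2 n)
  have := tendsto_nhds_unique (hsum.hasSum.comp tendsto_zerosInBall) h2
  rw [← this]
  exact hsum.hasSum

theorem summable_one_div_normSq_zeros :
    Summable fun i : ZetaZero => 1 / ‖2 - i.val‖ ^ 2 := by
  refine Summable.of_nonneg_of_le (fun i => by positivity) (fun i => ?_)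
    (hasSum_re_zeros (s := 2) (by simp)).summable
  rw [one_div_sub_re, ← normSq_eq_norm_sq]
  have := i.re_lt_one
  refine div_le_div_of_nonneg_right ?_ (normSq_nonneg _)
  simp; linarith

theorem hasSum_zeros_sub {s s' : ℂ} (hs : xiFun s ≠ 0) (hs' : xiFun s' ≠ 0) :
    HasSum (fun i : ZetaZero => 1 / (s - i.val) - 1 / (s' - i.val))
      (logDeriv xiFun s - logDeriv xiFun s') := by
  have h1 := (tendsto_sum_zerosInBall hs).sub (tendsto_sum_zerosInBall hs')
  simp_rw [← Finset.sum_sub_distrib] at h1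
  have hne : ∀ {w : ℂ}, xiFun w ≠ 0 → ∀ i : ZetaZero, w - i.val ≠ 0 := by
    intro w hw i h
    rw [sub_eq_zero] at h
    exact hw (h ▸ i.xiFun_val)
  have hev : ∀ w : ℂ, ∀ᶠ i : ZetaZero in cofinite, ‖2 - i.val‖ ≤ 2 * ‖w - i.val‖ := by
    intro w
    have hfin : {i : ZetaZero | i ∉ zerosInBall (2 * ‖2 - w‖ + ‖w - 1 / 2‖)} ∈ cofinite := by
      rw [mem_cofinite]
      refine (zerosInBall (2 * ‖2 - w‖ + ‖w - 1 / 2‖)).finite_toSet.subset fun i hi => ?_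
      simpa using hi
    filter_upwards [hfin] with i hi
    have hi' : ¬ (‖i.val - 1 / 2‖ ≤ 2 * ‖2 - w‖ + ‖w - 1 / 2‖) := by
      rw [← mem_zerosInBall]; exact hi
    have e1 : ‖i.val - 1 / 2‖ ≤ ‖i.val - w‖ + ‖w - 1 / 2‖ := by
      simpa using norm_add_le (i.val - w) (w - 1 / 2)
    have e2 : ‖2 - i.val‖ ≤ ‖2 - w‖ + ‖w - i.val‖ := by
      simpa using norm_add_le (2 - w) (w - i.val)
    rw [norm_sub_rev i.val w] at e1
    linarith [norm_nonneg (2 - w)]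
  have hsum : Summable fun i : ZetaZero => 1 / (s - i.val) - 1 / (s' - i.val) := by
    refine Summable.of_norm_bounded_eventually
      (g := fun i => 4 * ‖s' - s‖ * (1 / ‖2 - i.val‖ ^ 2))
      (summable_one_div_normSq_zeros.mul_left _) ?_
    filter_upwards [hev s, hev s'] with i h2 h3
    have e1 := hne hs i
    have e2 := hne hs' i
    have e3 : (2 : ℂ) - i.val ≠ 0 :=
      hne (xiFun_ne_zero_of_one_le_re (by simp)) i
    have n1 : 0 < ‖s - i.val‖ := norm_pos_iff.mpr e1
    have n2 : 0 < ‖s' - i.val‖ := norm_pos_iff.mpr e2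
    have n3 : 0 < ‖2 - i.val‖ := norm_pos_iff.mpr e3
    have e4 : 1 / (s - i.val) - 1 / (s' - i.val) = (s' - s) / ((s - i.val) * (s' - i.val)) := by
      field_simp; ring
    rw [e4, norm_div, norm_mul, div_le_iff₀ (by positivity)]
    have h4 : ‖2 - i.val‖ ^ 2 ≤ 4 * (‖s - i.val‖ * ‖s' - i.val‖) := by nlinarith
    have h5 : 4 * ‖s' - s‖ * (1 / ‖2 - i.val‖ ^ 2) * (‖s - i.val‖ * ‖s' - i.val‖) =
        ‖s' - s‖ * (4 * (‖s - i.val‖ * ‖s' - i.val‖) / ‖2 - i.val‖ ^ 2) := by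
      field_simp
    rw [h5]
    refine le_mul_of_one_le_right (norm_nonneg _) ?_
    rw [le_div_iff₀ (by positivity)]
    linarith
  have := tendsto_nhds_unique (hsum.hasSum.comp tendsto_zerosInBall) h1
  rw [← this]
  exact hsum.hasSum

theorem logDeriv_xiFun {s : ℂ} (hs : 1 < s.re) :
    logDeriv xiFun s = 1 / s + 1 / (s - 1) + logDeriv Gammaℝ s + logDeriv riemannZeta s := by
  have hopen : {s : ℂ | 1 < s.re} ∈ 𝓝 s :=
    (isOpen_lt continuous_const Complex.continuous_re).mem_nhds hs
  have hev : xiFun =ᶠ[𝓝 s] fun s => s * (s - 1) * (Gammaℝ s * riemannZeta s) := by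
    filter_upwards [hopen] with z hz
    have hz' : 1 < z.re := hz
    exact xiFun_eq_Gammaℝ_mul (by linarith) (by rintro rfl; simp at hz')
  have hs0 : s ≠ 0 := by rintro rfl; simp at hs; linarith
  have hs1 : s ≠ 1 := by rintro rfl; simp at hs
  have hs1' : s - 1 ≠ 0 := sub_ne_zero.mpr hs1
  have hG : Gammaℝ s ≠ 0 := Gammaℝ_ne_zero_of_re_pos (by linarith)
  have hZ : riemannZeta s ≠ 0 := riemannZeta_ne_zero_of_one_le_re hs.le
  have hGd : DifferentiableAt ℂ Gammaℝ s := by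
    have h1 := differentiable_Gammaℝ_inv.differentiableAt (x := s)
    have h2 := h1.inv (inv_ne_zero hG)
    have h3 : (fun s => (Gammaℝ s)⁻¹)⁻¹ = Gammaℝ := by ext; simp
    rwa [h3] at h2
  have hZd := differentiableAt_riemannZeta hs1
  have h1 : logDeriv xiFun s = logDeriv (fun s => s * (s - 1) * (Gammaℝ s * riemannZeta s)) s := by
    rw [logDeriv_apply, logDeriv_apply, hev.deriv_eq, hev.self_of_nhds]
  rw [h1, logDeriv_mul (f := fun s => s * (s - 1)) (g := fun s => Gammaℝ s * riemannZeta s) s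
      (mul_ne_zero hs0 hs1') (mul_ne_zero hG hZ) (by fun_prop) (by fun_prop),
    logDeriv_mul (f := fun s => s) (g := fun s => s - 1) s hs0 hs1' (by fun_prop) (by fun_prop),
    logDeriv_mul s hG hZ hGd hZd]
  simp [logDeriv_apply]
  ring

end

section

open Complex Filter Topology Set
open scoped Real

theorem norm_log_sub_log_sub_inv_le {u : ℂ} (hu : 3 / 2 ≤ u.re) :
    ‖log (u + 1 / 2) - log (u - 1 / 2) - 1 / u‖ ≤ 3 / 32 / ‖u‖ ^ 3 := by
  have hu1 : 3 / 2 ≤ ‖u‖ := hu.trans (re_le_norm u)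
  have hu0 : 0 < ‖u‖ := by linarith
  have hune : u ≠ 0 := norm_pos_iff.mp hu0
  have hsl : ∀ v : ℝ, |v| ≤ 1 / 2 → (u + v) ∈ slitPlane := fun v hv => Or.inl (by
    have := neg_le_of_abs_le hv
    simp
    linarith)
  have hd : ∀ v ∈ Icc (0 : ℝ) (1 / 2), HasDerivAt
      (fun v : ℝ => log (u + v) - log (u - v) - 2 * v / u)
      (2 * v ^ 2 / (u * ((u + v) * (u - v)))) v := by
    intro v hv
    have h1 := hsl v (by rw [abs_of_nonneg hv.1]; exact hv.2)
    have h2 := hsl (-v) (by rw [abs_neg, abs_of_nonneg hv.1]; exact hv.2)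
    have h2' : u - v ∈ slitPlane := by simpa [sub_eq_add_neg] using h2
    have hv : HasDerivAt (fun v : ℝ => (v : ℂ)) 1 v := ofRealCLM.hasDerivAt
    have h3 := (((hv.const_add u).clog_real h1).sub ((hv.const_sub u).clog_real h2')).sub
      ((hv.const_mul 2).div_const u)
    have h4 := slitPlane_ne_zero h1
    have h5 := slitPlane_ne_zero h2'
    refine h3.congr_deriv ?_
    field_simp
    ring
  have := image_norm_le_of_norm_deriv_right_le_deriv_boundary (a := 0) (b := 1 / 2)
    (f := fun v : ℝ => log (u + v) - log (u - v) - 2 * v / u)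
    (f' := fun v : ℝ => 2 * v ^ 2 / (u * ((u + v) * (u - v))))
    (B := fun v => 3 / 4 / ‖u‖ ^ 3 * v ^ 3) (B' := fun v => 3 / 4 / ‖u‖ ^ 3 * (3 * v ^ 2))
    (fun v hv => (hd v hv).continuousAt.continuousWithinAt)
    (fun v hv => (hd v ⟨hv.1, hv.2.le⟩).hasDerivWithinAt) (by simp)
    (fun v => by simpa using (hasDerivAt_pow 3 v).const_mul (3 / 4 / ‖u‖ ^ 3)) ?_
    (x := 1 / 2) ⟨by norm_num, le_rfl⟩
  · convert this using 1
    · congr 1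
      push_cast
      ring
    · ring
  · intro v hv
    have hv2 : v ^ 2 ≤ 1 / 4 := by nlinarith [hv.1, hv.2]
    have h1 : 8 / 9 * ‖u‖ ^ 2 ≤ ‖(u + v) * (u - v)‖ := by
      have h2 : ‖u ^ 2‖ - ‖(v ^ 2 : ℂ)‖ ≤ ‖u ^ 2 - v ^ 2‖ := norm_sub_norm_le _ _
      rw [norm_pow, norm_pow, norm_real, Real.norm_eq_abs, sq_abs] at h2
      rw [show (u + v) * (u - v) = u ^ 2 - v ^ 2 by ring]
      nlinarith
    rw [norm_div, norm_mul, norm_mul, norm_pow, norm_real, Real.norm_eq_abs, sq_abs]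
    simp only [Complex.norm_ofNat]
    calc 2 * v ^ 2 / (‖u‖ * ‖(u + v) * (u - v)‖) ≤ 2 * v ^ 2 / (‖u‖ * (8 / 9 * ‖u‖ ^ 2)) := by
          gcongr
      _ = _ := by
          field_simp
          ring

theorem digamma_ofReal {x : ℝ} (hx : 0 < x) :
    HasDerivAt (fun x : ℝ => Real.log (Real.Gamma x)) (digamma x).re x ∧ (digamma x).im = 0 := by
  have hG : Real.Gamma x ≠ 0 := (Real.Gamma_pos_of_pos hx).ne'
  have hm : ∀ m : ℕ, x ≠ -m := fun m h => by
    have : (0 : ℝ) ≤ m := m.cast_nonneg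
    linarith
  have h1 := (Real.differentiableAt_Gamma hm).hasDerivAt
  have h2 := (Complex.differentiableAt_Gamma (x : ℂ) fun m h => hm m (by exact_mod_cast h)).hasDerivAt
  have h3 : deriv Complex.Gamma x = (deriv Real.Gamma x : ℝ) := by
    refine h2.comp_ofReal.unique ?_
    simp_rw [Complex.Gamma_ofReal]
    exact h1.ofReal_comp
  have h4 : digamma x = ((deriv Real.Gamma x / Real.Gamma x : ℝ) : ℂ) := by
    rw [digamma, logDeriv_apply, h3, Complex.Gamma_ofReal]
    push_cast
    rfl
  rw [h4, ofReal_re, ofReal_im]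
  exact ⟨h1.log hG, rfl⟩

theorem digamma_bounds {x : ℝ} (hx : 1 < x) :
    Real.log (x - 1) ≤ (digamma x).re ∧ (digamma x).re ≤ Real.log x := by
  have hF : ∀ {y : ℝ}, 0 < y → Real.log (Real.Gamma (y + 1)) - Real.log (Real.Gamma y) =
      Real.log y := by
    intro y hy
    rw [Real.Gamma_add_one hy.ne', Real.log_mul hy.ne' (Real.Gamma_pos_of_pos hy).ne']
    ring
  have hd := (digamma_ofReal (by linarith : 0 < x)).1
  constructor
  · have := Real.convexOn_log_Gamma.slope_le_of_hasDerivAt (x := x - 1) (y := x)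
      (by simpa using hx) (by simp; linarith) (by linarith) hd
    have h2 := hF (y := x - 1) (by linarith)
    rw [sub_add_cancel] at h2
    rw [slope_def_field] at this
    simpa [h2] using this
  · have := Real.convexOn_log_Gamma.le_slope_of_hasDerivAt (x := x) (y := x + 1)
      (by simp; linarith) (by simp; linarith) (by linarith) hd
    have h2 := hF (y := x) (by linarith)
    rw [slope_def_field] at this
    simpa [h2] using this

/-- The terms of the telescoping series for `digamma (z + 1) - log (z + 1 / 2)`. -/
noncomputable def digammaTerm (n : ℕ) (z : ℂ) : ℂ :=
  log (z + 1 + n + 1 / 2) - log (z + 1 + n - 1 / 2) - 1 / (z + 1 + n)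

theorem norm_digammaTerm_le {z : ℂ} (hz : 1 / 2 ≤ z.re) (n : ℕ) :
    ‖digammaTerm n z‖ ≤ 3 / 32 / ‖z + 1 + n‖ ^ 3 :=
  norm_log_sub_log_sub_inv_le (by simp; have : (0 : ℝ) ≤ n := n.cast_nonneg; linarith)

theorem norm_digammaTerm_le' {z : ℂ} (hz : 1 / 2 ≤ z.re) (n : ℕ) :
    ‖digammaTerm n z‖ ≤ 3 / 32 / (z.re + 1 + n) ^ 3 := by
  have hn : (0 : ℝ) ≤ n := n.cast_nonneg
  refine (norm_digammaTerm_le hz n).trans ?_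
  have h := re_le_norm (z + 1 + n)
  simp only [add_re, one_re, natCast_re] at h
  gcongr

theorem sum_inv_cube_le {x : ℝ} (hx : 1 / 2 ≤ x) (N : ℕ) :
    ∑ n ∈ Finset.range N, 1 / (x + 1 + n) ^ 3 ≤
      1 / (2 * (x + 1 / 2) ^ 2) - 1 / (2 * (x + 1 / 2 + N) ^ 2) := by
  induction N with
  | zero => simp
  | succ N ih =>
    rw [Finset.sum_range_succ]
    have hn : (0 : ℝ) ≤ N := N.cast_nonneg
    have h : 1 / (x + 1 + N) ^ 3 ≤ 1 / (2 * (x + 1 / 2 + N) ^ 2) - 1 / (2 * (x + 1 / 2 + (N + 1)) ^ 2) := by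
      obtain ⟨y, hy⟩ : ∃ y, y = x + 1 + N := ⟨_, rfl⟩
      rw [show x + 1 / 2 + N = y - 1 / 2 by linarith, show x + 1 / 2 + (N + 1) = y + 1 / 2 by linarith,
        ← hy]
      have hy1 : 3 / 2 ≤ y := by linarith
      have : 0 < y - 1 / 2 := by linarith
      rw [div_sub_div _ _ (by positivity) (by positivity), div_le_div_iff₀ (by positivity) (by positivity)]
      nlinarith [sq_nonneg y]
    push_cast
    linarith

theorem sum_inv_sq_le {x : ℝ} (hx : 1 / 2 ≤ x) (N : ℕ) :
    ∑ n ∈ Finset.range N, 1 / (x + 1 + n) ^ 2 ≤ 1 / (x + 1 / 2) - 1 / (x + 1 / 2 + N) := by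
  induction N with
  | zero => simp
  | succ N ih =>
    rw [Finset.sum_range_succ]
    have hn : (0 : ℝ) ≤ N := N.cast_nonneg
    have h : 1 / (x + 1 + N) ^ 2 ≤ 1 / (x + 1 / 2 + N) - 1 / (x + 1 / 2 + (N + 1)) := by
      obtain ⟨y, hy⟩ : ∃ y, y = x + 1 + N := ⟨_, rfl⟩
      rw [show x + 1 / 2 + N = y - 1 / 2 by linarith, show x + 1 / 2 + (N + 1) = y + 1 / 2 by linarith,
        ← hy]
      have hy1 : 3 / 2 ≤ y := by linarith
      have : 0 < y - 1 / 2 := by linarith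
      rw [div_sub_div _ _ (by positivity) (by positivity), div_le_div_iff₀ (by positivity) (by positivity)]
      nlinarith [sq_nonneg y]
    push_cast
    linarith

theorem summable_inv_cube {x : ℝ} (hx : 1 / 2 ≤ x) :
    Summable fun n : ℕ => 1 / (x + 1 + n) ^ 3 := by
  refine summable_of_sum_range_le (c := 1 / (2 * (x + 1 / 2) ^ 2)) (fun n => by positivity)
    fun N => (sum_inv_cube_le hx N).trans ?_
  have : 0 ≤ 1 / (2 * (x + 1 / 2 + N) ^ 2) := by positivity
  linarith

theorem digamma_eq_of_re {z : ℂ} (hz : 1 / 2 < z.re) :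
    digamma (z + 1) = log (z + 1 / 2) + ∑' n, digammaTerm n z := by
  have hreal : ∀ x : ℝ, 1 / 2 < x →
      digamma ((x : ℂ) + 1) = log (x + 1 / 2) + ∑' n, digammaTerm n (x : ℂ) := by
    intro x hx
    have hsum : Summable fun n => ‖digammaTerm n (x : ℂ)‖ := by
      refine Summable.of_nonneg_of_le (fun n => norm_nonneg _)
        (fun n => norm_digammaTerm_le' (by simpa using hx.le) n) ?_
      have := (summable_inv_cube hx.le).mul_left (3 / 32)
      simpa [div_eq_mul_inv] using this
    have ht := hsum.of_norm.hasSum.tendsto_sum_nat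
    have hpart : ∀ N : ℕ, ∑ n ∈ Finset.range N, digammaTerm n (x : ℂ) =
        log (x + 1 / 2 + N) - log (x + 1 / 2) - (digamma (x + 1 + N) - digamma (x + 1)) := by
      intro N
      induction N with
      | zero => simp
      | succ N ih =>
        rw [Finset.sum_range_succ, ih, digammaTerm]
        have hn : (0 : ℝ) ≤ N := N.cast_nonneg
        have := digamma_apply_add_one (x + 1 + N) fun m h => by
          have h1 := congrArg Complex.re h
          have hm : (0 : ℝ) ≤ m := m.cast_nonneg
          simp at h1
          linarith
        push_cast
        rw [show (x + 1 + (N + 1) : ℂ) = x + 1 + N + 1 by ring, this,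
          show (x + 1 / 2 + (N + 1) : ℂ) = x + 1 + N + 1 / 2 by ring,
          show (x + 1 + N - 1 / 2 : ℂ) = x + 1 / 2 + N by ring]
        ring
    have hlim : Tendsto (fun N : ℕ => log (x + 1 / 2 + N) - digamma (x + 1 + N)) atTop (𝓝 0) := by
      have hre : ∀ N : ℕ, log (x + 1 / 2 + N : ℂ) - digamma (x + 1 + N : ℂ) =
          ((Real.log (x + 1 / 2 + N) - (digamma ((x + 1 + N : ℝ) : ℂ)).re : ℝ) : ℂ) := by
        intro N
        have hn : (0 : ℝ) ≤ N := N.cast_nonneg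
        have h1 := (digamma_ofReal (x := x + 1 + N) (by linarith)).2
        push_cast [Complex.ofReal_log (by linarith : 0 ≤ x + 1 / 2 + (N : ℝ))]
        congr 1
        refine Complex.ext (by simp) ?_
        push_cast at h1
        simpa using h1
      simp_rw [hre]
      have : Tendsto (fun N : ℕ => Real.log (x + 1 / 2 + N) - (digamma ((x + 1 + N : ℝ) : ℂ)).re)
          atTop (𝓝 0) := by
        have hNt : Tendsto (fun N : ℕ => 1 / (x + N)) atTop (𝓝 0) := by
          have := tendsto_const_nhds.div_atTop (a := (1 : ℝ))
            (tendsto_atTop_add_const_left atTop x tendsto_natCast_atTop_atTop)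
          simpa using this
        refine squeeze_zero_norm (fun N => ?_) hNt
        have hn : (0 : ℝ) ≤ N := N.cast_nonneg
        obtain ⟨h1, h2⟩ := digamma_bounds (x := x + 1 + N) (by linarith)
        have h3 : Real.log (x + 1 + N) ≤ Real.log (x + N) + 1 / (x + N) := by
          have h4 := Real.log_le_sub_one_of_pos (x := (x + 1 + N) / (x + N)) (by
            have : 0 < x + N := by linarith
            positivity)
          rw [Real.log_div (by linarith) (by linarith)] at h4
          have h5 : (x + 1 + N) / (x + N) - 1 = 1 / (x + N) := by
            have : x + N ≠ 0 := by linarith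
            field_simp
            ring
          linarith
        have h4 : Real.log (x + N) ≤ Real.log (x + 1 / 2 + N) :=
          Real.log_le_log (by linarith) (by linarith)
        have h5 : Real.log (x + 1 / 2 + N) ≤ Real.log (x + 1 + N) :=
          Real.log_le_log (by linarith) (by linarith)
        rw [show x + 1 + N - 1 = x + N by ring] at h1
        rw [Real.norm_eq_abs, abs_le]
        constructor <;> linarith
      have h := (continuous_ofReal.tendsto 0).comp this
      simpa [Function.comp_def] using h
    have h2 : Tendsto (fun N : ℕ => ∑ n ∈ Finset.range N, digammaTerm n (x : ℂ)) atTop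
        (𝓝 (0 - log (x + 1 / 2) + digamma (x + 1))) := by
      refine ((hlim.sub_const _).add_const _).congr fun N => ?_
      rw [hpart]
      ring
    rw [tendsto_nhds_unique ht h2]
    ring
  set U : Set ℂ := {z : ℂ | 1 / 2 < z.re} with hU
  have hUo : IsOpen U := isOpen_lt continuous_const continuous_re
  have hterm : ∀ n : ℕ, DifferentiableOn ℂ (digammaTerm n) U := by
    intro n s hs
    have hs' : 1 / 2 < s.re := hs
    have hn : (0 : ℝ) ≤ n := n.cast_nonneg
    have h1 : s + 1 + n + 1 / 2 ∈ slitPlane := Or.inl (by simp; linarith)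
    have h2 : s + 1 + n - 1 / 2 ∈ slitPlane := Or.inl (by simp; linarith)
    have h3 : s + 1 + n ≠ 0 := slitPlane_ne_zero (Or.inl (by simp; linarith))
    have hid : DifferentiableAt ℂ (fun s : ℂ => s + 1 + n) s := by fun_prop
    exact ((((hid.add_const _).clog h1).sub ((hid.sub_const _).clog h2)).sub
      ((differentiableAt_const _).div hid h3)).differentiableWithinAt
  have hF : DifferentiableOn ℂ (fun z => log (z + 1 / 2) + ∑' n, digammaTerm n z) U := by
    refine DifferentiableOn.add (fun s hs => ?_) ?_
    · have hs' : 1 / 2 < s.re := hs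
      exact ((differentiableAt_id.add_const (1 / 2 : ℂ)).clog
        (Or.inl (by simp; linarith))).differentiableWithinAt
    · refine Complex.differentiableOn_tsum_of_summable_norm
        (u := fun n : ℕ => 3 / 32 * (1 / (1 / 2 + 1 + (n : ℝ)) ^ 3))
        ((summable_inv_cube le_rfl).mul_left _) hterm hUo fun n w hw => ?_
      have hw' : 1 / 2 < w.re := hw
      refine (norm_digammaTerm_le' hw'.le n).trans ?_
      rw [mul_one_div]
      gcongr
  have hψ : DifferentiableOn ℂ (fun z => digamma (z + 1)) U := by
    intro s hs
    have hs' : 1 / 2 < s.re := hs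
    have hA : AnalyticAt ℂ Gamma (s + 1) := by
      have hV : {z : ℂ | 0 < z.re} ∈ 𝓝 (s + 1) :=
        (isOpen_lt continuous_const continuous_re).mem_nhds (by simp; linarith)
      refine DifferentiableOn.analyticAt (s := {z : ℂ | 0 < z.re}) (fun w hw => ?_) hV
      refine (differentiableAt_Gamma w fun m h => ?_).differentiableWithinAt
      have hw' : 0 < w.re := hw
      have hm : (0 : ℝ) ≤ m := m.cast_nonneg
      rw [h] at hw'
      simp at hw'
      linarith
    have hne : Gamma (s + 1) ≠ 0 := Gamma_ne_zero_of_re_pos (by simp; linarith)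
    have hdg : DifferentiableAt ℂ digamma (s + 1) :=
      (hA.deriv.differentiableAt.div hA.differentiableAt hne)
    exact (hdg.comp s (by fun_prop : DifferentiableAt ℂ (fun z : ℂ => z + 1) s)).differentiableWithinAt
  refine (hψ.analyticOnNhd hUo).eqOn_of_preconnected_of_frequently_eq (hF.analyticOnNhd hUo)
    (convex_halfSpace_re_gt _).isPreconnected (z₀ := 1) (by simp [hU]; norm_num) ?_ hz
  have h1 : Tendsto (fun n : ℕ => ((1 + 1 / ((n : ℝ) + 1) : ℝ) : ℂ)) atTop (𝓝[≠] 1) := by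
    refine tendsto_nhdsWithin_iff.mpr ⟨?_, Eventually.of_forall fun n => ?_⟩
    · have := (continuous_ofReal.tendsto _).comp
        ((tendsto_one_div_add_atTop_nhds_zero_nat (𝕜 := ℝ)).const_add 1)
      simpa [Function.comp_def] using this
    · have hp : (0 : ℝ) < 1 / ((n : ℝ) + 1) := by positivity
      simp only [mem_compl_iff, mem_singleton_iff]
      intro h
      have h := congrArg Complex.re h
      rw [ofReal_re, one_re] at h
      linarith
  refine h1.frequently (Frequently.of_forall fun n => ?_)
  have hp : (0 : ℝ) < 1 / ((n : ℝ) + 1) := by positivity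
  exact hreal _ (by linarith)

theorem one_div_add_logDeriv_Gammaℝ {s : ℂ} (hs : 0 < s.re) :
    1 / s + logDeriv Gammaℝ s = -(log π) / 2 + digamma (s / 2 + 1) / 2 := by
  have hs0 : s ≠ 0 := by rintro rfl; simp at hs
  have hre : 0 < (s / 2).re := by
    rw [show s / 2 = s / (2 : ℝ) by norm_num, div_ofReal_re]
    positivity
  have hm : ∀ m : ℕ, s / 2 ≠ -m := fun m h => by
    have hm : (0 : ℝ) ≤ m := m.cast_nonneg
    rw [h] at hre
    simp at hre
    linarith
  have hπ : (π : ℂ) ≠ 0 := by exact_mod_cast Real.pi_ne_zero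
  have h2 := (Complex.differentiableAt_Gamma (s / 2) hm).hasDerivAt
  have hid : HasDerivAt (fun s : ℂ => s / 2) (1 / 2) s := (hasDerivAt_id s).div_const 2
  have h3 : HasDerivAt (fun s : ℂ => Gamma (s / 2)) (deriv Gamma (s / 2) * (1 / 2)) s :=
    HasDerivAt.comp s h2 hid
  have hid2 : HasDerivAt (fun s : ℂ => -s / 2) (-1 / 2) s := (hasDerivAt_id s).neg.div_const 2
  have h4 := hid2.const_cpow (c := (π : ℂ)) (Or.inl hπ)
  have h5 := h4.mul h3
  have h6 : logDeriv Gammaℝ s = -(log π) / 2 + digamma (s / 2) / 2 := by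
    have h7 : HasDerivAt Gammaℝ _ s := h5
    have h8 : Gamma (s / 2) ≠ 0 := Gamma_ne_zero hm
    have h9 : (π : ℂ) ^ (-s / 2) ≠ 0 := by
      rw [Ne, cpow_eq_zero_iff]
      tauto
    rw [logDeriv_apply, h7.deriv, digamma, logDeriv_apply, Gammaℝ]
    field_simp
  rw [h6, digamma_apply_add_one _ hm]
  field_simp
  ring

theorem abs_gammaFactor_sub_le {s : ℂ} (hs : 1 < s.re) {E : ℝ}
    (hE : ∀ N, ∑ n ∈ Finset.range N, 1 / ‖s / 2 + 1 + n‖ ^ 3 ≤ E) :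
    |(1 / s + logDeriv Gammaℝ s).re - Real.log (‖s + 1‖ / (2 * π)) / 2| ≤ 3 / 64 * E := by
  have hre : (s / 2).re = s.re / 2 := by
    rw [show s / 2 = s / (2 : ℝ) by norm_num, div_ofReal_re]
  have hz : 1 / 2 < (s / 2).re := by rw [hre]; linarith
  have hs1 : 0 < ‖s + 1‖ := by
    have := re_le_norm (s + 1)
    simp at this
    linarith
  have hsum : Summable fun n : ℕ => 1 / ‖s / 2 + 1 + n‖ ^ 3 :=
    summable_of_sum_range_le (fun n => by positivity) hE
  have h1 : ‖∑' n, digammaTerm n (s / 2)‖ ≤ 3 / 32 * E := by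
    refine (tsum_of_norm_bounded ((hsum.mul_left (3 / 32)).hasSum) fun n => ?_).trans ?_
    · rw [mul_one_div]
      exact norm_digammaTerm_le hz.le n
    · rw [tsum_mul_left]
      exact mul_le_mul_of_nonneg_left (hsum.tsum_le_of_sum_range_le hE) (by norm_num)
  have h2 : (1 / s + logDeriv Gammaℝ s).re - Real.log (‖s + 1‖ / (2 * π)) / 2 =
      (∑' n, digammaTerm n (s / 2)).re / 2 := by
    rw [one_div_add_logDeriv_Gammaℝ (by linarith), digamma_eq_of_re hz,
      show s / 2 + 1 / 2 = (s + 1) / 2 by ring, ← Complex.ofReal_log Real.pi_pos.le]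
    have h3 : (log ((s + 1) / 2)).re = Real.log ‖s + 1‖ - Real.log 2 := by
      rw [log_re, norm_div, Complex.norm_ofNat, Real.log_div hs1.ne' (by norm_num)]
    rw [Real.log_div hs1.ne' (by positivity), Real.log_mul (by norm_num) Real.pi_ne_zero]
    have h4 : ∀ w : ℂ, (w / 2).re = w.re / 2 := fun w => by
      rw [show w / 2 = w / (2 : ℝ) by norm_num, div_ofReal_re]
    rw [add_re, h4, h4, add_re, h3, neg_re, ofReal_re]
    ring
  rw [h2, abs_div, abs_two]
  have := abs_re_le_norm (∑' n, digammaTerm n (s / 2))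
  linarith

theorem abs_gammaFactor_sub_le_re {s : ℂ} (hs : 1 < s.re) :
    |(1 / s + logDeriv Gammaℝ s).re - Real.log (‖s + 1‖ / (2 * π)) / 2| ≤
      3 / (32 * (s.re + 1) ^ 2) := by
  have hre : (s / 2).re = s.re / 2 := by
    rw [show s / 2 = s / (2 : ℝ) by norm_num, div_ofReal_re]
  refine (abs_gammaFactor_sub_le hs (E := 1 / (2 * (s.re / 2 + 1 / 2) ^ 2)) fun N => ?_).trans
    (le_of_eq ?_)
  · refine (Finset.sum_le_sum fun n _ => ?_).trans ((sum_inv_cube_le (x := s.re / 2)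
      (by linarith) N).trans (sub_le_self _ (by positivity)))
    have h := re_le_norm (s / 2 + 1 + n)
    simp only [add_re, one_re, natCast_re, hre] at h
    have : 0 < s.re / 2 + 1 + n := by positivity
    gcongr
  · have : s.re + 1 ≠ 0 := by linarith
    rw [show s.re / 2 + 1 / 2 = (s.re + 1) / 2 by ring]
    field_simp
    norm_num

theorem abs_gammaFactor_sub_le_im {s : ℂ} (hs : 1 < s.re) (ht : s.im ≠ 0) :
    |(1 / s + logDeriv Gammaℝ s).re - Real.log (‖s + 1‖ / (2 * π)) / 2| ≤
      3 / (16 * |s.im| * (s.re + 1)) := by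
  have hre : (s / 2).re = s.re / 2 := by
    rw [show s / 2 = s / (2 : ℝ) by norm_num, div_ofReal_re]
  have him : (s / 2).im = s.im / 2 := by
    rw [show s / 2 = s / (2 : ℝ) by norm_num, div_ofReal_im]
  have ht' : 0 < |s.im| := abs_pos.mpr ht
  refine (abs_gammaFactor_sub_le hs (E := 2 / |s.im| * (1 / (s.re / 2 + 1 / 2))) fun N => ?_).trans
    (le_of_eq ?_)
  · refine (Finset.sum_le_sum fun n _ => ?_).trans ((Finset.mul_sum _ _ _).symm.le.trans
      (mul_le_mul_of_nonneg_left ((sum_inv_sq_le (x := s.re / 2)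
      (by linarith) N).trans (sub_le_self _ (by positivity))) (by positivity)))
    have h := re_le_norm (s / 2 + 1 + n)
    have h' := abs_im_le_norm (s / 2 + 1 + n)
    simp only [add_re, one_re, natCast_re, hre] at h
    simp only [add_im, one_im, natCast_im, him, add_zero, abs_div, abs_two] at h'
    have h0 : 0 < s.re / 2 + 1 + n := by positivity
    calc 1 / ‖s / 2 + 1 + n‖ ^ 3 = 1 / (‖s / 2 + 1 + n‖ * ‖s / 2 + 1 + n‖ ^ 2) := by ring
      _ ≤ 1 / (|s.im| / 2 * (s.re / 2 + 1 + n) ^ 2) := by gcongr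
      _ = _ := by field_simp
  · have : s.re + 1 ≠ 0 := by linarith
    rw [show s.re / 2 + 1 / 2 = (s.re + 1) / 2 by ring]
    field_simp
    norm_num

end

section

open Complex Filter Topology ComplexConjugate
open scoped Real

theorem logDeriv_xiFun_one : logDeriv xiFun 1 =
    ((1 + Real.eulerMascheroniConstant / 2 - Real.log (4 * π) / 2 : ℝ) : ℂ) := by
  set h : ℂ → ℂ := Function.update (fun s => (s - 1) * riemannZeta s) 1 1 with hh
  have hd : HasDerivAt h (Real.eulerMascheroniConstant : ℂ) 1 := by
    rw [hasDerivAt_iff_tendsto_slope]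
    refine (tendsto_riemannZeta_sub_one_div).congr' ?_
    filter_upwards [self_mem_nhdsWithin] with s hs
    have hs' : s ≠ 1 := hs
    have hs1 := sub_ne_zero.mpr hs'
    rw [slope_def_field, hh, Function.update_self, Function.update_of_ne hs']
    field_simp
  have hG := hasDerivAt_Gammaℝ_one
  have hxi : xiFun =ᶠ[𝓝 1] fun s => s * Gammaℝ s * h s := by
    have hopen : {s : ℂ | 0 < s.re} ∈ 𝓝 (1 : ℂ) :=
      (isOpen_lt continuous_const Complex.continuous_re).mem_nhds (by simp)
    filter_upwards [hopen] with s hs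
    by_cases h1 : s = 1
    · subst h1
      simp [hh, xiFun_one, Gammaℝ_one]
    · rw [xiFun_eq_Gammaℝ_mul hs h1, hh, Function.update_of_ne h1]
      ring
  have h2 := ((hasDerivAt_id (1 : ℂ)).mul hG).mul hd
  have h3 := h2.congr_of_eventuallyEq hxi
  rw [logDeriv_apply, h3.deriv, xiFun_one]
  have h4 : Complex.log (4 * π) = (Real.log (4 * π) : ℝ) := by
    rw [Complex.ofReal_log (by positivity)]
    push_cast
    rfl
  simp only [hh, Function.update_self, Gammaℝ_one, id, h4, Pi.mul_apply]
  push_cast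
  ring

theorem log_pi_gt : 9.1 / 8 < Real.log π := by
  have h1 : Real.exp 91 < π ^ 80 := by
    have h2 : Real.exp 91 = Real.exp 1 ^ 91 := by
      rw [← Real.exp_nat_mul]
      norm_num
    rw [h2]
    calc Real.exp 1 ^ 91 ≤ 2.7182818286 ^ 91 := by
          gcongr
          exact Real.exp_one_lt_d9.le
      _ < 3.14 ^ 80 := by norm_num
      _ < π ^ 80 := by
          gcongr
          exact Real.pi_gt_d2
  have h3 := Real.log_lt_log (Real.exp_pos _) h1
  rw [Real.log_exp, Real.log_pow] at h3
  push_cast at h3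
  linarith

theorem logDeriv_xiFun_one_lt : (logDeriv xiFun 1).re < 1 / 13 := by
  rw [logDeriv_xiFun_one, ofReal_re, Real.log_mul (by norm_num) Real.pi_ne_zero,
    show (4 : ℝ) = 2 ^ 2 by norm_num, Real.log_pow]
  have h1 := Real.eulerMascheroniConstant_lt_two_thirds
  have h2 := Real.log_two_gt_d9
  have h3 := log_pi_gt
  push_cast
  linarith

theorem one_div_sub_re_add_refl_ge {β γ : ℝ} (h0 : 0 < β) (h1 : β < 1) :
    1 / (1 + γ ^ 2) ≤ (1 - β) / ((1 - β) ^ 2 + γ ^ 2) + β / (β ^ 2 + γ ^ 2) := by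
  have h2 : 0 < 1 - β := by linarith
  rw [div_add_div _ _ (by positivity) (by positivity), div_le_div_iff₀ (by positivity) (by positivity)]
  have hp : 0 < β * (1 - β) := by positivity
  have hg := sq_nonneg γ
  nlinarith [mul_nonneg hp.le hg, mul_pos hp hp, mul_nonneg hg hg, mul_pos h0 h0, mul_pos h2 h2]

theorem ZetaZero.im_ne_zero (i : ZetaZero) : i.val.im ≠ 0 := by
  intro h
  have h1 : i.val = (i.val.re : ℂ) := Complex.ext (by simp) (by simp [h])
  have h2 := i.riemannZeta_val
  rw [h1] at h2
  exact riemannZeta_ne_zero_of_real i.re_pos i.re_lt_one h2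

open Classical in
theorem ZetaZero.five_le_abs_im (i : ZetaZero) (hi : 1 / 2 < i.val.re) : 5 ≤ |i.val.im| := by
  by_contra! hlt
  obtain ⟨j, hj⟩ := ZetaZero.exists_val_eq (a := conj i.val) (by
    rw [xiFun_conj, i.xiFun_val, map_zero])
  have him := i.im_ne_zero
  have hsum := hasSum_re_zeros (s := 1) (by simp)
  have hle := sum_le_hasSum ({i, refl i, j, refl j} : Finset ZetaZero)
    (fun k _ => one_div_sub_re_nonneg (by simp) k) hsum
  have hre : ∀ a : ℂ, (1 / (1 - a)).re = (1 - a.re) / ((1 - a.re) ^ 2 + a.im ^ 2) := by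
    intro a
    rw [one_div_sub_re]
    simp [normSq_apply, sq]
  have e1 : i ≠ refl i := fun h => by
    have := congrArg (fun k => k.val.re) h
    simp [ZetaZero.val_refl] at this
    linarith
  have e2 : i ≠ j := fun h => by
    have := congrArg (fun k => k.val.im) h
    simp [hj] at this
    exact him (by linarith)
  have e3 : i ≠ refl j := fun h => by
    have := congrArg (fun k => k.val.re) h
    simp [ZetaZero.val_refl, hj] at this
    linarith
  have e4 : refl i ≠ j := fun h => by
    have := congrArg (fun k => k.val.re) h
    simp [ZetaZero.val_refl, hj] at this
    linarith
  have e5 : refl i ≠ refl j := fun h => e2 ((refl).injective h)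
  have e6 : j ≠ refl j := fun h => by
    have := congrArg (fun k => k.val.re) h
    simp [ZetaZero.val_refl, hj] at this
    linarith
  rw [Finset.sum_insert (by simp [e1, e2, e3]), Finset.sum_insert (by simp [e4, e5]),
    Finset.sum_insert (by simp [e6]), Finset.sum_singleton] at hle
  have hre' : ∀ a : ℂ, (1 / a).re = a.re / (a.re ^ 2 + a.im ^ 2) := by
    intro a
    simp [normSq_apply, sq]
  simp only [ZetaZero.val_refl, hj, sub_sub_cancel, conj_conj] at hle
  simp only [hre, hre', conj_re, conj_im, neg_sq] at hle
  have h1 := one_div_sub_re_add_refl_ge (γ := i.val.im) i.re_pos i.re_lt_one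
  have h2 := logDeriv_xiFun_one_lt
  have h3 : 1 / 26 ≤ 1 / (1 + i.val.im ^ 2) := by
    apply one_div_le_one_div_of_le (by positivity)
    have : i.val.im ^ 2 ≤ 5 ^ 2 := by
      rw [← sq_abs]
      gcongr
    linarith
  linarith

end

section

open Complex Filter Topology ComplexConjugate

/-- The real part of `3 / (z + 2α) - 2 / (z + 3α) - κ / (z + 31 / 50)` at `z = b + i y`, with `Y = y ^ 2`
and `κ = 11 / 25`. -/
noncomputable def stechkin (α b Y : ℝ) : ℝ :=
  3 * ((b + 2 * α) / ((b + 2 * α) ^ 2 + Y)) - 2 * ((b + 3 * α) / ((b + 3 * α) ^ 2 + Y)) -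
    11 / 25 * ((b + 31 / 50) / ((b + 31 / 50) ^ 2 + Y))

theorem stechkin_poly_nonneg {α b Y : ℝ} (hα : 0 ≤ α) (hα' : α ≤ 3 / 40) (hb : 0 ≤ b) (hb' : b ≤ 1)
    (hY : 0 ≤ Y) :
    0.9856 * ((((b + 2 * α) ^ 2 + Y) * ((b + 3 * α) ^ 2 + Y)) *
      (((1 - b + 2 * α) ^ 2 + Y) * ((1 - b + 3 * α) ^ 2 + Y))) ≤
    (1 + Y) * ((b * Y + (b + 2 * α) * (b + 3 * α) * (b + 5 * α)) *
        (((1 - b + 2 * α) ^ 2 + Y) * ((1 - b + 3 * α) ^ 2 + Y)) +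
      ((1 - b) * Y + (1 - b + 2 * α) * (1 - b + 3 * α) * (1 - b + 5 * α)) *
        (((b + 2 * α) ^ 2 + Y) * ((b + 3 * α) ^ 2 + Y))) := by
  obtain ⟨P, hP⟩ : ∃ P, P = ((b + 2 * α) ^ 2 + Y) * ((b + 3 * α) ^ 2 + Y) := ⟨_, rfl⟩
  obtain ⟨Q, hQ⟩ : ∃ Q, Q = ((1 - b + 2 * α) ^ 2 + Y) * ((1 - b + 3 * α) ^ 2 + Y) := ⟨_, rfl⟩
  rw [← hP, ← hQ]
  obtain ⟨p, hp⟩ : ∃ p, p = b * (1 - b) := ⟨_, rfl⟩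
  have hc : 0 ≤ 1 - b := by linarith
  have hp0 : 0 ≤ p := hp ▸ mul_nonneg hb hc
  have hp1 : p ≤ 1 / 4 := by nlinarith [sq_nonneg (b - 1 / 2)]
  have hDD : Y ^ 2 * (1 - 4 * p + 2 * p ^ 2) ≤ P * Q := by
    rw [hP, hQ]
    have h1 : ∀ u : ℝ, 0 ≤ u → u ^ 4 + Y ^ 2 ≤ ((u + 2 * α) ^ 2 + Y) * ((u + 3 * α) ^ 2 + Y) := by
      intro u hu
      calc u ^ 4 + Y ^ 2 ≤ (u ^ 2 + Y) * (u ^ 2 + Y) := by nlinarith [mul_nonneg (sq_nonneg u) hY]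
        _ ≤ _ := by
          gcongr <;> linarith
    calc Y ^ 2 * (1 - 4 * p + 2 * p ^ 2) = Y ^ 2 * (b ^ 4 + (1 - b) ^ 4) := by rw [hp]; ring
      _ ≤ (b ^ 4 + Y ^ 2) * ((1 - b) ^ 4 + Y ^ 2) := by
        have : 0 ≤ b ^ 4 * (1 - b) ^ 4 := by positivity
        nlinarith [sq_nonneg (Y ^ 2)]
      _ ≤ _ := by
        gcongr
        · exact h1 b hb
        · exact h1 _ hc
  obtain ⟨C₀, hC₀⟩ : ∃ c, c = α ^ 3 * (30 + 300 * α + 1110 * α ^ 2 + 1584 * α ^ 3 - 1296 * α ^ 5) +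
      α ^ 2 * p * (31 + 190 * α + 283 * α ^ 2 - 360 * α ^ 3 - 936 * α ^ 4) +
      α * p ^ 2 * (10 + 7 * α - 130 * α ^ 2 - 241 * α ^ 3 - 26 * α * p) +
      p ^ 3 * (1 - p - 10 * α) := ⟨_, rfl⟩
  have hC0 : 0 ≤ C₀ := by
    rw [hC₀]
    have a2 : α ^ 2 ≤ (3 / 40) ^ 2 := by gcongr
    have a3 : α ^ 3 ≤ (3 / 40) ^ 3 := by gcongr
    have a4 : α ^ 4 ≤ (3 / 40) ^ 4 := by gcongr
    have a5 : α ^ 5 ≤ (3 / 40) ^ 5 := by gcongr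
    have ap : α * p ≤ 3 / 40 * (1 / 4) := by gcongr
    have b2 := pow_nonneg hα 2
    have b3 := pow_nonneg hα 3
    refine add_nonneg (add_nonneg (add_nonneg ?_ ?_) ?_) ?_ <;>
      refine mul_nonneg (by positivity) ?_
    · norm_num at a5
      linarith
    · norm_num at a3 a4
      linarith
    · norm_num at a2 a3 ap
      linarith
    · linarith
  obtain ⟨C₁, hC₁⟩ : ∃ c, c =
      90 * α ^ 3 + 522 * α ^ 4 + 1110 * α ^ 5 + 1980 * α ^ 6 + 2160 * α ^ 7 +
      p * (1 - 3 * p) + 10 * α * p + 143 * α ^ 2 * p + 510 * α ^ 3 * p + 645 * α ^ 4 * p +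
      780 * α ^ 5 * p + 20 * α * p ^ 2 + 70 * α ^ 2 * p ^ 2 + 60 * α ^ 3 * p ^ 2 + 5 * p ^ 3 :=
    ⟨_, rfl⟩
  have hC1 : 0 ≤ C₁ := by
    rw [hC₁]
    have : 0 ≤ 1 - 3 * p := by linarith
    positivity
  have hC2 : 0 ≤ -6 * α ^ 2 + 60 * α ^ 3 + 498 * α ^ 4 + 780 * α ^ 5 + 4 * p + 30 * α * p +
      186 * α ^ 2 * p + 360 * α ^ 3 * p - 7 * p ^ 2 + 0.0144 * (1 - 4 * p + 2 * p ^ 2) := by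
    have h1 : 0 ≤ -6 * α ^ 2 + 60 * α ^ 3 + 0.0144 := by
      nlinarith [mul_nonneg hα (sq_nonneg (α - 1 / 15)), sq_nonneg (α - 1 / 15)]
    have h2 : 0 ≤ 498 * α ^ 4 + 780 * α ^ 5 + 30 * α * p + 186 * α ^ 2 * p + 360 * α ^ 3 * p := by
      positivity
    have h3 : 0 ≤ p * (3.9424 - 6.9712 * p) := mul_nonneg hp0 (by linarith)
    linarith
  have hC3 : 0 ≤ 18 * α ^ 2 + 60 * α ^ 3 + 3 * p := by positivity
  have hid : (1 + Y) * ((b * Y + (b + 2 * α) * (b + 3 * α) * (b + 5 * α)) * Q +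
      ((1 - b) * Y + (1 - b + 2 * α) * (1 - b + 3 * α) * (1 - b + 5 * α)) * P) - P * Q =
      C₀ + Y * C₁ +
      Y ^ 2 * (-6 * α ^ 2 + 60 * α ^ 3 + 498 * α ^ 4 + 780 * α ^ 5 + 4 * p + 30 * α * p +
      186 * α ^ 2 * p + 360 * α ^ 3 * p - 7 * p ^ 2) +
      Y ^ 3 * (18 * α ^ 2 + 60 * α ^ 3 + 3 * p) := by
    rw [hC₀, hC₁, hp, hP, hQ]
    ring
  have h2 := mul_nonneg (sq_nonneg Y) hC2
  have h1 := mul_nonneg hY hC1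
  have h3 := mul_nonneg (pow_nonneg hY 3) hC3
  rw [mul_add, mul_left_comm] at h2
  have key : ∀ N DD t₀ t₁ t₂ t₃ q : ℝ, N - DD = t₀ + t₁ + t₂ + t₃ → 0 ≤ t₀ → 0 ≤ t₁ →
      0 ≤ t₂ + 0.0144 * q → 0 ≤ t₃ → q ≤ DD → 0.9856 * DD ≤ N := by
    intros
    linarith
  exact key _ _ _ _ _ _ _ hid hC0 h1 h2 h3 hDD

theorem stechkin_add_nonneg {α b Y : ℝ} (hα : 0 < α) (hα' : α ≤ 3 / 40) (hb : 0 ≤ b) (hb' : b ≤ 1)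
    (hY : 0 ≤ Y) : 0 ≤ stechkin α b Y + stechkin α (1 - b) Y := by
  have hc : 0 ≤ 1 - b := by linarith
  have hform : ∀ u : ℝ, 0 ≤ u → 3 * ((u + 2 * α) / ((u + 2 * α) ^ 2 + Y)) -
      2 * ((u + 3 * α) / ((u + 3 * α) ^ 2 + Y)) =
      (u * Y + (u + 2 * α) * (u + 3 * α) * (u + 5 * α)) /
        (((u + 2 * α) ^ 2 + Y) * ((u + 3 * α) ^ 2 + Y)) := by
    intro u hu
    have h1 : (u + 2 * α) ^ 2 + Y ≠ 0 := by positivity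
    have h2 : (u + 3 * α) ^ 2 + Y ≠ 0 := by positivity
    field_simp
    ring
  have h1 : 0.9856 / (1 + Y) ≤ (b * Y + (b + 2 * α) * (b + 3 * α) * (b + 5 * α)) /
        (((b + 2 * α) ^ 2 + Y) * ((b + 3 * α) ^ 2 + Y)) +
      ((1 - b) * Y + (1 - b + 2 * α) * (1 - b + 3 * α) * (1 - b + 5 * α)) /
        (((1 - b + 2 * α) ^ 2 + Y) * ((1 - b + 3 * α) ^ 2 + Y)) := by
    rw [div_add_div _ _ (by positivity) (by positivity),
      div_le_div_iff₀ (by positivity) (by positivity)]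
    have := stechkin_poly_nonneg hα.le hα' hb hb' hY
    linarith
  have h2 : 11 / 25 * ((b + 31 / 50) / ((b + 31 / 50) ^ 2 + Y)) +
      11 / 25 * ((1 - b + 31 / 50) / ((1 - b + 31 / 50) ^ 2 + Y)) ≤ 0.9856 / (1 + Y) := by
    rw [← mul_add, div_add_div _ _ (by positivity) (by positivity), ← mul_div_assoc,
      div_le_div_iff₀ (by positivity) (by positivity)]
    have hm : 0 ≤ b * (1 - b) := mul_nonneg hb hc
    have hm1 : b * (1 - b) ≤ 1 / 4 := by nlinarith [sq_nonneg (b - 1 / 2)]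
    obtain ⟨m, hme⟩ : ∃ m, m = (b + 31 / 50) * (1 - b + 31 / 50) := ⟨_, rfl⟩
    have e1 : (b + 31 / 50) * ((1 - b + 31 / 50) ^ 2 + Y) +
        ((b + 31 / 50) ^ 2 + Y) * (1 - b + 31 / 50) = 2.24 * (m + Y) := by
      rw [hme]; ring
    have e2 : ((b + 31 / 50) ^ 2 + Y) * ((1 - b + 31 / 50) ^ 2 + Y) =
        m ^ 2 + (5.0176 - 2 * m) * Y + Y ^ 2 := by
      rw [hme]; ring
    rw [e1, e2]
    have hm2 : 1 ≤ m := by rw [hme]; nlinarith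
    have hm3 : m ≤ 1.3 := by rw [hme]; nlinarith
    nlinarith [mul_nonneg hY (by linarith : 0 ≤ 1.3 - m),
      mul_nonneg (by linarith : 0 ≤ m) (by linarith : 0 ≤ m - 1)]
  have h3 := hform b hb
  have h4 := hform (1 - b) hc
  unfold stechkin
  linarith

theorem stechkin_add_ge {α b : ℝ} (hα : 0 < α) (hα' : α ≤ 3 / 40) (hb : 0 < b) (hb' : b ≤ 1 / 2) :
    (b + 5 * α) / ((b + 2 * α) * (b + 3 * α)) - 3 / 100 ≤
      stechkin α b 0 + stechkin α (1 - b) 0 := by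
  have hform : ∀ u : ℝ, 0 < u → stechkin α u 0 =
      (u + 5 * α) / ((u + 2 * α) * (u + 3 * α)) - 11 / 25 / (u + 31 / 50) := by
    intro u hu
    have h1 : (u + 2 * α) ≠ 0 := by positivity
    have h2 : (u + 3 * α) ≠ 0 := by positivity
    unfold stechkin
    field_simp
    ring
  have hc : 1 / 2 ≤ 1 - b := by linarith
  rw [hform b hb, hform (1 - b) (by linarith)]
  obtain ⟨c, hce⟩ : ∃ c, c = 1 - b := ⟨_, rfl⟩
  have hbc : b = 1 - c := by linarith
  rw [← hce]
  rw [← hce] at hc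
  have h1 : 1 / (c + 0.0386) ≤ (c + 5 * α) / ((c + 2 * α) * (c + 3 * α)) := by
    rw [div_le_div_iff₀ (by positivity) (by positivity)]
    nlinarith [mul_nonneg hα.le (by linarith : 0 ≤ 3 / 40 - α)]
  have h2 : 11 / 25 / (b + 31 / 50) + 11 / 25 / (c + 31 / 50) ≤ 1 / (c + 0.0386) + 3 / 100 := by
    have hb1 : 0 ≤ 1 - c := by linarith
    have e : 11 / 25 / (b + 31 / 50) + 11 / 25 / (c + 31 / 50) = 0.9856 / (1.0044 + c * (1 - c)) := by
      have : 0 < 1.0044 + c * (1 - c) := by nlinarith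
      rw [hbc, div_add_div _ _ (by linarith) (by linarith), div_eq_div_iff
        (mul_ne_zero (by linarith) (by linarith)) this.ne']
      ring
    rw [e, div_add' _ _ _ (by linarith), div_le_div_iff₀ (by nlinarith) (by linarith)]
    nlinarith [mul_nonneg (by linarith : 0 ≤ c) hb1, mul_nonneg hb1 (by linarith : 0 ≤ c - 1 / 2)]
  linarith

theorem hasSum_of_eq {ι : Type*} {f g : ι → ℝ} {a b : ℝ} (h : HasSum f a) (hf : ∀ i, f i = g i)
    (hab : a = b) : HasSum g b := by
  rwa [← funext hf, ← hab]

open ArithmeticFunction in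
theorem hasSum_vonMangoldt_re {σ : ℝ} (hσ : 1 < σ) (y : ℝ) :
    HasSum (fun n : ℕ => vonMangoldt n * ((n : ℝ) ^ (-σ) * Real.cos (y * Real.log n)))
      (-(logDeriv riemannZeta (σ + y * I)).re) := by
  have hs : 1 < ((σ : ℂ) + y * I).re := by simpa using hσ
  have h1 := (LSeriesSummable_vonMangoldt hs).LSeriesHasSum
  rw [LSeries_vonMangoldt_eq_deriv_riemannZeta_div hs, neg_div, ← logDeriv_apply] at h1
  have h2 := hasSum_re h1
  rw [neg_re] at h2
  convert h2 using 1
  ext n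
  rcases eq_or_ne n 0 with rfl | hn
  · simp
  have hn' : (0 : ℝ) < n := by positivity
  rw [LSeries.term_of_ne_zero hn, div_eq_mul_inv, ← cpow_neg, re_ofReal_mul,
    cpow_def_of_ne_zero (by exact_mod_cast hn), Real.rpow_def_of_pos hn', ← ofReal_natCast,
    ← ofReal_log hn'.le, show ((Real.log n : ℝ) : ℂ) * -(σ + y * I) =
      ((Real.log n * -σ : ℝ) : ℂ) + ((-(y * Real.log n) : ℝ) : ℂ) * I by push_cast; ring,
    exp_re]
  simp [-natCast_log]

/-- Stechkin's combination of values of `-ζ'/ζ` at height `y`. -/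
noncomputable def stechkinZeta (α y : ℝ) : ℝ :=
  3 * -(logDeriv riemannZeta ((1 + 2 * α : ℝ) + y * I)).re -
    2 * -(logDeriv riemannZeta ((1 + 3 * α : ℝ) + y * I)).re -
    11 / 25 * -(logDeriv riemannZeta ((1 + 31 / 50 : ℝ) + y * I)).re

theorem stechkin_weight_nonneg {α : ℝ} (hα : 0 < α) (hα' : α ≤ 3 / 40) {n : ℕ} (hn : n ≠ 0) :
    0 ≤ 3 * (n : ℝ) ^ (-(1 + 2 * α)) - 2 * (n : ℝ) ^ (-(1 + 3 * α)) -
      11 / 25 * (n : ℝ) ^ (-(1 + 31 / 50 : ℝ)) := by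
  have hn1 : (1 : ℝ) ≤ n := by exact_mod_cast Nat.one_le_iff_ne_zero.mpr hn
  have h1 : (n : ℝ) ^ (-(1 + 3 * α)) ≤ (n : ℝ) ^ (-(1 + 2 * α)) :=
    Real.rpow_le_rpow_of_exponent_le hn1 (by linarith)
  have h2 : (n : ℝ) ^ (-(1 + 31 / 50 : ℝ)) ≤ (n : ℝ) ^ (-(1 + 2 * α)) :=
    Real.rpow_le_rpow_of_exponent_le hn1 (by linarith)
  have h3 : 0 ≤ (n : ℝ) ^ (-(1 + 2 * α)) := by positivity
  linarith

theorem sum_stechkinZeta_nonneg {α : ℝ} (hα : 0 < α) (hα' : α ≤ 3 / 40) (t : ℝ) :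
    0 ≤ 370 * stechkinZeta α 0 + 595 * stechkinZeta α t + 306 * stechkinZeta α (2 * t) +
      81 * stechkinZeta α (3 * t) := by
  have hs : ∀ y, HasSum (fun n : ℕ => ArithmeticFunction.vonMangoldt n *
      ((3 * (n : ℝ) ^ (-(1 + 2 * α)) - 2 * (n : ℝ) ^ (-(1 + 3 * α)) -
      11 / 25 * (n : ℝ) ^ (-(1 + 31 / 50 : ℝ))) * Real.cos (y * Real.log n)))
      (stechkinZeta α y) := by
    intro y
    have h1 := ((hasSum_vonMangoldt_re (σ := 1 + 2 * α) (by linarith) y).mul_left 3).sub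
      ((hasSum_vonMangoldt_re (σ := 1 + 3 * α) (by linarith) y).mul_left 2)
    have h2 := h1.sub
      ((hasSum_vonMangoldt_re (σ := 1 + 31 / 50) (by norm_num) y).mul_left (11 / 25))
    exact hasSum_of_eq h2 (fun n => by ring) rfl
  have h := ((((hs 0).mul_left 370).add ((hs t).mul_left 595)).add
    ((hs (2 * t)).mul_left 306)).add ((hs (3 * t)).mul_left 81)
  refine h.nonneg fun n => ?_
  rcases eq_or_ne n 0 with rfl | hn
  · simp
  have hw := stechkin_weight_nonneg hα hα' hn
  have hΛ : 0 ≤ ArithmeticFunction.vonMangoldt n := ArithmeticFunction.vonMangoldt_nonneg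
  obtain ⟨c, hc⟩ : ∃ c, c = Real.cos (t * Real.log n) := ⟨_, rfl⟩
  have h2 : Real.cos (2 * t * Real.log n) = 2 * c ^ 2 - 1 := by
    rw [mul_assoc, Real.cos_two_mul, hc]
  have h3 : Real.cos (3 * t * Real.log n) = 4 * c ^ 3 - 3 * c := by
    rw [mul_assoc, Real.cos_three_mul, hc]
  rw [zero_mul, Real.cos_zero, h2, h3, ← hc]
  have hc1 : 0 ≤ 1 + c := by
    rw [hc]
    linarith [Real.neg_one_le_cos (t * Real.log n)]
  have hP : 0 ≤ 4 * ((1 + c) * (4 + 9 * c) ^ 2) := by positivity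
  have := mul_nonneg hΛ (mul_nonneg hw hP)
  nlinarith [this]

/-- Stechkin's combination of gamma factors at height `y`. -/
noncomputable def stechkinGamma (α y : ℝ) : ℝ :=
  3 * (1 / ((1 + 2 * α : ℝ) + y * I) + logDeriv Gammaℝ ((1 + 2 * α : ℝ) + y * I)).re -
    2 * (1 / ((1 + 3 * α : ℝ) + y * I) + logDeriv Gammaℝ ((1 + 3 * α : ℝ) + y * I)).re -
    11 / 25 * (1 / ((1 + 31 / 50 : ℝ) + y * I) + logDeriv Gammaℝ ((1 + 31 / 50 : ℝ) + y * I)).re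

theorem hasSum_stechkin {α : ℝ} (hα : 0 < α) (y : ℝ) :
    HasSum (fun i : ZetaZero => stechkin α (1 - i.val.re) ((y - i.val.im) ^ 2))
      (stechkin α 0 (y ^ 2) + stechkinGamma α y - stechkinZeta α y) := by
  have hre : ∀ u v : ℝ, (1 / ((u : ℂ) + v * I)).re = u / (u ^ 2 + v ^ 2) := by
    intro u v
    simp [normSq_apply, sq]
  have key : ∀ a : ℝ, 0 < a →
      HasSum (fun i : ZetaZero => (1 - i.val.re + a) / ((1 - i.val.re + a) ^ 2 + (y - i.val.im) ^ 2))
      ((0 + a) / ((0 + a) ^ 2 + y ^ 2) +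
        (1 / ((1 + a : ℝ) + y * I) + logDeriv Gammaℝ ((1 + a : ℝ) + y * I)).re -
        -(logDeriv riemannZeta ((1 + a : ℝ) + y * I)).re) := by
    intro a ha
    have h1 : 1 < (((1 + a : ℝ) : ℂ) + y * I).re := by simpa using ha
    have h2 := hasSum_re_zeros h1.le
    rw [logDeriv_xiFun h1] at h2
    convert h2 using 1
    · ext i
      rw [show ((1 + a : ℝ) : ℂ) + y * I - i.val =
        ((1 - i.val.re + a : ℝ) : ℂ) + ((y - i.val.im : ℝ) : ℂ) * I by
          apply Complex.ext <;> simp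
          ring, hre]
    · rw [show 1 / (((1 + a : ℝ) : ℂ) + y * I - 1) = 1 / ((a : ℂ) + y * I) by push_cast; ring_nf]
      simp only [add_re]
      rw [hre a y]
      simp only [zero_add]
      ring
  have h := (((key (2 * α) (by positivity)).mul_left 3).sub
    ((key (3 * α) (by positivity)).mul_left 2)).sub ((key (31 / 50) (by norm_num)).mul_left (11 / 25))
  refine hasSum_of_eq h (fun i => rfl) ?_
  unfold stechkin stechkinGamma stechkinZeta
  ring

theorem hasSum_stechkin_pair {α : ℝ} (hα : 0 < α) (y : ℝ) :
    HasSum (fun i : ZetaZero => stechkin α (1 - i.val.re) ((y - i.val.im) ^ 2) +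
        stechkin α (1 - (1 - i.val.re)) ((y - i.val.im) ^ 2))
      (2 * (stechkin α 0 (y ^ 2) + stechkinGamma α y - stechkinZeta α y)) := by
  have h1 := hasSum_stechkin hα y
  have h2 := (ZetaZero.refl.hasSum_iff).mpr h1
  rw [two_mul]
  convert h1.add h2 using 1
  ext i
  simp [ZetaZero.val_refl]

theorem stechkinZeta_le {α : ℝ} (hα : 0 < α) (hα' : α ≤ 3 / 40) (y : ℝ) :
    stechkinZeta α y ≤ stechkin α 0 (y ^ 2) + stechkinGamma α y := by
  have := (hasSum_stechkin_pair hα y).nonneg fun i =>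
    stechkin_add_nonneg hα hα' (by linarith [i.re_lt_one]) (by linarith [i.re_pos]) (sq_nonneg _)
  linarith

theorem stechkinZeta_le_of_zero {α : ℝ} (hα : 0 < α) (hα' : α ≤ 3 / 40) (i : ZetaZero)
    (hi : 1 / 2 < i.val.re) :
    stechkinZeta α i.val.im + ((1 - i.val.re + 5 * α) /
        ((1 - i.val.re + 2 * α) * (1 - i.val.re + 3 * α)) - 3 / 100) ≤
      stechkin α 0 (i.val.im ^ 2) + stechkinGamma α i.val.im := by
  classical
  have h := sum_le_hasSum {i, ZetaZero.refl i} (fun i _ =>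
    stechkin_add_nonneg hα hα' (by linarith [i.re_lt_one]) (by linarith [i.re_pos]) (sq_nonneg _))
    (hasSum_stechkin_pair hα i.val.im)
  have hne : i ≠ ZetaZero.refl i := fun h => by
    have := congrArg (fun k => k.val.re) h
    simp [ZetaZero.val_refl] at this
    linarith
  rw [Finset.sum_insert (by simpa using hne), Finset.sum_singleton] at h
  simp only [ZetaZero.val_refl, sub_re, one_re, conj_re, sub_im, one_im, conj_im, sub_sub_cancel,
    zero_sub, neg_neg, sub_self] at h
  have h2 := stechkin_add_ge (b := 1 - i.val.re) hα hα' (by linarith [i.re_lt_one]) (by linarith)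
  simp only [sub_sub_cancel, ne_eq, OfNat.ofNat_ne_zero, not_false_eq_true, zero_pow] at h h2
  linarith

end

section

open Complex hiding exp log
open Filter Topology ComplexConjugate
open Real

theorem stechkin_zero_le {α Y : ℝ} (hα : 0 < α) (hα' : α ≤ 3 / 40) (hY : 25 ≤ Y) :
    stechkin α 0 Y ≤ 0 := by
  have hY0 : 0 < Y := by linarith
  have h1 : 3 * ((0 + 2 * α) / ((0 + 2 * α) ^ 2 + Y)) - 2 * ((0 + 3 * α) / ((0 + 3 * α) ^ 2 + Y)) ≤
      30 * α ^ 3 / Y ^ 2 := by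
    have e : 3 * ((0 + 2 * α) / ((0 + 2 * α) ^ 2 + Y)) - 2 * ((0 + 3 * α) / ((0 + 3 * α) ^ 2 + Y)) =
        30 * α ^ 3 / ((4 * α ^ 2 + Y) * (9 * α ^ 2 + Y)) := by
      have : 4 * α ^ 2 + Y ≠ 0 := by positivity
      have : 9 * α ^ 2 + Y ≠ 0 := by positivity
      have : (0 + 2 * α) ^ 2 + Y = 4 * α ^ 2 + Y := by ring
      have : (0 + 3 * α) ^ 2 + Y = 9 * α ^ 2 + Y := by ring
      simp only [*]
      field_simp
      ring
    rw [e]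
    apply div_le_div_of_nonneg_left (by positivity) (by positivity)
    nlinarith [mul_nonneg (sq_nonneg α) hY0.le, sq_nonneg (α ^ 2)]
  have h2 : 30 * α ^ 3 / Y ^ 2 ≤ 11 / 25 * ((0 + 31 / 50) / ((0 + 31 / 50) ^ 2 + Y)) := by
    rw [← mul_div_assoc, div_le_div_iff₀ (by positivity) (by positivity)]
    have h3 : α ^ 3 ≤ (3 / 40) ^ 3 := by gcongr
    calc 30 * α ^ 3 * ((0 + 31 / 50) ^ 2 + Y) ≤ 30 * (3 / 40) ^ 3 * (Y + Y) := by
          gcongr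
          linarith
      _ ≤ 11 / 25 * (0 + 31 / 50) * Y ^ 2 := by nlinarith
  unfold stechkin
  linarith

theorem stechkin_zero_zero {α : ℝ} (hα : 0 < α) :
    stechkin α 0 (0 ^ 2) = 5 / (6 * α) - 22 / 31 := by
  unfold stechkin
  field_simp
  ring

theorem stechkinGamma_zero_le {α : ℝ} (hα : 0 < α) (hα' : α ≤ 3 / 40) :
    stechkinGamma α 0 ≤ -0.247 := by
  have key : ∀ a : ℝ, 0 < a →
      |(1 / ((1 + a : ℝ) + (0 : ℝ) * I) + logDeriv Gammaℝ ((1 + a : ℝ) + (0 : ℝ) * I)).re -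
        (log (1 + a / 2) - log π) / 2| ≤ 3 / (32 * (2 + a) ^ 2) := by
    intro a ha
    have h := abs_gammaFactor_sub_le_re (s := (1 + a : ℝ) + (0 : ℝ) * I) (by simpa using ha)
    have e : ‖((1 + a : ℝ) : ℂ) + (0 : ℝ) * I + 1‖ = 2 * (1 + a / 2) := by
      rw [show ((1 + a : ℝ) : ℂ) + (0 : ℝ) * I + 1 = ((2 * (1 + a / 2) : ℝ) : ℂ) by push_cast; ring,
        norm_real, norm_of_nonneg (by positivity)]
    rw [e, mul_div_mul_left _ _ two_ne_zero, Real.log_div (by positivity) pi_ne_zero] at h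
    refine h.trans (le_of_eq ?_)
    simp
    ring
  have h1 := abs_le.mp (key (2 * α) (by positivity))
  have h2 := abs_le.mp (key (3 * α) (by positivity))
  have h3 := abs_le.mp (key (31 / 50) (by norm_num))
  have e1 : 3 / (32 * (2 + 2 * α) ^ 2) ≤ 3 / (32 * 2 ^ 2) := by
    gcongr
    linarith
  have e2 : 3 / (32 * (2 + 3 * α) ^ 2) ≤ 3 / (32 * 2 ^ 2) := by
    gcongr
    linarith
  have l1 : log (1 + 2 * α / 2) ≤ α := by
    have := log_le_sub_one_of_pos (x := 1 + 2 * α / 2) (by positivity)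
    linarith
  have l2 : 2 * (3 * α / 2) / (3 * α / 2 + 2) ≤ log (1 + 3 * α / 2) :=
    le_log_one_add_of_nonneg (by positivity)
  have l3 : 2 * ((31 / 50 : ℝ) / 2) / ((31 / 50 : ℝ) / 2 + 2) ≤ log (1 + (31 / 50 : ℝ) / 2) :=
    le_log_one_add_of_nonneg (by norm_num)
  have l2' : 3 * α / 2 - 0.0064 ≤ 2 * (3 * α / 2) / (3 * α / 2 + 2) := by
    rw [le_div_iff₀ (by positivity)]
    nlinarith
  have h4 := log_pi_gt
  unfold stechkinGamma
  norm_num1 at e1 e2 l3 h3 ⊢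
  linarith

theorem stechkinGamma_le {α y : ℝ} (hα : 0 < α) (hα' : α ≤ 3 / 40) (hy : 5 ≤ |y|) :
    stechkinGamma α y ≤ 0.28 * (log |y| - log (2 * π)) + 1.2 / |y| := by
  have hy0 : y ≠ 0 := by
    rintro rfl
    norm_num at hy
  have hy1 : 0 < |y| := by linarith
  have key : ∀ a : ℝ, 0 < a →
      |(1 / ((1 + a : ℝ) + y * I) + logDeriv Gammaℝ ((1 + a : ℝ) + y * I)).re -
        (log ‖((2 + a : ℝ) : ℂ) + y * I‖ - log (2 * π)) / 2| ≤
        3 / (16 * (2 + a)) * (1 / |y|) := by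
    intro a ha
    have h := abs_gammaFactor_sub_le_im (s := (1 + a : ℝ) + y * I) (by simpa using ha)
      (by simpa using hy0)
    have e : ((1 + a : ℝ) : ℂ) + y * I + 1 = ((2 + a : ℝ) : ℂ) + y * I := by push_cast; ring
    have hn : ‖((2 + a : ℝ) : ℂ) + y * I‖ ≠ 0 := by
      rw [norm_ne_zero_iff]
      intro h0
      have := congrArg Complex.im h0
      simp at this
      exact hy0 this
    rw [e, Real.log_div hn (by positivity)] at h
    refine h.trans (le_of_eq ?_)
    have : ((1 + a : ℝ) + y * I : ℂ).im = y := by simp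
    rw [this]
    have : ((1 + a : ℝ) + y * I : ℂ).re = 1 + a := by simp
    rw [this]
    field_simp
    ring
  have lo : ∀ a : ℝ, log |y| ≤ log ‖((2 + a : ℝ) : ℂ) + y * I‖ := by
    intro a
    refine log_le_log hy1 ?_
    have := abs_im_le_norm (((2 + a : ℝ) : ℂ) + y * I)
    simpa using this
  have hi : log ‖((2 + 2 * α : ℝ) : ℂ) + y * I‖ ≤ log |y| + 2.3113 / |y| ^ 2 := by
    have h1 : ‖((2 + 2 * α : ℝ) : ℂ) + y * I‖ ^ 2 = |y| ^ 2 * (1 + (2 + 2 * α) ^ 2 / |y| ^ 2) := by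
      rw [← normSq_eq_norm_sq, normSq_add_mul_I, sq_abs]
      field_simp
      ring
    have h2 := congrArg log h1
    rw [log_pow, Real.log_mul (by positivity) (by positivity), log_pow] at h2
    have h3 := log_le_sub_one_of_pos (x := 1 + (2 + 2 * α) ^ 2 / |y| ^ 2) (by positivity)
    have h4 : (2 + 2 * α) ^ 2 / |y| ^ 2 ≤ 4.6226 / |y| ^ 2 := by
      gcongr
      nlinarith
    have h5 : 4.6226 / |y| ^ 2 = 2 * (2.3113 / |y| ^ 2) := by ring
    simp only [Nat.cast_ofNat] at h2
    linarith
  have h1 := abs_le.mp (key (2 * α) (by positivity))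
  have h2 := abs_le.mp (key (3 * α) (by positivity))
  have h3 := abs_le.mp (key (31 / 50) (by norm_num))
  have g2 := lo (3 * α)
  have g3 := lo (31 / 50)
  have e1 : 3 / (16 * (2 + 2 * α)) * (1 / |y|) ≤ 3 / (16 * 2) * (1 / |y|) := by
    gcongr
    linarith
  have e2 : 3 / (16 * (2 + 3 * α)) * (1 / |y|) ≤ 3 / (16 * 2) * (1 / |y|) := by
    gcongr
    linarith
  have e3 : 3 / (16 * (2 + (31 / 50 : ℝ))) * (1 / |y|) ≤ 0.072 * (1 / |y|) := by
    gcongr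
    norm_num
  have e4 : 2.3113 / |y| ^ 2 ≤ 0.46226 * (1 / |y|) := by
    rw [mul_one_div, div_le_div_iff₀ (by positivity) hy1]
    nlinarith
  rw [show 1.2 / |y| = 1.2 * (1 / |y|) by ring]
  have hw : 0 < 1 / |y| := by positivity
  unfold stechkinGamma
  linarith [h1.2, h2.1, h3.1]

/-- The classical zero-free region, with explicit constants. -/
theorem zero_free {i : ZetaZero} (hi : 1 / 2 < i.val.re) {D : ℝ} (hD : 3 ≤ D)
    (hD' : 0.7432 * log |i.val.im| - 2.03 + 2.6 / |i.val.im| ≤ D) :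
    0.092 / D ≤ 1 - i.val.re := by
  by_contra! hb
  have hD0 : 0 < D := by linarith
  obtain ⟨t, ht⟩ : ∃ t, t = i.val.im := ⟨_, rfl⟩
  obtain ⟨b, hbe⟩ : ∃ b, b = 1 - i.val.re := ⟨_, rfl⟩
  have hb0 : 0 < b := by rw [hbe]; linarith [i.re_lt_one]
  have h5 : 5 ≤ |t| := ht ▸ i.five_le_abs_im hi
  have ht0 : 0 < |t| := by linarith
  have hα : 0 < 0.225 / D := by positivity
  have hα' : 0.225 / D ≤ 3 / 40 := by
    rw [div_le_div_iff₀ hD0 (by norm_num)]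
    linarith
  have hA := sum_stechkinZeta_nonneg hα hα' t
  have hB := stechkinZeta_le_of_zero hα hα' i hi
  have h0 := stechkinZeta_le hα hα' 0
  have h2 := stechkinZeta_le hα hα' (2 * t)
  have h3 := stechkinZeta_le hα hα' (3 * t)
  rw [← ht] at hB hD'
  rw [← hbe] at hB hb
  have a2 : |2 * t| = 2 * |t| := by rw [abs_mul]; norm_num
  have a3 : |3 * t| = 3 * |t| := by rw [abs_mul]; norm_num
  have sq25 : 25 ≤ t ^ 2 := by
    rw [← sq_abs]
    nlinarith
  have p1 := stechkin_zero_le hα hα' sq25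
  have p2 := stechkin_zero_le hα hα' (Y := (2 * t) ^ 2) (by linarith)
  have p3 := stechkin_zero_le hα hα' (Y := (3 * t) ^ 2) (by linarith)
  have p0 := stechkin_zero_zero hα
  have g0 := stechkinGamma_zero_le hα hα'
  have g1 := stechkinGamma_le hα hα' h5
  have g2 := stechkinGamma_le hα hα' (y := 2 * t) (by rw [a2]; linarith)
  have g3 := stechkinGamma_le hα hα' (y := 3 * t) (by rw [a3]; linarith)
  rw [a2, Real.log_mul two_ne_zero ht0.ne'] at g2
  rw [a3, Real.log_mul three_ne_zero ht0.ne'] at g3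
  rw [Real.log_mul two_ne_zero pi_ne_zero] at g1 g2 g3
  have lpi := log_pi_gt
  have l2 := log_two_gt_d9
  have l2' := log_two_lt_d9
  have l3 : log 3 < 1.0987 := by
    rw [log_lt_iff_lt_exp (by norm_num)]
    have h4 : exp 1.0987 = exp (1.0987 / 4) ^ 4 := by
      rw [← Real.exp_nat_mul]; norm_num
    have h5 : (1.3161 : ℝ) < exp (1.0987 / 4) := by
      refine lt_of_lt_of_le ?_ (sum_le_exp_of_nonneg (by norm_num) 7)
      norm_num [Finset.sum_range_succ, Nat.factorial]
    rw [h4]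
    calc (3 : ℝ) < 1.3161 ^ 4 := by norm_num
      _ < _ := by gcongr
  have e2 : 1.2 / (2 * |t|) = 0.6 * (1 / |t|) := by field_simp; norm_num
  have e3 : 1.2 / (3 * |t|) = 0.4 * (1 / |t|) := by field_simp; norm_num
  rw [e2] at g2
  rw [e3] at g3
  rw [show 1.2 / |t| = 1.2 * (1 / |t|) by ring] at g1
  rw [show 2.6 / |t| = 2.6 * (1 / |t|) by ring] at hD'
  have hw : 0 < 1 / |t| := by positivity
  have hlt : 0 < log |t| := log_pos (by linarith)
  have e5 : 5 / (6 * (0.225 / D)) = 1 / 0.27 * D := by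
    field_simp
    norm_num
  rw [e5] at p0
  have hΦ : 2.927 * D ≤ (b + 5 * (0.225 / D)) / ((b + 2 * (0.225 / D)) * (b + 3 * (0.225 / D))) := by
    have hbD : b * D < 0.092 := by rwa [lt_div_iff₀ hD0] at hb
    have e : (b + 5 * (0.225 / D)) / ((b + 2 * (0.225 / D)) * (b + 3 * (0.225 / D))) =
        D * ((b * D + 1.125) / ((b * D + 0.45) * (b * D + 0.675))) := by
      field_simp
      norm_num
      ring
    rw [e, mul_comm]
    refine mul_le_mul_of_nonneg_left ?_ hD0.le
    rw [le_div_iff₀ (by positivity)]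
    have : 0 < b * D := by positivity
    nlinarith
  linarith

end

section

open Complex Filter Topology MeasureTheory Set
open scoped Real

theorem integrable_vertical {g : ℝ → ℂ} (hg : Continuous g) {C R : ℝ}
    (hb : ∀ t : ℝ, R ≤ |t| → ‖g t‖ ≤ C / t ^ 2) : Integrable g := by
  obtain ⟨C', hC'⟩ := (isCompact_Icc (a := -(max R 1)) (b := max R 1)).exists_bound_of_continuousOn
    hg.continuousOn
  have hm : 1 ≤ max R 1 := le_max_right _ _
  have hC'0 : 0 ≤ C' := (norm_nonneg _).trans (hC' 0 ⟨by linarith, by linarith⟩)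
  refine Integrable.mono' (g := fun t : ℝ => (C' * (1 + max R 1 ^ 2) + 2 * |C|) * (1 + t ^ 2)⁻¹)
    (integrable_inv_one_add_sq.const_mul _) hg.aestronglyMeasurable (Eventually.of_forall fun t => ?_)
  rw [← div_eq_mul_inv, le_div_iff₀ (by positivity)]
  rcases le_total |t| (max R 1) with h | h
  · have h1 := hC' t (abs_le.mp h)
    have h2 : t ^ 2 ≤ max R 1 ^ 2 := by
      rw [← sq_abs]
      gcongr
    have h3 : ‖g t‖ * (1 + t ^ 2) ≤ C' * (1 + max R 1 ^ 2) := by gcongr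
    have := abs_nonneg C
    linarith
  · have h1 := hb t ((le_max_left _ _).trans h)
    have h2 : 1 ≤ t ^ 2 := by
      rw [← sq_abs]
      nlinarith
    rw [le_div_iff₀ (by linarith)] at h1
    have h3 : ‖g t‖ * (1 + t ^ 2) ≤ 2 * (‖g t‖ * t ^ 2) := by nlinarith [norm_nonneg (g t)]
    have h4 := le_abs_self C
    have h5 : 0 ≤ C' * (1 + max R 1 ^ 2) := by positivity
    linarith

theorem continuous_vertical {g : ℂ → ℂ} {c : ℝ} (hd : ∀ s : ℂ, s.re = c → DifferentiableAt ℂ g s) :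
    Continuous fun t : ℝ => g (c + t * I) := by
  rw [continuous_iff_continuousAt]
  intro t
  exact ContinuousAt.comp (f := fun t : ℝ => (c + t * I : ℂ)) (hd _ (by simp)).continuousAt
    (by fun_prop)

/-- Shifting the line of integration for a function holomorphic in a vertical strip. -/
theorem integral_vertical_eq {g : ℂ → ℂ} {a b : ℝ} (hab : a ≤ b)
    (hd : ∀ s : ℂ, a ≤ s.re → s.re ≤ b → DifferentiableAt ℂ g s) {C R : ℝ}
    (hb : ∀ s : ℂ, a ≤ s.re → s.re ≤ b → R ≤ |s.im| → ‖g s‖ ≤ C / s.im ^ 2) :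
    ∫ t : ℝ, g (b + t * I) = ∫ t : ℝ, g (a + t * I) := by
  have hgi : ∀ c : ℝ, a ≤ c → c ≤ b → Integrable fun t : ℝ => g (c + t * I) := by
    intro c hac hcb
    refine integrable_vertical (C := C) (R := R)
      (continuous_vertical fun s hs => hd s (hs ▸ hac) (hs ▸ hcb)) fun t ht => ?_
    have := hb (c + t * I) (by simpa using hac) (by simpa using hcb) (by simpa using ht)
    simpa using this
  have hlim : ∀ c : ℝ, a ≤ c → c ≤ b → Tendsto (fun r : ℝ => ∫ t in (-r)..r, g (c + t * I)) atTop
      (𝓝 (∫ t : ℝ, g (c + t * I))) := fun c hac hcb =>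
    intervalIntegral_tendsto_integral (hgi c hac hcb) tendsto_neg_atTop_atBot tendsto_id
  have hh : ∀ r : ℝ, max R 1 ≤ r → ∀ ε : ℝ, |ε| = 1 →
      ‖∫ x in a..b, g (x + (ε * r : ℝ) * I)‖ ≤ C / r ^ 2 * (b - a) := by
    intro r hr ε hε
    have := intervalIntegral.norm_integral_le_of_norm_le_const (a := a) (b := b) (C := C / r ^ 2)
      (f := fun x : ℝ => g (x + (ε * r : ℝ) * I)) ?_
    · rwa [abs_of_nonneg (by linarith)] at this
    · intro x hx
      rw [uIoc_of_le hab] at hx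
      have hr0 : 0 < r := by have := (le_max_right R 1).trans hr; linarith
      have h1 := hb (x + (ε * r : ℝ) * I) (by simpa using hx.1.le) (by simpa using hx.2)
        (by simp only [add_im, ofReal_im, mul_im, ofReal_re, I_im, mul_one, I_re, mul_zero,
              add_zero, zero_add, abs_mul, hε, one_mul, abs_of_pos hr0]
            exact (le_max_left _ _).trans hr)
      have h2 : (x + (ε * r : ℝ) * I : ℂ).im ^ 2 = r ^ 2 := by
        simp only [add_im, ofReal_im, mul_im, ofReal_re, I_im, mul_one, I_re, mul_zero,
              add_zero, zero_add]
        rw [mul_pow, ← sq_abs ε, hε]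
        ring
      rwa [h2] at h1
  have hz : Tendsto (fun r : ℝ => C / r ^ 2 * (b - a)) atTop (𝓝 0) := by
    have : Tendsto (fun r : ℝ => C / r ^ 2) atTop (𝓝 0) :=
      tendsto_const_nhds.div_atTop (tendsto_pow_atTop two_ne_zero)
    simpa using this.mul_const (b - a)
  have hhor : ∀ ε : ℝ, |ε| = 1 →
      Tendsto (fun r : ℝ => ∫ x in a..b, g (x + (ε * r : ℝ) * I)) atTop (𝓝 0) := by
    intro ε hε
    refine squeeze_zero_norm' ?_ hz
    filter_upwards [eventually_ge_atTop (max R 1)] with r hr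
    exact hh r hr ε hε
  have hrect : ∀ r : ℝ, (∫ x in a..b, g (x + ((-1) * r : ℝ) * I)) -
      (∫ x in a..b, g (x + (1 * r : ℝ) * I)) + I * (∫ t in (-r)..r, g (b + t * I)) -
      I * (∫ t in (-r)..r, g (a + t * I)) = 0 := by
    intro r
    have := Complex.integral_boundary_rect_eq_zero_of_differentiableOn g (a + (-r : ℝ) * I)
      (b + (r : ℝ) * I) ?_
    · simpa using this
    · intro s hs
      refine (hd s ?_ ?_).differentiableWithinAt
      all_goals
        have := hs.1
        simp only [add_re, ofReal_re, mul_re, I_re, mul_zero, ofReal_im, I_im, mul_one, sub_self,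
          add_zero, uIcc_of_le hab, mem_preimage, mem_Icc] at this
      · exact this.1
      · exact this.2
  have h0 : Tendsto (fun r : ℝ => (∫ x in a..b, g (x + ((-1) * r : ℝ) * I)) -
      (∫ x in a..b, g (x + (1 * r : ℝ) * I)) + I * (∫ t in (-r)..r, g (b + t * I)) -
      I * (∫ t in (-r)..r, g (a + t * I))) atTop
      (𝓝 (0 - 0 + I * (∫ t : ℝ, g (b + t * I)) - I * (∫ t : ℝ, g (a + t * I)))) :=
    (((hhor (-1) (by simp)).sub (hhor 1 (by simp))).add ((hlim b hab le_rfl).const_mul I)).sub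
      ((hlim a le_rfl hab).const_mul I)
  simp_rw [hrect] at h0
  have h1 := tendsto_nhds_unique h0 tendsto_const_nhds
  rw [sub_zero, zero_add, ← mul_sub, mul_eq_zero] at h1
  exact sub_eq_zero.mp (h1.resolve_left I_ne_zero)

theorem integral_div_sq_add_sq {u : ℝ} (hu : u ≠ 0) :
    Integrable (fun t : ℝ => u / (u ^ 2 + t ^ 2)) ∧
      ∫ t : ℝ, u / (u ^ 2 + t ^ 2) = π * SignType.sign u := by
  have h : (fun t : ℝ => u / (u ^ 2 + t ^ 2)) = fun t : ℝ => u⁻¹ * (1 + (u⁻¹ * t) ^ 2)⁻¹ := by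
    funext t
    have : u ^ 2 + t ^ 2 ≠ 0 := by positivity
    have : 1 + (u⁻¹ * t) ^ 2 ≠ 0 := by positivity
    field_simp
  rw [h]
  have hu' : u⁻¹ ≠ 0 := inv_ne_zero hu
  constructor
  · exact (integrable_inv_one_add_sq.comp_mul_left' hu').const_mul _
  · rw [integral_const_mul, Measure.integral_comp_mul_left (fun y => (1 + y ^ 2)⁻¹),
      integral_univ_inv_one_add_sq, inv_inv, smul_eq_mul]
    rcases hu.lt_or_gt with h0 | h0
    · rw [abs_of_neg h0, sign_neg h0]
      field_simp
      simp
    · rw [abs_of_pos h0, sign_pos h0]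
      field_simp
      simp

theorem integrable_kernel {u r : ℝ} (hu : u ≠ 0) (hur : u - r ≠ 0) :
    Integrable fun t : ℝ => (1 / (u + t * I : ℂ) - 1 / (u - r + t * I : ℂ)) := by
  set k : ℝ → ℂ := fun t => 1 / (u + t * I : ℂ) - 1 / (u - r + t * I : ℂ) with hk
  have hne : ∀ {v : ℝ}, v ≠ 0 → ∀ t : ℝ, (v + t * I : ℂ) ≠ 0 := fun hv t h0 => hv (by
    simpa using congrArg Complex.re h0)
  have hcast : (u - r : ℂ) = ((u - r : ℝ) : ℂ) := by push_cast; rfl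
  refine integrable_vertical (C := |r|) (R := 1) ?_ fun t ht => ?_
  · simp only [hk, hcast]
    exact (continuous_const.div (by fun_prop) (hne hu)).sub
      (continuous_const.div (by fun_prop) (hne hur))
  · have ht0 : 0 < |t| := by linarith
    have hn : ∀ v : ℝ, |t| ≤ ‖(v + t * I : ℂ)‖ := fun v => by
      simpa using Complex.abs_im_le_norm (v + t * I : ℂ)
    have h1 : k t = -r / ((u + t * I) * ((u - r : ℝ) + t * I)) := by
      simp only [hk, hcast]
      rw [div_sub_div _ _ (hne hu t) (hne hur t)]
      congr 1
      push_cast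
      ring
    rw [h1, norm_div, norm_mul, norm_neg, norm_real, Real.norm_eq_abs, ← sq_abs t, sq |t|]
    gcongr
    · exact hn _
    · exact hn _

/-- The integral of the kernel `1/w - 1/(w - r)` along a vertical line. -/
theorem integral_kernel {u r : ℝ} (hu : u ≠ 0) (hur : u - r ≠ 0) :
    ∫ t : ℝ, (1 / (u + t * I : ℂ) - 1 / (u - r + t * I : ℂ)) =
      π * ((SignType.sign u : ℝ) - (SignType.sign (u - r) : ℝ)) := by
  set k : ℝ → ℂ := fun t => 1 / (u + t * I : ℂ) - 1 / (u - r + t * I : ℂ) with hk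
  have hre : ∀ {v : ℝ} (t : ℝ), (1 / (v + t * I : ℂ)).re = v / (v ^ 2 + t ^ 2) := fun t => by
    simp [Complex.normSq_apply, sq]
  have hneg : ∀ t, k (-t) = (starRingEnd ℂ) (k t) := by
    intro t
    simp only [hk, map_sub, map_div₀, map_one, map_add, map_mul, conj_ofReal, conj_I]
    push_cast
    ring_nf
  obtain ⟨i1, e1⟩ := integral_div_sq_add_sq hu
  obtain ⟨i2, e2⟩ := integral_div_sq_add_sq hur
  have hkre : ∀ t, (k t).re = u / (u ^ 2 + t ^ 2) - (u - r) / ((u - r) ^ 2 + t ^ 2) := by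
    intro t
    rw [hk, ← hre, ← hre]
    simp
  have h1 : ∫ t, k t = ∫ t, (starRingEnd ℂ) (k t) := by
    rw [← integral_neg_eq_self]
    simp_rw [hneg]
  have hgi : Integrable k := integrable_kernel hu hur
  have h2 : (2 : ℂ) * ∫ t, k t = ∫ t, (2 : ℂ) * ((k t).re : ℂ) := by
    have hc : Integrable fun t => (starRingEnd ℂ) (k t) :=
      (Complex.conjLIE.toContinuousLinearEquiv.toContinuousLinearMap.integrable_comp hgi)
    calc (2 : ℂ) * ∫ t, k t = (∫ t, k t) + ∫ t, (starRingEnd ℂ) (k t) := by rw [← h1]; ring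
      _ = ∫ t, (k t + (starRingEnd ℂ) (k t)) := (integral_add hgi hc).symm
      _ = _ := by simp_rw [Complex.add_conj]; push_cast; rfl
  rw [integral_const_mul] at h2
  have h3 := mul_left_cancel₀ two_ne_zero h2
  rw [h3, integral_complex_ofReal]
  simp_rw [hkre]
  rw [integral_sub i1 i2, e1, e2]
  push_cast
  ring

theorem integral_mul_kernel {H : ℂ → ℂ} {a b r : ℝ} {ρ : ℂ} (ha : a < ρ.re) (hb : ρ.re < b)
    (hd : ∀ s : ℂ, a ≤ s.re → s.re ≤ b → DifferentiableAt ℂ H s) {C : ℝ}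
    (hC : ∀ s : ℂ, a ≤ s.re → s.re ≤ b → ‖H s‖ ≤ C) (hr : ρ.re + r < a ∨ b < ρ.re + r) :
    (∫ t : ℝ, H (b + t * I) * (1 / (b + t * I - ρ) - 1 / (b + t * I - (ρ + r)))) -
      ∫ t : ℝ, H (a + t * I) * (1 / (a + t * I - ρ) - 1 / (a + t * I - (ρ + r))) =
      2 * π * H ρ := by
  have hne : ∀ s : ℂ, a ≤ s.re → s.re ≤ b → s - (ρ + r) ≠ 0 := by
    intro s h1 h2 h0
    have := congrArg Complex.re h0
    simp at this
    rcases hr with hr | hr <;> linarith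
  set g : ℂ → ℂ := fun s => dslope H ρ s * (-r / (s - (ρ + r))) with hg
  have hgd : ∀ s : ℂ, a ≤ s.re → s.re ≤ b → DifferentiableAt ℂ g s := by
    intro s h1 h2
    refine DifferentiableAt.mul ?_ ((differentiableAt_const _).div (by fun_prop) (hne s h1 h2))
    by_cases hs : s = ρ
    · subst hs
      have hU : {z : ℂ | a < z.re ∧ z.re < b} ∈ 𝓝 s :=
        ((isOpen_lt continuous_const continuous_re).inter
          (isOpen_lt continuous_re continuous_const)).mem_nhds ⟨ha, hb⟩
      have := (Complex.differentiableOn_dslope (f := H) hU).mpr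
        fun z hz => (hd z hz.1.le hz.2.le).differentiableWithinAt
      exact this.differentiableAt hU
    · exact (differentiableAt_dslope_of_ne hs).mpr (hd s h1 h2)
  have hgeq : ∀ s : ℂ, a ≤ s.re → s.re ≤ b → s ≠ ρ →
      g s = (H s - H ρ) * (1 / (s - ρ) - 1 / (s - (ρ + r))) := by
    intro s h1 h2 hs
    have h3 := hne s h1 h2
    have h4 := sub_ne_zero.mpr hs
    simp only [hg, dslope_of_ne H hs, slope_def_field]
    field_simp
    ring
  have hC0 : 0 ≤ C := (norm_nonneg _).trans (hC ρ ha.le hb.le)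
  have hgb : ∀ s : ℂ, a ≤ s.re → s.re ≤ b → 2 * |ρ.im| + 1 ≤ |s.im| →
      ‖g s‖ ≤ 8 * C * |r| / s.im ^ 2 := by
    intro s h1 h2 h3
    have hi : 0 < |s.im| := by have := abs_nonneg ρ.im; linarith
    have hs : s ≠ ρ := by
      rintro rfl
      have := abs_nonneg s.im
      linarith
    have hn : ∀ q : ℂ, q.im = ρ.im → |s.im| / 2 ≤ ‖s - q‖ := by
      intro q hq
      have h5 := Complex.abs_im_le_norm (s - q)
      rw [sub_im, hq] at h5
      have h6 := abs_sub_abs_le_abs_sub s.im ρ.im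
      linarith
    have h5 : g s = (H s - H ρ) * (-r / ((s - ρ) * (s - (ρ + r)))) := by
      have h7 := hne s h1 h2
      have h4 := sub_ne_zero.mpr hs
      rw [hgeq s h1 h2 hs, div_sub_div _ _ h4 h7]
      congr 2
      ring
    rw [h5, norm_mul, norm_div, norm_mul, norm_neg, norm_real, Real.norm_eq_abs]
    have h6 : ‖H s - H ρ‖ ≤ 2 * C := (norm_sub_le _ _).trans
      (by linarith [hC s h1 h2, hC ρ ha.le hb.le])
    calc ‖H s - H ρ‖ * (|r| / (‖s - ρ‖ * ‖s - (ρ + r)‖))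
        ≤ 2 * C * (|r| / (|s.im| / 2 * (|s.im| / 2))) := by
          gcongr
          · exact hn _ rfl
          · exact hn _ (by simp)
      _ = 8 * C * |r| / s.im ^ 2 := by
          rw [← sq_abs s.im]
          field_simp
          ring
  have hab : a ≤ b := (ha.trans hb).le
  have hkey : ∀ c : ℝ, a ≤ c → c ≤ b → c ≠ ρ.re →
      ∫ t : ℝ, H (c + t * I) * (1 / (c + t * I - ρ) - 1 / (c + t * I - (ρ + r))) =
      (∫ t : ℝ, g (c + t * I)) +
        H ρ * (π * ((SignType.sign (c - ρ.re) : ℝ) - (SignType.sign (c - ρ.re - r) : ℝ))) := by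
    intro c hac hcb hcρ
    have hu : c - ρ.re ≠ 0 := sub_ne_zero.mpr hcρ
    have hur : c - ρ.re - r ≠ 0 := by
      rcases hr with hr | hr
      · exact ne_of_gt (by linarith)
      · exact ne_of_lt (by linarith)
    have hsne : ∀ t : ℝ, (c + t * I : ℂ) ≠ ρ := fun t h0 => hcρ (by
      simpa using congrArg Complex.re h0)
    have e1 : ∀ t : ℝ, (1 / (c + t * I - ρ) - 1 / (c + t * I - (ρ + r)) : ℂ) =
        (fun t : ℝ => (1 / ((c - ρ.re : ℝ) + t * I : ℂ) - 1 / ((c - ρ.re : ℝ) - r + t * I : ℂ)))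
          (t - ρ.im) := by
      intro t
      have : (c + t * I - ρ : ℂ) = (c - ρ.re : ℝ) + (t - ρ.im : ℝ) * I := by
        apply Complex.ext <;> simp
      have h2 : (c + t * I - (ρ + r) : ℂ) = (c - ρ.re : ℝ) - r + (t - ρ.im : ℝ) * I := by
        rw [← sub_sub, this]
        ring
      rw [h2, this]
    have hki := integrable_kernel hu hur
    have hk2 : Integrable fun t : ℝ =>
        (1 / (c + t * I - ρ) - 1 / (c + t * I - (ρ + r)) : ℂ) := by
      simp_rw [e1]
      exact hki.comp_sub_right ρ.im
    have hk3 : ∫ t : ℝ, (1 / (c + t * I - ρ) - 1 / (c + t * I - (ρ + r)) : ℂ) =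
        π * ((SignType.sign (c - ρ.re) : ℝ) - (SignType.sign (c - ρ.re - r) : ℝ)) := by
      simp_rw [e1]
      rw [integral_sub_right_eq_self (fun t : ℝ =>
        (1 / ((c - ρ.re : ℝ) + t * I : ℂ) - 1 / ((c - ρ.re : ℝ) - r + t * I : ℂ))),
        integral_kernel hu hur]
    have hgi : Integrable fun t : ℝ => g (c + t * I) := by
      refine integrable_vertical (C := 8 * C * |r|) (R := 2 * |ρ.im| + 1)
        (continuous_vertical fun s hs => hgd s (hs ▸ hac) (hs ▸ hcb)) fun t ht => ?_
      have := hgb (c + t * I) (by simpa using hac) (by simpa using hcb) (by simpa using ht)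
      simpa using this
    rw [← hk3, ← integral_const_mul, ← integral_add hgi (hk2.const_mul _)]
    congr 1 with t
    rw [hgeq (c + t * I) (by simpa using hac) (by simpa using hcb) (hsne t)]
    ring
  rw [hkey b hab le_rfl hb.ne', hkey a le_rfl hab ha.ne, integral_vertical_eq hab hgd hgb,
    sign_pos (sub_pos.mpr hb), sign_neg (sub_neg.mpr ha)]
  rcases hr with hr | hr
  · rw [sign_pos (by linarith : 0 < b - ρ.re - r), sign_pos (by linarith : 0 < a - ρ.re - r)]
    simp
    ring
  · rw [sign_neg (by linarith : b - ρ.re - r < 0), sign_neg (by linarith : a - ρ.re - r < 0)]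
    simp
    ring

end

section

open Complex hiding exp log exp_add exp_neg exp_zero exp_nat_mul cos_zero
open Filter Topology MeasureTheory ComplexConjugate
open ArithmeticFunction (vonMangoldt vonMangoldt_nonneg)
open Real

theorem logDeriv_riemannZeta_re_le {σ : ℝ} (hσ : 1 < σ) (t : ℝ) :
    (logDeriv riemannZeta (σ + t * I)).re ≤ 1 / (σ - 1) + log ((σ + 1) / (2 * π)) / 2 +
      3 / (32 * (σ + 1) ^ 2) := by
  have h0 := hasSum_vonMangoldt_re hσ 0
  have h1 := (hasSum_vonMangoldt_re hσ t).neg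
  have h2 : (logDeriv riemannZeta (σ + t * I)).re ≤
      -(logDeriv riemannZeta (σ + (0 : ℝ) * I)).re := by
    rw [neg_neg] at h1
    refine hasSum_le (fun n => ?_) h1 h0
    rw [zero_mul, cos_zero, ← mul_neg, ← mul_neg]
    refine mul_le_mul_of_nonneg_left (mul_le_mul_of_nonneg_left ?_ (by positivity))
      vonMangoldt_nonneg
    linarith [neg_one_le_cos (t * log n)]
  refine h2.trans ?_
  have hs : 1 < ((σ : ℂ) + (0 : ℝ) * I).re := by simpa using hσ
  have h3 := (hasSum_re_zeros hs.le).nonneg fun i => one_div_sub_re_nonneg hs.le i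
  rw [logDeriv_xiFun hs] at h3
  have h4 := (abs_le.mp (abs_gammaFactor_sub_le_re hs)).2
  have e1 : ‖(σ : ℂ) + (0 : ℝ) * I + 1‖ = σ + 1 := by
    rw [show (σ : ℂ) + (0 : ℝ) * I + 1 = ((σ + 1 : ℝ) : ℂ) by push_cast; ring, norm_real,
      norm_of_nonneg (by linarith)]
  have e2 : (1 / ((σ : ℂ) + (0 : ℝ) * I - 1)).re = 1 / (σ - 1) := by
    rw [show 1 / ((σ : ℂ) + (0 : ℝ) * I - 1) = ((1 / (σ - 1) : ℝ) : ℂ) by push_cast; simp, ofReal_re]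
  have e3 : ((σ : ℂ) + (0 : ℝ) * I).re = σ := by simp
  rw [e1, e3] at h4
  simp only [add_re, e2] at h3 h4
  linarith

theorem logDeriv_xiFun_re_le {σ : ℝ} (hσ : 1 < σ) (hσ' : σ ≤ 2) (t : ℝ) :
    (logDeriv xiFun (σ + t * I)).re ≤ (σ - 1) / ((σ - 1) ^ 2 + t ^ 2) + 1 / (σ - 1) +
      log (‖((σ + 1 : ℝ) : ℂ) + t * I‖ / (2 * π)) / 2 := by
  have hs : 1 < ((σ : ℂ) + t * I).re := by simpa using hσ
  rw [logDeriv_xiFun hs]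
  have h1 := logDeriv_riemannZeta_re_le hσ t
  have h2 := (abs_le.mp (abs_gammaFactor_sub_le_re hs)).2
  have e1 : (σ : ℂ) + t * I + 1 = ((σ + 1 : ℝ) : ℂ) + t * I := by push_cast; ring
  have e2 : (1 / ((σ : ℂ) + t * I - 1)).re = (σ - 1) / ((σ - 1) ^ 2 + t ^ 2) := by
    rw [show (σ : ℂ) + t * I - 1 = ((σ - 1 : ℝ) : ℂ) + t * I by push_cast; ring]
    simp [normSq_apply, sq]
  have e3 : ((σ : ℂ) + t * I).re = σ := by simp
  have h3 : 3 / (32 * (σ + 1) ^ 2) ≤ 3 / (32 * 2 ^ 2) := by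
    gcongr
    linarith
  have h4 : log ((σ + 1) / (2 * π)) ≤ -(1 / 2) := by
    have : (σ + 1) / (2 * π) ≤ 1 / 2 := by
      rw [div_le_div_iff₀ (by positivity) (by norm_num)]
      linarith [pi_gt_three]
    have := log_le_sub_one_of_pos (x := (σ + 1) / (2 * π)) (by positivity)
    linarith
  rw [e1, e3] at h2
  simp only [add_re, e2] at h2 ⊢
  linarith

theorem logDeriv_xiFun_two_re_le (t : ℝ) : (logDeriv xiFun (2 + t * I)).re ≤ 2 + |t| := by
  have h := logDeriv_xiFun_re_le (σ := 2) (by norm_num) le_rfl t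
  have h1 : ((2 : ℝ) - 1) / ((2 - 1) ^ 2 + t ^ 2) ≤ 1 := by
    rw [div_le_one (by positivity)]
    nlinarith
  have h2 : ‖(((2 : ℝ) + 1 : ℝ) : ℂ) + t * I‖ / (2 * π) ≤ 1 + |t| := by
    rw [div_le_iff₀ (by positivity)]
    have h3 := norm_add_le (((2 : ℝ) + 1 : ℝ) : ℂ) (t * I)
    rw [norm_mul, norm_I, norm_real, norm_real, norm_eq_abs, norm_eq_abs] at h3
    norm_num at h3 ⊢
    nlinarith [pi_gt_three, abs_nonneg t]
  have h3 : log (‖(((2 : ℝ) + 1 : ℝ) : ℂ) + t * I‖ / (2 * π)) ≤ |t| := by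
    have hpos : 0 < ‖(((2 : ℝ) + 1 : ℝ) : ℂ) + t * I‖ / (2 * π) := by
      refine div_pos (norm_pos_iff.mpr fun h0 => ?_) (by positivity)
      have := congrArg Complex.re h0
      norm_num at this
    have := log_le_sub_one_of_pos hpos
    linarith
  have h4 := abs_nonneg t
  norm_num at h h1 h3 ⊢
  linarith

theorem logDeriv_Gammaℝ_add_two {s : ℂ} (hs : 0 < s.re) :
    logDeriv Gammaℝ (s + 2) = logDeriv Gammaℝ s + 1 / s := by
  have hs0 : s ≠ 0 := by
    rintro rfl
    simp at hs
  have hd : ∀ z : ℂ, 0 < z.re → DifferentiableAt ℂ Gammaℝ z := by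
    intro z hz
    have h := differentiable_Gammaℝ_inv z
    have h2 := h.inv (inv_ne_zero (Gammaℝ_ne_zero_of_re_pos hz))
    refine h2.congr_of_eventuallyEq (Eventually.of_forall fun w => ?_)
    simp
  have h1 : (fun z => Gammaℝ (z + 2)) =ᶠ[𝓝 s] fun z => Gammaℝ z * (z / 2 / π) := by
    have hopen : {s : ℂ | 0 < s.re} ∈ 𝓝 s :=
      (isOpen_lt continuous_const Complex.continuous_re).mem_nhds hs
    filter_upwards [hopen] with z hz
    have hz0 : z ≠ 0 := by
      rintro rfl
      simp at hz
    rw [Gammaℝ_add_two hz0]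
    ring
  have h2 : logDeriv (fun z => Gammaℝ (z + 2)) s = logDeriv Gammaℝ (s + 2) := by
    rw [logDeriv_apply, logDeriv_apply, deriv_comp_add_const]
  have hpi : (π : ℂ) ≠ 0 := by exact_mod_cast pi_ne_zero
  have h3 : logDeriv (fun z : ℂ => z / 2 / π) s = 1 / s := by
    have : HasDerivAt (fun z : ℂ => z / 2 / π) (1 / 2 / π) s :=
      ((hasDerivAt_id s).div_const 2).div_const _
    rw [logDeriv_apply, this.deriv]
    field_simp
  rw [← h2, logDeriv_apply, h1.deriv_eq, h1.eq_of_nhds, ← logDeriv_apply,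
    logDeriv_mul s (g := fun z : ℂ => z / 2 / π)
      (Gammaℝ_ne_zero_of_re_pos hs) (div_ne_zero (div_ne_zero hs0 two_ne_zero) hpi) (hd s hs)
      (by fun_prop), h3]

theorem logDeriv_riemannZeta_add_two_sub {s : ℂ} (hs : 1 < s.re) :
    logDeriv riemannZeta (s + 2) - logDeriv riemannZeta s =
      1 / (s - 1) - 1 / (s + 1) - 1 / (s + 2) - (logDeriv xiFun s - logDeriv xiFun (s + 2)) := by
  rw [logDeriv_xiFun hs, logDeriv_xiFun (s := s + 2) (by simp; linarith),
    logDeriv_Gammaℝ_add_two (by linarith), show s + 2 - 1 = s + 1 by ring]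
  ring

instance : Countable ZetaZero := by
  have h := (hasSum_re_zeros (s := 2) (by simp)).summable.countable_support
  have h2 : Function.support (fun i : ZetaZero => (1 / (2 - i.val)).re) = Set.univ := by
    refine Set.eq_univ_of_forall fun i => ?_
    rw [Function.mem_support, one_div_sub_re]
    have h3 : 2 - i.val ≠ 0 := fun h0 => by
      have := congrArg Complex.re h0
      simp at this
      linarith [i.re_lt_one]
    have := i.re_lt_one
    exact div_ne_zero (by simp; linarith) (by simpa using h3)
  rw [h2] at h
  exact Set.countable_univ_iff.mp h

theorem vertical_sub_ne_zero {c : ℝ} {ρ : ℂ} (h : c ≠ ρ.re) (t : ℝ) : (c + t * I : ℂ) - ρ ≠ 0 :=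
  fun h0 => h (by
    have := congrArg Complex.re h0
    simp at this
    linarith)

/-- The kernel attached to a zero in the explicit formula. -/
noncomputable def zeroKernel (i : ZetaZero) (s : ℂ) : ℂ :=
  1 / (s - i.val) - 1 / (s - (i.val + ((-2 : ℝ) : ℂ)))

theorem continuous_zeroKernel (i : ZetaZero) {c : ℝ} (h : c ≠ i.val.re) (h' : c ≠ i.val.re - 2) :
    Continuous fun t : ℝ => zeroKernel i (c + t * I) := by
  unfold zeroKernel
  refine (continuous_const.div (by fun_prop) (vertical_sub_ne_zero h)).sub
    (continuous_const.div (by fun_prop) (vertical_sub_ne_zero ?_))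
  simpa [sub_eq_add_neg] using h'

theorem hasSum_zeroKernel {s : ℂ} (hs : 1 < s.re) :
    HasSum (fun i => zeroKernel i s) (logDeriv xiFun s - logDeriv xiFun (s + 2)) := by
  have h := hasSum_zeros_sub (xiFun_ne_zero_of_one_le_re hs.le)
    (xiFun_ne_zero_of_one_le_re (s := s + 2) (by simp; linarith))
  refine h.congr_fun fun i => ?_
  unfold zeroKernel
  congr 2
  push_cast
  ring

theorem norm_zeroKernel {i : ZetaZero} {s : ℂ} (h1 : s - i.val ≠ 0) (h2 : s + 2 - i.val ≠ 0) :
    ‖zeroKernel i s‖ = 2 / (‖s - i.val‖ * ‖s + 2 - i.val‖) := by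
  have h2' : s - (i.val + ((-2 : ℝ) : ℂ)) = s + 2 - i.val := by push_cast; ring
  rw [zeroKernel, h2', div_sub_div _ _ h1 h2, norm_div, norm_mul]
  congr 1
  rw [show 1 * (s + 2 - i.val) - (s - i.val) * 1 = 2 by ring]
  simp

theorem norm_zeroKernel_le_two (i : ZetaZero) (t : ℝ) :
    ‖zeroKernel i ((2 : ℝ) + t * I)‖ ≤ 2 * (1 / (2 + t * I - i.val)).re := by
  have hβ := i.re_lt_one
  have h1 : ((2 : ℝ) + t * I : ℂ) - i.val ≠ 0 := vertical_sub_ne_zero (by linarith) t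
  have e2 : ((2 : ℝ) + t * I : ℂ) + 2 - i.val = ((4 : ℝ) + t * I : ℂ) - i.val := by
    push_cast; ring
  have h2 : ((2 : ℝ) + t * I : ℂ) + 2 - i.val ≠ 0 := by
    rw [e2]
    exact vertical_sub_ne_zero (by linarith) t
  rw [norm_zeroKernel h1 h2, one_div_sub_re]
  have h3 : ‖((2 : ℝ) + t * I : ℂ) - i.val‖ ≤ ‖((2 : ℝ) + t * I : ℂ) + 2 - i.val‖ := by
    rw [← sq_le_sq₀ (norm_nonneg _) (norm_nonneg _), ← normSq_eq_norm_sq, ← normSq_eq_norm_sq,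
      normSq_apply, normSq_apply]
    simp
    nlinarith
  have e : (2 + t * I - i.val : ℂ) = ((2 : ℝ) + t * I : ℂ) - i.val := by push_cast; ring
  have hre : (2 + t * I : ℂ).re = 2 := by simp
  rw [e, normSq_eq_norm_sq, hre, ← mul_div_assoc]
  have hp : 0 < ‖((2 : ℝ) + t * I : ℂ) - i.val‖ := norm_pos_iff.mpr h1
  refine div_le_div₀ (by linarith) (by linarith) (by positivity) ?_
  rw [sq]
  gcongr

theorem norm_zeroKernel_le_left (i : ZetaZero) (t : ℝ) :
    ‖zeroKernel i ((-1 / 2 : ℝ) + t * I)‖ ≤ 24 * (1 / (2 + t * I - i.val)).re := by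
  have hβ := i.re_lt_one
  have hβ' := i.re_pos
  have h1 : ((-1 / 2 : ℝ) + t * I : ℂ) - i.val ≠ 0 := vertical_sub_ne_zero (by linarith) t
  have e2 : ((-1 / 2 : ℝ) + t * I : ℂ) + 2 - i.val = ((3 / 2 : ℝ) + t * I : ℂ) - i.val := by
    push_cast; ring
  have h2 : ((-1 / 2 : ℝ) + t * I : ℂ) + 2 - i.val ≠ 0 := by
    rw [e2]
    exact vertical_sub_ne_zero (by linarith) t
  have h0 : (2 + t * I : ℂ) - i.val ≠ 0 := by
    have := vertical_sub_ne_zero (c := 2) (ρ := i.val) (by linarith) t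
    exact_mod_cast this
  rw [norm_zeroKernel h1 h2, one_div_sub_re]
  set n1 := ‖((-1 / 2 : ℝ) + t * I : ℂ) - i.val‖ with hn1
  set n2 := ‖((-1 / 2 : ℝ) + t * I : ℂ) + 2 - i.val‖ with hn2
  have a1 : 1 / 2 ≤ n1 := by
    have := abs_re_le_norm (((-1 / 2 : ℝ) + t * I : ℂ) - i.val)
    refine le_trans ?_ this
    rw [le_abs]
    right
    simp
    linarith
  have a2 : 1 / 2 ≤ n2 := by
    have := abs_re_le_norm (((-1 / 2 : ℝ) + t * I : ℂ) + 2 - i.val)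
    refine le_trans ?_ this
    rw [le_abs]
    left
    rw [e2]
    simp
    linarith
  have b1 : ‖(2 + t * I : ℂ) - i.val‖ ≤ n1 + 5 / 2 := by
    have := norm_add_le (((-1 / 2 : ℝ) + t * I : ℂ) - i.val) (5 / 2)
    rw [show ((-1 / 2 : ℝ) + t * I : ℂ) - i.val + 5 / 2 = (2 + t * I : ℂ) - i.val by
      push_cast; ring, show ‖(5 / 2 : ℂ)‖ = 5 / 2 by norm_num] at this
    exact this
  have b2 : ‖(2 + t * I : ℂ) - i.val‖ ≤ n2 + 1 / 2 := by
    have := norm_add_le (((-1 / 2 : ℝ) + t * I : ℂ) + 2 - i.val) (1 / 2)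
    rw [show ((-1 / 2 : ℝ) + t * I : ℂ) + 2 - i.val + 1 / 2 = (2 + t * I : ℂ) - i.val by
      push_cast; ring, show ‖(1 / 2 : ℂ)‖ = 1 / 2 by norm_num] at this
    exact this
  have hre : (2 + t * I : ℂ).re = 2 := by simp
  rw [normSq_eq_norm_sq, hre, ← mul_div_assoc]
  have hp : 0 < ‖(2 + t * I : ℂ) - i.val‖ := norm_pos_iff.mpr h0
  rw [div_le_div_iff₀ (by positivity) (by positivity)]
  have : ‖(2 + t * I : ℂ) - i.val‖ ^ 2 ≤ (6 * n1) * (2 * n2) := by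
    rw [sq]
    gcongr <;> linarith
  have h12 : 0 ≤ n1 * n2 := by positivity
  nlinarith

theorem integrable_of_norm_le {g : ℝ → ℂ} (hg : Continuous g) {K : ℝ}
    (h : ∀ t, ‖g t‖ ≤ K / (1 + t ^ 2)) : Integrable g := by
  refine Integrable.mono' (g := fun t : ℝ => K * (1 + t ^ 2)⁻¹)
    (integrable_inv_one_add_sq.const_mul _) hg.aestronglyMeasurable (Eventually.of_forall fun t => ?_)
  rw [← div_eq_mul_inv]
  exact h t

theorem integral_norm_le_of_norm_le {g : ℝ → ℂ} {K : ℝ}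
    (h : ∀ t, ‖g t‖ ≤ K / (1 + t ^ 2)) : ∫ t, ‖g t‖ ≤ K * π := by
  calc ∫ t, ‖g t‖ ≤ ∫ t : ℝ, K * (1 + t ^ 2)⁻¹ := by
        refine integral_mono_of_nonneg (Eventually.of_forall fun t => norm_nonneg _)
          (integrable_inv_one_add_sq.const_mul _) (Eventually.of_forall fun t => ?_)
        simpa [div_eq_mul_inv] using h t
    _ = K * π := by rw [integral_const_mul, integral_univ_inv_one_add_sq]

/-- The contributions of the zeros on a vertical line are summable. -/
theorem summable_integral_zeroKernel {g : ℝ → ℂ} (hg : Continuous g) {A c m : ℝ} (hm : 0 ≤ m)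
    (hgA : ∀ t, ‖g t‖ ≤ A / (1 + t ^ 2) ^ 2)
    (hk : ∀ (i : ZetaZero) (t : ℝ), ‖zeroKernel i (c + t * I)‖ ≤ m * (1 / (2 + t * I - i.val)).re)
    (hc : ∀ i : ZetaZero, c ≠ i.val.re ∧ c ≠ i.val.re - 2) :
    (∀ i, Integrable fun t : ℝ => g t * zeroKernel i (c + t * I)) ∧
    (Summable fun i => ∫ t : ℝ, ‖g t * zeroKernel i (c + t * I)‖) ∧
      ∑' i, ∫ t : ℝ, ‖g t * zeroKernel i (c + t * I)‖ ≤ 3 * m * A * π := by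
  have hA : 0 ≤ A := by
    have := (norm_nonneg _).trans (hgA 0)
    simpa using this
  have hfin : ∀ (u : Finset ZetaZero) (t : ℝ),
      ∑ i ∈ u, ‖g t * zeroKernel i (c + t * I)‖ ≤ 3 * m * A / (1 + t ^ 2) := by
    intro u t
    have hs : 1 ≤ (2 + t * I : ℂ).re := by simp
    have h1 : ∑ i ∈ u, (1 / (2 + t * I - i.val)).re ≤ 2 + |t| :=
      (sum_le_hasSum u (fun i _ => one_div_sub_re_nonneg hs i) (hasSum_re_zeros hs)).trans
        (logDeriv_xiFun_two_re_le t)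
    calc ∑ i ∈ u, ‖g t * zeroKernel i (c + t * I)‖
        ≤ ∑ i ∈ u, A / (1 + t ^ 2) ^ 2 * (m * (1 / (2 + t * I - i.val)).re) := by
          refine Finset.sum_le_sum fun i _ => ?_
          rw [norm_mul]
          exact mul_le_mul (hgA t) (hk i t) (norm_nonneg _) (by positivity)
      _ = A / (1 + t ^ 2) ^ 2 * (m * ∑ i ∈ u, (1 / (2 + t * I - i.val)).re) := by
          rw [Finset.mul_sum, Finset.mul_sum]
      _ ≤ A / (1 + t ^ 2) ^ 2 * (m * (3 * (1 + t ^ 2))) := by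
          gcongr
          refine h1.trans ?_
          rw [← sq_abs t]
          nlinarith [sq_nonneg (|t| - 1 / 2)]
      _ = 3 * m * A / (1 + t ^ 2) := by
          field_simp
  have hcont : ∀ i, Continuous fun t : ℝ => g t * zeroKernel i (c + t * I) := fun i =>
    hg.mul (continuous_zeroKernel i (hc i).1 (hc i).2)
  have hgi : ∀ i, Integrable fun t : ℝ => g t * zeroKernel i (c + t * I) := fun i =>
    integrable_of_norm_le (hcont i) fun t => by simpa using hfin {i} t
  have hsum : ∀ u : Finset ZetaZero,
      ∑ i ∈ u, ∫ t : ℝ, ‖g t * zeroKernel i (c + t * I)‖ ≤ 3 * m * A * π := by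
    intro u
    rw [← integral_finsetSum u fun i _ => (hgi i).norm]
    calc ∫ t : ℝ, ∑ i ∈ u, ‖g t * zeroKernel i (c + t * I)‖
        ≤ ∫ t : ℝ, 3 * m * A * (1 + t ^ 2)⁻¹ := by
          refine integral_mono_of_nonneg
            (Eventually.of_forall fun t => Finset.sum_nonneg fun _ _ => norm_nonneg _)
            (integrable_inv_one_add_sq.const_mul _) (Eventually.of_forall fun t => ?_)
          simpa [div_eq_mul_inv] using hfin u t
      _ = _ := by rw [integral_const_mul, integral_univ_inv_one_add_sq]
  have hnn : ∀ i, 0 ≤ ∫ t : ℝ, ‖g t * zeroKernel i (c + t * I)‖ := fun i =>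
    integral_nonneg fun t => norm_nonneg _
  have hsummable := summable_of_sum_le hnn hsum
  exact ⟨hgi, hsummable, hsummable.tsum_le_of_sum_le hsum⟩

theorem hasSum_vonMangoldt_sub {s : ℂ} (hs : 1 < s.re) :
    HasSum (fun n : ℕ => ((vonMangoldt n * (1 - 1 / (n : ℝ) ^ 2) : ℝ) : ℂ) * (n : ℂ) ^ (-s))
      (logDeriv riemannZeta (s + 2) - logDeriv riemannZeta s) := by
  have key : ∀ z : ℂ, 1 < z.re →
      HasSum (fun n : ℕ => (vonMangoldt n : ℂ) * (n : ℂ) ^ (-z)) (-logDeriv riemannZeta z) := by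
    intro z hz
    have h1 := (ArithmeticFunction.LSeriesSummable_vonMangoldt hz).LSeriesHasSum
    rw [ArithmeticFunction.LSeries_vonMangoldt_eq_deriv_riemannZeta_div hz, neg_div, ← logDeriv_apply] at h1
    refine HasSum.congr_fun h1 fun n => ?_
    rcases eq_or_ne n 0 with rfl | hn
    · simp
    rw [LSeries.term_of_ne_zero hn, div_eq_mul_inv, ← cpow_neg]
  have h := (key s hs).sub (key (s + 2) (by simp; linarith))
  rw [show -logDeriv riemannZeta s - -logDeriv riemannZeta (s + 2) =
    logDeriv riemannZeta (s + 2) - logDeriv riemannZeta s by ring] at h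
  refine h.congr_fun fun n => ?_
  rcases eq_or_ne n 0 with rfl | hn
  · simp
  have hn' : (n : ℂ) ≠ 0 := by exact_mod_cast hn
  rw [neg_add, cpow_add _ _ hn', cpow_neg (n : ℂ) 2]
  push_cast
  rw [show ((n : ℂ) ^ (2 : ℂ)) = (n : ℂ) ^ 2 by exact_mod_cast cpow_natCast (n : ℂ) 2]
  ring

theorem summable_vonMangoldt_sq :
    Summable fun n : ℕ => vonMangoldt n * (n : ℝ) ^ (-2 : ℝ) := by
  have h := (hasSum_vonMangoldt_re (σ := 2) (by norm_num) 0).summable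
  simpa using h

theorem explicit_formula {H : ℂ → ℂ} (hd : Differentiable ℂ H) {A B C : ℝ}
    (hC : ∀ s : ℂ, -1 / 2 ≤ s.re → s.re ≤ 2 → ‖H s‖ ≤ C / (1 + s.im ^ 2))
    (hA : ∀ t : ℝ, ‖H ((-1 / 2 : ℝ) + t * I)‖ ≤ A / (1 + t ^ 2) ^ 2)
    (hB : ∀ t : ℝ, ‖H ((2 : ℝ) + t * I)‖ ≤ B / (1 + t ^ 2) ^ 2) :
    (Summable fun i : ZetaZero => ‖H i.val‖) ∧ ∃ S : ℂ,
      HasSum (fun n : ℕ => ((vonMangoldt n * (1 - 1 / (n : ℝ) ^ 2) : ℝ) : ℂ) *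
        ∫ t : ℝ, H ((2 : ℝ) + t * I) * (n : ℂ) ^ (-((2 : ℝ) + t * I : ℂ))) S ∧
      ‖S - 2 * π * H 1‖ ≤ 2 * π * ∑' i : ZetaZero, ‖H i.val‖ + 76 * π * A := by
  have hC0 : 0 ≤ C := by
    simpa using (norm_nonneg _).trans (hC 0 (by norm_num) (by norm_num))
  have hA0 : 0 ≤ A := by simpa using (norm_nonneg _).trans (hA 0)
  have hcont : ∀ c : ℝ, Continuous fun t : ℝ => H (c + t * I) := fun c =>
    hd.continuous.comp (by fun_prop)
  have hC' : ∀ s : ℂ, -1 / 2 ≤ s.re → s.re ≤ 2 → ‖H s‖ ≤ C := fun s h1 h2 =>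
    (hC s h1 h2).trans (div_le_self hC0 (by nlinarith [sq_nonneg s.im]))
  have hle : ∀ (K : ℝ), 0 ≤ K → ∀ t : ℝ, K / (1 + t ^ 2) ^ 2 ≤ K / (1 + t ^ 2) := by
    intro K hK t
    apply div_le_div_of_nonneg_left hK (by positivity)
    nlinarith [sq_nonneg t, sq_nonneg (t ^ 2)]
  have hA1 : ∀ t : ℝ, ‖H ((-1 / 2 : ℝ) + t * I)‖ ≤ A / (1 + t ^ 2) := fun t =>
    (hA t).trans (hle A hA0 t)
  have hB0 : 0 ≤ B := by simpa using (norm_nonneg _).trans (hB 0)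
  have hB1 : ∀ t : ℝ, ‖H ((2 : ℝ) + t * I)‖ ≤ B / (1 + t ^ 2) := fun t =>
    (hB t).trans (hle B hB0 t)
  obtain ⟨hi2, hs2, -⟩ := summable_integral_zeroKernel (c := 2) (hcont 2) (by norm_num) hB
    norm_zeroKernel_le_two fun i => ⟨by linarith [i.re_lt_one], by linarith [i.re_lt_one]⟩
  obtain ⟨hi1, hs1, hb1⟩ := summable_integral_zeroKernel (c := -1 / 2) (hcont _) (by norm_num) hA
    norm_zeroKernel_le_left fun i => ⟨by linarith [i.re_pos], by linarith [i.re_lt_one]⟩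
  set R : ZetaZero → ℂ := fun i => ∫ t : ℝ, H ((2 : ℝ) + t * I) * zeroKernel i ((2 : ℝ) + t * I)
    with hR
  set L : ZetaZero → ℂ := fun i =>
    ∫ t : ℝ, H ((-1 / 2 : ℝ) + t * I) * zeroKernel i ((-1 / 2 : ℝ) + t * I) with hL
  have hRL : ∀ i, R i - L i = 2 * π * H i.val := by
    intro i
    exact integral_mul_kernel (a := -1 / 2) (b := 2) (r := -2) (ρ := i.val) (by linarith [i.re_pos])
      (by linarith [i.re_lt_one]) (fun s _ _ => hd s) hC' (Or.inl (by linarith [i.re_lt_one]))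
  have hRn : Summable fun i => ‖R i‖ :=
    Summable.of_nonneg_of_le (fun i => norm_nonneg _) (fun i => norm_integral_le_integral_norm _) hs2
  have hLn : Summable fun i => ‖L i‖ :=
    Summable.of_nonneg_of_le (fun i => norm_nonneg _) (fun i => norm_integral_le_integral_norm _) hs1
  have hnormH : ∀ i : ZetaZero, ‖2 * π * H i.val‖ = 2 * π * ‖H i.val‖ := by
    intro i
    rw [norm_mul, norm_mul, norm_real, norm_of_nonneg pi_pos.le]
    simp
  have hHs : Summable fun i : ZetaZero => ‖H i.val‖ := by
    have : Summable fun i : ZetaZero => 2 * π * ‖H i.val‖ := by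
      refine Summable.of_nonneg_of_le (fun i => by positivity) (fun i => ?_) (hRn.add hLn)
      rw [← hnormH, ← hRL]
      exact norm_sub_le _ _
    exact (summable_mul_left_iff (by positivity)).mp this
  refine ⟨hHs, ∫ t : ℝ, H ((2 : ℝ) + t * I) *
      (logDeriv riemannZeta ((2 : ℝ) + t * I + 2) - logDeriv riemannZeta ((2 : ℝ) + t * I)), ?_, ?_⟩
  · set F : ℕ → ℝ → ℂ := fun n t =>
      ((vonMangoldt n * (1 - 1 / (n : ℝ) ^ 2) : ℝ) : ℂ) *
        (H ((2 : ℝ) + t * I) * (n : ℂ) ^ (-((2 : ℝ) + t * I : ℂ))) with hF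
    have hFn : ∀ n t, ‖F n t‖ ≤ vonMangoldt n * (n : ℝ) ^ (-2 : ℝ) *
        ‖H ((2 : ℝ) + t * I)‖ := by
      intro n t
      rcases eq_or_ne n 0 with rfl | hn
      · simp [hF]
      have hn1 : (1 : ℝ) ≤ n := by exact_mod_cast Nat.one_le_iff_ne_zero.mpr hn
      have h1 : 0 ≤ 1 - 1 / (n : ℝ) ^ 2 := by
        rw [sub_nonneg, div_le_one (by positivity)]
        exact one_le_pow₀ hn1
      have h2 : 1 - 1 / (n : ℝ) ^ 2 ≤ 1 := sub_le_self _ (by positivity)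
      have hΛ : 0 ≤ vonMangoldt n := vonMangoldt_nonneg
      simp only [hF]
      rw [norm_mul, norm_mul, norm_real, norm_of_nonneg (mul_nonneg hΛ h1),
        norm_natCast_cpow_of_pos (Nat.pos_of_ne_zero hn)]
      have : (-((2 : ℝ) + t * I : ℂ)).re = -2 := by simp
      rw [this]
      calc _ ≤ vonMangoldt n * 1 *
            (‖H ((2 : ℝ) + t * I)‖ * (n : ℝ) ^ (-2 : ℝ)) := by gcongr
        _ = _ := by ring
    have hFi : ∀ n, Integrable (F n) := by
      intro n
      rcases eq_or_ne n 0 with rfl | hn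
      · simp [hF]
      refine integrable_of_norm_le (K := vonMangoldt n * (n : ℝ) ^ (-2 : ℝ) * B)
        ?_ fun t => ?_
      · have hn' : (n : ℂ) ≠ 0 := by exact_mod_cast hn
        refine continuous_const.mul ((hcont 2).mul ?_)
        exact Continuous.const_cpow (by fun_prop) (Or.inl hn')
      · rw [mul_div_assoc]
        exact (hFn n t).trans (mul_le_mul_of_nonneg_left (hB1 t)
          (mul_nonneg vonMangoldt_nonneg (by positivity)))
    have h := hasSum_integral_of_summable_integral_norm hFi (by
      refine Summable.of_nonneg_of_le (fun n => integral_nonneg fun t => norm_nonneg _)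
        (fun n => ?_) (summable_vonMangoldt_sq.mul_right (∫ t : ℝ, ‖H ((2 : ℝ) + t * I)‖))
      rw [← integral_const_mul]
      exact integral_mono (hFi n).norm
        ((integrable_of_norm_le (hcont 2) hB1).norm.const_mul _) fun t => hFn n t)
    have e1 : ∀ n, ∫ t : ℝ, F n t = ((vonMangoldt n * (1 - 1 / (n : ℝ) ^ 2) : ℝ) : ℂ) *
        ∫ t : ℝ, H ((2 : ℝ) + t * I) * (n : ℂ) ^ (-((2 : ℝ) + t * I : ℂ)) := fun n =>
      integral_const_mul _ _
    have e2 : ∀ t : ℝ, ∑' n, F n t = H ((2 : ℝ) + t * I) *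
        (logDeriv riemannZeta ((2 : ℝ) + t * I + 2) - logDeriv riemannZeta ((2 : ℝ) + t * I)) := by
      intro t
      have := (hasSum_vonMangoldt_sub (s := (2 : ℝ) + t * I) (by simp)).mul_left
        (H ((2 : ℝ) + t * I))
      rw [← this.tsum_eq]
      refine tsum_congr fun n => ?_
      simp only [hF]
      ring
    simp only [e1, e2] at h
    exact h
  -- the pole at `1`
  set P : ℂ := ∫ t : ℝ, H ((2 : ℝ) + t * I) *
    (1 / ((2 : ℝ) + t * I - 1) - 1 / ((2 : ℝ) + t * I - (1 + (-2 : ℝ)))) with hP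
  set P' : ℂ := ∫ t : ℝ, H ((-1 / 2 : ℝ) + t * I) *
    (1 / ((-1 / 2 : ℝ) + t * I - 1) - 1 / ((-1 / 2 : ℝ) + t * I - (1 + (-2 : ℝ)))) with hP'
  have hPP : P - P' = 2 * π * H 1 :=
    integral_mul_kernel (a := -1 / 2) (b := 2) (r := -2) (ρ := 1) (by norm_num)
      (by norm_num) (fun s _ _ => hd s) hC' (Or.inl (by norm_num))
  have hP'n : ‖P'‖ ≤ 3 * A * π := by
    refine (norm_integral_le_integral_norm _).trans (integral_norm_le_of_norm_le fun t => ?_)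
    have n1 : 1 / 2 ≤ ‖((-1 / 2 : ℝ) + t * I : ℂ) + 1‖ :=
      le_trans (by norm_num) (abs_re_le_norm _)
    have n2 : 3 / 2 ≤ ‖((-1 / 2 : ℝ) + t * I : ℂ) - 1‖ :=
      le_trans (by norm_num) (abs_re_le_norm _)
    have hz1 : ((-1 / 2 : ℝ) + t * I : ℂ) - 1 ≠ 0 := norm_pos_iff.mp (by linarith)
    have hz2 : ((-1 / 2 : ℝ) + t * I : ℂ) + 1 ≠ 0 := norm_pos_iff.mp (by linarith)
    have e : 1 / (((-1 / 2 : ℝ) + t * I : ℂ) - 1) - 1 / ((-1 / 2 : ℝ) + t * I - (1 + (-2 : ℝ))) =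
        2 / ((((-1 / 2 : ℝ) + t * I : ℂ) - 1) * (((-1 / 2 : ℝ) + t * I : ℂ) + 1)) := by
      rw [show ((-1 / 2 : ℝ) + t * I - (1 + (-2 : ℝ)) : ℂ) = (-1 / 2 : ℝ) + t * I + 1 by
        push_cast; ring, div_sub_div _ _ hz1 hz2]
      ring
    have n3 : ‖2 / ((((-1 / 2 : ℝ) + t * I : ℂ) - 1) * (((-1 / 2 : ℝ) + t * I : ℂ) + 1))‖ ≤ 3 := by
      rw [norm_div, norm_mul, Complex.norm_ofNat, div_le_iff₀ (by positivity)]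
      nlinarith
    rw [e, norm_mul, mul_comm]
    calc _ ≤ 3 * (A / (1 + t ^ 2)) := mul_le_mul n3 (hA1 t) (norm_nonneg _) (by norm_num)
      _ = _ := by ring
  -- the trivial zero
  set Q : ℂ := ∫ t : ℝ, H ((2 : ℝ) + t * I) / ((2 : ℝ) + t * I + 2) with hQ
  have hQn : ‖Q‖ ≤ A * π := by
    have h1 : Q = ∫ t : ℝ, H ((-1 / 2 : ℝ) + t * I) / ((-1 / 2 : ℝ) + t * I + 2) := by
      refine integral_vertical_eq (g := fun s => H s / (s + 2)) (a := -1 / 2) (b := 2) (C := C)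
        (R := 1) (by norm_num) (fun s h1 h2 => ?_) fun s h1 h2 h3 => ?_
      · refine (hd s).div (by fun_prop) fun h0 => ?_
        have := congrArg Complex.re h0
        simp at this
        linarith
      · rw [norm_div]
        have h5 : 0 < s.im ^ 2 := by
          rw [← sq_abs]
          positivity
        refine (div_le_self (norm_nonneg _) (le_trans ?_ (re_le_norm _))).trans
          ((hC s h1 h2).trans (by gcongr; linarith))
        rw [add_re, re_ofNat]
        linarith
    rw [h1]
    refine (norm_integral_le_integral_norm _).trans (integral_norm_le_of_norm_le fun t => ?_)
    rw [norm_div]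
    exact (div_le_self (norm_nonneg _)
      (le_trans (by norm_num) (re_le_norm _))).trans (hA1 t)
  -- the nontrivial zeros
  have hsumR := hasSum_integral_of_summable_integral_norm hi2 hs2
  have hzk : ∀ t : ℝ, ∑' i, H ((2 : ℝ) + t * I) * zeroKernel i ((2 : ℝ) + t * I) =
      H ((2 : ℝ) + t * I) *
        (logDeriv xiFun ((2 : ℝ) + t * I) - logDeriv xiFun ((2 : ℝ) + t * I + 2)) := fun t =>
    ((hasSum_zeroKernel (s := (2 : ℝ) + t * I) (by simp)).mul_left _).tsum_eq
  simp only [hzk] at hsumR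
  have hline : ∀ t : ℝ, ((2 : ℝ) : ℂ) + t * I - 1 ≠ 0 ∧ ((2 : ℝ) : ℂ) + t * I - (1 + (-2 : ℝ)) ≠ 0 ∧
      ((2 : ℝ) : ℂ) + t * I + 2 ≠ 0 := by
    intro t
    refine ⟨?_, ?_, ?_⟩ <;>
    · intro h0
      have := congrArg Complex.re h0
      norm_num at this
  have hPi : Integrable fun t : ℝ => H ((2 : ℝ) + t * I) *
      (1 / ((2 : ℝ) + t * I - 1) - 1 / ((2 : ℝ) + t * I - (1 + (-2 : ℝ)))) := by
    refine (integrable_of_norm_le (hcont 2) hB1).mul_bdd (c := 2) ?_ (Eventually.of_forall fun t => ?_)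
    · refine Continuous.aestronglyMeasurable ?_
      exact (continuous_const.div (by fun_prop) fun t => (hline t).1).sub
        (continuous_const.div (by fun_prop) fun t => (hline t).2.1)
    · refine (norm_sub_le _ _).trans ?_
      rw [norm_div, norm_div, norm_one]
      refine (add_le_add (div_le_one_of_le₀ (le_trans ?_ (re_le_norm _)) (norm_nonneg _))
        (div_le_one_of_le₀ (le_trans ?_ (re_le_norm _)) (norm_nonneg _))).trans
          one_add_one_eq_two.le <;> norm_num
  have hQi : Integrable fun t : ℝ => H ((2 : ℝ) + t * I) / ((2 : ℝ) + t * I + 2) := by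
    refine integrable_of_norm_le (K := B) ((hcont 2).div (by fun_prop) fun t => (hline t).2.2)
      fun t => ?_
    rw [norm_div]
    exact (div_le_self (norm_nonneg _) (le_trans (by norm_num) (re_le_norm _))).trans (hB1 t)
  have hXi : Integrable fun t : ℝ => H ((2 : ℝ) + t * I) *
      (logDeriv xiFun ((2 : ℝ) + t * I) - logDeriv xiFun ((2 : ℝ) + t * I + 2)) := by
    refine integrable_of_norm_le (K := 6 * B) ?_ fun t => ?_
    · have hl : ∀ c : ℝ, 1 ≤ c → Continuous fun t : ℝ => logDeriv xiFun (c + t * I) := by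
        intro c h1
        refine Continuous.div (f := fun t : ℝ => deriv xiFun (c + t * I)) ?_
          (differentiable_xiFun.continuous.comp (by fun_prop)) fun t => ?_
        · exact (differentiable_xiFun.contDiff.continuous_deriv le_rfl (n := 1)).comp (by fun_prop)
        · exact xiFun_ne_zero_of_one_le_re (by simpa using h1)
      refine (hcont 2).mul ((hl 2 (by norm_num)).sub ?_)
      convert hl 4 (by norm_num) using 3
      push_cast
      ring
    · have hz := (hasSum_zeroKernel (s := (2 : ℝ) + t * I) (by simp))
      have h1 := tsum_of_norm_bounded ((hasSum_re_zeros (s := 2 + t * I) (by simp)).mul_left 2)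
        fun i => norm_zeroKernel_le_two i t
      rw [hz.tsum_eq] at h1
      have h2 := logDeriv_xiFun_two_re_le t
      rw [norm_mul]
      calc _ ≤ B / (1 + t ^ 2) ^ 2 * (6 * (1 + t ^ 2)) := by
            refine mul_le_mul (hB t) (h1.trans ?_) (norm_nonneg _) (by positivity)
            rw [← sq_abs t]
            nlinarith [sq_nonneg (|t| - 1 / 2)]
        _ = _ := by field_simp
  have hsplit : ∫ t : ℝ, H ((2 : ℝ) + t * I) *
      (logDeriv riemannZeta ((2 : ℝ) + t * I + 2) - logDeriv riemannZeta ((2 : ℝ) + t * I)) =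
      P - Q - ∑' i, R i := by
    rw [hsumR.tsum_eq, hP, hQ, ← integral_sub hPi hQi]
    have h0 := integral_sub (hPi.sub hQi) hXi
    simp only [Pi.sub_apply] at h0
    rw [← h0]
    refine integral_congr_ae (Eventually.of_forall fun t => ?_)
    have := logDeriv_riemannZeta_add_two_sub (s := (2 : ℝ) + t * I) (by simp)
    dsimp only
    rw [this, show ((2 : ℝ) + t * I - (1 + (-2 : ℝ)) : ℂ) = (2 : ℝ) + t * I + 1 by push_cast; ring]
    ring
  rw [hsplit]
  have hsub : ∑' i, R i - ∑' i, L i = ∑' i : ZetaZero, 2 * π * H i.val := by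
    rw [← hRn.of_norm.tsum_sub hLn.of_norm]
    exact tsum_congr hRL
  have hn1 : ‖∑' i : ZetaZero, 2 * π * H i.val‖ ≤ 2 * π * ∑' i : ZetaZero, ‖H i.val‖ := by
    rw [← tsum_mul_left]
    refine (norm_tsum_le_tsum_norm ?_).trans (le_of_eq (tsum_congr hnormH))
    simp only [hnormH]
    exact hHs.mul_left _
  have hn2 : ‖∑' i, L i‖ ≤ 72 * A * π := by
    refine (norm_tsum_le_tsum_norm hLn).trans ?_
    refine (hLn.tsum_le_tsum (fun i => norm_integral_le_integral_norm _) hs1).trans ?_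
    linarith
  rw [show P - Q - ∑' i, R i - 2 * π * H 1 =
    P' - Q - ∑' i : ZetaZero, 2 * π * H i.val - ∑' i, L i by rw [← hPP, ← hsub]; ring]
  have h1 := norm_sub_le (P' - Q - ∑' i : ZetaZero, 2 * π * H i.val) (∑' i, L i)
  have h2 := norm_sub_le (P' - Q) (∑' i : ZetaZero, 2 * π * H i.val)
  have h3 := norm_sub_le P' Q
  linarith

/-- The Mellin transform of the test function `n ↦ n⁻¹ k (l (log n - u))`, up to a constant factor,
where `k v = (1 - v ^ 2) exp (-3 v ^ 2 / 2)`. -/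
noncomputable def testFun (l u : ℝ) (s : ℂ) : ℂ :=
  (1 - ((s - 1) / l) ^ 2 / 6) * cexp (((s - 1) / l) ^ 2 / 6 + (s - 1) * u)

theorem differentiable_testFun (l u : ℝ) : Differentiable ℂ (testFun l u) := by
  unfold testFun
  fun_prop

theorem testFun_one (l u : ℝ) : testFun l u 1 = 1 := by simp [testFun]

theorem norm_testFun_le {l : ℝ} (hl : 10 ≤ l) (u : ℝ) {s : ℂ} (h1 : -1 / 2 ≤ s.re)
    (h2 : s.re ≤ 2) : ‖testFun l u s‖ ≤ 1.01 * (1 + s.im ^ 2 / (6 * l ^ 2)) *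
      exp (-(s.im ^ 2 / (6 * l ^ 2))) * exp ((s.re - 1) * u) := by
  have hl0 : 0 < l := by linarith
  have hx : (s.re - 1) ^ 2 ≤ 9 / 4 := by nlinarith
  have hl2 : 100 ≤ l ^ 2 := by nlinarith
  have hx' : (s.re - 1) ^ 2 / (6 * l ^ 2) ≤ 0.004 := by
    rw [div_le_iff₀ (by positivity)]
    linarith
  have e1 : ‖(1 - ((s - 1) / l) ^ 2 / 6 : ℂ)‖ ≤ 1.004 * (1 + s.im ^ 2 / (6 * l ^ 2)) := by
    refine (norm_sub_le _ _).trans ?_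
    have : ‖((s - 1) / l) ^ 2 / 6‖ = (s.re - 1) ^ 2 / (6 * l ^ 2) + s.im ^ 2 / (6 * l ^ 2) := by
      rw [norm_div, norm_pow, norm_div, div_pow, ← normSq_eq_norm_sq, norm_real, norm_eq_abs,
        sq_abs, normSq_apply]
      simp
      field_simp
    have h0 : 0 ≤ s.im ^ 2 / (6 * l ^ 2) := by positivity
    rw [this, norm_one]
    linarith
  have e2 : ‖cexp (((s - 1) / l) ^ 2 / 6 + (s - 1) * u)‖ ≤
      1.005 * exp (-(s.im ^ 2 / (6 * l ^ 2))) * exp ((s.re - 1) * u) := by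
    have : (((s - 1) / l) ^ 2 / 6 + (s - 1) * u : ℂ).re = (s.re - 1) ^ 2 / (6 * l ^ 2) +
        -(s.im ^ 2 / (6 * l ^ 2)) + (s.re - 1) * u := by
      rw [div_pow, div_div, ← ofReal_pow, show ((l ^ 2 : ℝ) : ℂ) * 6 = ((6 * l ^ 2 : ℝ) : ℂ) by
        push_cast; ring, add_re, div_ofReal_re]
      simp [sq]
      ring
    rw [norm_exp, this, exp_add, exp_add]
    gcongr
    refine (exp_le_exp.mpr hx').trans ?_
    have := exp_bound_div_one_sub_of_interval (x := 0.004) (by norm_num) (by norm_num)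
    refine this.trans (by norm_num)
  rw [testFun, norm_mul]
  calc _ ≤ 1.004 * (1 + s.im ^ 2 / (6 * l ^ 2)) *
        (1.005 * exp (-(s.im ^ 2 / (6 * l ^ 2))) * exp ((s.re - 1) * u)) := by gcongr
    _ ≤ _ := by
      have : 0 ≤ (1 + s.im ^ 2 / (6 * l ^ 2)) *
        exp (-(s.im ^ 2 / (6 * l ^ 2))) * exp ((s.re - 1) * u) := by positivity
      nlinarith

theorem one_add_mul_exp_neg_le {l : ℝ} (hl : 1 ≤ l) (t : ℝ) :
    (1 + t ^ 2 / (6 * l ^ 2)) * exp (-(t ^ 2 / (6 * l ^ 2))) ≤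
      600 * l ^ 4 / (1 + t ^ 2) ^ 2 := by
  set q := t ^ 2 / (6 * l ^ 2) with hq
  have hq0 : 0 ≤ q := by positivity
  have h1 : (1 + q) ^ 3 ≤ 6 * (2.7183 * exp q) := by
    have := pow_div_factorial_le_exp (1 + q) (by linarith) 3
    rw [exp_add] at this
    have h2 := exp_one_lt_d9
    have h3 : exp 1 * exp q ≤ 2.7183 * exp q := by gcongr; linarith
    norm_num [Nat.factorial] at this
    linarith
  have h2 : 1 + t ^ 2 ≤ 6 * l ^ 2 * (1 + q) := by
    have : 6 * l ^ 2 * (1 + q) = 6 * l ^ 2 + t ^ 2 := by rw [hq]; field_simp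
    nlinarith
  rw [exp_neg, ← div_eq_mul_inv, div_le_div_iff₀ (exp_pos _) (by positivity)]
  calc (1 + q) * (1 + t ^ 2) ^ 2 ≤ (1 + q) * (6 * l ^ 2 * (1 + q)) ^ 2 := by gcongr
    _ = 36 * l ^ 4 * (1 + q) ^ 3 := by ring
    _ ≤ 36 * l ^ 4 * (6 * (2.7183 * exp q)) := by gcongr
    _ ≤ _ := by
      have : 0 ≤ l ^ 4 * exp q := by positivity
      nlinarith

theorem norm_testFun_le' {l : ℝ} (hl : 10 ≤ l) (u : ℝ) {s : ℂ} (h1 : -1 / 2 ≤ s.re)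
    (h2 : s.re ≤ 2) : ‖testFun l u s‖ ≤
      606 * l ^ 4 * exp ((s.re - 1) * u) / (1 + s.im ^ 2) ^ 2 := by
  refine (norm_testFun_le hl u h1 h2).trans ?_
  have := mul_le_mul_of_nonneg_left (one_add_mul_exp_neg_le (l := l) (by linarith) s.im)
    (show 0 ≤ 1.01 * exp ((s.re - 1) * u) by positivity)
  calc _ = 1.01 * exp ((s.re - 1) * u) *
        ((1 + s.im ^ 2 / (6 * l ^ 2)) * exp (-(s.im ^ 2 / (6 * l ^ 2)))) := by ring
    _ ≤ _ := this
    _ = _ := by ring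

theorem integral_testFun_mul_cpow {l : ℝ} (hl : 10 ≤ l) (u : ℝ) {n : ℕ} (hn : n ≠ 0) :
    ∫ t : ℝ, testFun l u ((2 : ℝ) + t * I) * (n : ℂ) ^ (-((2 : ℝ) + t * I : ℂ)) =
      ((1 / n * (l * √(6 * π) * (3 / 2 * (1 - (l * (u - log n)) ^ 2) *
        exp (-(3 / 2 * (l * (u - log n)) ^ 2)))) : ℝ) : ℂ) := by
  have hl0 : 0 < l := by linarith
  have hlc : (l : ℂ) ≠ 0 := by exact_mod_cast hl0.ne'
  have hnc : (n : ℂ) ≠ 0 := by exact_mod_cast hn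
  set v := u - log n with hv
  set g : ℝ → ℂ := fun t => cexp (-(1 / (6 * l ^ 2) : ℝ) * t ^ 2 +
    (I * (1 / (3 * l ^ 2) + v : ℝ)) * t + (1 / (6 * l ^ 2) + v : ℝ)) with hg
  have hw : ∀ t : ℝ, g t = cexp (((1 + t * I) / l) ^ 2 / 6 + (1 + t * I) * v) := by
    intro t
    simp only [hg]
    congr 1
    push_cast
    field_simp
    ring_nf
    rw [I_sq]
    ring
  have h1 : ∀ t : ℝ, testFun l u ((2 : ℝ) + t * I) * (n : ℂ) ^ (-((2 : ℝ) + t * I : ℂ)) =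
      1 / n * ((1 - ((1 + t * I) / l) ^ 2 / 6) * g t) := by
    intro t
    have hp : (n : ℂ) ^ (-((2 : ℝ) + t * I : ℂ)) = 1 / n * cexp (-(1 + t * I) * log n) := by
      rw [show (-((2 : ℝ) + t * I : ℂ)) = -1 + (-(1 + t * I)) by push_cast; ring,
        cpow_add _ _ hnc, cpow_neg_one, one_div, cpow_def_of_ne_zero hnc, natCast_log,
        mul_comm (Complex.log _)]
    rw [testFun, hp, hw]
    have e : ((2 : ℝ) + t * I - 1 : ℂ) = 1 + t * I := by push_cast; ring
    rw [e, show ((1 + t * I) / l : ℂ) ^ 2 / 6 + (1 + t * I) * v =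
      ((1 + t * I) / l) ^ 2 / 6 + (1 + t * I) * u + -(1 + t * I) * log n by
        rw [hv]; push_cast; ring, Complex.exp_add _ (-(1 + t * I) * log n)]
    ring
  have hgi : ∫ t : ℝ, g t = ((l * √(6 * π) * exp (-(3 / 2 * (l * v) ^ 2)) : ℝ) : ℂ) := by
    have hb : (-((1 / (6 * l ^ 2) : ℝ) : ℂ)).re < 0 := by
      rw [neg_re, ofReal_re]
      have : 0 < 1 / (6 * l ^ 2) := by positivity
      linarith
    simp only [hg]
    rw [integral_cexp_quadratic hb, neg_neg]
    have e1 : ((π : ℂ) / ((1 / (6 * l ^ 2) : ℝ) : ℂ)) ^ (1 / 2 : ℂ) =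
        ((l * √(6 * π) : ℝ) : ℂ) := by
      rw [← ofReal_div, show (1 / 2 : ℂ) = ((1 / 2 : ℝ) : ℂ) by norm_num,
        ← ofReal_cpow (by positivity), ← sqrt_eq_rpow,
        show π / (1 / (6 * l ^ 2)) = l ^ 2 * (6 * π) by field_simp,
        sqrt_mul (by positivity), sqrt_sq hl0.le]
    rw [e1, ofReal_mul (l * √(6 * π)), ofReal_exp]
    congr 2
    push_cast
    field_simp
    ring_nf
    rw [I_sq]
    ring
  have hnorm : ∀ t : ℝ, ‖g t‖ = exp (1 / (6 * l ^ 2) + v) *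
      exp (-(t ^ 2 / (6 * l ^ 2))) := by
    intro t
    simp only [hg]
    rw [norm_exp, ← exp_add]
    congr 1
    simp [← ofReal_pow]
    ring
  have hg1 : ∀ t : ℝ, (1 + t ^ 2) * ‖g t‖ ≤
      (exp (1 / (6 * l ^ 2) + v) * (600 * l ^ 4)) / (1 + t ^ 2) := by
    intro t
    have := one_add_mul_exp_neg_le (l := l) (by linarith) t
    have h3 : exp (-(t ^ 2 / (6 * l ^ 2))) ≤ 600 * l ^ 4 / (1 + t ^ 2) ^ 2 := by
      refine le_trans ?_ this
      have h0 : 0 ≤ t ^ 2 / (6 * l ^ 2) := by positivity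
      nlinarith [exp_pos (-(t ^ 2 / (6 * l ^ 2)))]
    rw [hnorm]
    calc _ ≤ (1 + t ^ 2) * (exp (1 / (6 * l ^ 2) + v) * (600 * l ^ 4 / (1 + t ^ 2) ^ 2)) := by
          gcongr
      _ = _ := by field_simp
  have hgc : Continuous g := by
    simp only [hg]
    fun_prop
  have hpoly : ∀ {p : ℝ → ℂ}, Continuous p → ∀ {K : ℝ}, (∀ t, ‖p t‖ ≤ K * (1 + t ^ 2)) →
      Integrable fun t => p t * g t := by
    intro p hp K hK
    have hK0 : 0 ≤ K := by simpa using (norm_nonneg _).trans (hK 0)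
    refine integrable_of_norm_le (K := K * (exp (1 / (6 * l ^ 2) + v) * (600 * l ^ 4)))
      (hp.mul hgc) fun t => ?_
    rw [norm_mul, mul_div_assoc]
    calc _ ≤ K * (1 + t ^ 2) * ‖g t‖ := by gcongr; exact hK t
      _ = K * ((1 + t ^ 2) * ‖g t‖) := by ring
      _ ≤ _ := by gcongr; exact hg1 t
  have hzn : ∀ t : ℝ, ‖(1 + t * I : ℂ)‖ ^ 2 = 1 + t ^ 2 := by
    intro t
    rw [← normSq_eq_norm_sq, normSq_apply]
    simp
    ring
  have hzn1 : ∀ t : ℝ, ‖(1 + t * I : ℂ)‖ ≤ 1 + t ^ 2 := fun t => by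
    have := hzn t
    nlinarith [norm_nonneg (1 + t * I : ℂ), sq_nonneg t]
  have hl1 : 1 ≤ ‖(l : ℂ)‖ := by
    rw [norm_real, norm_of_nonneg hl0.le]
    linarith
  have hi1 : Integrable fun t : ℝ => (1 - ((1 + t * I) / l) ^ 2 / 6 : ℂ) * g t := by
    refine hpoly (by fun_prop) (K := 2) fun t => (norm_sub_le _ _).trans ?_
    rw [norm_div, norm_pow, norm_div, div_pow, hzn, norm_one, Complex.norm_ofNat]
    have : (1 + t ^ 2) / ‖(l : ℂ)‖ ^ 2 ≤ 1 + t ^ 2 :=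
      div_le_self (by positivity) (one_le_pow₀ hl1)
    nlinarith [sq_nonneg t]
  have hi2 : Integrable fun t : ℝ => ((3 / 2 * (1 - (l * v) ^ 2) : ℝ) : ℂ) * g t := by
    refine hpoly continuous_const (K := ‖((3 / 2 * (1 - (l * v) ^ 2) : ℝ) : ℂ)‖) fun t => ?_
    exact le_mul_of_one_le_right (norm_nonneg _) (by nlinarith [sq_nonneg t])
  have hi3 : Integrable fun t : ℝ =>
      (l / I * (-((1 + t * I) / l) / 2 + 3 * (l * v) / 2) : ℂ) * g t := by
    refine hpoly (by fun_prop) (K := ‖(l / I : ℂ)‖ * (1 + ‖(3 * (l * v) / 2 : ℂ)‖)) fun t => ?_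
    rw [norm_mul, mul_assoc]
    gcongr
    refine (norm_add_le _ _).trans ?_
    rw [norm_div, norm_neg, norm_div, Complex.norm_ofNat]
    have h2 := div_le_self (norm_nonneg (1 + t * I : ℂ)) hl1
    have h3 : 0 ≤ ‖(1 + t * I : ℂ)‖ / ‖(l : ℂ)‖ := by positivity
    nlinarith [hzn1 t, norm_nonneg (3 * (l * v) / 2 : ℂ), sq_nonneg t]
  have hder : ∀ t : ℝ, HasDerivAt (fun t : ℝ =>
      (l / I * (-((1 + t * I) / l) / 2 + 3 * (l * v) / 2) : ℂ) * g t)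
      ((1 - ((1 + t * I) / l) ^ 2 / 6 : ℂ) * g t - ((3 / 2 * (1 - (l * v) ^ 2) : ℝ) : ℂ) * g t)
      t := by
    intro t
    have d1 : HasDerivAt (fun t : ℝ => (1 + t * I : ℂ)) I t := by
      simpa using ((hasDerivAt_id t).ofReal_comp.mul_const I).const_add 1
    have d2 : HasDerivAt g (g t * ((1 + t * I) / (3 * l ^ 2) * I + I * v)) t := by
      have := ((((d1.div_const (l : ℂ)).pow 2).div_const 6).add (d1.mul_const (v : ℂ))).cexp
      refine (this.congr_of_eventuallyEq (Eventually.of_forall fun t => ?_)).congr_deriv ?_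
      · rw [hw]; rfl
      · simp only [Pi.add_apply, Pi.pow_apply]
        rw [hw]
        push_cast
        field_simp
        ring
    refine (((((d1.div_const (l : ℂ)).neg.div_const 2).add_const
      (3 * (l * v) / 2 : ℂ)).const_mul (l / I : ℂ)).mul d2).congr_deriv ?_
    simp only [Pi.neg_apply]
    push_cast
    field_simp
    ring
  have h0 := integral_eq_zero_of_hasDerivAt_of_integrable hder (hi1.sub hi2) hi3
  rw [integral_sub hi1 hi2, sub_eq_zero, integral_const_mul, hgi] at h0
  simp only [h1]
  rw [integral_const_mul, h0]
  push_cast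
  ring

theorem two_mul_le_width {T : ℝ} (hT : 0 < T) : 2 * T ≤ 2 / log (1 + 1 / T) := by
  have h0 : 0 < log (1 + 1 / T) := log_pos (by simpa using hT)
  have h1 := log_le_sub_one_of_pos (show 0 < 1 + 1 / T by positivity)
  rw [le_div_iff₀ h0]
  have : T * (1 / T) = 1 := by field_simp
  nlinarith

theorem width_le {T : ℝ} (hT : 0 < T) : 2 / log (1 + 1 / T) ≤ 2 * (T + 1) := by
  have h0 : 0 < log (1 + 1 / T) := log_pos (by simpa using hT)
  have h1 := one_sub_inv_le_log_of_pos (show 0 < 1 + 1 / T by positivity)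
  rw [div_le_iff₀ h0]
  have : 1 - (1 + 1 / T)⁻¹ = 1 / (T + 1) := by field_simp; ring
  rw [this, div_le_iff₀ (by positivity)] at h1
  linarith

theorem psi_sub_theta_mul_le {x T l : ℝ} (hT : 20 ≤ T) (hx : x = T ^ 106) (hl0 : 0 < l)
    (hl2 : l ≤ 3 * T) :
    (Chebyshev.psi (2 * x) - Chebyshev.theta (2 * x)) * (7 * l / x) ≤ 0.1 := by
  have hT0 : 0 < T := by linarith
  have hx1 : 1 ≤ x := hx ▸ one_le_pow₀ (by linarith)
  have hx0 : 0 < x := by linarith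
  have hpoly : x = T ^ 53 * T ^ 53 := by rw [hx]; ring
  have hψ := Chebyshev.psi_sub_theta_le (x := 2 * x) (by linarith)
  have hsq : √(2 * x) ≤ 2 * T ^ 53 := by
    rw [sqrt_le_left (by positivity), hpoly]
    have : 0 < T ^ 53 * T ^ 53 := by positivity
    nlinarith
  have hlog : log (2 * x) ≤ 107 * T := by
    rw [Real.log_mul (by norm_num) hx0.ne', hx, log_pow]
    have h1 := log_le_sub_one_of_pos hT0
    have := log_two_lt_d9
    push_cast
    linarith
  have hlog0 : 0 ≤ log (2 * x) := log_nonneg (by linarith)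
  calc _ ≤ (2 * (2 * T ^ 53) * (107 * T)) * (7 * (3 * T) / x) := by
        gcongr
        exact hψ.trans (by gcongr)
    _ = 8988 * (T ^ 2 / T ^ 53) := by rw [hpoly]; field_simp; ring
    _ ≤ _ := by
      rw [show T ^ 53 = T ^ 2 * (T ^ 5 * T ^ 46) by ring, div_mul_cancel_left₀ (by positivity)]
      have h1 : (10 : ℝ) ^ 5 ≤ T ^ 5 := pow_le_pow_left₀ (by norm_num) (by linarith) _
      have h2 : (1 : ℝ) ≤ T ^ 46 := one_le_pow₀ (by linarith)
      have h4 : (10 : ℝ) ^ 5 ≤ T ^ 5 * T ^ 46 := by nlinarith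
      have := inv_anti₀ (by norm_num) h4
      norm_num at this ⊢
      linarith

/-- If the zeros contribute little, then there is a prime in `[x, x + x / T]`. -/
theorem exists_prime_of_sum_zeros {x T l : ℝ} (hT : 20 ≤ T) (hx : x = T ^ 106)
    (hl : l = 2 / log (1 + 1 / T))
    (hE : ∑' i : ZetaZero, ‖testFun l (log x + 1 / l) i.val‖ ≤ 0.9) :
    ∃ p : ℕ, p.Prime ∧ x ≤ p ∧ (p : ℝ) ≤ x + x / T := by
  by_contra! hno
  have hT0 : 0 < T := by linarith
  have hl1 : 2 * T ≤ l := hl ▸ two_mul_le_width hT0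
  have hl2 : l ≤ 3 * T := (hl ▸ width_le hT0).trans (by linarith)
  have hl10 : 10 ≤ l := by linarith
  have hl0 : 0 < l := by linarith
  have hx1 : 1 ≤ x := hx ▸ one_le_pow₀ (by linarith)
  have hx0 : 0 < x := by linarith
  set u := log x + 1 / l with hu
  have hlogx : 0 ≤ log x := log_nonneg hx1
  have hu0 : 0 ≤ u := by positivity
  have hxu : exp (-(3 / 2) * u) ≤ 1 / x := by
    rw [one_div, ← Real.exp_log (inv_pos.mpr hx0), Real.log_inv]
    apply exp_le_exp.mpr
    have : 0 ≤ 1 / l := by positivity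
    linarith
  obtain ⟨-, S, hS, hSn⟩ := explicit_formula (differentiable_testFun l u)
    (A := 606 * l ^ 4 * (1 / x)) (B := 606 * l ^ 4 * exp u) (C := 606 * l ^ 4 * exp u)
    (fun s h1 h2 => (norm_testFun_le' hl10 u h1 h2).trans (by
      have h3 : (s.re - 1) * u ≤ u := by nlinarith
      have h4 : 1 ≤ 1 + s.im ^ 2 := by nlinarith [sq_nonneg s.im]
      gcongr
      nlinarith))
    (fun t => (norm_testFun_le' hl10 u (by simp) (by norm_num)).trans (by
      simp only [add_re, ofReal_re, mul_re, I_re, mul_zero, ofReal_im, I_im, mul_one, sub_self,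
        add_zero, add_im, mul_im, zero_add]
      gcongr
      refine le_trans (le_of_eq ?_) hxu
      norm_num))
    (fun t => (norm_testFun_le' hl10 u (by norm_num) (by norm_num)).trans (by
      simp only [add_re, ofReal_re, mul_re, I_re, mul_zero, ofReal_im, I_im, mul_one, sub_self,
        add_zero, add_im, mul_im, zero_add]
      norm_num))
  have hsm : T ^ 5 / x ≤ 1 / 10 ^ 10 := by
    rw [hx, show T ^ 106 = T ^ 5 * (T ^ 10 * T ^ 91) by ring, div_le_div_iff₀ (by positivity)
      (by positivity)]
    have h1 : (10 : ℝ) ^ 10 ≤ T ^ 10 := pow_le_pow_left₀ (by norm_num) (by linarith) _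
    have h2 : (1 : ℝ) ≤ T ^ 91 := one_le_pow₀ (by linarith)
    have h3 : 0 < T ^ 5 := by positivity
    have h4 : (10 : ℝ) ^ 10 ≤ T ^ 10 * T ^ 91 := by nlinarith
    nlinarith
  -- the lower bound for the sum
  have hlow : 0.5 ≤ S.re := by
    rw [testFun_one, mul_one] at hSn
    have h1 := (abs_re_le_norm _).trans hSn
    have h2 : (S - 2 * π : ℂ).re = S.re - 2 * π := by simp
    rw [h2] at h1
    have h3 : 606 * l ^ 4 * (1 / x) ≤ 1 / 10 ^ 5 := by
      calc 606 * l ^ 4 * (1 / x) ≤ 606 * (3 * T) ^ 4 * (1 / x) := by gcongr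
        _ ≤ 606 * 81 * (T ^ 5 / x) := by
          rw [show 606 * (3 * T) ^ 4 * (1 / x) = 606 * 81 * (T ^ 4 / x) by ring]
          gcongr
          · linarith
          · norm_num
        _ ≤ _ := by norm_num at hsm ⊢; linarith
    have := (abs_le.mp h1).1
    have hpi := pi_gt_d2
    have hpi' := pi_lt_d2
    nlinarith
  -- the upper bound for the sum
  set D := {n ∈ Finset.Ioc 0 ⌊2 * x⌋₊ | ¬n.Prime} with hD
  set f : ℕ → ℝ := fun n => if n ∈ D then vonMangoldt n * (7 * l / x) else 0
    with hf
  have hfs : HasSum f (∑ n ∈ D, f n) := hasSum_sum_of_ne_finset_zero fun n hn => by simp [hf, hn]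
  have hle : ∀ n : ℕ, (((vonMangoldt n * (1 - 1 / (n : ℝ) ^ 2) : ℝ) : ℂ) *
      ∫ t : ℝ, testFun l u ((2 : ℝ) + t * I) * (n : ℂ) ^ (-((2 : ℝ) + t * I : ℂ))).re ≤ f n := by
    intro n
    rcases eq_or_ne n 0 with rfl | hn
    · simp [hf, hD]
    have hn1 : (1 : ℝ) ≤ n := by exact_mod_cast Nat.one_le_iff_ne_zero.mpr hn
    have hn0 : (0 : ℝ) < n := by linarith
    rw [integral_testFun_mul_cpow hl10 u hn, ← ofReal_mul, ofReal_re]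
    have hΛ : 0 ≤ vonMangoldt n := vonMangoldt_nonneg
    have h1 : 0 ≤ 1 - 1 / (n : ℝ) ^ 2 := by
      rw [sub_nonneg, div_le_one (by positivity)]
      exact one_le_pow₀ hn1
    have h2 : 1 - 1 / (n : ℝ) ^ 2 ≤ 1 := sub_le_self _ (by positivity)
    have hf0 : 0 ≤ f n := by
      simp only [hf]
      split_ifs <;> positivity
    set v := l * (u - log n) with hv
    rcases le_or_gt 1 (v ^ 2) with hq | hq
    · refine le_trans (mul_nonpos_of_nonneg_of_nonpos (mul_nonneg hΛ h1) ?_) hf0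
      refine mul_nonpos_of_nonneg_of_nonpos (by positivity) ?_
      refine mul_nonpos_of_nonneg_of_nonpos (by positivity) ?_
      exact mul_nonpos_of_nonpos_of_nonneg (by linarith) (exp_pos _).le
    · have hv1 := abs_lt.mp ((sq_lt_one_iff_abs_lt_one v).mp hq)
      have hll : l * (1 / l) = 1 := by field_simp
      have hlog : l * log (1 + 1 / T) = 2 := by
        rw [hl, div_mul_cancel₀]
        exact (log_pos (by simpa using hT0)).ne'
      have hxn : x < n := by
        rw [← log_lt_log_iff hx0 hn0]
        nlinarith
      have hnx : n < x * (1 + 1 / T) := by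
        rw [← log_lt_log_iff hn0 (by positivity), Real.log_mul hx0.ne' (by positivity)]
        nlinarith
      have hnx' : n < x + x / T := hnx.trans_eq (by ring)
      have hnp : ¬ n.Prime := fun hp => hnx'.not_gt (hno n hp hxn.le)
      have hxT : x / T ≤ x := div_le_self hx0.le (by linarith)
      have hmem : n ∈ D := by
        rw [hD, Finset.mem_filter, Finset.mem_Ioc]
        exact ⟨⟨Nat.pos_of_ne_zero hn, Nat.le_floor (by linarith)⟩, hnp⟩
      simp only [hf, if_pos hmem]
      have hsq : √(6 * π) ≤ 4.4 := by
        rw [sqrt_le_left (by norm_num)]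
        have := pi_lt_d2
        norm_num
        linarith
      have hexp : exp (-(3 / 2 * v ^ 2)) ≤ 1 := by
        rw [exp_le_one_iff]
        linarith [sq_nonneg v]
      have hJ : 1 / n * (l * √(6 * π) * (3 / 2 * (1 - v ^ 2) *
          exp (-(3 / 2 * v ^ 2)))) ≤ 7 * l / x := by
        calc _ ≤ 1 / x * (l * 4.4 * (3 / 2 * 1 * 1)) := by
              have : 0 ≤ 1 - v ^ 2 := by linarith
              have : 1 - v ^ 2 ≤ 1 := by linarith [sq_nonneg v]
              gcongr
          _ = 6.6 * l / x := by ring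
          _ ≤ _ := by gcongr; norm_num
      calc _ ≤ vonMangoldt n * 1 * (7 * l / x) := by gcongr
        _ = _ := by ring
  have hup := hasSum_le hle (hasSum_re hS) hfs
  have hsum : ∑ n ∈ D, f n = (Chebyshev.psi (2 * x) - Chebyshev.theta (2 * x)) * (7 * l / x) := by
    rw [Chebyshev.psi_sub_theta_eq_sum_not_prime, Finset.sum_mul]
    exact Finset.sum_congr rfl fun n hn => if_pos hn
  linarith [psi_sub_theta_mul_le hT hx hl0 hl2]

theorem zero_free_of_abs_im_le {i : ZetaZero} (hi : 1 / 2 < i.val.re) {G D : ℝ}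
    (hG : |i.val.im| ≤ G) (hD : 3 ≤ D) (hD' : 0.7432 * log G - 2.03 + 2.6 / G ≤ D) :
    0.092 / D ≤ 1 - i.val.re := by
  refine zero_free hi hD (le_trans ?_ hD')
  have h5 := i.five_le_abs_im hi
  set g := |i.val.im|
  have hg0 : 0 < g := by linarith
  have hG0 : 0 < G := by linarith
  have h1 := one_sub_inv_le_log_of_pos (show 0 < G / g by positivity)
  rw [Real.log_div hG0.ne' hg0.ne', inv_div] at h1
  have h2 : 2.6 / g - 2.6 / G ≤ 0.52 * (1 - g / G) := by
    have e : 2.6 / g - 2.6 / G = 2.6 / g * (1 - g / G) := by field_simp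
    have h3 : 2.6 / g ≤ 0.52 := by
      rw [div_le_iff₀ hg0]
      linarith
    rw [e]
    exact mul_le_mul_of_nonneg_right h3 (sub_nonneg.mpr ((div_le_one hG0).mpr hG))
  have h4 : 0 ≤ 1 - g / G := sub_nonneg.mpr ((div_le_one hG0).mpr hG)
  linarith

theorem logDeriv_xiFun_ofReal_re_le {σ : ℝ} (hσ : 1 < σ) : (logDeriv xiFun σ).re ≤
    1 / (σ - 1) + log ((σ + 1) / (2 * π)) / 2 + 3 / (32 * (σ + 1) ^ 2) := by
  have hs : 1 < (σ : ℂ).re := by simpa using hσ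
  rw [logDeriv_xiFun hs]
  have h2 := (abs_le.mp (abs_gammaFactor_sub_le_re hs)).2
  have h3 := (hasSum_vonMangoldt_re hσ 0).nonneg fun n => by
    rw [zero_mul, cos_zero, mul_one]
    exact mul_nonneg vonMangoldt_nonneg (by positivity)
  have e1 : ‖(σ : ℂ) + 1‖ = σ + 1 := by
    rw [show (σ : ℂ) + 1 = ((σ + 1 : ℝ) : ℂ) by push_cast; ring, norm_real, norm_of_nonneg]
    linarith
  have e2 : (1 / ((σ : ℂ) - 1)).re = 1 / (σ - 1) := by
    rw [show 1 / ((σ : ℂ) - 1) = ((1 / (σ - 1) : ℝ) : ℂ) by push_cast; ring, ofReal_re]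
  simp only [ofReal_zero, zero_mul, add_zero] at h3
  rw [e1, ofReal_re] at h2
  simp only [add_re, e2] at h2 ⊢
  linarith

/-- A bump of width comparable to `l`, used to count zeros. -/
noncomputable def zeroWeight (l : ℝ) (i : ZetaZero) : ℝ := 1 / (1 + i.val.im ^ 2 / (16 * l ^ 2))

theorem zeroWeight_sum_le {T l : ℝ} (hT : 20 ≤ T) (h1 : 2 * T ≤ l) (h2 : l ≤ 2 * (T + 1)) :
    Summable (zeroWeight l) ∧ ∑' i, zeroWeight l i ≤ 4.25 * T * (log T + 0.36) := by
  have hl : 40 ≤ l := by linarith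
  have hs : 1 < ((4 * l : ℝ) : ℂ).re := by
    rw [ofReal_re]
    linarith
  have H := (hasSum_re_zeros hs.le).mul_left (4 * l * 1.0065)
  have hle : ∀ i, zeroWeight l i ≤ 4 * l * 1.0065 * (1 / (((4 * l : ℝ) : ℂ) - i.val)).re := by
    intro i
    have hb0 := i.re_pos
    have hb1 := i.re_lt_one
    rw [one_div_sub_re, normSq_apply, sub_re, sub_im, ofReal_re, ofReal_im, zeroWeight, mul_div,
      show 1 / (1 + i.val.im ^ 2 / (16 * l ^ 2)) = 16 * l ^ 2 / (16 * l ^ 2 + i.val.im ^ 2) by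
        field_simp]
    have h5 : (4 * l - i.val.re) * (4 * l - i.val.re) ≤ 16 * l ^ 2 := by nlinarith
    refine div_le_div₀ ?_ ?_ ?_ ?_
    · refine mul_nonneg (by positivity) (by linarith)
    · nlinarith
    · have : 0 < (4 * l - i.val.re) := by linarith
      nlinarith [mul_pos this this, sq_nonneg i.val.im]
    · nlinarith
  have h0 : ∀ i, 0 ≤ zeroWeight l i := fun i => by
    rw [zeroWeight]
    positivity
  have hsum : Summable (zeroWeight l) := Summable.of_nonneg_of_le h0 hle H.summable
  refine ⟨hsum, (hasSum_le hle hsum.hasSum H).trans ?_⟩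
  have h3 := logDeriv_xiFun_ofReal_re_le (σ := 4 * l) (by linarith)
  have h4 : 1 / (4 * l - 1) ≤ 0.0063 := by
    rw [div_le_iff₀ (by linarith)]
    linarith
  have h5 : 3 / (32 * (4 * l + 1) ^ 2) ≤ 0.0001 := by
    rw [div_le_iff₀ (by positivity)]
    nlinarith
  have h6 : log ((4 * l + 1) / (2 * π)) ≤ log T + 0.346 := by
    have h7 : (4 * l + 1) / (2 * π) ≤ T * 1.346 := by
      rw [div_le_iff₀ (by positivity)]
      nlinarith [pi_gt_d2]
    have h8 := log_le_log (by positivity) h7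
    rw [Real.log_mul (by positivity) (by norm_num)] at h8
    have := log_le_sub_one_of_pos (show (0 : ℝ) < 1.346 by norm_num)
    linarith
  have hL : 0 ≤ log T := log_nonneg (by linarith)
  calc 4 * l * 1.0065 * (logDeriv xiFun ((4 * l : ℝ) : ℂ)).re
      ≤ 4 * l * 1.0065 * (log T / 2 + 0.1795) := by
        refine mul_le_mul_of_nonneg_left ?_ (by positivity)
        linarith
    _ ≤ 4.25 * T * (log T + 0.36) := by nlinarith

theorem log_nine_le : log 8.95 ≤ 2.195 ∧ log 25.2 ≤ 3.235 := by
  have h := log_two_lt_d9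
  constructor
  · have h1 := log_le_log (by norm_num) (show (8.95 : ℝ) ^ 6 ≤ 2 ^ 19 by norm_num)
    rw [log_pow, log_pow] at h1
    push_cast at h1
    linarith
  · have h1 := log_le_log (by norm_num) (show (25.2 : ℝ) ^ 3 ≤ 2 ^ 14 by norm_num)
    rw [log_pow, log_pow] at h1
    push_cast at h1
    linarith

/-- The zero-free region at height at most `25 T`, in terms of `L = log T`. -/
theorem zero_free_of_le_mul {T : ℝ} (hT : 20 ≤ T) {i : ZetaZero} (hi : 1 / 2 < i.val.re) {c v D : ℝ}
    (hc : 1 ≤ c) (hcv : log c ≤ v) (hG : |i.val.im| ≤ c * T) (hD : 3 ≤ D)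
    (hD' : 0.7432 * (log T + v) - 1.9 ≤ D) : 0.092 / D ≤ 1 - i.val.re := by
  refine zero_free_of_abs_im_le hi hG hD ?_
  rw [Real.log_mul (by linarith) (by linarith)]
  have : 2.6 / (c * T) ≤ 0.13 := by
    rw [div_le_iff₀ (by positivity)]
    nlinarith
  linarith

/-- The relative height of a zero, on the scale `l`. -/
noncomputable def relHeight (l : ℝ) (i : ZetaZero) : ℝ := i.val.im ^ 2 / (6 * l ^ 2)

theorem relHeight_nonneg (l : ℝ) (i : ZetaZero) : 0 ≤ relHeight l i := by
  rw [relHeight]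
  positivity

theorem zeroWeight_eq {l : ℝ} (hl : 0 < l) (i : ZetaZero) :
    zeroWeight l i = 1 / (1 + 0.375 * relHeight l i) := by
  rw [zeroWeight, relHeight]
  congr 2
  field_simp
  ring

theorem abs_im_le_of_relHeight_le {l k m : ℝ} (hl : 0 < l) (hk : 0 ≤ k) (hm : 6 * m ≤ k ^ 2)
    {i : ZetaZero} (h : relHeight l i ≤ m) : |i.val.im| ≤ k * l := by
  rw [relHeight, div_le_iff₀ (by positivity)] at h
  refine abs_le_of_sq_le_sq (h.trans ?_) (by positivity)
  nlinarith [mul_le_mul_of_nonneg_right hm (sq_nonneg l)]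

theorem norm_testFun_zero_le {l L u : ℝ} (hl : 10 ≤ l) (hu : 106 * L ≤ u) (i : ZetaZero) :
    ‖testFun l u i.val‖ ≤ 1.01 * (1 + relHeight l i) * exp (-relHeight l i) *
      exp (-(106 * L * (1 - i.val.re))) := by
  have hb0 := i.re_pos
  have hb1 := i.re_lt_one
  refine (norm_testFun_le hl u (by linarith) (by linarith)).trans ?_
  have := relHeight_nonneg l i
  rw [relHeight] at *
  refine mul_le_mul_of_nonneg_left (exp_le_exp.mpr ?_) (by positivity)
  nlinarith

theorem quadratic_le_exp {q : ℝ} (hq : 0 ≤ q) :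
    (1 + q) * (1 + 0.375 * q) ≤ 1.12 * exp q := by
  nlinarith [quadratic_le_exp_of_nonneg hq, sq_nonneg (q - 0.69)]

theorem exp_three_gt : 20.08 < exp 3 := by
  have h : exp 3 = exp 1 ^ 3 := by rw [← exp_nat_mul]; norm_num
  rw [h]
  exact lt_of_lt_of_le (by norm_num) (pow_le_pow_left₀ (by norm_num) exp_one_gt_d9.le 3)

theorem quadratic_le_exp_of_three_le {q : ℝ} (hq : 3 ≤ q) :
    (1 + q) * (1 + 0.375 * q) ≤ 0.425 * exp q := by
  have h := quadratic_le_exp_of_nonneg (sub_nonneg.mpr hq)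
  have h1 := mul_le_mul exp_three_gt.le h (by nlinarith) (exp_pos _).le
  rw [← exp_add, add_sub_cancel] at h1
  nlinarith

theorem quadratic_le_exp_div_four {q : ℝ} (hq : 0 ≤ q) :
    (1 + q) * (1 + 0.375 * q) ≤ 12 * exp (q / 4) := by
  nlinarith [quadratic_le_exp_of_nonneg (show 0 ≤ q / 4 by positivity)]

theorem norm_testFun_zero_le_of_log_le {T l u : ℝ} (hL : 3 ≤ log T) (hL' : log T ≤ 9)
    (hT : 20 ≤ T) (h1 : 2 * T ≤ l) (h2 : l ≤ 2 * (T + 1)) (hu : 106 * log T ≤ u)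
    (i : ZetaZero) : ‖testFun l u i.val‖ ≤ 0.0218 / T * zeroWeight l i := by
  have hl : 40 ≤ l := by linarith
  have hl' : l ≤ 2.1 * T := by linarith
  refine (norm_testFun_zero_le (by linarith) hu i).trans ?_
  rw [zeroWeight_eq (by linarith)]
  have hq := relHeight_nonneg l i
  have hlog := log_nine_le
  have hg1 := fun {k m : ℝ} (hk : 0 ≤ k) (hm : 6 * m ≤ k ^ 2) =>
    abs_im_le_of_relHeight_le (l := l) (by linarith) hk hm (i := i)
  have hb1 := i.re_lt_one
  have hzf := fun {c v D : ℝ} (hi : 1 / 2 < i.val.re) =>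
    zero_free_of_le_mul hT hi (c := c) (v := v) (D := D)
  set q := relHeight l i
  set L := log T
  set b := 1 - i.val.re with hb
  suffices H : (1 + q) * (1 + 0.375 * q) * exp (L - q - 106 * L * b) ≤ 0.0215 by
    have e : 1 / T = exp (-L) := by
      rw [exp_neg, Real.exp_log (by linarith), one_div]
    rw [div_eq_mul_one_div, e, mul_one_div, le_div_iff₀ (by positivity)]
    rw [show L - q - 106 * L * b = -q + -(106 * L * b) + L by ring, exp_add, exp_add] at H
    have h5 := mul_le_mul_of_nonneg_right H (exp_pos (-L)).le
    have h6 : exp L * exp (-L) = 1 := by rw [← exp_add]; simp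
    have h7 := exp_pos (-L)
    calc _ = 1.01 * ((1 + q) * (1 + 0.375 * q) * (exp (-q) * exp (-(106 * L * b)) *
          exp L) * exp (-L)) := by
          linear_combination (-(1.01 * (1 + q) * (1 + 0.375 * q) * exp (-q) *
            exp (-(106 * L * b)))) * h6
      _ ≤ 0.0218 * exp (-L) := by linarith
  have key : ∀ {A e f : ℝ}, 0 ≤ A → (1 + q) * (1 + 0.375 * q) ≤ A * exp e →
      e + (L - q - 106 * L * b) ≤ f →
      (1 + q) * (1 + 0.375 * q) * exp (L - q - 106 * L * b) ≤ A * exp f := by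
    intro A e f hA h3 h4
    refine (mul_le_mul_of_nonneg_right h3 (exp_pos _).le).trans ?_
    rw [mul_assoc, ← exp_add]
    exact mul_le_mul_of_nonneg_left (exp_le_exp.mpr h4) hA
  have hexp3 : exp (-3) < 1 / 20.08 := by
    rw [exp_neg, inv_eq_one_div]
    exact one_div_lt_one_div_of_lt (by norm_num) exp_three_gt
  have hexp1 : exp (-1) < 0.37 := by
    rw [exp_neg, inv_lt_comm₀ (exp_pos _) (by norm_num)]
    exact lt_trans (by norm_num) exp_one_gt_d9
  have hexp4 : exp (-4) ≤ 0.0185 := by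
    rw [show (-4 : ℝ) = -3 + -1 by norm_num, exp_add]
    nlinarith [exp_pos (-3), exp_pos (-1)]
  rcases le_or_gt i.val.re (1 / 2) with hi | hi
  · refine (key (by norm_num) (quadratic_le_exp hq) (f := -4) ?_).trans (by linarith)
    nlinarith
  have hexp9 : exp (-9) ≤ 0.0001 * 1.5 := by
    rw [show (-9 : ℝ) = -3 + -3 + -3 by norm_num, exp_add, exp_add]
    have := mul_le_mul hexp3.le hexp3.le (exp_pos _).le (by norm_num)
    have := mul_le_mul this hexp3.le (exp_pos _).le (by norm_num)
    linarith
  rcases le_or_gt q 24 with hq24 | hq24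
  · rcases le_or_gt q 3 with hq3 | hq3
    · have hg := hg1 (k := 4.25) (by norm_num) (by norm_num) hq3
      have hg' : |i.val.im| ≤ 8.95 * T := by linarith
      refine (key (by norm_num) (quadratic_le_exp hq) (f := -4) ?_).trans (by linarith)
      rcases le_or_gt (0.7432 * L - 0.2686) 3 with hD | hD
      · have := hzf hi (by norm_num) hlog.1 hg' (D := 3) le_rfl (by linarith)
        nlinarith
      · have := hzf hi (by norm_num) hlog.1 hg' (D := 0.7432 * L - 0.2686) (by linarith)
          (by linarith)
        rw [div_le_iff₀ (by linarith)] at this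
        nlinarith [mul_nonneg (sub_nonneg.mpr hL) (sub_nonneg.mpr hL')]
    · have hg := hg1 (k := 12) (by norm_num) (by norm_num) hq24
      have hg' : |i.val.im| ≤ 25.2 * T := by linarith
      refine (key (by norm_num) (quadratic_le_exp_of_three_le hq3.le) (f := -3) ?_).trans
        (by linarith)
      rcases le_or_gt (0.7432 * L + 0.5043) 3 with hD | hD
      · have := hzf hi (by norm_num) hlog.2 hg' (D := 3) le_rfl (by linarith)
        nlinarith
      · have := hzf hi (by norm_num) hlog.2 hg' (D := 0.7432 * L + 0.5043) (by linarith)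
          (by linarith)
        rw [div_le_iff₀ (by linarith)] at this
        nlinarith [mul_nonneg (sub_nonneg.mpr hL) (sub_nonneg.mpr hL')]
  · refine (key (by norm_num) (quadratic_le_exp_div_four hq) (f := -9) ?_).trans (by linarith)
    have : 0 ≤ L * b := mul_nonneg (by linarith) (by linarith)
    linarith

theorem tsum_testFun_le_of_log_le {T l u : ℝ} (hL : 3 ≤ log T) (hL' : log T ≤ 9)
    (hT : 20 ≤ T) (h1 : 2 * T ≤ l) (h2 : l ≤ 2 * (T + 1)) (hu : 106 * log T ≤ u) :
    ∑' i : ZetaZero, ‖testFun l u i.val‖ ≤ 0.9 := by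
  obtain ⟨hs, hS⟩ := zeroWeight_sum_le hT h1 h2
  have hle := norm_testFun_zero_le_of_log_le hL hL' hT h1 h2 hu
  have hs' := hs.mul_left (0.0218 / T)
  refine ((hs'.of_nonneg_of_le (fun i => norm_nonneg _) hle).tsum_le_tsum hle hs').trans ?_
  rw [tsum_mul_left]
  calc _ ≤ 0.0218 / T * (4.25 * T * (9 + 0.36)) := by
        refine mul_le_mul_of_nonneg_left (hS.trans ?_) (by positivity)
        refine mul_le_mul_of_nonneg_left (by linarith) (by positivity)
    _ ≤ _ := by
      field_simp
      norm_num

theorem kernel_norm_eq {b t : ℝ} {ρ : ℂ} (hb : ρ.re < b) :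
    ‖1 / ((b : ℂ) + t * I - ρ) - 1 / ((b : ℂ) + t * I - (ρ + ((2 * (b - ρ.re) : ℝ) : ℂ)))‖ =
      2 * (1 / ((b : ℂ) + t * I - ρ)).re := by
  set w := (b : ℂ) + t * I - ρ with hw
  have h1 : (b : ℂ) + t * I - (ρ + ((2 * (b - ρ.re) : ℝ) : ℂ)) = -conj w := by
    apply Complex.ext <;> simp [hw] <;> ring
  have h2 : 1 / w - 1 / -conj w = ((2 * (1 / w).re : ℝ) : ℂ) := by
    rw [← add_conj, div_neg, sub_neg_eq_add, map_div₀, map_one]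
  rw [h1, h2, norm_real, norm_of_nonneg]
  rw [one_div_sub_re]
  have : ((b : ℂ) + t * I).re = b := by simp
  rw [this]
  exact mul_nonneg zero_le_two (div_nonneg (by linarith) (normSq_nonneg _))

theorem kernel_norm_le {b t : ℝ} (hb : 1 < b) (hb' : b ≤ 1.01) (i : ZetaZero)
    (hi : 1 / 2 < i.val.re) :
    ‖1 / (((1 / 10 : ℝ) : ℂ) + t * I - i.val) -
      1 / (((1 / 10 : ℝ) : ℂ) + t * I - (i.val + ((2 * (b - i.val.re) : ℝ) : ℂ)))‖ ≤
      15 * (1 / (2 + t * I - i.val)).re := by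
  have hβ := i.re_lt_one
  have h1 : ((1 / 10 : ℝ) : ℂ) + t * I - i.val ≠ 0 := vertical_sub_ne_zero (by linarith) t
  have h2 : ((1 / 10 : ℝ) : ℂ) + t * I - (i.val + ((2 * (b - i.val.re) : ℝ) : ℂ)) ≠ 0 := by
    refine vertical_sub_ne_zero ?_ t
    simp
    linarith
  have e : ∀ w r : ℂ, w - (i.val + r) - (w - i.val) = -r := fun w r => by ring
  rw [div_sub_div _ _ h1 h2, one_mul, mul_one, e, norm_div, norm_mul, norm_neg, norm_real,
    norm_of_nonneg (by linarith), one_div_sub_re]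
  have e1 : ‖((1 / 10 : ℝ) : ℂ) + t * I - i.val‖ ^ 2 =
      (1 / 10 - i.val.re) ^ 2 + (t - i.val.im) ^ 2 := by
    rw [← normSq_eq_norm_sq, normSq_apply]
    simp
    ring
  have e2 : ‖((1 / 10 : ℝ) : ℂ) + t * I - (i.val + ((2 * (b - i.val.re) : ℝ) : ℂ))‖ ^ 2 =
      (2 * b - i.val.re - 1 / 10) ^ 2 + (t - i.val.im) ^ 2 := by
    rw [← normSq_eq_norm_sq, normSq_apply]
    simp
    ring
  have e3 : normSq (2 + t * I - i.val) = (2 - i.val.re) ^ 2 + (t - i.val.im) ^ 2 := by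
    rw [normSq_apply]
    simp
    ring
  have e4 : (2 + t * I : ℂ).re = 2 := by simp
  have h3 : ‖((1 / 10 : ℝ) : ℂ) + t * I - i.val‖ ≤
      ‖((1 / 10 : ℝ) : ℂ) + t * I - (i.val + ((2 * (b - i.val.re) : ℝ) : ℂ))‖ := by
    refine le_of_sq_le_sq ?_ (norm_nonneg _)
    rw [e1, e2]
    nlinarith
  have h4 := mul_le_mul_of_nonneg_left h3 (norm_nonneg (((1 / 10 : ℝ) : ℂ) + t * I - i.val))
  rw [← sq, e1] at h4
  have h5 : 0.16 + (t - i.val.im) ^ 2 ≤ (1 / 10 - i.val.re) ^ 2 + (t - i.val.im) ^ 2 := by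
    nlinarith
  rw [e3, e4, ← mul_div_assoc]
  refine (div_le_div_of_nonneg_left (by linarith) (by positivity) (h5.trans h4)).trans ?_
  have h6 : 0 < (2 - i.val.re) ^ 2 := by nlinarith
  rw [div_le_div_iff₀ (by positivity) (by positivity)]
  have h7 : (2 - i.val.re) ^ 2 ≤ 2.25 := by nlinarith
  have hv := sq_nonneg (t - i.val.im)
  calc _ ≤ 1.02 * (2.25 + (t - i.val.im) ^ 2) := by
        refine mul_le_mul (by linarith) (by linarith) (by positivity) (by norm_num)
    _ ≤ 15 * 1 * (0.16 + (t - i.val.im) ^ 2) := by linarith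
    _ ≤ _ := by
      refine mul_le_mul_of_nonneg_right (by linarith) (by positivity)

theorem sum_integral_norm_le {ι : Type*} (u : Finset ι) {f : ι → ℝ → ℂ} {g : ℝ → ℝ}
    (hf : ∀ i ∈ u, Continuous (f i)) (hg : Integrable g) (h : ∀ t, ∑ i ∈ u, ‖f i t‖ ≤ g t) :
    ∑ i ∈ u, ∫ t, ‖f i t‖ ≤ ∫ t, g t := by
  have hgi : ∀ i ∈ u, Integrable (f i) := fun i hi =>
    hg.mono' (hf i hi).aestronglyMeasurable (Eventually.of_forall fun t =>
      (Finset.single_le_sum (f := fun i => ‖f i t‖) (fun _ _ => norm_nonneg _) hi).trans (h t))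
  rw [← integral_finsetSum u fun i hi => (hgi i hi).norm]
  exact integral_mono (integrable_finsetSum u fun i hi => (hgi i hi).norm) hg h

/-- A function that is small on the lines `Re s = 1/10` and `Re s = b > 1` is small on average over
the zeros of `ζ` with real part above `1/2`. -/
theorem sum_norm_zeros_le {H : ℂ → ℂ} {b C : ℝ} {gR gL : ℝ → ℝ} (hb : 1 < b) (hb' : b ≤ 1.01)
    (hd : ∀ s : ℂ, 1 / 10 ≤ s.re → s.re ≤ b → DifferentiableAt ℂ H s)
    (hC : ∀ s : ℂ, 1 / 10 ≤ s.re → s.re ≤ b → ‖H s‖ ≤ C) (iR : Integrable gR) (iL : Integrable gL)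
    (hR : ∀ t : ℝ, ‖H (b + t * I)‖ * (2 * (logDeriv xiFun (b + t * I)).re) ≤ gR t)
    (hL : ∀ t : ℝ, ‖H (((1 / 10 : ℝ) : ℂ) + t * I)‖ * (15 * (2 + |t|)) ≤ gL t)
    (u : Finset ZetaZero) (hu : ∀ i ∈ u, 1 / 2 < i.val.re) :
    ∑ i ∈ u, ‖H i.val‖ ≤ ((∫ t, gR t) + ∫ t, gL t) / (2 * π) := by
  set k : ZetaZero → ℂ → ℂ := fun i s =>
    1 / (s - i.val) - 1 / (s - (i.val + ((2 * (b - i.val.re) : ℝ) : ℂ))) with hk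
  have hc : ∀ {c : ℝ}, 1 / 10 ≤ c → c ≤ b → (∀ i ∈ u, c ≠ i.val.re) →
      (∀ i ∈ u, c ≠ i.val.re + 2 * (b - i.val.re)) →
      ∀ i ∈ u, Continuous fun t : ℝ => H (c + t * I) * k i (c + t * I) := by
    intro c h1 h2 h3 h4 i hi
    refine Continuous.mul (continuous_iff_continuousAt.mpr fun t => ?_) ?_
    · have : ContinuousAt H (c + t * I) :=
        (hd _ (by simpa using h1) (by simpa using h2)).continuousAt
      exact this.comp (f := fun t : ℝ => (c + t * I : ℂ)) (by fun_prop)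
    · simp only [hk]
      refine (continuous_const.div (by fun_prop) (vertical_sub_ne_zero (h3 i hi))).sub
        (continuous_const.div (by fun_prop) (vertical_sub_ne_zero ?_))
      simpa using h4 i hi
  have h1 : ∑ i ∈ u, ∫ t : ℝ, ‖H (b + t * I) * k i (b + t * I)‖ ≤ ∫ t, gR t := by
    refine sum_integral_norm_le u (hc (by linarith) le_rfl ?_ ?_) iR fun t => ?_
    · intro i _
      linarith [i.re_lt_one]
    · intro i _
      linarith [i.re_lt_one]
    · refine le_trans ?_ (hR t)
      simp only [norm_mul, ← Finset.mul_sum]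
      refine mul_le_mul_of_nonneg_left ?_ (norm_nonneg _)
      have hs : 1 ≤ ((b : ℂ) + t * I).re := by simpa using hb.le
      rw [Finset.sum_congr rfl fun i _ => kernel_norm_eq (i.re_lt_one.trans hb), ← Finset.mul_sum]
      exact mul_le_mul_of_nonneg_left (sum_le_hasSum u
        (fun i _ => one_div_sub_re_nonneg hs i) (hasSum_re_zeros hs)) zero_le_two
  have h2 : ∑ i ∈ u, ∫ t : ℝ, ‖H (((1 / 10 : ℝ) : ℂ) + t * I) *
      k i (((1 / 10 : ℝ) : ℂ) + t * I)‖ ≤ ∫ t, gL t := by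
    refine sum_integral_norm_le u (hc le_rfl (by linarith) ?_ ?_) iL fun t => ?_
    · intro i hi
      linarith [hu i hi]
    · intro i _
      linarith [i.re_lt_one]
    · refine le_trans ?_ (hL t)
      simp only [norm_mul, ← Finset.mul_sum]
      refine mul_le_mul_of_nonneg_left ?_ (norm_nonneg _)
      refine (Finset.sum_le_sum fun i hi => kernel_norm_le hb hb' i (hu i hi)).trans ?_
      have hs : 1 ≤ (2 + t * I : ℂ).re := by simp
      rw [← Finset.mul_sum]
      exact mul_le_mul_of_nonneg_left ((sum_le_hasSum u (fun i _ => one_div_sub_re_nonneg hs i)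
        (hasSum_re_zeros hs)).trans (logDeriv_xiFun_two_re_le t)) (by norm_num)
  rw [le_div_iff₀' (by positivity), Finset.mul_sum]
  refine le_trans (Finset.sum_le_sum fun i hi => ?_)
    (Finset.sum_add_distrib.le.trans (add_le_add h1 h2))
  have hβ := hu i hi
  have hβ' := i.re_lt_one
  have h3 := integral_mul_kernel (r := 2 * (b - i.val.re)) (by linarith) (hβ'.trans hb) hd hC
    (Or.inr (by linarith))
  have h4 := congrArg norm h3
  rw [norm_mul, norm_mul, norm_real, norm_of_nonneg pi_pos.le, Complex.norm_ofNat] at h4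
  rw [← h4]
  exact (norm_sub_le _ _).trans (add_le_add (norm_integral_le_integral_norm _)
    (norm_integral_le_integral_norm _))

/-- The error `(s - 1) (1 - ζ(s) M(s)) / s` of a mollifier `M`, without its singularity at `1`. -/
noncomputable def mollified (M : ℂ → ℂ) (s : ℂ) : ℂ :=
  (s - 1 - xiFun s * (Gammaℝ s)⁻¹ / s * M s) / s

theorem mollified_eq (M : ℂ → ℂ) {s : ℂ} (h0 : 0 < s.re) (h1 : s ≠ 1) :
    mollified M s = (s - 1) / s * (1 - riemannZeta s * M s) := by
  have hs0 : s ≠ 0 := by rintro rfl; simp at h0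
  rw [mollified, xiFun_eq_Gammaℝ_mul h0 h1]
  field_simp [Gammaℝ_ne_zero_of_re_pos h0]

theorem differentiableAt_mollified {M : ℂ → ℂ} (hM : Differentiable ℂ M) {s : ℂ} (h0 : 0 < s.re) :
    DifferentiableAt ℂ (mollified M) s := by
  have hs0 : s ≠ 0 := by rintro rfl; simp at h0
  have h1 := differentiable_xiFun s
  have h2 := differentiable_Gammaℝ_inv s
  have h3 := hM s
  unfold mollified
  fun_prop (disch := assumption)

theorem norm_mollified_le {M : ℂ → ℂ} {N : ℝ} (hN : 1 ≤ N) {s : ℂ} (hs : 1 / 10 ≤ s.re)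
    (hM : ‖M s‖ ≤ N) : ‖mollified M s‖ ≤ (1 + 20 * ‖s - 1‖) * N := by
  by_cases h1 : s = 1
  · subst h1
    simpa [mollified, xiFun_one, Gammaℝ_one] using hM
  have h0 : 0 < s.re := by linarith
  have hn : 1 / 10 ≤ ‖s‖ := hs.trans ((le_abs_self _).trans (abs_re_le_norm s))
  have hn0 : 0 < ‖s‖ := by linarith
  have hx : 0 < ‖s - 1‖ := norm_pos_iff.mpr (sub_ne_zero.mpr h1)
  rw [mollified_eq M h0 h1, norm_mul, norm_div]
  have h2 : ‖1 - riemannZeta s * M s‖ ≤ 1 + (‖s‖ / ‖s - 1‖ + ‖s‖ / s.re) * N := by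
    refine (norm_sub_le _ _).trans ?_
    rw [norm_one, norm_mul]
    have := mul_le_mul (norm_riemannZeta_le h0 h1) hM (norm_nonneg _) (by positivity)
    linarith
  have h3 : ‖s - 1‖ / ‖s‖ ≤ 10 * ‖s - 1‖ := by
    rw [div_le_iff₀ hn0]
    nlinarith
  have h4 : ‖s - 1‖ / s.re ≤ 10 * ‖s - 1‖ := by
    rw [div_le_iff₀ h0]
    nlinarith
  calc _ ≤ ‖s - 1‖ / ‖s‖ * (1 + (‖s‖ / ‖s - 1‖ + ‖s‖ / s.re) * N) :=
        mul_le_mul_of_nonneg_left h2 (by positivity)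
    _ = ‖s - 1‖ / ‖s‖ + (1 + ‖s - 1‖ / s.re) * N := by field_simp
    _ ≤ 10 * ‖s - 1‖ + (1 + 10 * ‖s - 1‖) * N := by gcongr
    _ ≤ _ := by nlinarith

theorem normSq_mollified_le {M : ℂ → ℂ} {N : ℝ} (hN : 1 ≤ N) {s : ℂ} (hs : 1 / 10 ≤ s.re)
    (hs' : s.re ≤ 2) (hM : ‖M s‖ ≤ N) : ‖mollified M s‖ ^ 2 ≤ 441 * (1 + s.im ^ 2) * N ^ 2 := by
  refine (pow_le_pow_left₀ (norm_nonneg _) (norm_mollified_le hN hs hM) 2).trans ?_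
  have h : ‖s - 1‖ ^ 2 ≤ 1 + s.im ^ 2 := by
    rw [← normSq_eq_norm_sq, normSq_apply]
    simp
    nlinarith
  rw [mul_pow]
  refine mul_le_mul_of_nonneg_right ?_ (sq_nonneg _)
  nlinarith [sq_nonneg (‖s - 1‖ - 1), sq_nonneg s.im]

/-- The function whose values at the zeros are bounded by means of a mollifier `M`. -/
noncomputable def sieveFun (M : ℂ → ℂ) (V μ : ℝ) (s : ℂ) : ℂ :=
  mollified M s ^ 2 * cexp ((s - 1) * V + μ * (s - 1) ^ 2)

theorem norm_sieveFun (M : ℂ → ℂ) (V μ : ℝ) (s : ℂ) : ‖sieveFun M V μ s‖ =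
    ‖mollified M s‖ ^ 2 * exp ((s.re - 1) * V + μ * ((s.re - 1) ^ 2 - s.im ^ 2)) := by
  rw [sieveFun, norm_mul, norm_pow, norm_exp]
  congr 2
  simp [sq]

theorem norm_sieveFun_le {M : ℂ → ℂ} {N V μ : ℝ} (hμ : 0 < μ) (hN : 1 ≤ N) (hV : 0 ≤ V) {s : ℂ}
    (hs : 1 / 10 ≤ s.re) (hs' : s.re ≤ 2) (hM : ‖M s‖ ≤ N) :
    ‖sieveFun M V μ s‖ ≤ 441 * N ^ 2 * exp (V + μ) * (1 + 1 / μ) := by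
  rw [norm_sieveFun]
  have h1 : (s.re - 1) * V + μ * ((s.re - 1) ^ 2 - s.im ^ 2) ≤ V + μ + -(μ * s.im ^ 2) := by
    have : μ * (s.re - 1) ^ 2 ≤ μ * 1 := mul_le_mul_of_nonneg_left (by nlinarith) hμ.le
    nlinarith
  have h2 : (1 + s.im ^ 2) * exp (-(μ * s.im ^ 2)) ≤ 1 + 1 / μ := by
    rw [exp_neg, ← div_eq_mul_inv, div_le_iff₀ (exp_pos _)]
    have h3 := add_one_le_exp (μ * s.im ^ 2)
    have h4 : (1 + 1 / μ) * (μ * s.im ^ 2 + 1) = 1 + s.im ^ 2 + μ * s.im ^ 2 + 1 / μ := by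
      field_simp
      ring
    have h5 : 0 ≤ μ * s.im ^ 2 + 1 / μ := by positivity
    refine le_trans ?_ (mul_le_mul_of_nonneg_left h3 (by positivity))
    linarith
  calc _ ≤ 441 * (1 + s.im ^ 2) * N ^ 2 * (exp (V + μ) * exp (-(μ * s.im ^ 2))) := by
        rw [← exp_add]
        exact mul_le_mul (normSq_mollified_le hN hs hs' hM) (exp_le_exp.mpr h1)
          (exp_pos _).le (by positivity)
    _ = 441 * N ^ 2 * exp (V + μ) * ((1 + s.im ^ 2) * exp (-(μ * s.im ^ 2))) := by ring
    _ ≤ _ := mul_le_mul_of_nonneg_left h2 (by positivity)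

theorem norm_sieveFun_left_le {M : ℂ → ℂ} {N V l : ℝ} (hl : 40 ≤ l) (hN : 1 ≤ N) (t : ℝ)
    (hM : ‖M (((1 / 10 : ℝ) : ℂ) + t * I)‖ ≤ N) :
    ‖sieveFun M V (1 / (24 * l ^ 2)) (((1 / 10 : ℝ) : ℂ) + t * I)‖ * (15 * (2 + |t|)) ≤
      3.2e8 * N ^ 2 * l ^ 3 * exp (-0.9 * V) * (1 + (t / l) ^ 2)⁻¹ := by
  have hre : (((1 / 10 : ℝ) : ℂ) + t * I).re = 1 / 10 := by simp
  have him : (((1 / 10 : ℝ) : ℂ) + t * I).im = t := by simp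
  have h1 := normSq_mollified_le hN (by rw [hre]) (by rw [hre]; norm_num) hM
  rw [norm_sieveFun, hre, him] at *
  have hl0 : 0 < l := by linarith
  obtain ⟨y, rfl⟩ : ∃ y, t = l * y := ⟨t / l, by field_simp⟩
  have e1 : (1 / 10 - 1) * V + 1 / (24 * l ^ 2) * ((1 / 10 - 1) ^ 2 - (l * y) ^ 2) =
      -0.9 * V + (0.81 / (24 * l ^ 2) - y ^ 2 / 24) := by
    field_simp
    ring
  have e2 : l * y / l = y := by field_simp
  rw [e1, e2, exp_add]
  set v := 1 + y ^ 2 with hv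
  have hv1 : 1 ≤ v := by nlinarith
  have h2 : 1 + (l * y) ^ 2 ≤ l ^ 2 * v := by nlinarith
  have h3 : 2 + |l * y| ≤ 0.55 * l * v := by
    rw [abs_mul, abs_of_pos hl0]
    have : |y| ≤ v / 2 := by nlinarith [sq_abs y, sq_nonneg (|y| - 1)]
    nlinarith [mul_le_mul_of_nonneg_left this hl0.le, mul_le_mul_of_nonneg_left hv1 hl0.le]
  have h4 : v ^ 3 * exp (0.81 / (24 * l ^ 2) - y ^ 2 / 24) ≤ 87500 := by
    have h5 := pow_div_factorial_le_exp (v / 24) (by positivity) 3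
    have h6 : 0.81 / (24 * l ^ 2) ≤ 0.001 := by
      rw [div_le_iff₀ (by positivity)]
      nlinarith
    have h7 : exp (0.81 / (24 * l ^ 2) - y ^ 2 / 24) ≤
        exp (0.043) * exp (-(v / 24)) := by
      rw [← exp_add, hv]
      exact exp_le_exp.mpr (by linarith)
    have h8 : exp 0.043 ≤ 1.05 := by
      have := one_sub_le_exp_neg 0.043
      rw [exp_neg] at this
      rw [← inv_inv (exp 0.043), inv_le_comm₀ (by positivity) (by norm_num)]
      exact le_trans (by norm_num) this
    have h9 : v ^ 3 ≤ 82944 * exp (v / 24) := by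
      norm_num [Nat.factorial] at h5
      linarith
    have h10 : exp (v / 24) * exp (-(v / 24)) = 1 := by rw [← exp_add]; simp
    calc _ ≤ 82944 * exp (v / 24) * (exp 0.043 * exp (-(v / 24))) :=
          mul_le_mul h9 h7 (exp_pos _).le (by positivity)
      _ = 82944 * exp 0.043 := by linear_combination (82944 * exp 0.043) * h10
      _ ≤ _ := by linarith
  rw [← div_eq_mul_inv, le_div_iff₀ (by positivity)]
  have hE := exp_pos (-0.9 * V)
  have hE' := exp_pos (0.81 / (24 * l ^ 2) - y ^ 2 / 24)
  calc _ ≤ 441 * (l ^ 2 * v) * N ^ 2 * (exp (-0.9 * V) *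
        exp (0.81 / (24 * l ^ 2) - y ^ 2 / 24)) * (15 * (0.55 * l * v)) * v := by
        gcongr
        exact h1.trans (by gcongr)
    _ = 3638.25 * N ^ 2 * l ^ 3 * exp (-0.9 * V) *
        (v ^ 3 * exp (0.81 / (24 * l ^ 2) - y ^ 2 / 24)) := by ring
    _ ≤ 3638.25 * N ^ 2 * l ^ 3 * exp (-0.9 * V) * 87500 :=
        mul_le_mul_of_nonneg_left h4 (by positivity)
    _ ≤ _ := by
      have : 0 ≤ N ^ 2 * l ^ 3 * exp (-0.9 * V) := by positivity
      linarith

theorem normSq_mul_logDeriv_xiFun_le {l δ : ℝ} (hl : 40 ≤ l) (hδ : 0 < δ) (hδ' : δ ≤ 0.01) (t : ℝ) :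
    (δ ^ 2 + t ^ 2) / ((1 + δ) ^ 2 + t ^ 2) * (logDeriv xiFun (((1 + δ : ℝ) : ℂ) + t * I)).re ≤
      δ + 1 / δ + log l / 2 + t ^ 2 / (156 * l ^ 2) := by
  have hl0 : 0 < l := by linarith
  have h := logDeriv_xiFun_re_le (σ := 1 + δ) (by linarith) (by linarith) t
  rw [add_sub_cancel_left] at h
  set n := ‖((1 + δ + 1 : ℝ) : ℂ) + t * I‖ with hn
  have hn2 : n ^ 2 = (2 + δ) ^ 2 + t ^ 2 := by
    rw [hn, ← normSq_eq_norm_sq, normSq_apply]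
    simp
    ring
  have hn0 : 0 < n := by
    refine lt_of_le_of_ne (norm_nonneg _) fun h0 => ?_
    rw [← h0] at hn2
    nlinarith [sq_nonneg t]
  have hlog : log (n / (2 * π)) / 2 ≤ log l / 2 + t ^ 2 / (156 * l ^ 2) := by
    have h1 := log_le_sub_one_of_pos (show 0 < (n / (2 * π) / l) ^ 2 by positivity)
    rw [log_pow, Real.log_div (by positivity) hl0.ne', div_pow, div_pow, hn2] at h1
    have h2 : ((2 + δ) ^ 2 + t ^ 2) / (2 * π) ^ 2 / l ^ 2 ≤ 1 + 4 * (t ^ 2 / (156 * l ^ 2)) := by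
      have h3 : (39 : ℝ) ≤ (2 * π) ^ 2 := by nlinarith [pi_gt_d2]
      calc _ ≤ ((2 + δ) ^ 2 + t ^ 2) / 39 / l ^ 2 := by gcongr
        _ = (2 + δ) ^ 2 / 39 / l ^ 2 + 4 * (t ^ 2 / (156 * l ^ 2)) := by
          field_simp
          ring
        _ ≤ _ := by
          rw [div_div]
          gcongr
          rw [div_le_one (by positivity)]
          nlinarith
    push_cast at h1
    linarith
  set R := (δ ^ 2 + t ^ 2) / ((1 + δ) ^ 2 + t ^ 2) with hR
  have hR0 : 0 ≤ R := by positivity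
  have hR1 : R ≤ 1 := by
    rw [hR, div_le_one (by positivity)]
    nlinarith
  have hR2 : R * (δ / (δ ^ 2 + t ^ 2)) ≤ δ := by
    rw [hR, div_mul_div_comm, div_le_iff₀ (by positivity)]
    nlinarith [mul_nonneg (show 0 ≤ δ ^ 2 + t ^ 2 by positivity)
      (show 0 ≤ 2 * δ + δ ^ 2 + t ^ 2 by positivity),
      mul_pos hδ (show 0 < δ ^ 2 + t ^ 2 by positivity)]
  have hl1 : 0 ≤ log l := log_nonneg (by linarith)
  have hB : 0 ≤ 1 / δ + log l / 2 + t ^ 2 / (156 * l ^ 2) := by positivity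
  calc _ ≤ R * (δ / (δ ^ 2 + t ^ 2) + (1 / δ + log l / 2 + t ^ 2 / (156 * l ^ 2))) :=
        mul_le_mul_of_nonneg_left (by linarith) hR0
    _ = R * (δ / (δ ^ 2 + t ^ 2)) + R * (1 / δ + log l / 2 + t ^ 2 / (156 * l ^ 2)) := by ring
    _ ≤ δ + 1 * (1 / δ + log l / 2 + t ^ 2 / (156 * l ^ 2)) :=
        add_le_add hR2 (mul_le_mul_of_nonneg_right hR1 hB)
    _ = _ := by ring

theorem norm_sieveFun_right_le {M : ℂ → ℂ} {V l δ : ℝ} (hl : 40 ≤ l) (hδ : 0 < δ) (hδ' : δ ≤ 0.01)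
    (t : ℝ) : ‖sieveFun M V (1 / (24 * l ^ 2)) (((1 + δ : ℝ) : ℂ) + t * I)‖ *
      (2 * (logDeriv xiFun (((1 + δ : ℝ) : ℂ) + t * I)).re) ≤
    2 * (δ + 1 / δ + log l / 2) * exp (δ * V + δ ^ 2) *
      (‖riemannZeta (1 + δ + I * t) * M (1 + δ + I * t) - 1‖ ^ 2 *
        exp (-(1 / (25 * l ^ 2)) * t ^ 2)) := by
  have hl0 : 0 < l := by linarith
  have hs : (1 + δ + I * t : ℂ) = ((1 + δ : ℝ) : ℂ) + t * I := by push_cast; ring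
  rw [hs]
  have H := normSq_mul_logDeriv_xiFun_le hl hδ hδ' t
  set s := ((1 + δ : ℝ) : ℂ) + t * I with hsd
  have hre : s.re = 1 + δ := by simp [hsd]
  have him : s.im = t := by simp [hsd]
  have h1 : s ≠ 1 := by
    intro h
    rw [h, one_re] at hre
    linarith
  have e1 : ‖mollified M s‖ ^ 2 = (δ ^ 2 + t ^ 2) / ((1 + δ) ^ 2 + t ^ 2) *
      ‖riemannZeta s * M s - 1‖ ^ 2 := by
    rw [mollified_eq M (by linarith) h1, norm_mul, norm_div, mul_pow, div_pow, norm_sub_rev 1,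
      ← normSq_eq_norm_sq, ← normSq_eq_norm_sq, normSq_apply, normSq_apply, sub_re, sub_im, hre, him,
      one_re, one_im]
    ring
  rw [norm_sieveFun, e1, hre, him, add_sub_cancel_left]
  set K := δ + 1 / δ + log l / 2 with hK
  have hK4 : 4 ≤ K := by
    have h2 : 4 ≤ 1 / δ := by
      rw [le_div_iff₀ hδ]
      linarith
    have : 0 ≤ log l := log_nonneg (by linarith)
    linarith
  set Q := ‖riemannZeta s * M s - 1‖ ^ 2
  have hx : (K + t ^ 2 / (156 * l ^ 2)) ≤ K * exp (t ^ 2 / (600 * l ^ 2)) := by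
    have h2 := add_one_le_exp (t ^ 2 / (600 * l ^ 2))
    have h3 : t ^ 2 / (156 * l ^ 2) ≤ 4 * (t ^ 2 / (600 * l ^ 2)) := by
      rw [show 4 * (t ^ 2 / (600 * l ^ 2)) = t ^ 2 / (150 * l ^ 2) by field_simp; ring]
      gcongr
      norm_num
    have h4 : 0 ≤ t ^ 2 / (600 * l ^ 2) := by positivity
    nlinarith
  have hexp : exp (t ^ 2 / (600 * l ^ 2)) * exp (δ * V + 1 / (24 * l ^ 2) * (δ ^ 2 - t ^ 2)) ≤
      exp (δ * V + δ ^ 2) * exp (-(1 / (25 * l ^ 2)) * t ^ 2) := by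
    rw [← exp_add, ← exp_add]
    refine exp_le_exp.mpr ?_
    have h2 : t ^ 2 / (600 * l ^ 2) - 1 / (24 * l ^ 2) * t ^ 2 = -(1 / (25 * l ^ 2)) * t ^ 2 := by
      field_simp
      ring
    have h3 : 1 / (24 * l ^ 2) ≤ 1 := by
      rw [div_le_one (by positivity)]
      nlinarith
    have h4 := mul_le_mul_of_nonneg_right h3 (sq_nonneg δ)
    linarith
  set E := exp (δ * V + 1 / (24 * l ^ 2) * (δ ^ 2 - t ^ 2)) with hE
  have hE0 : 0 < E := exp_pos _
  have hQ : 0 ≤ Q := sq_nonneg _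
  calc _ = 2 * Q * E * ((δ ^ 2 + t ^ 2) / ((1 + δ) ^ 2 + t ^ 2) * (logDeriv xiFun s).re) := by ring
    _ ≤ 2 * Q * E * (K * exp (t ^ 2 / (600 * l ^ 2))) :=
        mul_le_mul_of_nonneg_left (H.trans hx) (by positivity)
    _ = 2 * Q * K * (exp (t ^ 2 / (600 * l ^ 2)) * E) := by ring
    _ ≤ _ := mul_le_mul_of_nonneg_left hexp (by positivity)
    _ = _ := by ring

theorem integrable_mollified_line {M : ℂ → ℂ} (hM : Differentiable ℂ M) {N δ κ : ℝ} (hN : 1 ≤ N)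
    (hMN : ∀ s : ℂ, 0 ≤ s.re → ‖M s‖ ≤ N) (hδ : 0 < δ) (hδ' : δ ≤ 0.01) (hκ : 0 < κ) :
    Integrable fun t : ℝ => ‖riemannZeta (1 + δ + I * t) * M (1 + δ + I * t) - 1‖ ^ 2 *
      exp (-κ * t ^ 2) := by
  have hre : ∀ t : ℝ, (1 + δ + I * t : ℂ).re = 1 + δ := fun t => by simp
  have him : ∀ t : ℝ, (1 + δ + I * t : ℂ).im = t := fun t => by simp
  have h1 : ∀ t : ℝ, (1 + δ + I * t : ℂ) ≠ 1 := by
    intro t h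
    have := hre t
    rw [h, one_re] at this
    linarith
  have hc : Continuous fun t : ℝ => riemannZeta (1 + δ + I * t) :=
    continuous_iff_continuousAt.mpr fun t =>
      (differentiableAt_riemannZeta (h1 t)).continuousAt.comp
        (f := fun t : ℝ => (1 + δ + I * t : ℂ)) (by fun_prop)
  have hM' := hM.continuous
  have i1 := integrable_exp_neg_mul_sq hκ
  have i2 := integrable_rpow_mul_exp_neg_mul_sq hκ (s := 2) (by norm_num)
  refine ((i1.add i2).const_mul (441 * N ^ 2 * (1 + 1 / δ) ^ 2)).mono'
    (Continuous.aestronglyMeasurable (by fun_prop)) (Eventually.of_forall fun t => ?_)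
  rw [norm_of_nonneg (by positivity), Pi.add_apply, rpow_two]
  have h2 := normSq_mollified_le hN (s := 1 + δ + I * t) (by rw [hre]; linarith)
    (by rw [hre]; linarith) (hMN _ (by rw [hre]; linarith))
  have hd : δ ≤ ‖(1 + δ + I * t : ℂ) - 1‖ := by
    have := (le_abs_self _).trans (abs_re_le_norm ((1 + δ + I * t : ℂ) - 1))
    rwa [sub_re, hre, one_re, add_sub_cancel_left] at this
  rw [mollified_eq M (by rw [hre]; linarith) (h1 t), norm_mul, norm_div, him] at h2
  have hs := norm_add_le ((1 + δ + I * t : ℂ) - 1) 1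
  rw [sub_add_cancel, norm_one] at hs
  set n := ‖(1 + δ + I * t : ℂ) - 1‖
  set m := ‖(1 + δ + I * t : ℂ)‖
  have hn0 : 0 < n := hδ.trans_le hd
  have hm0 : 0 < m := norm_pos_iff.mpr fun h => by
    have := hre t
    rw [h, zero_re] at this
    linarith
  rw [norm_sub_rev]
  set Q := ‖1 - riemannZeta (1 + δ + I * t) * M (1 + δ + I * t)‖
  have h3 : Q ≤ (1 + 1 / δ) * (n / m * Q) := by
    have h4 : m / n ≤ 1 + 1 / δ := by
      rw [div_le_iff₀ hn0]
      have : 1 ≤ 1 / δ * n := by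
        rw [one_div_mul_eq_div, le_div_iff₀ hδ]
        linarith
      linarith
    calc Q = m / n * (n / m * Q) := by field_simp
      _ ≤ _ := mul_le_mul_of_nonneg_right h4 (by positivity)
  have h5 := (pow_le_pow_left₀ (norm_nonneg _) h3 2).trans
    ((mul_pow _ _ 2).le.trans (mul_le_mul_of_nonneg_left h2 (sq_nonneg _)))
  have := mul_le_mul_of_nonneg_right h5 (exp_pos (-κ * t ^ 2)).le
  linarith

/-- The mean value of a mollifier on `Re s = 1 + δ` controls `sieveFun` at the zeros. -/
theorem sum_norm_sieveFun_le {M : ℂ → ℂ} (hM : Differentiable ℂ M) {N V l δ : ℝ} (hN : 1 ≤ N)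
    (hMN : ∀ s : ℂ, 0 ≤ s.re → ‖M s‖ ≤ N) (hV : 0 ≤ V) (hl : 40 ≤ l) (hδ : 0 < δ) (hδ' : δ ≤ 0.01)
    (u : Finset ZetaZero) (hu : ∀ i ∈ u, 1 / 2 < i.val.re) :
    ∑ i ∈ u, ‖sieveFun M V (1 / (24 * l ^ 2)) i.val‖ ≤
      (δ + 1 / δ + log l / 2) * exp (δ * V + δ ^ 2) / π *
        (∫ t : ℝ, ‖riemannZeta (1 + δ + I * t) * M (1 + δ + I * t) - 1‖ ^ 2 *
          exp (-(1 / (25 * l ^ 2)) * t ^ 2)) +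
      1.6e8 * N ^ 2 * l ^ 4 * exp (-0.9 * V) := by
  have hl0 : 0 < l := by linarith
  have hi : Integrable fun t : ℝ => (1 + (t / l) ^ 2)⁻¹ :=
    integrable_inv_one_add_sq.comp_div hl0.ne'
  have hre : ∀ t : ℝ, 0 ≤ (((1 / 10 : ℝ) : ℂ) + t * I).re := fun t => by simp
  refine (sum_norm_zeros_le (b := 1 + δ) (by linarith) (by linarith) (fun s h1 _ => ?_)
    (fun s h1 h2 => norm_sieveFun_le (by positivity) hN hV h1 (by linarith)
      (hMN s (by linarith))) ((integrable_mollified_line hM hN hMN hδ hδ'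
        (κ := 1 / (25 * l ^ 2)) (by positivity)).const_mul _) (hi.const_mul _)
    (norm_sieveFun_right_le hl hδ hδ')
    (fun t => norm_sieveFun_left_le hl hN t (hMN _ (hre t))) u hu).trans (le_of_eq ?_)
  · have := differentiableAt_mollified hM (s := s) (by linarith)
    unfold sieveFun
    fun_prop
  · rw [integral_const_mul, integral_const_mul, Measure.integral_comp_div (fun t : ℝ => (1 + t ^ 2)⁻¹),
      integral_univ_inv_one_add_sq, abs_of_pos hl0, smul_eq_mul]
    field_simp
    ring

end

section

open Finset Real
open ArithmeticFunction hiding log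
open scoped ArithmeticFunction.Moebius ArithmeticFunction.zeta

theorem sum_moebius_mul_div (N : ℕ) (hN : 1 ≤ N) :
    ∑ n ∈ Ioc 0 N, (μ n : ℝ) * (N / n : ℕ) = 1 := by
  have h := sum_Ioc_mul_zeta_eq_sum (μ : ArithmeticFunction ℤ) N
  rw [moebius_mul_coe_zeta] at h
  have h1 : ∑ n ∈ Ioc 0 N, (1 : ArithmeticFunction ℤ) n = 1 := by
    rw [sum_eq_single 1]
    · simp
    · intro b _ hb; exact one_apply_ne hb
    · intro h; simp at h; omega
  rw [h1] at h
  have h2 := congrArg (fun z : ℤ => (z : ℝ)) h.symm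
  simp only [Int.cast_sum] at h2
  simpa only [Int.cast_mul, Int.cast_natCast, Int.cast_one] using h2

theorem sum_moebius_div_mul_harmonic (N : ℕ) (hN : 1 ≤ N) :
    ∑ n ∈ Ioc 0 N, (μ n : ℝ) / n * (harmonic (N / n) : ℝ) = 1 := by
  set f : ArithmeticFunction ℝ := ⟨fun n => (μ n : ℝ) / n, by simp⟩ with hf
  set g : ArithmeticFunction ℝ := ⟨fun n => (1 : ℝ) / n, by simp⟩ with hg
  have h := sum_Ioc_mul_eq_sum_sum f g N
  have hfg : f * g = 1 := by
    ext n
    rcases Nat.eq_zero_or_pos n with rfl | hn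
    · simp
    rw [mul_apply]
    have h1 : ∀ x ∈ n.divisorsAntidiagonal, f x.1 * g x.2 = (1 / n : ℝ) * (μ x.1 * (ζ x.2 : ℤ) : ℤ) := by
      intro x hx
      obtain ⟨hx1, hx2⟩ := Nat.mem_divisorsAntidiagonal.mp hx
      have hx3 : x.2 ≠ 0 := by rintro h; rw [h] at hx1; simp at hx1; omega
      simp only [hf, hg, coe_mk, zeta_apply, hx3, if_false]
      rw [← hx1]; push_cast
      ring
    rw [sum_congr rfl h1, ← mul_sum, ← Int.cast_sum]
    have h2 : ∑ x ∈ n.divisorsAntidiagonal, μ x.1 * ((ζ x.2 : ℕ) : ℤ) =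
        (μ * (ζ : ArithmeticFunction ℤ)) n := by
      rw [mul_apply]; simp
    rw [h2, moebius_mul_coe_zeta]
    by_cases h : n = 1
    · subst h; simp
    · simp [one_apply_ne h]
  rw [hfg] at h
  have h1 : ∑ n ∈ Ioc 0 N, (1 : ArithmeticFunction ℝ) n = 1 := by
    rw [sum_eq_single 1]
    · simp
    · intro b _ hb; exact one_apply_ne hb
    · intro h; simp at h; omega
  rw [h1] at h
  rw [h]
  refine sum_congr rfl fun n _ => ?_
  simp only [hf, hg, coe_mk]
  congr 1
  rw [harmonic_eq_sum_Icc]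
  push_cast
  refine sum_congr rfl fun m _ => by simp

theorem log_le_half_sub_inv {x : ℝ} (hx : 1 ≤ x) : log x ≤ (x - x⁻¹) / 2 := by
  rw [← sinh_log (by linarith)]
  exact self_le_sinh_iff.mpr (log_nonneg hx)

/-- The Euler-Maclaurin remainder of the harmonic sum is at most `1 / 2` in absolute value. -/
theorem abs_mul_harmonic_sub_log_le {t : ℝ} (ht : 1 ≤ t) :
    |t * (harmonic ⌊t⌋₊ - log t) - eulerMascheroniConstant * ⌊t⌋₊| ≤ 1 / 2 := by
  set γ := eulerMascheroniConstant
  set n := ⌊t⌋₊ with hn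
  have hn1 : 1 ≤ n := Nat.le_floor (by simpa using ht)
  have hnt : (n : ℝ) ≤ t := Nat.floor_le (by linarith)
  have htn : t < n + 1 := Nat.lt_floor_add_one t
  have hnR : (1 : ℝ) ≤ n := by exact_mod_cast hn1
  have h1 : γ < (harmonic (n + 1) : ℝ) - log (n + 1) := by
    have := eulerMascheroniConstant_lt_eulerMascheroniSeq' (n + 1)
    simpa [eulerMascheroniSeq'] using this
  have h2 : (harmonic (n + 1) : ℝ) = harmonic n + 1 / (n + 1) := by
    rw [harmonic_succ]; push_cast; simp
  have hγ := one_half_lt_eulerMascheroniConstant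
  have hlog : log t - log n ≥ (t - n) / t := by
    rw [← log_div (by positivity) (by positivity)]
    have := one_sub_inv_le_log_of_pos (x := t / n) (by positivity)
    have e : 1 - (t / n)⁻¹ = (t - n) / t := by field_simp
    linarith
  have hlog2 : log (n + 1) - log t ≥ 1 - t / (n + 1) := by
    rw [← log_div (by positivity) (by positivity)]
    have := one_sub_inv_le_log_of_pos (x := (n + 1) / t) (by positivity)
    have e : 1 - ((n + 1) / t)⁻¹ = 1 - t / (n + 1) := by rw [inv_div]
    linarith
  have hup : (harmonic n : ℝ) - log n - γ ≤ 1 / (2 * n) := by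
    have hmono : ∀ m : ℕ, (harmonic n : ℝ) - log n - 1 / (2 * n) ≤
        (harmonic (n + m) : ℝ) - log (n + m : ℕ) - 1 / (2 * (n + m : ℕ)) := by
      intro m
      induction m with
      | zero => simp
      | succ m ih =>
        refine ih.trans ?_
        have hk : (1 : ℝ) ≤ ((n + m : ℕ) : ℝ) := by push_cast; linarith [Nat.cast_nonneg (α := ℝ) m]
        rw [← add_assoc]
        generalize n + m = k at *
        have h3 : (harmonic (k + 1) : ℝ) = harmonic k + 1 / (k + 1) := by
          rw [harmonic_succ]; push_cast; simp
        have h4 := log_le_half_sub_inv (x := ((k + 1 : ℕ) : ℝ) / k) (by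
          rw [le_div_iff₀ (by linarith)]; push_cast; linarith)
        rw [log_div (by positivity) (by positivity), inv_div] at h4
        rw [h3]
        push_cast at *
        have h5 : (((k : ℝ) + 1) / k - k / (k + 1)) / 2 =
            1 / (k + 1) + 1 / (2 * k) - 1 / (2 * (k + 1)) := by field_simp; ring
        linarith
    have hlim : Filter.Tendsto (fun m : ℕ => (harmonic (n + m) : ℝ) - log (n + m : ℕ) -
        1 / (2 * (n + m : ℕ))) Filter.atTop (nhds (γ - 0)) := by
      have e1 := tendsto_harmonic_sub_log.comp (Filter.tendsto_add_atTop_nat n)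
      have e2 : Filter.Tendsto (fun m : ℕ => (1 / 2 : ℝ) * (1 / (m : ℝ))) Filter.atTop (nhds 0) := by
        simpa using tendsto_one_div_atTop_nhds_zero_nat.const_mul (1 / 2 : ℝ)
      refine (e1.sub (e2.comp (Filter.tendsto_add_atTop_nat n))).congr fun m => ?_
      simp only [Function.comp_apply, add_comm m n]
      congr 1
      ring
    have := ge_of_tendsto' hlim hmono
    linarith
  have hH1 : (harmonic n : ℝ) - log n ≤ 1 := by
    have := strictAnti_eulerMascheroniSeq'.antitone hn1
    rw [eulerMascheroniSeq'_one] at this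
    have hn0 : n ≠ 0 := by omega
    simpa [eulerMascheroniSeq', hn0] using this
  rw [abs_le]
  constructor
  · have e1 : (harmonic n : ℝ) - log t ≥ γ - 1 / (n + 1) + (1 - t / (n + 1)) := by linarith
    have e2 : t * (harmonic n - log t) ≥ t * (γ - 1 / (n + 1) + (1 - t / (n + 1))) :=
      mul_le_mul_of_nonneg_left e1 (by linarith)
    have e3 : t * (γ - 1 / (n + 1) + (1 - t / (n + 1))) - γ * n + 1 / 2 =
        (γ * (t - n) * (n + 1) + t * (n - t) + (n + 1) / 2) / (n + 1) := by
      field_simp; ring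
    have e4 : 0 ≤ (γ * (t - n) * (n + 1) + t * (n - t) + (n + 1) / 2) / (n + 1 : ℝ) := by
      refine div_nonneg ?_ (by linarith)
      nlinarith [mul_nonneg (sub_nonneg.mpr hnt) (sub_nonneg.mpr htn.le),
        mul_nonneg (mul_nonneg (sub_nonneg.mpr hnt) (sub_nonneg.mpr hγ.le)) (by linarith : (0:ℝ) ≤ n + 1)]
    linarith
  · have e1 : t * (harmonic n - log t) ≤ t * (harmonic n - log n) - (t - n) := by
      have : t * ((t - n) / t) = t - n := by field_simp
      nlinarith
    have e2 : t * (harmonic n - log n) ≤ n * (harmonic n - log n) + (t - n) := by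
      nlinarith
    have e3 : n * ((harmonic n : ℝ) - log n - γ) ≤ n * (1 / (2 * n)) :=
      mul_le_mul_of_nonneg_left hup (by linarith)
    have e4 : (n : ℝ) * (1 / (2 * n)) = 1 / 2 := by field_simp
    linarith

theorem sum_abs_moebius_le (N : ℕ) : ∑ n ∈ Ioc 0 N, |(μ n : ℝ)| ≤ (3 * N + 3) / 4 := by
  have h1 : ∑ n ∈ Ioc 0 N, |(μ n : ℝ)| ≤ ∑ n ∈ Ioc 0 N, (if 4 ∣ n then (0 : ℝ) else 1) := by
    refine sum_le_sum fun n _ => ?_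
    split_ifs with h
    · have : ¬ Squarefree n := fun hs => by
        have := hs 2 (by simpa using h)
        simp at this
      simp [moebius_eq_zero_of_not_squarefree this]
    · have := abs_moebius_le_one (n := n)
      exact_mod_cast this
  refine h1.trans ?_
  have h2 : ∑ n ∈ Ioc 0 N, (if 4 ∣ n then (0 : ℝ) else 1) =
      ∑ n ∈ Ioc 0 N, (1 - if 4 ∣ n then (1 : ℝ) else 0) :=
    sum_congr rfl fun n _ => by split_ifs <;> simp
  rw [h2, sum_sub_distrib, sum_boole, Nat.Ioc_filter_dvd_card_eq_div]
  simp only [sum_const, Nat.card_Ioc, nsmul_eq_mul, mul_one, tsub_zero]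
  have : N ≤ 4 * (N / 4) + 3 := by omega
  have : (N : ℝ) ≤ 4 * (N / 4 : ℕ) + 3 := by exact_mod_cast this
  linarith

/-- The logarithmically weighted sum `∑_{n ≤ y} μ(n) / n * log (y / n)`. -/
noncomputable def moebiusLogSum (y : ℝ) : ℝ :=
  ∑ n ∈ Ioc 0 ⌊y⌋₊, (μ n : ℝ) / n * log (y / n)

theorem moebiusLogSum_eq {y : ℝ} (hy : 1 ≤ y) :
    ∑ n ∈ Ioc 0 ⌊y⌋₊, (μ n : ℝ) * (y / n * (harmonic ⌊y / n⌋₊ - log (y / n)) -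
      eulerMascheroniConstant * ⌊y / n⌋₊) =
      y - y * moebiusLogSum y - eulerMascheroniConstant := by
  have hN : 1 ≤ ⌊y⌋₊ := Nat.le_floor (by simpa using hy)
  have h1 := sum_moebius_mul_div _ hN
  have h2 := sum_moebius_div_mul_harmonic _ hN
  rw [moebiusLogSum]
  calc _ = y * ∑ n ∈ Ioc 0 ⌊y⌋₊, (μ n : ℝ) / n * (harmonic (⌊y⌋₊ / n) : ℝ) -
        y * ∑ n ∈ Ioc 0 ⌊y⌋₊, (μ n : ℝ) / n * log (y / n) -
        eulerMascheroniConstant * ∑ n ∈ Ioc 0 ⌊y⌋₊, (μ n : ℝ) * (⌊y⌋₊ / n : ℕ) := by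
        rw [mul_sum, mul_sum, mul_sum, ← sum_sub_distrib, ← sum_sub_distrib]
        refine sum_congr rfl fun n _ => ?_
        rw [Nat.floor_div_natCast]
        ring
    _ = _ := by rw [h1, h2]; ring

theorem abs_moebiusLogSum_error_le {y : ℝ} (hy : 1 ≤ y) :
    |y - y * moebiusLogSum y - eulerMascheroniConstant| ≤ (3 * y + 3) / 8 := by
  rw [← moebiusLogSum_eq hy]
  have h1 : ∀ n ∈ Ioc 0 ⌊y⌋₊, |(μ n : ℝ) * (y / n * (harmonic ⌊y / n⌋₊ - log (y / n)) -
      eulerMascheroniConstant * ⌊y / n⌋₊)| ≤ |(μ n : ℝ)| * (1 / 2) := by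
    intro n hn
    obtain ⟨hn0, hn1⟩ := mem_Ioc.mp hn
    rw [abs_mul]
    refine mul_le_mul_of_nonneg_left (abs_mul_harmonic_sub_log_le ?_) (abs_nonneg _)
    rw [le_div_iff₀ (by exact_mod_cast hn0), one_mul]
    exact (Nat.le_floor_iff (by linarith)).mp hn1
  refine (abs_sum_le_sum_abs _ _).trans ((sum_le_sum h1).trans ?_)
  rw [← sum_mul]
  have := sum_abs_moebius_le ⌊y⌋₊
  have := Nat.floor_le (a := y) (by linarith)
  linarith

theorem moebiusLogSum_of_lt_one {y : ℝ} (hy : y < 1) : moebiusLogSum y = 0 := by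
  simp [moebiusLogSum, Nat.floor_eq_zero.mpr hy]

theorem moebiusLogSum_le (y : ℝ) : moebiusLogSum y ≤ 11 / 8 := by
  rcases lt_or_ge y 1 with hy | hy
  · rw [moebiusLogSum_of_lt_one hy]; norm_num
  have h := (abs_le.mp (abs_moebiusLogSum_error_le hy)).1
  have hγ := one_half_lt_eulerMascheroniConstant
  by_contra! hc
  nlinarith

theorem moebiusLogSum_nonneg (y : ℝ) : 0 ≤ moebiusLogSum y := by
  rcases lt_or_ge y 1 with hy | hy
  · rw [moebiusLogSum_of_lt_one hy]
  rcases lt_or_ge y 2 with hy2 | hy2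
  · have : ⌊y⌋₊ = 1 := (Nat.floor_eq_iff (by linarith)).mpr ⟨by simpa using hy, by norm_num; linarith⟩
    simp [moebiusLogSum, this, log_nonneg hy]
  have h := (abs_le.mp (abs_moebiusLogSum_error_le hy)).2
  have hγ := eulerMascheroniConstant_lt_two_thirds
  by_contra! hc
  nlinarith

theorem integral_posPart_mul {η l v : ℝ} (hv : 0 ≤ v) (hvl : v ≤ l) :
    ∫ w in (0 : ℝ)..l, max (w - v) 0 * (exp (-η * w) * (2 * η + η ^ 2 * (l - w))) =
      exp (-η * v) * (l - v) - exp (-η * l) * (l - v) := by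
  have hc : Continuous fun w : ℝ =>
      max (w - v) 0 * (exp (-η * w) * (2 * η + η ^ 2 * (l - w))) := by fun_prop
  rw [← intervalIntegral.integral_add_adjacent_intervals (hc.intervalIntegrable 0 v)
    (hc.intervalIntegrable v l)]
  have h1 : ∫ w in (0 : ℝ)..v, max (w - v) 0 * (exp (-η * w) * (2 * η + η ^ 2 * (l - w))) = 0 := by
    rw [intervalIntegral.integral_congr (g := fun _ => 0)]
    · simp
    · intro w hw
      rw [Set.uIcc_of_le hv] at hw
      simp [max_eq_right (show w - v ≤ 0 by linarith [hw.2])]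
  have h2 : ∫ w in v..l, max (w - v) 0 * (exp (-η * w) * (2 * η + η ^ 2 * (l - w))) =
      ∫ w in v..l, (w - v) * (exp (-η * w) * (2 * η + η ^ 2 * (l - w))) := by
    refine intervalIntegral.integral_congr fun w hw => ?_
    rw [Set.uIcc_of_le hvl] at hw
    simp only [max_eq_left (show 0 ≤ w - v by linarith [hw.1])]
  have h3 : ∀ w ∈ Set.uIcc v l, HasDerivAt (fun w => (w - v) *
      (-exp (-η * w) * (1 + η * (l - w))) - exp (-η * w) * (l - w))
      ((w - v) * (exp (-η * w) * (2 * η + η ^ 2 * (l - w)))) w := by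
    intro w _
    have e1 : HasDerivAt (fun w => exp (-η * w)) (exp (-η * w) * (-η)) w := by
      simpa using ((hasDerivAt_id w).const_mul (-η)).exp
    have e2 : HasDerivAt (fun w => l - w) (-1) w := by
      simpa using (hasDerivAt_id w).const_sub l
    have e3 : HasDerivAt (fun w => w - v) 1 w := (hasDerivAt_id w).sub_const v
    have := (e3.mul (e1.neg.mul ((e2.const_mul η).const_add 1))).sub (e1.mul e2)
    convert! this using 1
    simp
    ring
  rw [h1, h2, intervalIntegral.integral_eq_sub_of_hasDerivAt h3
    (Continuous.intervalIntegrable (by fun_prop) _ _)]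
  ring

theorem integral_convexity_weight (η l : ℝ) :
    ∫ w in (0 : ℝ)..l, exp (-η * w) * (2 * η + η ^ 2 * (l - w)) =
      1 + η * l - exp (-η * l) := by
  have h3 : ∀ w ∈ Set.uIcc 0 l, HasDerivAt (fun w =>
      (-exp (-η * w) * (1 + η * (l - w))))
      (exp (-η * w) * (2 * η + η ^ 2 * (l - w))) w := by
    intro w _
    have e1 : HasDerivAt (fun w => exp (-η * w)) (exp (-η * w) * (-η)) w := by
      simpa using ((hasDerivAt_id w).const_mul (-η)).exp
    have e2 : HasDerivAt (fun w => l - w) (-1) w := by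
      simpa using (hasDerivAt_id w).const_sub l
    have := (e1.neg.mul ((e2.const_mul η).const_add 1))
    convert! this using 1
    simp
    ring
  rw [intervalIntegral.integral_eq_sub_of_hasDerivAt h3
    (Continuous.intervalIntegrable (by fun_prop) _ _)]
  simp
  ring

/-- The sum `∑ μ(n) n ^ (-1 - η) log (y / n)` over `n ≤ y` free of prime factors in `P`. -/
noncomputable def moebiusLogSumCoprime (P : Finset ℕ) (η y : ℝ) : ℝ :=
  ∑ n ∈ Ioc 0 ⌊y⌋₊, if ∀ p ∈ P, ¬ p ∣ n then
    (μ n : ℝ) * (n : ℝ) ^ (-1 - η) * log (y / n) else 0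

theorem moebiusLogSum_exp {l w : ℝ} (hw : w ∈ Set.Icc 0 l) :
    moebiusLogSum (exp w) = ∑ n ∈ Ioc 0 ⌊exp l⌋₊,
      (μ n : ℝ) / n * max (w - log n) 0 := by
  rw [moebiusLogSum]
  have hsub : Ioc 0 ⌊exp w⌋₊ ⊆ Ioc 0 ⌊exp l⌋₊ :=
    Ioc_subset_Ioc_right (Nat.floor_mono (exp_le_exp.mpr hw.2))
  rw [← sum_subset hsub]
  · refine sum_congr rfl fun n hn => ?_
    obtain ⟨hn0, hn1⟩ := mem_Ioc.mp hn
    have hn0' : (0 : ℝ) < n := by exact_mod_cast hn0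
    have h1 : (n : ℝ) ≤ exp w := (Nat.le_floor_iff (exp_pos w).le).mp hn1
    have h2 : log n ≤ w := (log_le_iff_le_exp hn0').mpr h1
    rw [log_div (exp_pos w).ne' hn0'.ne', log_exp, max_eq_left (by linarith)]
  · intro n hn hn'
    obtain ⟨hn0, hn1⟩ := mem_Ioc.mp hn
    have hn0' : (0 : ℝ) < n := by exact_mod_cast hn0
    have h1 : exp w < n := by
      have : ⌊exp w⌋₊ < n := by
        by_contra! h
        exact hn' (mem_Ioc.mpr ⟨hn0, h⟩)
      exact (Nat.floor_lt (exp_pos w).le).mp this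
    have h2 : w < log n := (lt_log_iff_exp_lt hn0').mpr h1
    rw [max_eq_right (by linarith), mul_zero]

theorem moebiusLogSumCoprime_empty_eq {η l : ℝ} (hl : 0 ≤ l) : moebiusLogSumCoprime ∅ η (exp l) =
      (∫ w in (0 : ℝ)..l, moebiusLogSum (exp w) * (exp (-η * w) * (2 * η + η ^ 2 * (l - w)))) +
      exp (-η * l) * moebiusLogSum (exp l) := by
  have h1 : ∫ w in (0 : ℝ)..l, moebiusLogSum (exp w) * (exp (-η * w) * (2 * η + η ^ 2 * (l - w))) =
      ∫ w in (0 : ℝ)..l, ∑ n ∈ Ioc 0 ⌊exp l⌋₊, (μ n : ℝ) / n * (max (w - log n) 0 *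
        (exp (-η * w) * (2 * η + η ^ 2 * (l - w)))) := by
    refine intervalIntegral.integral_congr fun w hw => ?_
    rw [Set.uIcc_of_le hl] at hw
    rw [moebiusLogSum_exp hw, sum_mul]
    exact sum_congr rfl fun n _ => by ring
  rw [h1, intervalIntegral.integral_finsetSum
    (fun n _ => Continuous.intervalIntegrable (by fun_prop) _ _), moebiusLogSum, mul_sum,
    ← sum_add_distrib, moebiusLogSumCoprime]
  refine sum_congr rfl fun n hn => ?_
  obtain ⟨hn0, hn1⟩ := mem_Ioc.mp hn
  have hn0' : (0 : ℝ) < n := by exact_mod_cast hn0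
  have e1 : (n : ℝ) ≤ exp l := (Nat.le_floor_iff (exp_pos l).le).mp hn1
  have e2 : log n ≤ l := (log_le_iff_le_exp hn0').mpr e1
  have e3 : 0 ≤ log n := log_natCast_nonneg n
  have e4 : (n : ℝ) ^ (-1 - η) = 1 / n * exp (-η * log n) := by
    rw [sub_eq_add_neg, rpow_add hn0', rpow_neg_one, rpow_def_of_pos hn0',
      mul_comm (log n), one_div]
  rw [intervalIntegral.integral_const_mul, integral_posPart_mul e3 e2,
    log_div (exp_pos l).ne' hn0'.ne', log_exp, e4]
  simp
  ring

theorem moebiusLogSumCoprime_of_lt_one (P : Finset ℕ) (η : ℝ) {y : ℝ} (hy : y < 1) :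
    moebiusLogSumCoprime P η y = 0 := by
  simp [moebiusLogSumCoprime, Nat.floor_eq_zero.mpr hy]

theorem moebiusLogSumCoprime_empty_bounds {η y : ℝ} (hη : 0 ≤ η) (hy : 1 ≤ y) :
    0 ≤ moebiusLogSumCoprime ∅ η y ∧
      moebiusLogSumCoprime ∅ η y ≤ 11 / 8 * (1 + η * log y) := by
  obtain ⟨l, hl, rfl⟩ : ∃ l, 0 ≤ l ∧ exp l = y :=
    ⟨log y, log_nonneg hy, exp_log (by linarith)⟩
  rw [moebiusLogSumCoprime_empty_eq hl, log_exp]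
  have hw : ∀ w ∈ Set.Icc 0 l, 0 ≤ exp (-η * w) * (2 * η + η ^ 2 * (l - w)) := by
    intro w hw
    have : 0 ≤ l - w := by linarith [hw.2]
    positivity
  have hI : ContinuousOn (fun w => moebiusLogSum (exp w) *
      (exp (-η * w) * (2 * η + η ^ 2 * (l - w)))) (Set.Icc 0 l) := by
    have : ContinuousOn (fun w => (∑ n ∈ Ioc 0 ⌊exp l⌋₊, (μ n : ℝ) / n * max (w - log n) 0) *
      (exp (-η * w) * (2 * η + η ^ 2 * (l - w)))) (Set.Icc 0 l) := by fun_prop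
    exact this.congr fun w hw => by simp only [moebiusLogSum_exp hw]
  constructor
  · refine add_nonneg (intervalIntegral.integral_nonneg hl fun w h =>
      mul_nonneg (moebiusLogSum_nonneg _) (hw w h)) ?_
    exact mul_nonneg (exp_pos _).le (moebiusLogSum_nonneg _)
  · have h1 : ∫ w in (0 : ℝ)..l, moebiusLogSum (exp w) *
        (exp (-η * w) * (2 * η + η ^ 2 * (l - w))) ≤
        ∫ w in (0 : ℝ)..l, 11 / 8 * (exp (-η * w) * (2 * η + η ^ 2 * (l - w))) := by
      refine intervalIntegral.integral_mono_on hl ?_ (Continuous.intervalIntegrable (by fun_prop) _ _)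
        fun w h => mul_le_mul_of_nonneg_right (moebiusLogSum_le _) (hw w h)
      exact ContinuousOn.intervalIntegrable (by rwa [Set.uIcc_of_le hl])
    rw [intervalIntegral.integral_const_mul, integral_convexity_weight] at h1
    have h2 := mul_le_mul_of_nonneg_left (moebiusLogSum_le (exp l)) (exp_pos (-η * l)).le
    linarith

theorem sum_Ioc_dvd {R : Type*} [AddCommMonoid R] (N p : ℕ) (hp : 0 < p) (f : ℕ → R) :
    (∑ n ∈ Ioc 0 N, if p ∣ n then f n else 0) = ∑ m ∈ Ioc 0 (N / p), f (p * m) := by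
  rw [← sum_filter]
  symm
  refine sum_nbij' (fun m => p * m) (fun n => n / p) ?_ ?_ ?_ ?_ ?_
  · intro m hm
    obtain ⟨h1, h2⟩ := mem_Ioc.mp hm
    rw [mem_filter, mem_Ioc]
    refine ⟨⟨Nat.mul_pos hp h1, ?_⟩, dvd_mul_right _ _⟩
    rw [mul_comm]; exact (Nat.le_div_iff_mul_le hp).mp h2
  · intro n hn
    obtain ⟨h1, k, rfl⟩ := mem_filter.mp hn
    rw [mem_Ioc] at h1 ⊢
    rw [Nat.mul_div_cancel_left _ hp]
    exact ⟨Nat.pos_of_mul_pos_left h1.1, (Nat.le_div_iff_mul_le hp).mpr (by rw [mul_comm]; exact h1.2)⟩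
  · intro m _; exact Nat.mul_div_cancel_left _ hp
  · intro n hn
    exact Nat.mul_div_cancel' (mem_filter.mp hn).2
  · intro m _; rfl

theorem moebiusLogSumCoprime_insert {P : Finset ℕ} {p : ℕ} (hp : p.Prime) (hP : ∀ q ∈ P, q.Prime)
    (hpP : p ∉ P) (η y : ℝ) :
    moebiusLogSumCoprime (insert p P) η y = moebiusLogSumCoprime P η y +
      (p : ℝ) ^ (-1 - η) * moebiusLogSumCoprime (insert p P) η (y / p) := by
  set g : ℕ → ℝ := fun n => if ∀ q ∈ P, ¬ q ∣ n then
    (μ n : ℝ) * (n : ℝ) ^ (-1 - η) * log (y / n) else 0 with hg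
  have h1 : moebiusLogSumCoprime P η y = moebiusLogSumCoprime (insert p P) η y +
      ∑ n ∈ Ioc 0 ⌊y⌋₊, if p ∣ n then g n else 0 := by
    rw [moebiusLogSumCoprime, moebiusLogSumCoprime, ← sum_add_distrib]
    refine sum_congr rfl fun n _ => ?_
    by_cases h : p ∣ n <;> simp [h, hg]
  rw [sum_Ioc_dvd _ _ hp.pos] at h1
  have h2 : ∑ m ∈ Ioc 0 (⌊y⌋₊ / p), g (p * m) =
      -((p : ℝ) ^ (-1 - η) * moebiusLogSumCoprime (insert p P) η (y / p)) := by
    rw [moebiusLogSumCoprime, Nat.floor_div_natCast, mul_sum, ← sum_neg_distrib]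
    refine sum_congr rfl fun m _ => ?_
    have e1 : (∀ q ∈ P, ¬ q ∣ p * m) ↔ ∀ q ∈ P, ¬ q ∣ m := by
      refine forall₂_congr fun q hq => not_congr ⟨fun h => ?_, fun h => h.mul_left _⟩
      rcases (hP q hq).dvd_mul.mp h with h | h
      · exact absurd ((Nat.prime_dvd_prime_iff_eq (hP q hq) hp).mp h ▸ hq) hpP
      · exact h
    simp only [hg, e1]
    by_cases hpm : p ∣ m
    · have : ¬ Squarefree (p * m) := fun hs => by
        have := hs p (mul_dvd_mul_left p hpm)
        exact hp.one_lt.ne' (Nat.isUnit_iff.mp this)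
      simp [moebius_eq_zero_of_not_squarefree this, hpm]
    · have hc : Nat.Coprime p m := (Nat.Prime.coprime_iff_not_dvd hp).mpr hpm
      have hμ : μ (p * m) = - μ m := by
        rw [isMultiplicative_moebius.map_mul_of_coprime hc, moebius_apply_prime hp]; ring
      by_cases hh : ∀ q ∈ P, ¬ q ∣ m
      · rw [if_pos hh, if_pos (by simpa [hpm] using hh), hμ]
        push_cast
        rw [mul_rpow (by positivity) (by positivity), div_div]
        ring
      · rw [if_neg hh, if_neg (by simpa [hpm] using hh)]
        simp
  linarith

theorem moebiusLogSumCoprime_bounds {P : Finset ℕ} (hP : ∀ q ∈ P, q.Prime) {η : ℝ} (hη : 0 ≤ η)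
    {y : ℝ} (hy : 1 ≤ y) :
    0 ≤ moebiusLogSumCoprime P η y ∧ moebiusLogSumCoprime P η y ≤
      11 / 8 * (1 + η * log y) * ∏ p ∈ P, (1 - (p : ℝ)⁻¹)⁻¹ := by
  induction P using Finset.induction_on generalizing y with
  | empty => simpa using moebiusLogSumCoprime_empty_bounds hη hy
  | insert p P hpP ih =>
    have hp : p.Prime := hP p (mem_insert_self _ _)
    have hP' : ∀ q ∈ P, q.Prime := fun q hq => hP q (mem_insert_of_mem hq)
    have hp1 : (1 : ℝ) < p := by exact_mod_cast hp.one_lt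
    have hpi : (p : ℝ)⁻¹ < 1 := inv_lt_one_of_one_lt₀ hp1
    have hrp : (p : ℝ) ^ (-1 - η) ≤ (p : ℝ)⁻¹ := by
      rw [← rpow_neg_one]
      exact rpow_le_rpow_of_exponent_le hp1.le (by linarith)
    have hrp0 : 0 ≤ (p : ℝ) ^ (-1 - η) := by positivity
    have hprod : 0 ≤ ∏ p ∈ P, (1 - (p : ℝ)⁻¹)⁻¹ := by
      refine prod_nonneg fun q hq => inv_nonneg.mpr ?_
      have : (1 : ℝ) ≤ q := by exact_mod_cast (hP' q hq).one_lt.le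
      linarith [inv_le_one_of_one_le₀ this]
    suffices H : ∀ N : ℕ, ∀ y : ℝ, 1 ≤ y → y ≤ N → 0 ≤ moebiusLogSumCoprime (insert p P) η y ∧
        moebiusLogSumCoprime (insert p P) η y ≤
          11 / 8 * (1 + η * log y) * ∏ p ∈ insert p P, (1 - (p : ℝ)⁻¹)⁻¹ by
      obtain ⟨N, hN⟩ := exists_nat_ge y
      exact H N y hy hN
    intro N
    induction N using Nat.strong_induction_on with
    | _ N ihN =>
      intro y hy hyN
      rw [moebiusLogSumCoprime_insert hp hP' hpP, prod_insert hpP]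
      obtain ⟨h1, h2⟩ := ih hP' hy
      have hly : 0 ≤ log y := log_nonneg hy
      have h3 : 0 ≤ moebiusLogSumCoprime (insert p P) η (y / p) ∧
          moebiusLogSumCoprime (insert p P) η (y / p) ≤ 11 / 8 * (1 + η * log y) *
            ((1 - (p : ℝ)⁻¹)⁻¹ * ∏ p ∈ P, (1 - (p : ℝ)⁻¹)⁻¹) := by
        have hpos : 0 ≤ (1 - (p : ℝ)⁻¹)⁻¹ := inv_nonneg.mpr (by linarith)
        rcases lt_or_ge (y / p) 1 with hyp | hyp
        · rw [moebiusLogSumCoprime_of_lt_one _ _ hyp]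
          exact ⟨le_rfl, by positivity⟩
        · have hlt : y / p ≤ (N - 1 : ℕ) := by
            have h2p : (2 : ℝ) ≤ p := by exact_mod_cast hp.two_le
            have hy2 : 2 ≤ y := by
              rw [le_div_iff₀ (by linarith)] at hyp; linarith
            have hN1 : 1 ≤ N := by
              have : (1 : ℝ) ≤ N := hy.trans hyN
              exact_mod_cast this
            push_cast [hN1]
            have : y / p ≤ y / 2 := by gcongr
            linarith
          have hN0 : N - 1 < N := by
            have : (1 : ℝ) ≤ N := hy.trans hyN
            have : 1 ≤ N := by exact_mod_cast this
            omega
          obtain ⟨e1, e2⟩ := ihN (N - 1) hN0 (y / p) hyp hlt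
          refine ⟨e1, e2.trans ?_⟩
          rw [prod_insert hpP]
          refine mul_le_mul_of_nonneg_right ?_ (mul_nonneg hpos hprod)
          have : log (y / p) ≤ log y :=
            log_le_log (by linarith) (div_le_self (by linarith) hp1.le)
          gcongr
      refine ⟨add_nonneg h1 (mul_nonneg hrp0 h3.1), ?_⟩
      set X := 11 / 8 * (1 + η * log y) with hX
      set Q := ∏ p ∈ P, (1 - (p : ℝ)⁻¹)⁻¹
      have hX0 : 0 ≤ X := by positivity
      have e : X * Q + (p : ℝ)⁻¹ * (X * ((1 - (p : ℝ)⁻¹)⁻¹ * Q)) = X * ((1 - (p : ℝ)⁻¹)⁻¹ * Q) := by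
        have : (1 - (p : ℝ)⁻¹) * (1 - (p : ℝ)⁻¹)⁻¹ = 1 := mul_inv_cancel₀ (by linarith)
        linear_combination -(X * Q) * this
      rw [← e]
      exact add_le_add h2 (mul_le_mul hrp h3.2 h3.1 (by positivity))

theorem sum_divisors_prod_primeFactors (g : ℕ → ℝ) {n : ℕ} (hn : Squarefree n) :
    ∑ d ∈ n.divisors, ∏ p ∈ d.primeFactors, g p = ∏ p ∈ n.primeFactors, (1 + g p) := by
  have h := (IsMultiplicative.prodPrimeFactors g).prodPrimeFactors_one_add_of_squarefree hn
  have h1 : ∀ p ∈ n.primeFactors, (1 + g p) = 1 + prodPrimeFactors g p := by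
    intro p hp
    have := Nat.prime_of_mem_primeFactors hp
    rw [prodPrimeFactors_apply this.ne_zero, this.primeFactors, prod_singleton]
  rw [prod_congr rfl h1, h]
  refine sum_congr rfl fun d hd => ?_
  rw [prodPrimeFactors_apply (Nat.pos_of_mem_divisors hd).ne']

theorem prod_primeFactors_mul_of_coprime (g : ℕ → ℝ) {m n : ℕ} (h : Nat.Coprime m n) :
    ∏ p ∈ (m * n).primeFactors, g p = (∏ p ∈ m.primeFactors, g p) * ∏ p ∈ n.primeFactors, g p := by
  rw [h.primeFactors_mul, prod_union h.disjoint_primeFactors]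

/-- The multiplicative function `∏_{p ∣ n} (p ^ σ - 1)`. -/
noncomputable def jordan (σ : ℝ) (n : ℕ) : ℝ := ∏ p ∈ n.primeFactors, ((p : ℝ) ^ σ - 1)

theorem jordan_nonneg {σ : ℝ} (hσ : 0 ≤ σ) (n : ℕ) : 0 ≤ jordan σ n := by
  refine prod_nonneg fun p hp => ?_
  have : (1 : ℝ) ≤ p := by exact_mod_cast (Nat.prime_of_mem_primeFactors hp).one_lt.le
  linarith [one_le_rpow this hσ]

theorem jordan_one_pos (n : ℕ) : 0 < jordan 1 n := by
  refine prod_pos fun p hp => ?_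
  have : (1 : ℝ) < p := by exact_mod_cast (Nat.prime_of_mem_primeFactors hp).one_lt
  rw [rpow_one]; linarith

theorem prod_primeFactors_rpow {n : ℕ} (hn : Squarefree n) (σ : ℝ) :
    ∏ p ∈ n.primeFactors, (p : ℝ) ^ σ = (n : ℝ) ^ σ := by
  rw [finsetProd_rpow _ _ (fun p _ => by positivity), ← Nat.cast_prod,
    Nat.prod_primeFactors_of_squarefree hn]

theorem sum_divisors_jordan {n : ℕ} (hn : Squarefree n) (σ : ℝ) :
    ∑ d ∈ n.divisors, jordan σ d = (n : ℝ) ^ σ := by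
  simp only [jordan]
  rw [sum_divisors_prod_primeFactors _ hn, ← prod_primeFactors_rpow hn]
  exact prod_congr rfl fun p _ => by ring

theorem lcm_rpow_neg {d e : ℕ} (hd : 0 < d) (he : 0 < e) (σ : ℝ) :
    (Nat.lcm d e : ℝ) ^ (-σ) = (d : ℝ) ^ (-σ) * (e : ℝ) ^ (-σ) * (Nat.gcd d e : ℝ) ^ σ := by
  have h : (Nat.gcd d e : ℝ) * Nat.lcm d e = d * e := by exact_mod_cast Nat.gcd_mul_lcm d e
  have hg : (0 : ℝ) < Nat.gcd d e := by exact_mod_cast Nat.gcd_pos_of_pos_left e hd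
  rw [← mul_rpow (by positivity) (by positivity), ← h,
    mul_rpow hg.le (by positivity), rpow_neg hg.le]
  have : (Nat.gcd d e : ℝ) ^ σ ≠ 0 := (rpow_pos_of_pos hg σ).ne'
  field_simp

/-- Diagonalisation of the quadratic form with matrix `lcm(d, e) ^ (-σ)`. -/
theorem sum_lcm_eq_sum_sq (N : ℕ) (x : ℕ → ℝ) (hx : ∀ n, ¬ Squarefree n → x n = 0) (σ : ℝ) :
    ∑ d ∈ Ioc 0 N, ∑ e ∈ Ioc 0 N, x d * x e * (Nat.lcm d e : ℝ) ^ (-σ) =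
      ∑ r ∈ Ioc 0 N, jordan σ r * (∑ d ∈ Ioc 0 N, if r ∣ d then x d * (d : ℝ) ^ (-σ) else 0) ^ 2 := by
  have h1 : ∀ d ∈ Ioc 0 N, ∀ e ∈ Ioc 0 N, x d * x e * (Nat.lcm d e : ℝ) ^ (-σ) =
      ∑ r ∈ Ioc 0 N, jordan σ r * ((if r ∣ d then x d * (d : ℝ) ^ (-σ) else 0) *
        (if r ∣ e then x e * (e : ℝ) ^ (-σ) else 0)) := by
    intro d hd e he
    by_cases hsd : Squarefree d
    swap
    · simp [hx d hsd]
    obtain ⟨hd0, hd1⟩ := mem_Ioc.mp hd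
    obtain ⟨he0, he1⟩ := mem_Ioc.mp he
    have hg : Squarefree (Nat.gcd d e) := hsd.squarefree_of_dvd (Nat.gcd_dvd_left d e)
    rw [lcm_rpow_neg hd0 he0, ← sum_divisors_jordan hg]
    have h2 : ∑ r ∈ (Nat.gcd d e).divisors, jordan σ r =
        ∑ r ∈ Ioc 0 N, if r ∣ d ∧ r ∣ e then jordan σ r else 0 := by
      rw [← sum_filter]
      refine sum_congr ?_ fun _ _ => rfl
      ext r
      simp only [Nat.mem_divisors, mem_filter, mem_Ioc, Nat.dvd_gcd_iff]
      constructor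
      · rintro ⟨⟨h1, h2⟩, h3⟩
        exact ⟨⟨Nat.pos_of_dvd_of_pos h1 hd0, (Nat.le_of_dvd hd0 h1).trans hd1⟩, h1, h2⟩
      · rintro ⟨_, h⟩
        exact ⟨h, (Nat.gcd_pos_of_pos_left e hd0).ne'⟩
    rw [h2]
    simp only [mul_sum]
    refine sum_congr rfl fun r _ => ?_
    by_cases h3 : r ∣ d <;> by_cases h4 : r ∣ e <;> simp [h3, h4]
    ring
  have h3 := sum_congr rfl fun d hd => sum_congr rfl fun e he => h1 d hd e he
  rw [h3]
  conv_lhs =>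
    enter [2, d]
    rw [sum_comm]
  rw [sum_comm]
  refine sum_congr rfl fun r _ => ?_
  rw [sq, sum_mul_sum, mul_sum]
  refine sum_congr rfl fun d _ => ?_
  rw [mul_sum]

/-- The sum of `μ(n) ^ 2 / φ(n)` over `n ≤ N`. -/
noncomputable def selbergSum (N : ℕ) : ℝ :=
  ∑ n ∈ Ioc 0 N, if Squarefree n then (jordan 1 n)⁻¹ else 0

theorem div_jordan_one {n : ℕ} (hn : Squarefree n) :
    (n : ℝ) / jordan 1 n = ∑ d ∈ n.divisors, (jordan 1 d)⁻¹ := by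
  simp only [jordan, ← prod_inv_distrib]
  rw [sum_divisors_prod_primeFactors _ hn]
  have := prod_primeFactors_rpow hn 1
  rw [rpow_one] at this
  rw [← this, ← prod_div_distrib]
  refine prod_congr rfl fun p hp => ?_
  have : (1 : ℝ) < p := by exact_mod_cast (Nat.prime_of_mem_primeFactors hp).one_lt
  have : (p : ℝ) - 1 ≠ 0 := by linarith
  simp only [rpow_one]
  field_simp
  ring

theorem prod_one_add_inv_le (N : ℕ) :
    ∏ p ∈ (Ioc 0 N).filter Nat.Prime, (1 + ((p : ℝ) * (p - 1))⁻¹) ≤ 21 / 10 := by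
  have hf : ∀ p : ℕ, p.Prime → 1 ≤ 1 + ((p : ℝ) * (p - 1))⁻¹ := fun p hp => by
    have : (1 : ℝ) < p := by exact_mod_cast hp.one_lt
    have : 0 ≤ ((p : ℝ) * (p - 1))⁻¹ := inv_nonneg.mpr (mul_nonneg (by linarith) (by linarith))
    linarith
  have hf0 : ∀ N : ℕ, 0 ≤ ∏ p ∈ (Ioc 0 N).filter Nat.Prime, (1 + ((p : ℝ) * (p - 1))⁻¹) := fun N =>
    prod_nonneg fun p hp => by linarith [hf p (mem_filter.mp hp).2]
  have h10 : ∏ p ∈ (Ioc 0 10).filter Nat.Prime, (1 + ((p : ℝ) * (p - 1))⁻¹) = 301 / 160 := by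
    rw [show (Ioc 0 10).filter Nat.Prime = {2, 3, 5, 7} by decide]
    norm_num
  have key : ∀ k : ℕ, ∏ p ∈ (Ioc 0 (10 + k)).filter Nat.Prime, (1 + ((p : ℝ) * (p - 1))⁻¹) ≤
      301 / 160 * (10 / 9) * (((k : ℝ) + 9) / (k + 10)) := by
    intro k
    induction k with
    | zero => rw [add_zero, h10]; norm_num
    | succ k ih =>
      rw [← add_assoc, ← insert_Ioc_right_eq_Ioc_add_one (Nat.zero_le _), filter_insert]
      have hmono : 301 / 160 * (10 / 9) * (((k : ℝ) + 9) / (k + 10)) *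
          (1 + (((k : ℝ) + 11) * (k + 10))⁻¹) ≤
          301 / 160 * (10 / 9) * (((k + 1 : ℕ) + 9) / ((k + 1 : ℕ) + 10)) := by
        rw [mul_assoc]
        refine mul_le_mul_of_nonneg_left ?_ (by norm_num)
        push_cast
        have e : ((k : ℝ) + 9) / (k + 10) * (1 + (((k : ℝ) + 11) * (k + 10))⁻¹) =
          ((k + 9) * ((k + 11) * (k + 10) + 1)) / ((k + 10) * ((k + 11) * (k + 10))) := by
          field_simp
        rw [e, div_le_div_iff₀ (by positivity) (by positivity)]
        have hk : (0 : ℝ) ≤ k := Nat.cast_nonneg k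
        nlinarith [mul_nonneg hk hk, mul_nonneg (mul_nonneg hk hk) hk,
          mul_nonneg (mul_nonneg (mul_nonneg hk hk) hk) hk]
      have hc : 0 ≤ (((k : ℝ) + 11) * (k + 10))⁻¹ := by positivity
      have hih := mul_le_mul_of_nonneg_right ih (show 0 ≤ 1 + (((k : ℝ) + 11) * (k + 10))⁻¹ by linarith)
      split_ifs with hp
      · rw [prod_insert (by simp)]
        refine le_trans (le_of_eq ?_) (hih.trans hmono)
        rw [mul_comm]
        push_cast
        congr 3
        ring
      · refine le_trans ?_ (hih.trans hmono)
        exact le_mul_of_one_le_right (hf0 _) (by linarith)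
  have hmon : ∏ p ∈ (Ioc 0 N).filter Nat.Prime, (1 + ((p : ℝ) * (p - 1))⁻¹) ≤
      ∏ p ∈ (Ioc 0 (10 + N)).filter Nat.Prime, (1 + ((p : ℝ) * (p - 1))⁻¹) := by
    refine prod_le_prod_of_subset_of_one_le (filter_subset_filter _ (Ioc_subset_Ioc_right (by omega)))
      (fun p hp => by linarith [hf p (mem_filter.mp hp).2]) fun p hp _ => hf p (mem_filter.mp hp).2
  refine hmon.trans ((key N).trans ?_)
  have : ((N : ℝ) + 9) / (N + 10) ≤ 1 := by
    rw [div_le_one (by positivity)]; linarith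
  nlinarith

theorem sum_squarefree_le_prod {g : ℕ → ℝ} (hg : ∀ p : ℕ, p.Prime → 0 ≤ g p) (N : ℕ) :
    (∑ n ∈ Ioc 0 N, if Squarefree n then ∏ p ∈ n.primeFactors, g p else 0) ≤
      ∏ p ∈ (Ioc 0 N).filter Nat.Prime, (1 + g p) := by
  rw [prod_one_add, ← sum_filter]
  have hinj : Set.InjOn Nat.primeFactors ((Ioc 0 N).filter Squarefree : Set ℕ) := by
    intro a ha b hb hab
    simp only [coe_filter, Set.mem_ofPred_eq] at ha hb
    rw [← Nat.prod_primeFactors_of_squarefree ha.2, ← Nat.prod_primeFactors_of_squarefree hb.2, hab]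
  rw [← sum_image (f := fun s => ∏ p ∈ s, g p) hinj]
  refine sum_le_sum_of_subset_of_nonneg ?_ ?_
  · intro s hs
    obtain ⟨n, hn, rfl⟩ := mem_image.mp hs
    rw [mem_filter, mem_Ioc] at hn
    rw [mem_powerset]
    intro p hp
    have := Nat.le_of_mem_primeFactors hp
    have hpp := Nat.prime_of_mem_primeFactors hp
    simp only [mem_filter, mem_Ioc]
    exact ⟨⟨hpp.pos, this.trans hn.1.2⟩, hpp⟩
  · intro s hs _
    exact prod_nonneg fun p hp => hg p (mem_filter.mp (mem_powerset.mp hs hp)).2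

theorem selbergSum_le (N : ℕ) : selbergSum N ≤ 21 / 10 * (log N + 1) := by
  have hJ : ∀ n, 0 < (jordan 1 n)⁻¹ := fun n => inv_pos.mpr (jordan_one_pos n)
  have h1 : selbergSum N ≤ ∑ n ∈ Ioc 0 N, ∑ d ∈ Ioc 0 N,
      if d ∣ n then (if Squarefree d then (jordan 1 d)⁻¹ else 0) * (n : ℝ)⁻¹ else 0 := by
    refine sum_le_sum fun n hn => ?_
    obtain ⟨hn0, hn1⟩ := mem_Ioc.mp hn
    have hnn : (n : ℝ) ≠ 0 := by positivity
    split_ifs with hs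
    · have : (jordan 1 n)⁻¹ = ∑ d ∈ n.divisors, (jordan 1 d)⁻¹ * (n : ℝ)⁻¹ := by
        rw [← sum_mul, ← div_jordan_one hs]
        field_simp
      rw [this, ← sum_filter]
      refine le_of_eq_of_le (sum_congr rfl fun d hd => ?_) (sum_le_sum_of_subset_of_nonneg
        (f := fun d => (if Squarefree d then (jordan 1 d)⁻¹ else 0) * (n : ℝ)⁻¹) ?_ ?_)
      · rw [if_pos (hs.squarefree_of_dvd (Nat.dvd_of_mem_divisors hd))]
      · intro d hd
        have := Nat.dvd_of_mem_divisors hd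
        rw [mem_filter, mem_Ioc]
        exact ⟨⟨Nat.pos_of_dvd_of_pos this hn0, (Nat.le_of_dvd hn0 this).trans hn1⟩, this⟩
      · intro d _ _
        split_ifs
        · exact mul_nonneg (hJ d).le (by positivity)
        · simp
    · refine sum_nonneg fun d _ => ?_
      split_ifs
      · exact mul_nonneg (hJ d).le (by positivity)
      · simp
      · simp
  refine h1.trans ?_
  rw [sum_comm]
  have h2 : ∀ d ∈ Ioc 0 N, (∑ n ∈ Ioc 0 N,
      if d ∣ n then (if Squarefree d then (jordan 1 d)⁻¹ else 0) * (n : ℝ)⁻¹ else 0) ≤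
      (if Squarefree d then ∏ p ∈ d.primeFactors, ((p : ℝ) * (p - 1))⁻¹ else 0) *
        (log N + 1) := by
    intro d hd
    obtain ⟨hd0, hd1⟩ := mem_Ioc.mp hd
    have hdd : (0 : ℝ) < d := by exact_mod_cast hd0
    split_ifs with hs
    · rw [sum_Ioc_dvd N d hd0]
      have : ∏ p ∈ d.primeFactors, ((p : ℝ) * (p - 1))⁻¹ = (jordan 1 d)⁻¹ * (d : ℝ)⁻¹ := by
        rw [prod_inv_distrib, prod_mul_distrib, mul_inv, mul_comm, jordan]
        have h := prod_primeFactors_rpow hs 1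
        simp only [rpow_one] at h ⊢
        rw [h]
      rw [this]
      push_cast
      simp_rw [mul_inv, ← mul_assoc]
      rw [← mul_sum]
      refine mul_le_mul_of_nonneg_left ?_ (mul_nonneg (hJ d).le (by positivity))
      have hh := harmonic_le_one_add_log (N / d)
      rw [harmonic_eq_sum_Icc] at hh
      push_cast at hh
      have e : Ioc 0 (N / d) = Icc 1 (N / d) := by ext; simp; omega
      rw [e]
      have : log ((N / d : ℕ) : ℝ) ≤ log N :=
        log_le_log (by exact_mod_cast Nat.div_pos hd1 hd0) (by exact_mod_cast Nat.div_le_self N d)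
      linarith
    · simp
  have hlog : 0 ≤ log N := log_natCast_nonneg N
  calc _ ≤ _ := sum_le_sum h2
    _ = (∑ d ∈ Ioc 0 N, if Squarefree d then ∏ p ∈ d.primeFactors, ((p : ℝ) * (p - 1))⁻¹ else 0) *
        (log N + 1) := by rw [sum_mul]
    _ ≤ _ := by
      refine mul_le_mul_of_nonneg_right ((sum_squarefree_le_prod ?_ N).trans (prod_one_add_inv_le N))
        (by linarith)
      intro p hp
      have : (1 : ℝ) < p := by exact_mod_cast hp.one_lt
      exact inv_nonneg.mpr (mul_nonneg (by linarith) (by linarith))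

/-- The Barban–Vehov weights. -/
noncomputable def barbanVehov (D₁ D₂ : ℝ) (d : ℕ) : ℝ :=
  μ d * (max (log (D₂ / d)) 0 - max (log (D₁ / d)) 0) / log (D₂ / D₁)

theorem barbanVehov_of_not_squarefree (D₁ D₂ : ℝ) {d : ℕ} (hd : ¬ Squarefree d) :
    barbanVehov D₁ D₂ d = 0 := by
  simp [barbanVehov, moebius_eq_zero_of_not_squarefree hd]

theorem barbanVehov_of_le {D₁ D₂ : ℝ} (h1 : 1 ≤ D₁) (h12 : D₁ < D₂) {d : ℕ} (hd0 : 0 < d)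
    (hd : (d : ℝ) ≤ D₁) : barbanVehov D₁ D₂ d = μ d := by
  have hdd : (0 : ℝ) < d := by exact_mod_cast hd0
  have hl : 0 < log (D₂ / D₁) := log_pos (by rw [lt_div_iff₀ (by linarith)]; linarith)
  have e1 : 0 ≤ log (D₁ / d) := log_nonneg (by rw [le_div_iff₀ hdd]; linarith)
  have e2 : 0 ≤ log (D₂ / d) := log_nonneg (by rw [le_div_iff₀ hdd]; linarith)
  rw [barbanVehov, max_eq_left e1, max_eq_left e2, div_eq_iff hl.ne',
    log_div (by linarith) hdd.ne', log_div (by linarith) hdd.ne',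
    log_div (by linarith) (by linarith)]
  ring

theorem abs_barbanVehov_le {D₁ D₂ : ℝ} (h1 : 1 ≤ D₁) (h12 : D₁ < D₂) (d : ℕ) :
    |barbanVehov D₁ D₂ d| ≤ 1 := by
  have hl : 0 < log (D₂ / D₁) := log_pos (by rw [lt_div_iff₀ (by linarith)]; linarith)
  rcases Nat.eq_zero_or_pos d with rfl | hd0
  · simp [barbanVehov]
  have hdd : (0 : ℝ) < d := by exact_mod_cast hd0
  rw [barbanVehov, abs_div, abs_mul, abs_of_pos hl, div_le_one hl]
  have hm : |((μ d : ℤ) : ℝ)| ≤ 1 := by exact_mod_cast abs_moebius_le_one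
  have hab : |max (log (D₂ / d)) 0 - max (log (D₁ / d)) 0| ≤ log (D₂ / D₁) := by
    refine (abs_max_sub_max_le_abs _ _ _).trans ?_
    rw [log_div (by linarith) hdd.ne', log_div (by linarith) hdd.ne',
      log_div (by linarith) (by linarith)] at *
    rw [abs_le]
    constructor <;> linarith
  calc _ ≤ 1 * log (D₂ / D₁) := mul_le_mul hm hab (abs_nonneg _) zero_le_one
    _ = _ := one_mul _

theorem barbanVehov_one {D₁ D₂ : ℝ} (h1 : 1 ≤ D₁) (h12 : D₁ < D₂) : barbanVehov D₁ D₂ 1 = 1 := by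
  rw [barbanVehov_of_le h1 h12 one_pos (by simpa using h1)]
  simp

theorem sum_divisors_barbanVehov {D₁ D₂ : ℝ} (h1 : 1 ≤ D₁) (h12 : D₁ < D₂) {n : ℕ} (hn : 1 < n)
    (hnD : (n : ℝ) ≤ D₁) : ∑ d ∈ n.divisors, barbanVehov D₁ D₂ d = 0 := by
  have : ∀ d ∈ n.divisors, barbanVehov D₁ D₂ d = ((μ d : ℤ) : ℝ) := fun d hd =>
    barbanVehov_of_le h1 h12 (Nat.pos_of_mem_divisors hd)
      (le_trans (by exact_mod_cast Nat.divisor_le hd) hnD)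
  rw [sum_congr rfl this, ← Int.cast_sum]
  have h := congrArg (fun f => f n) moebius_mul_coe_zeta
  simp only [coe_mul_zeta_apply] at h
  rw [h, one_apply_ne (by omega)]
  simp

theorem sum_moebius_log_dvd {D : ℝ} (hD : 1 ≤ D) {N : ℕ} (hN : ⌊D⌋₊ ≤ N) (η : ℝ) {r : ℕ} (hr : 0 < r) :
    (∑ d ∈ Ioc 0 N, if r ∣ d then μ d * max (log (D / d)) 0 * (d : ℝ) ^ (-(1 + η)) else 0) =
      μ r * (r : ℝ) ^ (-(1 + η)) * moebiusLogSumCoprime r.primeFactors η (D / r) := by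
  have h1 : (∑ d ∈ Ioc 0 N, if r ∣ d then μ d * max (log (D / d)) 0 * (d : ℝ) ^ (-(1 + η)) else 0) =
      ∑ d ∈ Ioc 0 ⌊D⌋₊, if r ∣ d then μ d * log (D / d) * (d : ℝ) ^ (-(1 + η)) else 0 := by
    symm
    refine sum_subset_zero_on_sdiff (Ioc_subset_Ioc_right hN) ?_ ?_
    · intro d hd
      simp only [mem_sdiff, mem_Ioc, not_and, not_le] at hd
      have hdD : D < d := (Nat.floor_lt (by linarith)).mp (hd.2 hd.1.1)
      rw [max_eq_right (log_nonpos (by positivity)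
        (by rw [div_le_one (by linarith)]; exact hdD.le))]
      simp
    · intro d hd
      obtain ⟨hd0, hd1⟩ := mem_Ioc.mp hd
      have hdD : (d : ℝ) ≤ D := (Nat.le_floor_iff (by linarith)).mp hd1
      rw [max_eq_left (log_nonneg (by rw [le_div_iff₀ (by positivity)]; linarith))]
  rw [h1, sum_Ioc_dvd _ r hr, moebiusLogSumCoprime, mul_sum, Nat.floor_div_natCast]
  refine sum_congr rfl fun m hm => ?_
  obtain ⟨hm0, hm1⟩ := mem_Ioc.mp hm
  have hmm : (0 : ℝ) < m := by exact_mod_cast hm0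
  have hrr : (0 : ℝ) < r := by exact_mod_cast hr
  have hc : (∀ p ∈ r.primeFactors, ¬ p ∣ m) ↔ Nat.Coprime r m := by
    constructor
    · intro h
      refine Nat.coprime_of_dvd fun p hp h1 h2 => h p (Nat.mem_primeFactors.mpr ⟨hp, h1, hr.ne'⟩) h2
    · intro h p hp h2
      exact (Nat.prime_of_mem_primeFactors hp).one_lt.ne'
        (Nat.eq_one_of_dvd_coprimes h (Nat.dvd_of_mem_primeFactors hp) h2)
  by_cases h : Nat.Coprime r m
  · rw [if_pos (hc.mpr h), isMultiplicative_moebius.map_mul_of_coprime h]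
    push_cast
    rw [mul_rpow hrr.le hmm.le, div_div, neg_add', sub_eq_add_neg]
    ring
  · rw [if_neg (mt hc.mp h), moebius_eq_zero_of_not_squarefree]
    · simp
    · intro hsq
      exact h (Nat.coprime_of_squarefree_mul hsq)

theorem sum_barbanVehov_dvd {D₁ D₂ : ℝ} (h1 : 1 ≤ D₁) (h12 : D₁ < D₂) (η : ℝ) {r : ℕ} (hr : 0 < r) :
    (∑ d ∈ Ioc 0 ⌊D₂⌋₊, if r ∣ d then barbanVehov D₁ D₂ d * (d : ℝ) ^ (-(1 + η)) else 0) =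
      μ r * (r : ℝ) ^ (-(1 + η)) * (moebiusLogSumCoprime r.primeFactors η (D₂ / r) -
        moebiusLogSumCoprime r.primeFactors η (D₁ / r)) / log (D₂ / D₁) := by
  rw [mul_sub, ← sum_moebius_log_dvd (h1.trans h12.le) le_rfl η hr,
    ← sum_moebius_log_dvd h1 (Nat.floor_le_floor h12.le) η hr, ← sum_sub_distrib, sum_div]
  refine sum_congr rfl fun d _ => ?_
  split_ifs
  · rw [barbanVehov]; ring
  · simp

theorem jordan_mul_sq_le {r : ℕ} (hr : Squarefree r) {η : ℝ} (hη : 0 ≤ η) :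
    jordan (1 + η) r * ((r : ℝ) ^ (-(1 + η)) * ∏ p ∈ r.primeFactors, (1 - (p : ℝ)⁻¹)⁻¹) ^ 2 ≤
      (jordan 1 r)⁻¹ := by
  rw [← prod_primeFactors_rpow hr, ← prod_mul_distrib, ← prod_pow, jordan, ← prod_mul_distrib,
    jordan, ← prod_inv_distrib]
  refine prod_le_prod ?_ ?_
  · intro p hp
    have : (1 : ℝ) ≤ p := by exact_mod_cast (Nat.prime_of_mem_primeFactors hp).one_lt.le
    have := one_le_rpow this (show 0 ≤ 1 + η by linarith)
    exact mul_nonneg (by linarith) (sq_nonneg _)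
  · intro p hp
    have hp2 : (2 : ℝ) ≤ p := by exact_mod_cast (Nat.prime_of_mem_primeFactors hp).two_le
    have hq : (p : ℝ) ≤ (p : ℝ) ^ (1 + η) := by
      simpa using rpow_le_rpow_of_exponent_le (show (1 : ℝ) ≤ p by linarith)
        (show (1 : ℝ) ≤ 1 + η by linarith)
    rw [rpow_neg (by linarith), rpow_one]
    generalize (p : ℝ) ^ (1 + η) = q at *
    generalize (p : ℝ) = t at *
    have e : (1 - t⁻¹)⁻¹ = t / (t - 1) := by
      rw [show 1 - t⁻¹ = (t - 1) / t by field_simp, inv_div]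
    rw [e, inv_eq_one_div (t - 1), le_div_iff₀ (by linarith)]
    have : (q - 1) * (q⁻¹ * (t / (t - 1))) ^ 2 * (t - 1) = (q - 1) * t ^ 2 / (q ^ 2 * (t - 1)) := by
      have : t - 1 ≠ 0 := by linarith
      have : q ≠ 0 := by linarith
      field_simp
    rw [this, div_le_one (mul_pos (by nlinarith) (by linarith))]
    have : 0 ≤ (q - t) * (t * q - q - t) :=
      mul_nonneg (by linarith) (by nlinarith)
    nlinarith

/-- The quadratic form in the Barban–Vehov weights. -/
theorem sum_barbanVehov_lcm_le {D₁ D₂ : ℝ} (h1 : 1 ≤ D₁) (h12 : D₁ < D₂) {η : ℝ} (hη : 0 ≤ η) :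
    ∑ d ∈ Ioc 0 ⌊D₂⌋₊, ∑ e ∈ Ioc 0 ⌊D₂⌋₊,
      barbanVehov D₁ D₂ d * barbanVehov D₁ D₂ e * (Nat.lcm d e : ℝ) ^ (-(1 + η)) ≤
      4 * (log D₂ + 1) * (1 + η * log D₂) ^ 2 / log (D₂ / D₁) ^ 2 := by
  rw [sum_lcm_eq_sum_sq _ _ fun n hn => barbanVehov_of_not_squarefree D₁ D₂ hn]
  have hl : 0 < log (D₂ / D₁) := log_pos (by rw [lt_div_iff₀ (by linarith)]; linarith)
  have hl2 : 0 ≤ log D₂ := log_nonneg (by linarith)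
  set B := 11 / 8 * (1 + η * log D₂) with hB
  have hB0 : 0 ≤ B := by positivity
  have hbd : ∀ r : ℕ, 0 < r → ∀ D : ℝ, 1 ≤ D → D ≤ D₂ →
      0 ≤ moebiusLogSumCoprime r.primeFactors η (D / r) ∧
      moebiusLogSumCoprime r.primeFactors η (D / r) ≤ B * ∏ p ∈ r.primeFactors, (1 - (p : ℝ)⁻¹)⁻¹ := by
    intro r hr D hD hDD
    have hrr : (1 : ℝ) ≤ r := by exact_mod_cast hr
    have hP : 0 ≤ ∏ p ∈ r.primeFactors, (1 - (p : ℝ)⁻¹)⁻¹ := by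
      refine prod_nonneg fun p hp => inv_nonneg.mpr ?_
      have : (1 : ℝ) ≤ p := by exact_mod_cast (Nat.prime_of_mem_primeFactors hp).one_lt.le
      linarith [inv_le_one_of_one_le₀ this]
    rcases lt_or_ge (D / r) 1 with h | h
    · rw [moebiusLogSumCoprime_of_lt_one _ _ h]
      exact ⟨le_rfl, mul_nonneg hB0 hP⟩
    · obtain ⟨a, b⟩ := moebiusLogSumCoprime_bounds
        (fun q hq => Nat.prime_of_mem_primeFactors (n := r) hq) hη h
      refine ⟨a, b.trans (mul_le_mul_of_nonneg_right ?_ hP)⟩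
      have : log (D / r) ≤ log D₂ := by
        refine log_le_log (by positivity) (le_trans ?_ hDD)
        exact div_le_self (by linarith) hrr
      rw [hB]
      gcongr
  have hterm : ∀ r ∈ Ioc 0 ⌊D₂⌋₊, jordan (1 + η) r *
      (∑ d ∈ Ioc 0 ⌊D₂⌋₊, if r ∣ d then barbanVehov D₁ D₂ d * (d : ℝ) ^ (-(1 + η)) else 0) ^ 2 ≤
      (B / log (D₂ / D₁)) ^ 2 * if Squarefree r then (jordan 1 r)⁻¹ else 0 := by
    intro r hr
    have hr0 := (mem_Ioc.mp hr).1
    rw [sum_barbanVehov_dvd h1 h12 η hr0]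
    split_ifs with hs
    · obtain ⟨a1, b1⟩ := hbd r hr0 D₁ h1 h12.le
      obtain ⟨a2, b2⟩ := hbd r hr0 D₂ (h1.trans h12.le) le_rfl
      refine le_trans ?_ (mul_le_mul_of_nonneg_left (jordan_mul_sq_le hs hη) (sq_nonneg _))
      rw [mul_left_comm]
      refine mul_le_mul_of_nonneg_left ?_ (jordan_nonneg (by linarith) r)
      rw [← mul_pow, sq_le_sq]
      have hm : |((μ r : ℤ) : ℝ)| ≤ 1 := by exact_mod_cast abs_moebius_le_one
      have hdiff : |moebiusLogSumCoprime r.primeFactors η (D₂ / r) -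
          moebiusLogSumCoprime r.primeFactors η (D₁ / r)| ≤
          B * ∏ p ∈ r.primeFactors, (1 - (p : ℝ)⁻¹)⁻¹ := by
        rw [abs_le]; constructor <;> linarith
      have hnn : 0 ≤ B * ∏ p ∈ r.primeFactors, (1 - (p : ℝ)⁻¹)⁻¹ := a1.trans b1
      rw [abs_div, abs_mul, abs_mul, abs_of_pos hl, abs_of_nonneg (by positivity : 0 ≤ (r : ℝ) ^ (-(1 + η)))]
      calc _ ≤ 1 * (r : ℝ) ^ (-(1 + η)) * (B * ∏ p ∈ r.primeFactors, (1 - (p : ℝ)⁻¹)⁻¹) /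
            log (D₂ / D₁) := by gcongr
        _ = B / log (D₂ / D₁) * ((r : ℝ) ^ (-(1 + η)) * ∏ p ∈ r.primeFactors, (1 - (p : ℝ)⁻¹)⁻¹) := by
          ring
        _ ≤ _ := le_abs_self _
    · rw [moebius_eq_zero_of_not_squarefree hs]
      simp
  refine (sum_le_sum hterm).trans ?_
  rw [← mul_sum]
  have hfl : 1 ≤ ⌊D₂⌋₊ := Nat.le_floor (by simpa using h1.trans h12.le)
  have hG : selbergSum ⌊D₂⌋₊ ≤ 21 / 10 * (log D₂ + 1) := by
    refine (selbergSum_le _).trans ?_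
    have : log (⌊D₂⌋₊ : ℝ) ≤ log D₂ :=
      log_le_log (by exact_mod_cast hfl) (Nat.floor_le (by linarith))
    linarith
  rw [← selbergSum]
  refine (mul_le_mul_of_nonneg_left hG (sq_nonneg _)).trans ?_
  rw [div_pow, div_mul_eq_mul_div]
  refine div_le_div_of_nonneg_right ?_ (sq_nonneg _)
  rw [hB]
  have : 0 ≤ (1 + η * log D₂) ^ 2 * (log D₂ + 1) := by positivity
  nlinarith

theorem sum_inv_le_prod_of_factoredNumbers (s S : Finset ℕ) (hS : ∀ m ∈ S, m ∈ Nat.factoredNumbers s) :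
    ∑ m ∈ S, (m : ℝ)⁻¹ ≤ ∏ p ∈ s with p.Prime, (1 - (p : ℝ)⁻¹)⁻¹ := by
  let f : ℕ →* ℝ := ⟨⟨fun n => (n : ℝ)⁻¹, by simp⟩, fun m n => by simp [mul_comm]⟩
  have h := (EulerProduct.summable_and_hasSum_factoredNumbers_prod_filter_prime_geometric (f := f)
    (fun {p} hp => by
      have : (1 : ℝ) < p := by exact_mod_cast hp.one_lt
      change ‖(p : ℝ)⁻¹‖ < 1
      rw [norm_inv, Real.norm_natCast]
      exact inv_lt_one_of_one_lt₀ this) s).2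
  rw [← Finset.sum_subtype_of_mem (fun m : ℕ => (m : ℝ)⁻¹) hS]
  exact sum_le_hasSum _ (fun m _ => by change 0 ≤ ((m : ℕ) : ℝ)⁻¹; positivity) h

theorem sum_inv_radical_le {r : ℕ} (hr : Squarefree r) (N : ℕ) :
    (∑ n ∈ Ioc 0 N, if ∏ p ∈ n.primeFactors, p = r then (n : ℝ)⁻¹ else 0) ≤ (jordan 1 r)⁻¹ := by
  have hr0 : 0 < r := Nat.pos_of_ne_zero hr.ne_zero
  have h1 : (∑ n ∈ Ioc 0 N, if ∏ p ∈ n.primeFactors, p = r then (n : ℝ)⁻¹ else 0) =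
      ∑ n ∈ Ioc 0 N, if r ∣ n then (if ∏ p ∈ n.primeFactors, p = r then (n : ℝ)⁻¹ else 0) else 0 := by
    refine sum_congr rfl fun n hn => ?_
    by_cases h : ∏ p ∈ n.primeFactors, p = r
    · rw [if_pos h, if_pos (h ▸ Nat.prod_primeFactors_dvd n)]
    · simp [h]
  rw [h1, sum_Ioc_dvd _ _ hr0, ← sum_filter]
  have h2 : ∀ m ∈ (Ioc 0 (N / r)).filter (fun m => ∏ p ∈ (r * m).primeFactors, p = r),
      m ∈ Nat.factoredNumbers r.primeFactors := by
    intro m hm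
    simp only [mem_filter, mem_Ioc] at hm
    refine Nat.mem_factoredNumbers_of_primeFactors_subset hm.1.1.ne' ?_
    have : (r * m).primeFactors = r.primeFactors := by
      conv_rhs => rw [← hm.2]
      rw [Nat.primeFactors_prod fun p hp => Nat.prime_of_mem_primeFactors hp]
    rw [← this]
    exact Nat.primeFactors_mono (Nat.dvd_mul_left m r) (Nat.mul_pos hr0 hm.1.1).ne'
  have h3 := sum_inv_le_prod_of_factoredNumbers _ _ h2
  rw [filter_true_of_mem fun p hp => Nat.prime_of_mem_primeFactors hp] at h3
  have h4 : (jordan 1 r)⁻¹ = (r : ℝ)⁻¹ * ∏ p ∈ r.primeFactors, (1 - (p : ℝ)⁻¹)⁻¹ := by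
    have h := prod_primeFactors_rpow hr 1
    simp only [rpow_one] at h
    conv_rhs => rw [← h]
    rw [jordan, ← prod_inv_distrib, ← prod_inv_distrib, ← prod_mul_distrib]
    refine prod_congr rfl fun p hp => ?_
    have : (1 : ℝ) < p := by exact_mod_cast (Nat.prime_of_mem_primeFactors hp).one_lt
    rw [rpow_one, ← mul_inv]
    congr 1
    field_simp
  rw [h4]
  push_cast
  simp_rw [mul_inv]
  rw [← mul_sum]
  exact mul_le_mul_of_nonneg_left h3 (by positivity)

theorem log_le_selbergSum (N : ℕ) : log (N + 1) ≤ selbergSum N := by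
  have h1 : log (N + 1) ≤ ∑ n ∈ Ioc 0 N, (n : ℝ)⁻¹ := by
    have := log_add_one_le_harmonic N
    rw [harmonic_eq_sum_Icc] at this
    push_cast at this
    have e : Ioc 0 N = Icc 1 N := by ext; simp; omega
    rwa [e]
  refine h1.trans ?_
  have hmaps : ∀ n ∈ Ioc 0 N, ∏ p ∈ n.primeFactors, p ∈ (Ioc 0 N).filter Squarefree := by
    intro n hn
    obtain ⟨hn0, hn1⟩ := mem_Ioc.mp hn
    have hd := Nat.prod_primeFactors_dvd n
    rw [mem_filter, mem_Ioc]
    refine ⟨⟨Nat.pos_of_dvd_of_pos hd hn0, (Nat.le_of_dvd hn0 hd).trans hn1⟩, ?_⟩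
    refine Finset.squarefree_prod_of_pairwise_isCoprime (fun p hp q hq hpq => ?_)
      fun p hp => (Nat.prime_of_mem_primeFactors hp).prime.squarefree
    exact Nat.coprime_iff_isRelPrime.mp ((Nat.coprime_primes (Nat.prime_of_mem_primeFactors hp)
      (Nat.prime_of_mem_primeFactors hq)).mpr hpq)
  rw [← sum_fiberwise_of_maps_to hmaps, selbergSum, ← sum_filter]
  refine sum_le_sum fun r hr => ?_
  rw [sum_filter]
  exact sum_inv_radical_le (mem_filter.mp hr).2 N

/-- Selberg's optimal weights of level `N`. -/
noncomputable def selbergWeight (N d : ℕ) : ℝ :=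
  μ d * d / selbergSum N * ∑ r ∈ Ioc 0 N, if d ∣ r ∧ Squarefree r then (jordan 1 r)⁻¹ else 0

theorem selbergSum_pos {N : ℕ} (hN : 0 < N) : 0 < selbergSum N :=
  (log_pos (by
    have : (0 : ℝ) < N := by exact_mod_cast hN
    linarith)).trans_le (log_le_selbergSum N)

theorem selbergWeight_of_not_squarefree (N : ℕ) {d : ℕ} (hd : ¬ Squarefree d) :
    selbergWeight N d = 0 := by
  simp [selbergWeight, moebius_eq_zero_of_not_squarefree hd]

theorem selbergWeight_one {N : ℕ} (hN : 0 < N) : selbergWeight N 1 = 1 := by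
  have := (selbergSum_pos hN).ne'
  rw [selbergSum] at this
  simp [selbergWeight, selbergSum, this]

theorem jordan_mul_of_coprime (σ : ℝ) {m n : ℕ} (h : Nat.Coprime m n) :
    jordan σ (m * n) = jordan σ m * jordan σ n :=
  prod_primeFactors_mul_of_coprime _ h

theorem mul_sum_inv_jordan_le (N : ℕ) {d : ℕ} (hd : Squarefree d) :
    (d : ℝ) * (∑ r ∈ Ioc 0 N, if d ∣ r ∧ Squarefree r then (jordan 1 r)⁻¹ else 0) ≤ selbergSum N := by
  have hd0 : 0 < d := Nat.pos_of_ne_zero hd.ne_zero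
  have h1 : (∑ r ∈ Ioc 0 N, if d ∣ r ∧ Squarefree r then (jordan 1 r)⁻¹ else 0) =
      ∑ l ∈ (Ioc 0 (N / d)).filter (fun l => Squarefree (d * l)), (jordan 1 (d * l))⁻¹ := by
    rw [sum_filter, ← sum_Ioc_dvd N d hd0 fun r => if Squarefree r then (jordan 1 r)⁻¹ else 0]
    refine sum_congr rfl fun r _ => ?_
    by_cases h : d ∣ r <;> by_cases h' : Squarefree r <;> simp [h, h']
  set A := (Ioc 0 (N / d)).filter (fun l => Squarefree (d * l)) with hA
  have h2 : (d : ℝ) * ∑ l ∈ A, (jordan 1 (d * l))⁻¹ =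
      ∑ x ∈ A ×ˢ d.divisors, (jordan 1 (x.1 * x.2))⁻¹ := by
    rw [sum_product, mul_sum]
    refine sum_congr rfl fun l hl => ?_
    have hc : Nat.Coprime d l := Nat.coprime_of_squarefree_mul (mem_filter.mp hl).2
    rw [jordan_mul_of_coprime 1 hc, mul_inv, ← mul_assoc, ← div_eq_mul_inv (d : ℝ), div_jordan_one hd,
      sum_mul]
    refine sum_congr rfl fun k hk => ?_
    rw [jordan_mul_of_coprime 1 (Nat.Coprime.coprime_dvd_left (Nat.dvd_of_mem_divisors hk) hc).symm,
      mul_inv, mul_comm]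
  rw [h1, h2, selbergSum, ← sum_filter]
  have hinj : Set.InjOn (fun x : ℕ × ℕ => x.1 * x.2) (A ×ˢ d.divisors : Finset (ℕ × ℕ)) := by
    rintro ⟨l, k⟩ hx ⟨l', k'⟩ hy hxy
    simp only [coe_product, Set.mem_prod, mem_coe] at hx hy hxy
    have hk : ∀ l k, l ∈ A → k ∈ d.divisors → Nat.gcd d (l * k) = k := by
      intro l k hl hk
      have hc : Nat.Coprime d l := Nat.coprime_of_squarefree_mul (mem_filter.mp hl).2
      rw [Nat.Coprime.gcd_mul_left_cancel_right _ hc.symm]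
      exact Nat.gcd_eq_right (Nat.dvd_of_mem_divisors hk)
    have e : k = k' := by rw [← hk l k hx.1 hx.2, ← hk l' k' hy.1 hy.2, hxy]
    subst e
    have := Nat.pos_of_mem_divisors hx.2
    rw [Nat.mul_right_cancel this hxy]
  rw [← sum_image (f := fun n => (jordan 1 n)⁻¹) hinj]
  refine sum_le_sum_of_subset_of_nonneg ?_ fun n _ _ => (inv_pos.mpr (jordan_one_pos n)).le
  intro n hn
  obtain ⟨⟨l, k⟩, hx, rfl⟩ := mem_image.mp hn
  rw [mem_product] at hx
  obtain ⟨hl, hk⟩ := hx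
  simp only [hA, mem_filter, mem_Ioc] at hl ⊢
  have hkd := Nat.dvd_of_mem_divisors hk
  have hdvd : l * k ∣ d * l := mul_comm l k ▸ Nat.mul_dvd_mul_right hkd l
  have h4 : d * l ≤ N := by
    calc d * l ≤ d * (N / d) := Nat.mul_le_mul_left d hl.1.2
      _ ≤ N := Nat.mul_div_le N d
  exact ⟨⟨Nat.mul_pos hl.1.1 (Nat.pos_of_mem_divisors hk),
    (Nat.le_of_dvd (Nat.mul_pos hd0 hl.1.1) hdvd).trans h4⟩, hl.2.squarefree_of_dvd hdvd⟩

theorem abs_selbergWeight_le {N : ℕ} (hN : 0 < N) (d : ℕ) : |selbergWeight N d| ≤ 1 := by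
  by_cases hd : Squarefree d
  swap
  · simp [selbergWeight_of_not_squarefree N hd]
  have hG := selbergSum_pos hN
  have hs : 0 ≤ ∑ r ∈ Ioc 0 N, if d ∣ r ∧ Squarefree r then (jordan 1 r)⁻¹ else 0 := by
    refine sum_nonneg fun r _ => ?_
    split_ifs
    · exact (inv_pos.mpr (jordan_one_pos r)).le
    · exact le_rfl
  have hm : |((μ d : ℤ) : ℝ)| ≤ 1 := by exact_mod_cast abs_moebius_le_one
  rw [selbergWeight, abs_mul, abs_div, abs_mul, abs_of_pos hG, abs_of_nonneg hs, Nat.abs_cast,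
    div_mul_eq_mul_div, div_le_one hG, mul_assoc]
  exact (mul_le_of_le_one_left (by positivity) hm).trans (mul_sum_inv_jordan_le N hd)

theorem sum_moebius_between {r m : ℕ} (hm : Squarefree m) {N : ℕ} (hmN : m ≤ N) (hr : 0 < r) :
    (∑ d ∈ Ioc 0 N, if r ∣ d ∧ d ∣ m then ((μ d : ℤ) : ℝ) else 0) = if r = m then (μ r : ℝ) else 0 := by
  have hm0 : 0 < m := Nat.pos_of_ne_zero hm.ne_zero
  by_cases hrm : r ∣ m
  swap
  · rw [if_neg fun h : r = m => hrm (h ▸ dvd_rfl)]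
    exact sum_eq_zero fun d _ => if_neg fun h => hrm (h.1.trans h.2)
  obtain ⟨k, rfl⟩ := hrm
  have hk0 : 0 < k := Nat.pos_of_mul_pos_left hm0
  have hc : Nat.Coprime r k := Nat.coprime_of_squarefree_mul hm
  have h1 : (∑ d ∈ Ioc 0 N, if r ∣ d ∧ d ∣ r * k then ((μ d : ℤ) : ℝ) else 0) =
      ∑ d ∈ k.divisors, (μ r : ℝ) * ((μ d : ℤ) : ℝ) := by
    have h2 := sum_Ioc_dvd N r hr fun d => if d ∣ r * k then ((μ d : ℤ) : ℝ) else 0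
    simp only [← ite_and] at h2
    rw [h2, ← sum_filter]
    have h3 : (Ioc 0 (N / r)).filter (fun d => r * d ∣ r * k) = k.divisors := by
      ext d
      simp only [mem_filter, mem_Ioc, Nat.mem_divisors, Nat.mul_dvd_mul_iff_left hr]
      constructor
      · rintro ⟨_, h⟩; exact ⟨h, hk0.ne'⟩
      · rintro ⟨h, _⟩
        refine ⟨⟨Nat.pos_of_dvd_of_pos h hk0, ?_⟩, h⟩
        exact (Nat.le_of_dvd hk0 h).trans ((Nat.le_div_iff_mul_le hr).mpr (by rwa [mul_comm]))
    rw [h3]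
    refine sum_congr rfl fun d hd => ?_
    rw [isMultiplicative_moebius.map_mul_of_coprime (hc.coprime_dvd_right (Nat.dvd_of_mem_divisors hd))]
    push_cast
    rfl
  rw [h1, ← mul_sum]
  have h := congrArg (fun f => f k) moebius_mul_coe_zeta
  simp only [coe_mul_zeta_apply] at h
  rw [← Int.cast_sum, h]
  by_cases hk : k = 1
  · simp [hk]
  · rw [one_apply_ne hk, if_neg]
    · simp
    · intro h
      exact hk (Nat.eq_of_mul_eq_mul_left hr (by omega))

theorem sum_selbergWeight_dvd {N r : ℕ} (hr : r ∈ Ioc 0 N) :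
    (∑ d ∈ Ioc 0 N, if r ∣ d then selbergWeight N d * (d : ℝ) ^ (-(1 : ℝ)) else 0) =
      if Squarefree r then μ r * (jordan 1 r)⁻¹ / selbergSum N else 0 := by
  obtain ⟨hr0, hrN⟩ := mem_Ioc.mp hr
  have h1 : ∀ d ∈ Ioc 0 N, (if r ∣ d then selbergWeight N d * (d : ℝ) ^ (-(1 : ℝ)) else 0) =
      ∑ m ∈ Ioc 0 N, (if Squarefree m then (jordan 1 m)⁻¹ / selbergSum N else 0) *
        (if r ∣ d ∧ d ∣ m then ((μ d : ℤ) : ℝ) else 0) := by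
    intro d hd
    have hd0 : (d : ℝ) ≠ 0 := by exact_mod_cast (mem_Ioc.mp hd).1.ne'
    by_cases h : r ∣ d
    · simp only [if_pos h, selbergWeight, rpow_neg_one]
      rw [mul_sum, sum_mul]
      refine sum_congr rfl fun m _ => ?_
      by_cases h' : d ∣ m <;> by_cases h'' : Squarefree m <;> simp [h, h', h'']
      field_simp
    · simp [h]
  rw [sum_congr rfl h1, sum_comm]
  have h2 : ∀ m ∈ Ioc 0 N, (∑ d ∈ Ioc 0 N, (if Squarefree m then (jordan 1 m)⁻¹ / selbergSum N else 0) *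
        (if r ∣ d ∧ d ∣ m then ((μ d : ℤ) : ℝ) else 0)) =
      if r = m then (if Squarefree r then μ r * (jordan 1 r)⁻¹ / selbergSum N else 0) else 0 := by
    intro m hm
    rw [← mul_sum]
    by_cases h : Squarefree m
    · rw [sum_moebius_between h (mem_Ioc.mp hm).2 hr0, if_pos h]
      by_cases h' : r = m
      · subst h'; simp [h]; ring
      · simp [h']
    · simp only [if_neg h, zero_mul]
      split_ifs with h1 h2
      · exact absurd (h1 ▸ h2) h
      · rfl
      · rfl
  rw [sum_congr rfl h2, sum_ite_eq, if_pos hr]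

/-- The value of Selberg's quadratic form at the optimal weights. -/
theorem sum_selbergWeight_lcm {N : ℕ} (hN : 0 < N) : ∑ d ∈ Ioc 0 N, ∑ e ∈ Ioc 0 N,
      selbergWeight N d * selbergWeight N e * (Nat.lcm d e : ℝ) ^ (-(1 : ℝ)) = (selbergSum N)⁻¹ := by
  rw [sum_lcm_eq_sum_sq _ _ fun n hn => selbergWeight_of_not_squarefree N hn]
  have hG := (selbergSum_pos hN).ne'
  have : ∀ r ∈ Ioc 0 N, jordan 1 r *
      (∑ d ∈ Ioc 0 N, if r ∣ d then selbergWeight N d * (d : ℝ) ^ (-(1 : ℝ)) else 0) ^ 2 =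
      (if Squarefree r then (jordan 1 r)⁻¹ else 0) * ((selbergSum N)⁻¹) ^ 2 := by
    intro r hr
    rw [sum_selbergWeight_dvd hr]
    split_ifs with hs
    · have h1 : ((μ r : ℤ) : ℝ) ^ 2 = 1 := by
        rw [← Int.cast_pow, moebius_sq_eq_one_of_squarefree hs, Int.cast_one]
      have := (jordan_one_pos r).ne'
      rw [div_pow, mul_pow, h1]
      field_simp
    · simp
  rw [sum_congr rfl this, ← sum_mul, ← selbergSum]
  field_simp

theorem abs_sum_sub_integral_le_of_unimodal {g : ℝ → ℝ} {p M : ℝ} (h0 : ∀ u, 0 ≤ g u)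
    (hM : ∀ u, g u ≤ M) (h1 : MonotoneOn g (Set.Icc 0 p)) (h2 : AntitoneOn g (Set.Ici p))
    (hi : ∀ a b, IntervalIntegrable g MeasureTheory.volume a b) (N : ℕ) :
    |∑ k ∈ Ioc 0 N, g k - ∫ u in (0 : ℝ)..N, g u| ≤ M := by
  have hstep : ∀ n : ℕ, ∫ u in (0 : ℝ)..(n + 1 : ℕ), g u =
      (∫ u in (0 : ℝ)..n, g u) + ∫ u in (n : ℝ)..(n + 1 : ℕ), g u := fun n =>
    (intervalIntegral.integral_add_adjacent_intervals (hi _ _) (hi _ _)).symm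
  have hsum : ∀ n : ℕ, ∑ k ∈ Ioc 0 (n + 1), g k = ∑ k ∈ Ioc 0 n, g k + g (n + 1 : ℕ) := fun n =>
    sum_Ioc_succ_top (Nat.zero_le n) _
  have hup : ∀ (n : ℕ) (m : ℝ), (∀ u ∈ Set.Icc (n : ℝ) (n + 1 : ℕ), g u ≤ m) →
      ∫ u in (n : ℝ)..(n + 1 : ℕ), g u ≤ m := by
    intro n m h
    have := intervalIntegral.integral_mono_on (by push_cast; linarith) (hi n (n + 1 : ℕ))
      intervalIntegrable_const h
    simpa using this
  have hlo : ∀ (n : ℕ) (m : ℝ), (∀ u ∈ Set.Icc (n : ℝ) (n + 1 : ℕ), m ≤ g u) →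
      m ≤ ∫ u in (n : ℝ)..(n + 1 : ℕ), g u := by
    intro n m h
    have := intervalIntegral.integral_mono_on (by push_cast; linarith)
      intervalIntegrable_const (hi n (n + 1 : ℕ)) h
    simpa using this
  have hn0 : ∀ n : ℕ, (0 : ℝ) ≤ n := fun n => Nat.cast_nonneg n
  have hn1 : ∀ n : ℕ, (n : ℝ) ≤ (n + 1 : ℕ) := fun n => by push_cast; linarith
  have key : ((N : ℝ) ≤ p → ∑ k ∈ Ioc 0 N, g k ≤ (∫ u in (0 : ℝ)..N, g u) + g N ∧
      (∫ u in (0 : ℝ)..N, g u) ≤ ∑ k ∈ Ioc 0 N, g k) ∧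
      (p < N → ∑ k ∈ Ioc 0 N, g k ≤ (∫ u in (0 : ℝ)..N, g u) + M ∧
      (∫ u in (0 : ℝ)..N, g u) ≤ ∑ k ∈ Ioc 0 N, g k + M - g N) := by
    induction N with
    | zero =>
      simp only [Ioc_self, sum_empty, Nat.cast_zero, intervalIntegral.integral_same]
      have := h0 0
      have := hM 0
      exact ⟨fun _ => ⟨by linarith, le_rfl⟩, fun _ => ⟨by linarith, by linarith⟩⟩
    | succ n ih =>
      rw [hstep, hsum]
      constructor
      · intro hp
        obtain ⟨i1, i2⟩ := ih.1 ((hn1 n).trans hp)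
        have a1 := hup n (g (n + 1 : ℕ)) fun u hu =>
          h1 ⟨(hn0 n).trans hu.1, hu.2.trans hp⟩ ⟨hn0 _, hp⟩ hu.2
        have a2 := hlo n (g n) fun u hu =>
          h1 ⟨hn0 n, (hn1 n).trans hp⟩ ⟨(hn0 n).trans hu.1, hu.2.trans hp⟩ hu.1
        constructor <;> linarith
      · intro hp
        rcases le_or_gt (n : ℝ) p with hnp | hnp
        · obtain ⟨i1, i2⟩ := ih.1 hnp
          have a1 := hup n M fun u _ => hM u
          have a2 := hlo n (min (g n) (g (n + 1 : ℕ))) fun u hu => by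
            rcases le_or_gt u p with h | h
            · exact (min_le_left _ _).trans
                (h1 ⟨hn0 n, hnp⟩ ⟨(hn0 n).trans hu.1, h⟩ hu.1)
            · exact (min_le_right _ _).trans (h2 h.le (h.le.trans hu.2) hu.2)
          have := hM n; have := hM (n + 1 : ℕ)
          have : g n + g (n + 1 : ℕ) ≤ min (g n) (g (n + 1 : ℕ)) + M := by
            rcases min_cases (g n) (g (n + 1 : ℕ)) with h | h <;> linarith [h.1]
          constructor <;> linarith
        · obtain ⟨i1, i2⟩ := ih.2 hnp
          have a1 := hup n (g n) fun u hu => h2 hnp.le (hnp.le.trans hu.1) hu.1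
          have a2 := hlo n (g (n + 1 : ℕ)) fun u hu => h2 (hnp.le.trans hu.1) hp.le hu.2
          constructor <;> linarith
  rw [abs_le]
  have := h0 N; have := hM N
  rcases le_or_gt (N : ℝ) p with h | h
  · obtain ⟨a, b⟩ := key.1 h
    constructor <;> linarith
  · obtain ⟨a, b⟩ := key.2 h
    constructor <;> linarith

/-- The log-normal bump `exp (-A (log u - c) ^ 2)`, extended by zero. -/
noncomputable def logGaussian (A c u : ℝ) : ℝ :=
  if u ≤ 0 then 0 else exp (-A * (log u - c) ^ 2)

theorem integral_exp_mul_gaussian {A : ℝ} (hA : 0 < A) (c : ℝ) :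
    MeasureTheory.Integrable (fun v : ℝ => exp v * exp (-A * (v - c) ^ 2)) ∧
    ∫ v : ℝ, exp v * exp (-A * (v - c) ^ 2) =
      √(π / A) * exp (c + 1 / (4 * A)) := by
  have e : (fun v : ℝ => exp v * exp (-A * (v - c) ^ 2)) =
      fun v => (fun w => exp (-A * w ^ 2)) (v - (c + 1 / (2 * A))) * exp (c + 1 / (4 * A)) := by
    funext v
    simp only
    rw [← exp_add, ← exp_add]
    congr 1
    field_simp
    ring
  rw [e]
  constructor
  · exact ((integrable_exp_neg_mul_sq hA).comp_sub_right _).mul_const _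
  · rw [MeasureTheory.integral_mul_const,
      MeasureTheory.integral_sub_right_eq_self (fun w => exp (-A * w ^ 2)), integral_gaussian]

theorem integral_logGaussian {A : ℝ} (hA : 0 < A) (c : ℝ) :
    MeasureTheory.IntegrableOn (logGaussian A c) (Set.Ioi 0) ∧
    ∫ u in Set.Ioi 0, logGaussian A c u = √(π / A) * exp (c + 1 / (4 * A)) := by
  obtain ⟨h1, h2⟩ := integral_exp_mul_gaussian hA c
  have hr : Set.Ioi (0 : ℝ) = exp '' Set.univ := by rw [Set.image_univ, range_exp]
  have hd : ∀ x ∈ (Set.univ : Set ℝ), HasDerivWithinAt exp (exp x) Set.univ x :=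
    fun x _ => (hasDerivAt_exp x).hasDerivWithinAt
  have hinj : Set.InjOn exp Set.univ := exp_injective.injOn
  have e : ∀ v : ℝ, |exp v| • logGaussian A c (exp v) =
      exp v * exp (-A * (v - c) ^ 2) := by
    intro v
    rw [abs_of_pos (exp_pos v), smul_eq_mul, logGaussian, if_neg (not_le.mpr (exp_pos v)), log_exp]
  rw [hr]
  constructor
  · rw [MeasureTheory.integrableOn_image_iff_integrableOn_abs_deriv_smul MeasurableSet.univ hd hinj]
    simp_rw [e]
    rwa [MeasureTheory.integrableOn_univ]
  · rw [MeasureTheory.integral_image_eq_integral_abs_deriv_smul MeasurableSet.univ hd hinj]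
    simp_rw [e]
    rw [MeasureTheory.setIntegral_univ, h2]

theorem logGaussian_nonneg (A c u : ℝ) : 0 ≤ logGaussian A c u := by
  rw [logGaussian]; split_ifs
  · exact le_rfl
  · positivity

theorem logGaussian_le_one {A : ℝ} (hA : 0 < A) (c u : ℝ) : logGaussian A c u ≤ 1 := by
  rw [logGaussian]; split_ifs
  · exact zero_le_one
  · rw [exp_le_one_iff]
    have := mul_nonneg hA.le (sq_nonneg (log u - c))
    linarith

theorem measurable_logGaussian (A c : ℝ) : Measurable (logGaussian A c) := by
  refine Measurable.ite measurableSet_Iic measurable_const ?_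
  fun_prop

theorem exists_tendsto_sum_logGaussian {A : ℝ} (hA : 0 < A) (c : ℝ) :
    ∃ W, Filter.Tendsto (fun N : ℕ => ∑ k ∈ Ioc 0 N, logGaussian A c k) Filter.atTop (nhds W) ∧
      |W - √(π / A) * exp (c + 1 / (4 * A))| ≤ 1 := by
  obtain ⟨hgi, hval⟩ := integral_logGaussian hA c
  have hmono : MonotoneOn (logGaussian A c) (Set.Icc 0 (exp c)) := by
    intro a ha b hb hab
    rcases ha.1.eq_or_lt with h | h
    · rw [← h]
      refine le_trans (le_of_eq ?_) (logGaussian_nonneg A c b)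
      simp [logGaussian]
    · rw [logGaussian, logGaussian, if_neg (not_le.mpr h), if_neg (not_le.mpr (h.trans_le hab)),
        exp_le_exp]
      have h1 := log_le_log h hab
      have h2 : log b ≤ c := (log_le_iff_le_exp (h.trans_le hab)).mpr hb.2
      have : (log b - c) ^ 2 ≤ (log a - c) ^ 2 := by nlinarith
      nlinarith
  have hanti : AntitoneOn (logGaussian A c) (Set.Ici (exp c)) := by
    intro a ha b hb hab
    have h : 0 < a := (exp_pos c).trans_le ha
    rw [logGaussian, logGaussian, if_neg (not_le.mpr h), if_neg (not_le.mpr (h.trans_le hab)),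
        exp_le_exp]
    have h1 := log_le_log h hab
    have h2 : c ≤ log a := (le_log_iff_exp_le h).mpr ha
    have : (log a - c) ^ 2 ≤ (log b - c) ^ 2 := by nlinarith
    nlinarith
  have hi : ∀ a b, IntervalIntegrable (logGaussian A c) MeasureTheory.volume a b := by
    intro a b
    refine (intervalIntegrable_const (c := (1 : ℝ))).mono_fun
      (measurable_logGaussian A c).aestronglyMeasurable ?_
    filter_upwards with u
    rw [Real.norm_of_nonneg (logGaussian_nonneg A c u)]
    simpa using logGaussian_le_one hA c u
  have hb := abs_sum_sub_integral_le_of_unimodal (logGaussian_nonneg A c) (logGaussian_le_one hA c)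
    hmono hanti hi
  have hlim : Filter.Tendsto (fun N : ℕ => ∫ u in (0 : ℝ)..N, logGaussian A c u) Filter.atTop
      (nhds (√(π / A) * exp (c + 1 / (4 * A)))) := by
    rw [← hval]
    exact MeasureTheory.intervalIntegral_tendsto_integral_Ioi 0 hgi tendsto_natCast_atTop_atTop
  have hm : Monotone fun N : ℕ => ∑ k ∈ Ioc 0 N, logGaussian A c k := fun a b hab =>
    sum_le_sum_of_subset_of_nonneg (Ioc_subset_Ioc_right hab) fun k _ _ => logGaussian_nonneg A c k
  have hbdd : BddAbove (Set.range fun N : ℕ => ∑ k ∈ Ioc 0 N, logGaussian A c k) := by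
    refine ⟨√(π / A) * exp (c + 1 / (4 * A)) + 1, ?_⟩
    rintro _ ⟨N, rfl⟩
    have h1 := (abs_le.mp (hb N)).2
    have h2 : ∫ u in (0 : ℝ)..N, logGaussian A c u ≤ √(π / A) * exp (c + 1 / (4 * A)) := by
      refine ge_of_tendsto hlim ?_
      filter_upwards [Filter.eventually_ge_atTop N] with n hn
      exact intervalIntegral.integral_mono_interval le_rfl (Nat.cast_nonneg N) (by exact_mod_cast hn)
        (Filter.Eventually.of_forall (logGaussian_nonneg A c)) (hi _ _)
    simp only
    linarith
  refine ⟨_, tendsto_atTop_ciSup hm hbdd, ?_⟩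
  exact le_of_tendsto ((tendsto_atTop_ciSup hm hbdd).sub hlim).abs (Filter.Eventually.of_forall hb)

/-- The sum of `x d` over the divisors `d ≤ D` of `n`. -/
def dvdSum {R : Type*} [CommSemiring R] (D : ℕ) (x : ℕ → R) (n : ℕ) : R :=
  ∑ d ∈ Ioc 0 D, if d ∣ n then x d else 0

theorem sum_dvdSum_mul {R : Type*} [CommSemiring R] (N D E : ℕ) (x y f : ℕ → R) :
    ∑ n ∈ Ioc 0 N, dvdSum D x n * dvdSum E y n * f n = ∑ d ∈ Ioc 0 D, ∑ e ∈ Ioc 0 E,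
        x d * y e * ∑ k ∈ Ioc 0 (N / Nat.lcm d e), f (Nat.lcm d e * k) := by
  have h : ∀ n, dvdSum D x n * dvdSum E y n * f n = ∑ d ∈ Ioc 0 D, ∑ e ∈ Ioc 0 E,
      x d * y e * (if Nat.lcm d e ∣ n then f n else 0) := by
    intro n
    rw [dvdSum, dvdSum, sum_mul_sum, sum_mul]
    refine sum_congr rfl fun d _ => ?_
    rw [sum_mul]
    refine sum_congr rfl fun e _ => ?_
    by_cases h1 : d ∣ n <;> by_cases h2 : e ∣ n <;> simp [h1, h2, Nat.lcm_dvd_iff]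
  simp_rw [h]
  rw [sum_comm]
  refine sum_congr rfl fun d hd => ?_
  rw [sum_comm]
  refine sum_congr rfl fun e he => ?_
  rw [← mul_sum, sum_Ioc_dvd _ _ (Nat.lcm_pos (mem_Ioc.mp hd).1 (mem_Ioc.mp he).1)]

theorem abs_dvdSum_le {D : ℕ} {x : ℕ → ℝ} (hx : ∀ d, |x d| ≤ 1) (n : ℕ) : |dvdSum D x n| ≤ D := by
  refine (abs_sum_le_sum_abs _ _).trans ?_
  calc _ ≤ ∑ d ∈ Ioc 0 D, (1 : ℝ) := sum_le_sum fun d _ => by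
        split_ifs
        · exact hx d
        · simp
    _ = D := by simp

theorem logGaussian_mul (A c : ℝ) {q : ℕ} (hq : 0 < q) (k : ℕ) :
    logGaussian A c ((q * k : ℕ) : ℝ) = logGaussian A (c - log q) k := by
  have hq' : (0 : ℝ) < q := by exact_mod_cast hq
  rcases Nat.eq_zero_or_pos k with rfl | hk
  · simp [logGaussian]
  · have hk' : (0 : ℝ) < k := by exact_mod_cast hk
    rw [logGaussian, logGaussian, if_neg (by push_cast; exact not_le.mpr (by positivity)),
      if_neg (not_le.mpr hk')]
    push_cast
    rw [log_mul hq'.ne' hk'.ne']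
    ring_nf

theorem tendsto_natDiv_atTop {q : ℕ} (hq : 0 < q) :
    Filter.Tendsto (fun N : ℕ => N / q) Filter.atTop Filter.atTop :=
  Nat.tendsto_div_const_atTop hq.ne'

theorem sum_sq_dvdSum_logGaussian_le {A : ℝ} (hA : 0 < A) (c : ℝ) (N z : ℕ) {θ : ℕ → ℝ}
    (hθ : ∀ d, |θ d| ≤ 1) :
    ∑ n ∈ Ioc 0 N, dvdSum z θ n ^ 2 * logGaussian A c n ≤ √(π / A) * exp (c + 1 / (4 * A)) *
        (∑ d ∈ Ioc 0 z, ∑ e ∈ Ioc 0 z, θ d * θ e * (Nat.lcm d e : ℝ) ^ (-(1 : ℝ))) + z ^ 2 := by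
  choose W hW hWb using fun q : ℕ => exists_tendsto_sum_logGaussian hA (c - log q)
  have hlim : Filter.Tendsto (fun N : ℕ => ∑ n ∈ Ioc 0 N, dvdSum z θ n ^ 2 * logGaussian A c n)
      Filter.atTop (nhds (∑ d ∈ Ioc 0 z, ∑ e ∈ Ioc 0 z, θ d * θ e * W (Nat.lcm d e))) := by
    have : ∀ N : ℕ, ∑ n ∈ Ioc 0 N, dvdSum z θ n ^ 2 * logGaussian A c n =
        ∑ d ∈ Ioc 0 z, ∑ e ∈ Ioc 0 z, θ d * θ e * ∑ k ∈ Ioc 0 (N / Nat.lcm d e),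
          logGaussian A (c - log (Nat.lcm d e)) k := by
      intro N
      simp_rw [sq]
      rw [sum_dvdSum_mul N z z θ θ (fun n => logGaussian A c n)]
      refine sum_congr rfl fun d hd => sum_congr rfl fun e he => ?_
      congr 1
      exact sum_congr rfl fun k _ =>
        logGaussian_mul A c (Nat.lcm_pos (mem_Ioc.mp hd).1 (mem_Ioc.mp he).1) k
    simp_rw [this]
    refine tendsto_finsetSum _ fun d hd => tendsto_finsetSum _ fun e he => ?_
    refine Filter.Tendsto.const_mul _ ?_
    exact (hW _).comp (tendsto_natDiv_atTop (Nat.lcm_pos (mem_Ioc.mp hd).1 (mem_Ioc.mp he).1))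
  have hm : Monotone fun N : ℕ => ∑ n ∈ Ioc 0 N, dvdSum z θ n ^ 2 * logGaussian A c n :=
    fun a b hab => sum_le_sum_of_subset_of_nonneg (Ioc_subset_Ioc_right hab) fun k _ _ =>
      mul_nonneg (sq_nonneg _) (logGaussian_nonneg A c k)
  refine (hm.ge_of_tendsto hlim N).trans ?_
  have hz : (z : ℝ) ^ 2 = ∑ d ∈ Ioc 0 z, ∑ e ∈ Ioc 0 z, (1 : ℝ) := by simp [sq]
  rw [hz, mul_sum, ← sum_add_distrib]
  refine sum_le_sum fun d hd => ?_
  rw [mul_sum, ← sum_add_distrib]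
  refine sum_le_sum fun e he => ?_
  have hq : (0 : ℝ) < Nat.lcm d e := by
    exact_mod_cast Nat.lcm_pos (mem_Ioc.mp hd).1 (mem_Ioc.mp he).1
  have h1 := hWb (Nat.lcm d e)
  have h2 : exp (c - log (Nat.lcm d e) + 1 / (4 * A)) =
      exp (c + 1 / (4 * A)) * (Nat.lcm d e : ℝ) ^ (-(1 : ℝ)) := by
    rw [show c - log (Nat.lcm d e) + 1 / (4 * A) =
      c + 1 / (4 * A) + -log (Nat.lcm d e) by ring, exp_add, exp_neg,
      exp_log hq, rpow_neg_one]
  rw [h2] at h1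
  set V := √(π / A) * (exp (c + 1 / (4 * A)) * (Nat.lcm d e : ℝ) ^ (-(1 : ℝ)))
  have h3 : |θ d * θ e| ≤ 1 := by
    rw [abs_mul]
    exact mul_le_one₀ (hθ d) (abs_nonneg _) (hθ e)
  have h4 : θ d * θ e * (W (Nat.lcm d e) - V) ≤ 1 := by
    refine (le_abs_self _).trans ?_
    rw [abs_mul]
    exact mul_le_one₀ h3 (abs_nonneg _) h1
  have h5 : √(π / A) * exp (c + 1 / (4 * A)) *
      (θ d * θ e * (Nat.lcm d e : ℝ) ^ (-(1 : ℝ))) = θ d * θ e * V := by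
    simp only [V]
    ring
  rw [h5]
  linarith

theorem sum_sq_dvdSum_rpow_gaussian_le {A δ : ℝ} (hA : 0 < A) {m : ℝ} (hm : 0 < m)
    (N z : ℕ) {θ : ℕ → ℝ} (hθ : ∀ d, |θ d| ≤ 1) :
    ∑ n ∈ Ioc 0 N, dvdSum z θ n ^ 2 * ((n : ℝ) ^ (-(1 + δ)) * exp (-(A * (log n - log m) ^ 2))) ≤
      √(π / A) * m ^ (-δ) * exp (δ ^ 2 / (4 * A)) *
        (∑ d ∈ Ioc 0 z, ∑ e ∈ Ioc 0 z, θ d * θ e * (Nat.lcm d e : ℝ) ^ (-(1 : ℝ))) +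
      z ^ 2 * (m ^ (-(1 + δ)) * exp ((1 + δ) ^ 2 / (4 * A))) := by
  set l := log m
  have hpow : ∀ {u v : ℝ}, 0 < u → u ^ v = exp (v * log u) := fun {u v} hu => by
    rw [rpow_def_of_pos hu, mul_comm]
  have h := sum_sq_dvdSum_logGaussian_le hA (l - (1 + δ) / (2 * A)) N z hθ
  have hC : 0 ≤ exp (-(1 + δ) * l + (1 + δ) ^ 2 / (4 * A)) := (exp_pos _).le
  have h2 := mul_le_mul_of_nonneg_left h hC
  rw [mul_sum, mul_add] at h2
  refine le_trans (le_of_eq (sum_congr rfl fun n hn => ?_)) (h2.trans (le_of_eq ?_))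
  · have hn' : (0 : ℝ) < n := by exact_mod_cast (mem_Ioc.mp hn).1
    rw [hpow hn', logGaussian, if_neg (not_le.mpr hn'), ← exp_add, mul_left_comm, ← exp_add]
    congr 2
    field_simp
    ring
  · congr 1
    · rw [← mul_assoc]
      congr 1
      rw [hpow hm, mul_left_comm, ← exp_add, mul_assoc, ← exp_add]
      congr 2
      field_simp
      ring
    · rw [mul_comm, hpow hm, ← exp_add]

theorem integral_normSq_sum_gaussian {κ : ℝ} (hκ : 0 < κ) (S : Finset ℕ) (a l : ℕ → ℝ) :
    ∫ t : ℝ, ‖∑ n ∈ S, (a n : ℂ) * Complex.exp (-(Complex.I * t * l n))‖ ^ 2 * exp (-κ * t ^ 2) =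
      √(π / κ) * ∑ m ∈ S, ∑ n ∈ S, a m * a n *
        exp (-((l m - l n) ^ 2 / (4 * κ))) := by
  have hκ' : 0 < (κ : ℂ).re := by simpa using hκ
  have hgi : ∀ u : ℝ, MeasureTheory.Integrable fun t : ℝ =>
      Complex.exp (Complex.I * u * t) * Complex.exp (-κ * t ^ 2) := by
    intro u
    have := integrable_cexp_quadratic' (b := -(κ : ℂ)) (by simpa using hκ) (Complex.I * u) 0
    refine this.congr (Filter.Eventually.of_forall fun t => ?_)
    simp only
    rw [← Complex.exp_add]
    congr 1
    ring
  have hval : ∀ u : ℝ, ∫ t : ℝ, Complex.exp (Complex.I * u * t) * Complex.exp (-κ * t ^ 2) =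
      ((√(π / κ) * exp (-(u ^ 2 / (4 * κ))) : ℝ) : ℂ) := by
    intro u
    rw [fourierIntegral_gaussian hκ' (u : ℂ)]
    push_cast
    congr 1
    · rw [sqrt_eq_rpow, Complex.ofReal_cpow (by positivity)]
      push_cast
      rfl
    · congr 1
      ring
  have hpt : ∀ t : ℝ, ((‖∑ n ∈ S, (a n : ℂ) * Complex.exp (-(Complex.I * t * l n))‖ ^ 2 *
      exp (-κ * t ^ 2) : ℝ) : ℂ) = ∑ m ∈ S, ∑ n ∈ S, ((a m * a n : ℝ) : ℂ) *
        (Complex.exp (Complex.I * (l n - l m : ℝ) * t) * Complex.exp (-κ * t ^ 2)) := by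
    intro t
    push_cast
    rw [← Complex.mul_conj', map_sum, sum_mul_sum, sum_mul]
    refine sum_congr rfl fun m _ => ?_
    rw [sum_mul]
    refine sum_congr rfl fun n _ => ?_
    rw [map_mul, ← Complex.exp_conj, map_neg, map_mul, map_mul, Complex.conj_I,
      Complex.conj_ofReal, Complex.conj_ofReal, Complex.conj_ofReal,
      show Complex.I * (l n - l m) * t = -(Complex.I * t * l m) + -(-Complex.I * t * l n) by ring,
      Complex.exp_add]
    ring
  have key : ((∫ t : ℝ, ‖∑ n ∈ S, (a n : ℂ) * Complex.exp (-(Complex.I * t * l n))‖ ^ 2 *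
      exp (-κ * t ^ 2) : ℝ) : ℂ) = ((√(π / κ) * ∑ m ∈ S, ∑ n ∈ S, a m * a n *
        exp (-((l m - l n) ^ 2 / (4 * κ))) : ℝ) : ℂ) := by
    rw [← integral_complex_ofReal]
    simp_rw [hpt]
    rw [MeasureTheory.integral_finsetSum _ fun m _ => MeasureTheory.integrable_finsetSum _
      fun n _ => (hgi _).const_mul _]
    rw [Complex.ofReal_mul, Complex.ofReal_sum, mul_sum]
    refine sum_congr rfl fun m _ => ?_
    rw [MeasureTheory.integral_finsetSum _ fun n _ => (hgi _).const_mul _, Complex.ofReal_sum, mul_sum]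
    refine sum_congr rfl fun n _ => ?_
    rw [MeasureTheory.integral_const_mul, hval (l n - l m), ← Complex.ofReal_mul,
      ← Complex.ofReal_mul, show (l n - l m) ^ 2 = (l m - l n) ^ 2 by ring]
    congr 1
    ring
  exact_mod_cast key

theorem sum_lcm_nonneg (z : ℕ) {θ : ℕ → ℝ} (hθ : ∀ d, |θ d| ≤ 1) :
    0 ≤ ∑ d ∈ Ioc 0 z, ∑ e ∈ Ioc 0 z, θ d * θ e * (Nat.lcm d e : ℝ) ^ (-(1 : ℝ)) := by
  set S := ∑ d ∈ Ioc 0 z, ∑ e ∈ Ioc 0 z, θ d * θ e * (Nat.lcm d e : ℝ) ^ (-(1 : ℝ))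
  by_contra hneg
  push Not at hneg
  have h4 : ∀ c : ℝ, 0 ≤ √(π / 1) * exp (c + 1 / (4 * 1)) * S + (z : ℝ) ^ 2 := by
    intro c
    have := sum_sq_dvdSum_logGaussian_le one_pos c 0 z hθ
    simpa using this
  have hq : 0 < √(π / 1) := sqrt_pos.mpr (by positivity)
  have h5 : Filter.Tendsto (fun c : ℝ => √(π / 1) * exp (c + 1 / (4 * 1)) * S
      + (z : ℝ) ^ 2) Filter.atTop Filter.atBot := by
    refine Filter.tendsto_atBot_add_const_right _ _ ?_
    refine Filter.Tendsto.atTop_mul_const_of_neg hneg ?_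
    refine Filter.Tendsto.const_mul_atTop hq ?_
    exact tendsto_exp_atTop.comp (Filter.tendsto_atTop_add_const_right _ _ Filter.tendsto_id)
  obtain ⟨c, hc⟩ := (h5.eventually (Filter.eventually_lt_atBot 0)).exists
  exact absurd (h4 c) (not_le.mpr hc)

theorem integral_normSq_dirichlet_le {κ δ D₁ : ℝ} (hκ : 0 < κ) (hD₁ : 0 < D₁) (N z : ℕ)
    {θ : ℕ → ℝ} (hθ : ∀ d, |θ d| ≤ 1) (L : ℕ → ℝ) :
    ∫ t : ℝ, ‖∑ n ∈ Ioc 0 N, ((if D₁ < n then L n * dvdSum z θ n else 0 : ℝ) : ℂ) *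
        (n : ℂ) ^ (-(1 + δ + Complex.I * t))‖ ^ 2 * exp (-κ * t ^ 2) ≤
      (2 * π * exp (δ ^ 2 * κ) *
        (∑ d ∈ Ioc 0 z, ∑ e ∈ Ioc 0 z, θ d * θ e * (Nat.lcm d e : ℝ) ^ (-(1 : ℝ))) +
        √(π / κ) * z ^ 2 * exp ((1 + δ) ^ 2 * κ) / D₁) *
        ∑ m ∈ Ioc 0 N, L m ^ 2 * (m : ℝ) ^ (-(1 + 2 * δ)) := by
  set b : ℕ → ℝ := fun n => if D₁ < n then L n * dvdSum z θ n else 0 with hb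
  set a : ℕ → ℝ := fun n => b n * (n : ℝ) ^ (-(1 + δ))
  set A : ℝ := 1 / (4 * κ) with hA
  have hA0 : 0 < A := by positivity
  set Sθ := ∑ d ∈ Ioc 0 z, ∑ e ∈ Ioc 0 z, θ d * θ e * (Nat.lcm d e : ℝ) ^ (-(1 : ℝ))
  have hE : ∀ m n : ℕ, (log m - log n) ^ 2 / (4 * κ) =
      A * (log m - log n) ^ 2 := fun m n => by rw [hA]; ring
  set G : ℕ → ℕ → ℝ := fun m n => exp (-(A * (log m - log n) ^ 2)) with hG
  have hG0 : ∀ m n, 0 ≤ G m n := fun m n => (exp_pos _).le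
  have hGs : ∀ m n, G m n = G n m := fun m n => by
    simp only [hG]
    rw [show (log m - log n) ^ 2 = (log n - log m) ^ 2 by ring]
  have h1 : ∫ t : ℝ, ‖∑ n ∈ Ioc 0 N, (b n : ℂ) *
      (n : ℂ) ^ (-(1 + δ + Complex.I * t))‖ ^ 2 * exp (-κ * t ^ 2) =
      √(π / κ) * ∑ m ∈ Ioc 0 N, ∑ n ∈ Ioc 0 N, a m * a n * G m n := by
    simp_rw [hG, ← hE]
    rw [← integral_normSq_sum_gaussian hκ (Ioc 0 N) a (fun n => log n)]
    refine MeasureTheory.integral_congr_ae (Filter.Eventually.of_forall fun t => ?_)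
    simp only
    congr 3
    refine sum_congr rfl fun n hn => ?_
    have hn' : (0 : ℝ) < n := by exact_mod_cast (mem_Ioc.mp hn).1
    have hn0 : (n : ℂ) ≠ 0 := by exact_mod_cast hn'.ne'
    rw [show -(1 + (δ : ℂ) + Complex.I * t) = ((-(1 + δ) : ℝ) : ℂ) + -(Complex.I * t) by
      push_cast; ring, Complex.cpow_add _ _ hn0]
    simp only [a]
    push_cast
    rw [Complex.ofReal_cpow hn'.le, mul_assoc]
    congr 2
    · push_cast
      rfl
    · rw [Complex.cpow_def_of_ne_zero hn0, ← Complex.natCast_log]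
      congr 1
      ring
  rw [h1]
  -- pairs with both variables above the threshold
  set P : ℕ → ℕ → ℝ := fun m n => if D₁ < m then
    L m ^ 2 * dvdSum z θ n ^ 2 * (m : ℝ) ^ (-(1 + δ)) * (n : ℝ) ^ (-(1 + δ)) * G m n else 0
    with hP
  have hP0 : ∀ m n, 0 ≤ P m n := fun m n => by
    simp only [hP]
    split_ifs
    · have := hG0 m n
      positivity
    · exact le_rfl
  have h2 : ∀ m n, a m * a n * G m n ≤ (P m n + P n m) / 2 := by
    intro m n
    by_cases hm : D₁ < m
    · by_cases hn : D₁ < n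
      · simp only [a, hb, hP, if_pos hm, if_pos hn, hGs n m]
        have h3 : 0 ≤ (m : ℝ) ^ (-(1 + δ)) * (n : ℝ) ^ (-(1 + δ)) * G m n := by
          have := hG0 m n
          positivity
        nlinarith [mul_nonneg h3 (sq_nonneg (L m * dvdSum z θ n - L n * dvdSum z θ m))]
      · have : a n = 0 := by simp only [a, hb, if_neg hn, zero_mul]
        rw [this]
        have := hP0 m n
        have := hP0 n m
        simp only [mul_zero, zero_mul]
        linarith
    · have : a m = 0 := by simp only [a, hb, if_neg hm, zero_mul]
      rw [this]
      have := hP0 m n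
      have := hP0 n m
      simp only [zero_mul]
      linarith
  have h3 : ∑ m ∈ Ioc 0 N, ∑ n ∈ Ioc 0 N, a m * a n * G m n ≤
      ∑ m ∈ Ioc 0 N, ∑ n ∈ Ioc 0 N, P m n := by
    refine (sum_le_sum fun m _ => sum_le_sum fun n _ => h2 m n).trans (le_of_eq ?_)
    simp_rw [← sum_div, sum_add_distrib]
    rw [sum_comm (f := fun m n => P n m)]
    ring
  set Q := √(π / A) * exp (δ ^ 2 / (4 * A)) * Sθ + z ^ 2 * (exp ((1 + δ) ^ 2 / (4 * A)) / D₁)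
  have hS0 : 0 ≤ Sθ := sum_lcm_nonneg z hθ
  have h4 : ∀ m ∈ Ioc 0 N, ∑ n ∈ Ioc 0 N, P m n ≤ L m ^ 2 * (m : ℝ) ^ (-(1 + 2 * δ)) * Q := by
    intro m hm
    have hm' : (0 : ℝ) < m := by exact_mod_cast (mem_Ioc.mp hm).1
    have hQ : 0 ≤ Q := by positivity
    by_cases hmD : D₁ < m
    · have h5 := sum_sq_dvdSum_rpow_gaussian_le (δ := δ) hA0 hm' N z hθ
      have h6 : ∑ n ∈ Ioc 0 N, P m n = L m ^ 2 * (m : ℝ) ^ (-(1 + δ)) *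
          ∑ n ∈ Ioc 0 N, dvdSum z θ n ^ 2 * ((n : ℝ) ^ (-(1 + δ)) *
          exp (-(A * (log n - log m) ^ 2))) := by
        rw [mul_sum]
        refine sum_congr rfl fun n _ => ?_
        simp only [hP, if_pos hmD, hGs m n]
        simp only [hG]
        ring
      rw [h6]
      have e1 : (m : ℝ) ^ (-(1 + 2 * δ)) = (m : ℝ) ^ (-(1 + δ)) * (m : ℝ) ^ (-δ) := by
        rw [← rpow_add hm']
        ring_nf
      have e2 : (m : ℝ) ^ (-(1 + δ)) = (m : ℝ) ^ (-δ) * (m : ℝ)⁻¹ := by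
        rw [← rpow_neg_one, ← rpow_add hm']
        ring_nf
      rw [e1, mul_assoc (L m ^ 2), mul_assoc (L m ^ 2), mul_assoc ((m : ℝ) ^ (-(1 + δ)))]
      refine mul_le_mul_of_nonneg_left (mul_le_mul_of_nonneg_left (h5.trans ?_) (by positivity))
        (sq_nonneg _)
      have e3 : (m : ℝ)⁻¹ ≤ D₁⁻¹ := inv_anti₀ hD₁ hmD.le
      rw [e2]
      have e4 : (z : ℝ) ^ 2 * ((m : ℝ) ^ (-δ) * (m : ℝ)⁻¹ * exp ((1 + δ) ^ 2 / (4 * A))) ≤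
          (z : ℝ) ^ 2 * ((m : ℝ) ^ (-δ) * D₁⁻¹ * exp ((1 + δ) ^ 2 / (4 * A))) := by
        gcongr
      refine (add_le_add_right e4 _).trans (le_of_eq ?_)
      change _ + _ = _ * Q
      rw [show (∑ d ∈ Ioc 0 z, ∑ e ∈ Ioc 0 z, θ d * θ e * (Nat.lcm d e : ℝ) ^ (-(1 : ℝ))) = Sθ
        from rfl]
      simp only [Q]
      ring
    · simp only [hP, if_neg hmD, sum_const_zero]
      positivity
  have hsq : √(π / κ) * √(π / A) = 2 * π := by
    rw [← sqrt_mul (by positivity), hA,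
      show π / κ * (π / (1 / (4 * κ))) = (2 * π) ^ 2 by field_simp; ring]
    exact sqrt_sq (by positivity)
  have hA4 : ∀ u : ℝ, u / (4 * A) = u * κ := fun u => by
    rw [hA]
    field_simp
  calc _ ≤ √(π / κ) * ∑ m ∈ Ioc 0 N, L m ^ 2 * (m : ℝ) ^ (-(1 + 2 * δ)) * Q :=
        mul_le_mul_of_nonneg_left (h3.trans (sum_le_sum h4)) (sqrt_nonneg _)
    _ = _ := by
      rw [← sum_mul, ← hsq]
      simp only [Q, hA4]
      ring

theorem sum_rpow_le_one_add {η : ℝ} (hη : 0 < η) (N : ℕ) :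
    ∑ k ∈ Ioc 0 N, (k : ℝ) ^ (-(1 + η)) ≤ 1 + 1 / η := by
  have hstep : ∀ k : ℕ, 0 < k →
      ((k + 1 : ℕ) : ℝ) ^ (-(1 + η)) ≤ 1 / η * ((k : ℝ) ^ (-η) - ((k + 1 : ℕ) : ℝ) ^ (-η)) := by
    intro k hk
    have hk' : (0 : ℝ) < k := by exact_mod_cast hk
    have h1 : (0 : ℝ) < k + 1 := by positivity
    push_cast
    -- `(k/(k+1))^(-η) ≥ 1 + η/(k+1)`
    have hb : 1 + η * (1 / (k + 1)) ≤ (k / (k + 1) : ℝ) ^ (-η) := by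
      have h2 : (0 : ℝ) < k / (k + 1) := by positivity
      rw [rpow_def_of_pos h2]
      have h3 := log_le_sub_one_of_pos h2
      have h4 : (k / (k + 1) : ℝ) - 1 = -(1 / (k + 1)) := by
        field_simp
        ring
      have h5 := add_one_le_exp (log (k / (k + 1) : ℝ) * -η)
      rw [h4] at h3
      nlinarith
    have h6 : (k : ℝ) ^ (-η) = (k / (k + 1) : ℝ) ^ (-η) * ((k : ℝ) + 1) ^ (-η) := by
      rw [← mul_rpow (by positivity) h1.le]
      congr 1
      field_simp
    have h7 : ((k : ℝ) + 1) ^ (-(1 + η)) = ((k : ℝ) + 1) ^ (-η) * (1 / (k + 1)) := by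
      rw [one_div, ← rpow_neg_one, ← rpow_add h1]
      ring_nf
    have h8 : 0 < ((k : ℝ) + 1) ^ (-η) := rpow_pos_of_pos h1 _
    rw [h6, h7]
    have h9 := mul_le_mul_of_nonneg_left hb h8.le
    rw [div_mul_eq_mul_div, le_div_iff₀ hη]
    nlinarith
  have hmain : ∀ N : ℕ, ∑ k ∈ Ioc 0 (N + 1), (k : ℝ) ^ (-(1 + η)) ≤
      1 + 1 / η * (1 - ((N + 1 : ℕ) : ℝ) ^ (-η)) := by
    intro N
    induction N with
    | zero => simp
    | succ N ih =>
      rw [sum_Ioc_succ_top (Nat.zero_le _)]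
      have := hstep (N + 1) (Nat.succ_pos N)
      linarith
  rcases N with _ | N
  · simp
    positivity
  · refine (hmain N).trans ?_
    have h1 : 0 ≤ ((N + 1 : ℕ) : ℝ) ^ (-η) := by positivity
    have h2 : 0 ≤ 1 / η := by positivity
    nlinarith

theorem sum_sq_dvdSum_rpow_le {η : ℝ} (hη : 0 < η) (N D : ℕ) (x : ℕ → ℝ)
    (hx : ∀ n, ¬Squarefree n → x n = 0) :
    ∑ n ∈ Ioc 0 N, dvdSum D x n ^ 2 * (n : ℝ) ^ (-(1 + η)) ≤ (1 + 1 / η) *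
        ∑ d ∈ Ioc 0 D, ∑ e ∈ Ioc 0 D, x d * x e * (Nat.lcm d e : ℝ) ^ (-(1 + η)) := by
  set S := ∑ d ∈ Ioc 0 D, ∑ e ∈ Ioc 0 D, x d * x e * (Nat.lcm d e : ℝ) ^ (-(1 + η)) with hS
  have hS0 : 0 ≤ S := by
    rw [hS, sum_lcm_eq_sum_sq D x hx (1 + η)]
    refine sum_nonneg fun r _ => mul_nonneg (jordan_nonneg (by positivity) r) (sq_nonneg _)
  have hm1 : Monotone fun N : ℕ => ∑ k ∈ Ioc 0 N, (k : ℝ) ^ (-(1 + η)) := fun a b hab =>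
    sum_le_sum_of_subset_of_nonneg (Ioc_subset_Ioc_right hab) fun k _ _ => by positivity
  obtain ⟨Z, hZ⟩ : ∃ Z, Filter.Tendsto (fun N : ℕ => ∑ k ∈ Ioc 0 N, (k : ℝ) ^ (-(1 + η)))
      Filter.atTop (nhds Z) := by
    refine ⟨_, tendsto_atTop_ciSup hm1 ⟨1 + 1 / η, ?_⟩⟩
    rintro _ ⟨N, rfl⟩
    exact sum_rpow_le_one_add hη N
  have hZ1 : Z ≤ 1 + 1 / η := le_of_tendsto hZ (Filter.Eventually.of_forall (sum_rpow_le_one_add hη))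
  have hlim : Filter.Tendsto (fun N : ℕ => ∑ n ∈ Ioc 0 N, dvdSum D x n ^ 2 * (n : ℝ) ^ (-(1 + η)))
      Filter.atTop (nhds (∑ d ∈ Ioc 0 D, ∑ e ∈ Ioc 0 D,
        x d * x e * ((Nat.lcm d e : ℝ) ^ (-(1 + η)) * Z))) := by
    simp_rw [sq]
    have : ∀ N : ℕ, _ := fun N => sum_dvdSum_mul N D D x x (fun n => (n : ℝ) ^ (-(1 + η)))
    simp_rw [this]
    refine tendsto_finsetSum _ fun d hd => tendsto_finsetSum _ fun e he => ?_
    refine Filter.Tendsto.const_mul _ ?_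
    simp only [Nat.cast_mul]
    have h2 : ∀ N : ℕ, ∑ k ∈ Ioc 0 (N / Nat.lcm d e),
        ((Nat.lcm d e : ℝ) * k) ^ (-(1 + η)) = (Nat.lcm d e : ℝ) ^ (-(1 + η)) *
          ∑ k ∈ Ioc 0 (N / Nat.lcm d e), (k : ℝ) ^ (-(1 + η)) := fun N => by
      rw [mul_sum]
      exact sum_congr rfl fun k _ => mul_rpow (Nat.cast_nonneg _) (Nat.cast_nonneg _)
    simp_rw [h2]
    exact (hZ.comp (tendsto_natDiv_atTop
      (Nat.lcm_pos (mem_Ioc.mp hd).1 (mem_Ioc.mp he).1))).const_mul _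
  have hm : Monotone fun N : ℕ => ∑ n ∈ Ioc 0 N, dvdSum D x n ^ 2 * (n : ℝ) ^ (-(1 + η)) :=
    fun a b hab => sum_le_sum_of_subset_of_nonneg (Ioc_subset_Ioc_right hab) fun k _ _ => by
      positivity
  refine (hm.ge_of_tendsto hlim N).trans ?_
  have : ∑ d ∈ Ioc 0 D, ∑ e ∈ Ioc 0 D, x d * x e * ((Nat.lcm d e : ℝ) ^ (-(1 + η)) * Z) =
      Z * S := by
    rw [hS, mul_sum]
    refine sum_congr rfl fun d _ => ?_
    rw [mul_sum]
    exact sum_congr rfl fun e _ => by ring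
  rw [this]
  exact mul_le_mul_of_nonneg_right hZ1 hS0

/-- The product of two Dirichlet polynomials twisted by least common multiples; it is such that
`ζ s * lcmSum D z x θ s` is the Dirichlet series of `dvdSum D x n * dvdSum z θ n`. -/
noncomputable def lcmSum (D z : ℕ) (x θ : ℕ → ℝ) (s : ℂ) : ℂ :=
  ∑ d ∈ Ioc 0 D, ∑ e ∈ Ioc 0 z, ((x d * θ e : ℝ) : ℂ) * (Nat.lcm d e : ℂ) ^ (-s)

theorem differentiable_lcmSum (D z : ℕ) (x θ : ℕ → ℝ) : Differentiable ℂ (lcmSum D z x θ) := by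
  unfold lcmSum
  refine Differentiable.fun_sum fun d hd => Differentiable.fun_sum fun e he => ?_
  refine Differentiable.const_mul ?_ _
  intro s
  refine DifferentiableAt.const_cpow (by fun_prop) (Or.inl ?_)
  exact_mod_cast (Nat.lcm_pos (mem_Ioc.mp hd).1 (mem_Ioc.mp he).1).ne'

theorem tendsto_sum_cpow_neg {s : ℂ} (hs : 1 < s.re) :
    Filter.Tendsto (fun N : ℕ => ∑ k ∈ Ioc 0 N, (k : ℂ) ^ (-s)) Filter.atTop
      (nhds (riemannZeta s)) := by
  rw [zeta_eq_tsum_one_div_nat_cpow hs]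
  have h := ((Complex.summable_one_div_nat_cpow.mpr hs).hasSum.tendsto_sum_nat).comp
    (Filter.tendsto_add_atTop_nat 1)
  refine h.congr fun N => ?_
  simp only [Function.comp]
  have hs0 : s ≠ 0 := by
    rintro rfl
    simp at hs
    linarith
  rw [range_eq_Ico, sum_eq_sum_Ico_succ_bot (Nat.succ_pos N)]
  simp only [Nat.cast_zero, Complex.zero_cpow hs0, div_zero, zero_add]
  refine sum_congr (by ext; simp; omega) fun k _ => ?_
  rw [Complex.cpow_neg, one_div]

theorem tendsto_sum_dvdSum_cpow {s : ℂ} (hs : 1 < s.re) (D z : ℕ) (x θ : ℕ → ℝ) :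
    Filter.Tendsto (fun N : ℕ => ∑ n ∈ Ioc 0 N, ((dvdSum D x n * dvdSum z θ n : ℝ) : ℂ) *
      (n : ℂ) ^ (-s)) Filter.atTop (nhds (riemannZeta s * lcmSum D z x θ s)) := by
  have hc : ∀ (D : ℕ) (x : ℕ → ℝ) (n : ℕ), ((dvdSum D x n : ℝ) : ℂ) =
      dvdSum D (fun d => (x d : ℂ)) n := fun D x n => by
    rw [dvdSum, dvdSum, Complex.ofReal_sum]
    exact sum_congr rfl fun d _ => by split_ifs <;> simp
  have h : ∀ N : ℕ, ∑ n ∈ Ioc 0 N, ((dvdSum D x n * dvdSum z θ n : ℝ) : ℂ) * (n : ℂ) ^ (-s) =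
      ∑ d ∈ Ioc 0 D, ∑ e ∈ Ioc 0 z, ((x d * θ e : ℝ) : ℂ) * ((Nat.lcm d e : ℂ) ^ (-s) *
        ∑ k ∈ Ioc 0 (N / Nat.lcm d e), (k : ℂ) ^ (-s)) := by
    intro N
    have := sum_dvdSum_mul N D z (fun d => (x d : ℂ)) (fun d => (θ d : ℂ)) (fun n => (n : ℂ) ^ (-s))
    simp_rw [Complex.ofReal_mul, hc] at this ⊢
    rw [this]
    refine sum_congr rfl fun d _ => sum_congr rfl fun e _ => ?_
    rw [mul_sum _ _ ((Nat.lcm d e : ℂ) ^ (-s))]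
    congr 1
    exact sum_congr rfl fun k _ => by
      rw [Nat.cast_mul, Complex.natCast_mul_natCast_cpow]
  simp_rw [h]
  rw [lcmSum, mul_sum]
  refine tendsto_finsetSum _ fun d hd => ?_
  rw [mul_sum]
  refine tendsto_finsetSum _ fun e he => ?_
  rw [show riemannZeta s * (((x d * θ e : ℝ) : ℂ) * (Nat.lcm d e : ℂ) ^ (-s)) =
    ((x d * θ e : ℝ) : ℂ) * ((Nat.lcm d e : ℂ) ^ (-s) * riemannZeta s) by ring]
  exact (((tendsto_sum_cpow_neg hs).comp (tendsto_natDiv_atTop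
    (Nat.lcm_pos (mem_Ioc.mp hd).1 (mem_Ioc.mp he).1))).const_mul _).const_mul _

theorem integral_normSq_mollified_le {κ δ D₁ : ℝ} (hκ : 0 < κ) (hδ : 0 < δ) (hD₁ : 1 ≤ D₁)
    {D z : ℕ} (hD : 0 < D) (hz : 0 < z) {x θ : ℕ → ℝ} (hx : ∀ d, |x d| ≤ 1) (hθ : ∀ d, |θ d| ≤ 1)
    (hxs : ∀ n, ¬Squarefree n → x n = 0) (hx1 : x 1 = 1) (hθ1 : θ 1 = 1)
    (hx0 : ∀ n : ℕ, 1 < n → (n : ℝ) ≤ D₁ → dvdSum D x n = 0) :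
    ∫ t : ℝ, ‖riemannZeta (1 + δ + Complex.I * t) * lcmSum D z x θ (1 + δ + Complex.I * t) - 1‖ ^ 2 *
        exp (-κ * t ^ 2) ≤
      (2 * π * exp (δ ^ 2 * κ) *
        (∑ d ∈ Ioc 0 z, ∑ e ∈ Ioc 0 z, θ d * θ e * (Nat.lcm d e : ℝ) ^ (-(1 : ℝ))) +
        √(π / κ) * z ^ 2 * exp ((1 + δ) ^ 2 * κ) / D₁) *
        ((1 + 1 / (2 * δ)) *
          ∑ d ∈ Ioc 0 D, ∑ e ∈ Ioc 0 D, x d * x e * (Nat.lcm d e : ℝ) ^ (-(1 + 2 * δ))) := by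
  have hs : ∀ t : ℝ, 1 < (1 + δ + Complex.I * t : ℂ).re := fun t => by simpa using hδ
  set F : ℕ → ℝ → ℂ := fun N t => ∑ n ∈ Ioc 0 N,
    ((if D₁ < n then dvdSum D x n * dvdSum z θ n else 0 : ℝ) : ℂ) *
      (n : ℂ) ^ (-(1 + δ + Complex.I * t)) with hF
  have h1 : ∀ t : ℝ, Filter.Tendsto (fun N => F N t) Filter.atTop
      (nhds (riemannZeta (1 + δ + Complex.I * t) * lcmSum D z x θ (1 + δ + Complex.I * t) - 1)) := by
    intro t
    refine ((tendsto_sum_dvdSum_cpow (hs t) D z x θ).sub_const 1).congr' ?_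
    filter_upwards [Filter.eventually_ge_atTop 1] with N hN
    have hone : ∀ (D : ℕ) (x : ℕ → ℝ), 0 < D → x 1 = 1 → dvdSum D x 1 = 1 := by
      intro D x hD hx1
      rw [dvdSum, sum_eq_single 1]
      · simp [hx1]
      · intro d _ hd
        rw [if_neg (by simpa using hd)]
      · intro h
        exact absurd (mem_Ioc.mpr ⟨Nat.one_pos, hD⟩) h
    rw [hF]
    simp only
    have hmem : 1 ∈ Ioc 0 N := mem_Ioc.mpr ⟨Nat.one_pos, hN⟩
    rw [← add_sum_erase _ _ hmem, ← add_sum_erase _ _ hmem, hone D x hD hx1, hone z θ hz hθ1,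
      if_neg (by push_cast; linarith)]
    simp only [mul_one, Nat.cast_one, Complex.one_cpow, Complex.ofReal_one, Complex.ofReal_zero,
      zero_add, add_sub_cancel_left]
    refine sum_congr rfl fun n hn => ?_
    have hn1 : 1 < n := by
      have h2 := (mem_Ioc.mp (mem_erase.mp hn).2).1
      have h3 := (mem_erase.mp hn).1
      omega
    by_cases h : D₁ < n
    · rw [if_pos h]
    · rw [if_neg h, hx0 n hn1 (not_lt.mp h)]
      simp
  set C : ℝ := D * z * (1 + 1 / δ)
  have h2 : ∀ N t, ‖F N t‖ ≤ C := by
    intro N t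
    refine (norm_sum_le _ _).trans ?_
    calc _ ≤ ∑ n ∈ Ioc 0 N, (D * z : ℝ) * (n : ℝ) ^ (-(1 + δ)) := by
          refine sum_le_sum fun n hn => ?_
          rw [norm_mul, Complex.norm_natCast_cpow_of_pos (mem_Ioc.mp hn).1]
          have hre : (-(1 + δ + Complex.I * t : ℂ)).re = -(1 + δ) := by simp
          rw [hre, Complex.norm_real]
          refine mul_le_mul_of_nonneg_right ?_ (by positivity)
          split_ifs
          · rw [norm_mul]
            exact mul_le_mul (abs_dvdSum_le hx n) (abs_dvdSum_le hθ n) (norm_nonneg _)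
              (by positivity)
          · rw [norm_zero]
            positivity
      _ ≤ C := by
          rw [← mul_sum]
          exact mul_le_mul_of_nonneg_left (sum_rpow_le_one_add hδ N) (by positivity)
  have hFc : ∀ N, Continuous (F N) := by
    intro N
    refine continuous_finsetSum _ fun n hn => Continuous.mul continuous_const ?_
    have hn0 : (n : ℂ) ≠ 0 := by exact_mod_cast (mem_Ioc.mp hn).1.ne'
    refine Continuous.const_cpow (by fun_prop) (Or.inl hn0)
  have h3 : Filter.Tendsto (fun N => ∫ t : ℝ, ‖F N t‖ ^ 2 * exp (-κ * t ^ 2)) Filter.atTop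
      (nhds (∫ t : ℝ, ‖riemannZeta (1 + δ + Complex.I * t) *
        lcmSum D z x θ (1 + δ + Complex.I * t) - 1‖ ^ 2 * exp (-κ * t ^ 2))) := by
    refine MeasureTheory.tendsto_integral_of_dominated_convergence
      (fun t => C ^ 2 * exp (-κ * t ^ 2)) ?_ ?_ ?_ ?_
    · intro N
      have := hFc N
      exact Continuous.aestronglyMeasurable (by fun_prop)
    · exact (integrable_exp_neg_mul_sq hκ).const_mul _
    · intro N
      refine Filter.Eventually.of_forall fun t => ?_
      rw [Real.norm_of_nonneg (by positivity)]
      have := h2 N t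
      gcongr
    · exact Filter.Eventually.of_forall fun t => (((h1 t).norm.pow 2).mul_const _)
  refine le_of_tendsto h3 (Filter.Eventually.of_forall fun N => ?_)
  refine (integral_normSq_dirichlet_le hκ (by linarith) N z hθ (dvdSum D x)).trans ?_
  refine mul_le_mul_of_nonneg_left (sum_sq_dvdSum_rpow_le (by positivity) N D x hxs) ?_
  have hS := sum_lcm_nonneg z hθ
  positivity

/-- An entire mollifier of `ζ` that is small in mean square just to the right of `Re s = 1`. -/
theorem exists_mollifier {κ δ D₁ D₂ y : ℝ} (hκ : 0 < κ) (hδ : 0 < δ) (hD₁ : 1 ≤ D₁) (hD : D₁ < D₂)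
    (hy : 1 < y) : ∃ M : ℂ → ℂ, Differentiable ℂ M ∧ (∀ s : ℂ, 0 ≤ s.re → ‖M s‖ ≤ D₂ * y) ∧
      ∫ t : ℝ, ‖riemannZeta (1 + δ + Complex.I * t) * M (1 + δ + Complex.I * t) - 1‖ ^ 2 *
        exp (-κ * t ^ 2) ≤
      (2 * π * exp (δ ^ 2 * κ) / log y + √(π / κ) * y ^ 2 * exp ((1 + δ) ^ 2 * κ) / D₁) *
        ((1 + 1 / (2 * δ)) * (4 * (log D₂ + 1) * (1 + 2 * δ * log D₂) ^ 2 /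
          log (D₂ / D₁) ^ 2)) := by
  have hD2 : 1 < D₂ := hD₁.trans_lt hD
  set D := ⌊D₂⌋₊ with hDd
  set z := ⌊y⌋₊ with hzd
  have hD0 : 0 < D := Nat.floor_pos.mpr hD2.le
  have hz0 : 0 < z := Nat.floor_pos.mpr hy.le
  have hDle : (D : ℝ) ≤ D₂ := Nat.floor_le (by linarith)
  have hzle : (z : ℝ) ≤ y := Nat.floor_le (by linarith)
  have hx := abs_barbanVehov_le hD₁ hD
  have hθ := abs_selbergWeight_le hz0
  have hlog : 0 < log y := log_pos hy
  refine ⟨lcmSum D z (barbanVehov D₁ D₂) (selbergWeight z), differentiable_lcmSum _ _ _ _,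
    fun s hs => ?_, ?_⟩
  · calc _ ≤ ∑ d ∈ Ioc 0 D, ∑ e ∈ Ioc 0 z, (1 : ℝ) := by
          refine (norm_sum_le _ _).trans (sum_le_sum fun d hd => ?_)
          refine (norm_sum_le _ _).trans (sum_le_sum fun e he => ?_)
          have hl := Nat.lcm_pos (mem_Ioc.mp hd).1 (mem_Ioc.mp he).1
          rw [norm_mul, Complex.norm_natCast_cpow_of_pos hl, Complex.norm_real, norm_mul,
            Complex.neg_re]
          refine mul_le_one₀ (mul_le_one₀ (hx d) (norm_nonneg _) (hθ e)) (by positivity) ?_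
          exact rpow_le_one_of_one_le_of_nonpos (by exact_mod_cast hl) (by linarith)
      _ = D * z := by simp
      _ ≤ D₂ * y := by gcongr
  · have hkey := integral_normSq_mollified_le hκ hδ hD₁ hD0 hz0 hx hθ
      (fun n hn => barbanVehov_of_not_squarefree _ _ hn) (barbanVehov_one hD₁ hD)
      (selbergWeight_one hz0) ?_
    · refine hkey.trans ?_
      rw [sum_selbergWeight_lcm hz0]
      have hS : (selbergSum z)⁻¹ ≤ (log y)⁻¹ := by
        refine inv_anti₀ hlog (le_trans ?_ (log_le_selbergSum z))
        exact log_le_log (by linarith) (Nat.lt_floor_add_one y).le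
      have hB := sum_barbanVehov_lcm_le hD₁ hD (η := 2 * δ) (by positivity)
      have hS0 := (inv_pos.mpr (selbergSum_pos hz0)).le
      have hL : 0 ≤ 4 * (log D₂ + 1) * (1 + 2 * δ * log D₂) ^ 2 /
          log (D₂ / D₁) ^ 2 := by
        have := log_pos hD2
        positivity
      refine mul_le_mul ?_ (mul_le_mul_of_nonneg_left hB (by positivity)) ?_ ?_
      · rw [div_eq_mul_inv _ (log y)]
        gcongr
      · refine mul_nonneg (by positivity) ?_
        rw [sum_lcm_eq_sum_sq D _ (fun n hn => barbanVehov_of_not_squarefree _ _ hn) (1 + 2 * δ)]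
        exact sum_nonneg fun r _ => mul_nonneg (jordan_nonneg (by positivity) r) (sq_nonneg _)
      · positivity
    · intro n hn hnD
      rw [← sum_divisors_barbanVehov hD₁ hD hn hnD, dvdSum, ← sum_filter]
      refine sum_congr ?_ fun _ _ => rfl
      ext d
      simp only [mem_filter, mem_Ioc, Nat.mem_divisors]
      constructor
      · rintro ⟨_, h⟩
        exact ⟨h, by omega⟩
      · rintro ⟨h, _⟩
        refine ⟨⟨Nat.pos_of_dvd_of_pos h (by omega), ?_⟩, h⟩
        refine (Nat.le_of_dvd (by omega) h).trans (Nat.le_floor ?_)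
        linarith

end

section

open Complex hiding exp log exp_add exp_neg exp_zero exp_nat_mul cos_zero
open Filter Topology MeasureTheory ComplexConjugate
open ArithmeticFunction (vonMangoldt vonMangoldt_nonneg)
open Real

theorem exp_nine_gt : 8096 < exp 9 := by
  have h := exp_three_gt
  have h2 : exp 9 = exp 3 ^ 3 := by rw [← exp_nat_mul]; norm_num
  have h3 : (20.08 : ℝ) ^ 3 < exp 3 ^ 3 := by gcongr
  rw [h2]
  exact lt_trans (by norm_num) h3

theorem exp_nine_half_gt : 72 < exp (9 / 2) := by
  have h := exp_three_gt
  have h1 := quadratic_le_exp_of_nonneg (show (0 : ℝ) ≤ 3 / 2 by norm_num)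
  rw [show (9 / 2 : ℝ) = 3 + 3 / 2 by norm_num, exp_add]
  nlinarith

theorem exp_mul_one_sub_le_one (x : ℝ) : exp x * (1 - x) ≤ 1 := by
  have h := mul_le_mul_of_nonneg_left (add_one_le_exp (-x)) (exp_pos x).le
  rw [← exp_add, add_neg_cancel, exp_zero] at h
  linarith

theorem exists_mollifier_of_le_exp {L l δ : ℝ} (hL : 9 ≤ L) (hδ : δ = 1 / (16 * L)) (hl : 40 ≤ l)
    (hl' : l ≤ 2.1 * exp L) : ∃ M : ℂ → ℂ, Differentiable ℂ M ∧
      (∀ s : ℂ, 0 ≤ s.re → ‖M s‖ ≤ exp (5.5 * L)) ∧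
      ∫ t : ℝ, ‖riemannZeta (1 + δ + Complex.I * t) * M (1 + δ + Complex.I * t) - 1‖ ^ 2 *
        exp (-(1 / (25 * l ^ 2)) * t ^ 2) ≤ 1060 / L := by
  have hL0 : 0 < L := by linarith
  have hl0 : 0 < l := by linarith
  have hδ0 : 0 < δ := by rw [hδ]; positivity
  have hδ1 : δ ≤ 0.01 := by
    rw [hδ, div_le_iff₀ (by positivity)]
    linarith
  obtain ⟨M, hM, hMN, hI⟩ := exists_mollifier (κ := 1 / (25 * l ^ 2)) (δ := δ)
    (D₁ := exp (5 / 2 * L)) (D₂ := exp (5 * L)) (y := exp (L / 2)) (by positivity) hδ0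
    (one_le_exp (by positivity)) (exp_lt_exp.mpr (by linarith))
    (Real.one_lt_exp_iff.mpr (by positivity))
  refine ⟨M, hM, fun s hs => (hMN s hs).trans ?_, hI.trans ?_⟩
  · rw [← exp_add]
    exact exp_le_exp.mpr (by linarith)
  rw [← Real.exp_sub, Real.log_exp, Real.log_exp, Real.log_exp]
  have hκ : 1 / (25 * l ^ 2) ≤ 0.0001 := by
    rw [div_le_iff₀ (by positivity)]
    nlinarith
  have hκ0 : 0 < 1 / (25 * l ^ 2) := by positivity
  have hexp : ∀ x : ℝ, x ≤ 1.1 → exp (x * (1 / (25 * l ^ 2))) ≤ 1.001 := by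
    intro x hx
    have h1 : x * (1 / (25 * l ^ 2)) ≤ 0.0009 := by nlinarith
    have h2 := exp_mul_one_sub_le_one 0.0009
    exact (exp_le_exp.mpr h1).trans (by linarith)
  have hA : 2 * π * exp (δ ^ 2 * (1 / (25 * l ^ 2))) / (L / 2) ≤ 12.6 / L := by
    rw [div_le_div_iff₀ (by positivity) hL0]
    have h1 := hexp (δ ^ 2) (by nlinarith)
    have h2 := pi_lt_d4
    have h3 : π * exp (δ ^ 2 * (1 / (25 * l ^ 2))) ≤ 3.1416 * 1.001 :=
      mul_le_mul h2.le h1 (exp_pos _).le (by norm_num)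
    nlinarith
  have hs : √(π / (1 / (25 * l ^ 2))) ≤ 8.863 * l := by
    rw [sqrt_le_iff]
    refine ⟨by positivity, ?_⟩
    rw [div_div_eq_mul_div, div_one, mul_pow]
    nlinarith [pi_lt_d4, sq_nonneg l]
  have hy : exp (L / 2) ^ 2 = exp L := by
    rw [← exp_nat_mul]
    congr 1
    push_cast
    ring
  have hB : √(π / (1 / (25 * l ^ 2))) * exp (L / 2) ^ 2 *
      exp ((1 + δ) ^ 2 * (1 / (25 * l ^ 2))) / exp (5 / 2 * L) ≤ 2.4 / L := by
    have h1 := hexp ((1 + δ) ^ 2) (by nlinarith)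
    have h2 : 8 * L ≤ exp (L / 2) := by
      have h3 := add_one_le_exp ((L - 9) / 2)
      have h4 := exp_nine_half_gt
      rw [show L / 2 = 9 / 2 + (L - 9) / 2 by ring, exp_add]
      nlinarith
    have h5 : exp (5 / 2 * L) = exp L * exp L * exp (L / 2) := by
      rw [← exp_add, ← exp_add]
      congr 1
      ring
    rw [hy, h5, div_le_div_iff₀ (by positivity) hL0]
    calc _ ≤ (8.863 * (2.1 * exp L)) * exp L * 1.001 * (exp (L / 2) / 8) := by
          gcongr
          · exact hs.trans (by linarith)
          · linarith
      _ ≤ _ := by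
          have : 0 < exp L * exp L * exp (L / 2) := by positivity
          linarith
  have hC : (1 + 1 / (2 * δ)) * (4 * (5 * L + 1) * (1 + 2 * δ * (5 * L)) ^ 2 /
      (5 * L - 5 / 2 * L) ^ 2) ≤ 70.2 := by
    have e : (1 + 1 / (2 * δ)) * (4 * (5 * L + 1) * (1 + 2 * δ * (5 * L)) ^ 2 /
        (5 * L - 5 / 2 * L) ^ 2) = 1.69 * (8 * L + 1) * (5 * L + 1) / L ^ 2 := by
      rw [hδ, show 5 * L - 5 / 2 * L = 5 / 2 * L by ring]
      field_simp
      ring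
    rw [e, div_le_iff₀ (by positivity)]
    nlinarith
  calc _ ≤ (12.6 / L + 2.4 / L) * 70.2 := by
        refine mul_le_mul (add_le_add hA hB) hC ?_ (by positivity)
        positivity
    _ = 1053 / L := by ring
    _ ≤ _ := by gcongr; norm_num

theorem exists_sum_norm_sieveFun_le {L l : ℝ} (hL : 9 ≤ L) (hl : 40 ≤ l)
    (hl' : l ≤ 2.1 * exp L) : ∃ M : ℂ → ℂ, ∀ u : Finset ZetaZero, (∀ i ∈ u, 1 / 2 < i.val.re) →
      ∑ i ∈ u, ‖sieveFun M (19 * L) (1 / (24 * l ^ 2)) i.val‖ ≤ 18900 := by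
  obtain ⟨δ, hδ⟩ : ∃ δ, δ = 1 / (16 * L) := ⟨_, rfl⟩
  have hL0 : 0 < L := by linarith
  have hl0 : 0 < l := by linarith
  have hδ0 : 0 < δ := by rw [hδ]; positivity
  have hδ1 : δ ≤ 0.007 := by
    rw [hδ, div_le_iff₀ (by positivity)]
    linarith
  obtain ⟨M, hM, hMN, hI⟩ := exists_mollifier_of_le_exp hL hδ hl hl'
  refine ⟨M, fun u hu => (sum_norm_sieveFun_le hM (one_le_exp (by positivity)) hMN
    (by positivity : 0 ≤ 19 * L) hl hδ0 (by linarith) u hu).trans ?_⟩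
  have hK : δ + 1 / δ + log l / 2 ≤ 16.57 * L := by
    have h1 : 1 / δ = 16 * L := by rw [hδ, one_div_one_div]
    have h2 : log l ≤ L + 1.1 := by
      have h3 := log_le_sub_one_of_pos (show (0 : ℝ) < 2.1 by norm_num)
      refine (log_le_log hl0 hl').trans ?_
      rw [Real.log_mul (by norm_num) (exp_pos _).ne', Real.log_exp]
      linarith
    linarith
  have hE : exp (δ * (19 * L) + δ ^ 2) ≤ 3.35 := by
    have h1 : δ * (19 * L) + δ ^ 2 ≤ 1 + 0.188 := by
      have : δ * (19 * L) = 19 / 16 := by rw [hδ]; field_simp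
      nlinarith
    refine (exp_le_exp.mpr h1).trans ?_
    rw [exp_add]
    have h2 := exp_mul_one_sub_le_one 0.188
    have h3 := exp_one_lt_d9
    have h4 : exp 0.188 ≤ 1.2316 := by linarith
    calc _ ≤ (2.7182818286 : ℝ) * 1.2316 := mul_le_mul h3.le h4 (exp_pos _).le (by norm_num)
      _ ≤ _ := by norm_num
  have h1 : (δ + 1 / δ + log l / 2) * exp (δ * (19 * L) + δ ^ 2) / π *
      (∫ t : ℝ, ‖riemannZeta (1 + δ + I * t) * M (1 + δ + I * t) - 1‖ ^ 2 *
        exp (-(1 / (25 * l ^ 2)) * t ^ 2)) ≤ 18800 := by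
    calc _ ≤ 16.57 * L * 3.35 / 3.14 * (1060 / L) := by
          have := pi_gt_d2
          have hlog : 0 ≤ log l := log_nonneg (by linarith)
          gcongr
      _ ≤ _ := by
          field_simp
          norm_num
  have h2 : 1.6e8 * exp (5.5 * L) ^ 2 * l ^ 4 * exp (-0.9 * (19 * L)) ≤ 100 := by
    have e9 : exp (-18) ≤ 1 / 8096 ^ 2 := by
      rw [exp_neg, one_div, inv_le_inv₀ (exp_pos _) (by norm_num),
        show (18 : ℝ) = 9 + 9 by norm_num, exp_add]
      nlinarith [exp_nine_gt]
    calc _ ≤ 1.6e8 * exp (5.5 * L) ^ 2 * (2.1 * exp L) ^ 4 *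
          exp (-0.9 * (19 * L)) := by gcongr
      _ = 1.6e8 * 2.1 ^ 4 * exp (-2.1 * L) := by
          rw [mul_pow, ← exp_nat_mul, ← exp_nat_mul,
            show (-2.1 * L : ℝ) = (2 : ℕ) * (5.5 * L) + (4 : ℕ) * L + -0.9 * (19 * L) by
              push_cast; ring, exp_add, exp_add]
          ring
      _ ≤ 1.6e8 * 2.1 ^ 4 * (1 / 8096 ^ 2) := by
          gcongr
          exact (exp_le_exp.mpr (by linarith)).trans e9
      _ ≤ _ := by norm_num
  linarith

theorem le_norm_sieveFun (M : ℂ → ℂ) {L l : ℝ} (hl : 40 ≤ l) {i : ZetaZero} (hi : 1 / 2 < i.val.re) :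
    25 / 26 * exp (-(19 * L * (1 - i.val.re)) - relHeight l i / 4) ≤
      ‖sieveFun M (19 * L) (1 / (24 * l ^ 2)) i.val‖ := by
  have h5 := i.five_le_abs_im hi
  have h25 : 25 ≤ i.val.im ^ 2 := by
    rw [← sq_abs]
    nlinarith
  have h1 := i.re_lt_one
  have h0 := i.re_pos
  have hne : i.val ≠ 1 := fun h => by
    rw [h, one_re] at h1
    exact lt_irrefl _ h1
  rw [norm_sieveFun, mollified_eq M h0 hne, i.riemannZeta_val, zero_mul, sub_zero, mul_one, norm_div,
    div_pow, ← normSq_eq_norm_sq, ← normSq_eq_norm_sq, normSq_apply, normSq_apply, sub_re, sub_im,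
    one_re, one_im, sub_zero]
  have hd : 0 < i.val.re * i.val.re + i.val.im * i.val.im := by nlinarith
  refine mul_le_mul ?_ (exp_le_exp.mpr ?_) (exp_pos _).le
    (div_nonneg (add_nonneg (mul_self_nonneg _) (mul_self_nonneg _)) hd.le)
  · rw [div_le_div_iff₀ (by norm_num) hd]
    nlinarith [sq_nonneg (i.val.re - 1)]
  · have e : relHeight l i / 4 = 1 / (24 * l ^ 2) * i.val.im ^ 2 := by
      rw [relHeight]
      field_simp
      ring
    have : 0 ≤ 1 / (24 * l ^ 2) * (i.val.re - 1) ^ 2 := by positivity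
    rw [e]
    linarith

theorem one_add_relHeight_mul_exp_le {T l : ℝ} (hL : 9 ≤ log T) (hT : 20 ≤ T) (h1 : 2 * T ≤ l)
    (h2 : l ≤ 2 * (T + 1)) {i : ZetaZero} (hi : 1 / 2 < i.val.re) :
    (1 + relHeight l i) *
      exp (-(3 / 4 * relHeight l i) - 87 * log T * (1 - i.val.re)) ≤ 3.04e-5 := by
  have hl' : l ≤ 2.1 * T := by linarith
  have hq := relHeight_nonneg l i
  have hlog := log_nine_le.2
  have hg := fun {k m : ℝ} (hk : 0 ≤ k) (hm : 6 * m ≤ k ^ 2) =>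
    abs_im_le_of_relHeight_le (l := l) (by linarith) hk hm (i := i)
  have hb := i.re_lt_one
  have hzf := fun {c v D : ℝ} => zero_free_of_le_mul hT hi (c := c) (v := v) (D := D)
  set q := relHeight l i
  set L := log T
  set b := 1 - i.val.re with hbd
  have key : ∀ {A f c : ℝ}, 0 ≤ A → 1 + q ≤ A * exp (3 / 4 * q) → f ≤ 87 * L * b →
      A ≤ c * exp f → (1 + q) * exp (-(3 / 4 * q) - 87 * L * b) ≤ c := by
    intro A f c hA h3 h4 h5
    rw [sub_eq_add_neg, exp_add, ← mul_assoc]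
    have h6 : (1 + q) * exp (-(3 / 4 * q)) ≤ A := by
      rw [exp_neg, ← div_eq_mul_inv, div_le_iff₀ (exp_pos _)]
      exact h3
    calc _ ≤ A * exp (-f) := by gcongr
      _ ≤ _ := by
        rw [exp_neg, ← div_eq_mul_inv, div_le_iff₀ (exp_pos _)]
        exact h5
  have h9 := exp_nine_gt
  rcases le_or_gt q 24 with hq24 | hq24
  · rcases le_or_gt q 6 with hq6 | hq6
    · have hg' : |i.val.im| ≤ 12.6 * T := by
        linarith [hg (k := 6) (by norm_num) (by norm_num) hq6]
      have hlog' : log 12.6 ≤ 2.556 := by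
        have h3 : log 25.2 = log 2 + log 12.6 := by
          rw [← Real.log_mul (by norm_num) (by norm_num)]
          norm_num
        linarith [log_two_gt_d9]
      have h3 := hzf (by norm_num) hlog' hg' (D := 0.7432 * L) (by linarith) (by linarith)
      rw [div_le_iff₀ (by linarith)] at h3
      refine key (A := 1.041) (f := 9 + 1.76) (by norm_num) ?_ (by linarith) ?_
      · have h4 := quadratic_le_exp_of_nonneg (show (0 : ℝ) ≤ 1 / 4 by norm_num)
        have h5 := add_one_le_exp (3 / 4 * q - 1 / 4)
        rw [show 3 / 4 * q = 1 / 4 + (3 / 4 * q - 1 / 4) by ring, exp_add]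
        nlinarith
      · have h4 := quadratic_le_exp_of_nonneg (show (0 : ℝ) ≤ 1.76 by norm_num)
        rw [exp_add]
        nlinarith
    · have hg' : |i.val.im| ≤ 25.2 * T := by
        linarith [hg (k := 12) (by norm_num) (by norm_num) hq24]
      have h3 := hzf (by norm_num) hlog hg' (D := 0.7432 * L + 0.5043) (by linarith) (by linarith)
      rw [div_le_iff₀ (by linarith)] at h3
      have hb0 : 0 ≤ b := by linarith
      refine key (A := 0.1) (f := 9) (by norm_num) ?_ (by nlinarith) (by linarith)
      have h4 := exp_nine_half_gt
      have h5 := add_one_le_exp (3 / 4 * q - 9 / 2)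
      rw [show 3 / 4 * q = 9 / 2 + (3 / 4 * q - 9 / 2) by ring, exp_add]
      nlinarith
  · refine key (A := 3.04e-5) (f := 0) (by norm_num) ?_
      (mul_nonneg (by linarith) (by linarith)) (by norm_num)
    have h4 := add_one_le_exp (3 / 4 * q - 18)
    have h5 : 8096 ^ 2 ≤ exp 18 := by
      rw [show (18 : ℝ) = 9 + 9 by norm_num, exp_add]
      nlinarith
    rw [show 3 / 4 * q = 18 + (3 / 4 * q - 18) by ring, exp_add]
    nlinarith

theorem norm_testFun_zero_le_sieveFun (M : ℂ → ℂ) {T l u : ℝ} (hL : 9 ≤ log T) (hT : 20 ≤ T)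
    (h1 : 2 * T ≤ l) (h2 : l ≤ 2 * (T + 1)) (hu : 106 * log T ≤ u) {i : ZetaZero}
    (hi : 1 / 2 < i.val.re) :
    ‖testFun l u i.val‖ ≤ 3.2e-5 * ‖sieveFun M (19 * log T) (1 / (24 * l ^ 2)) i.val‖ := by
  refine (norm_testFun_zero_le (by linarith) hu i).trans ?_
  refine le_trans ?_ (mul_le_mul_of_nonneg_left (le_norm_sieveFun M (by linarith) hi) (by norm_num))
  have h := one_add_relHeight_mul_exp_le hL hT h1 h2 hi
  set q := relHeight l i
  set L := log T
  set b := 1 - i.val.re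
  set E := exp (-(19 * L * b) - q / 4)
  have e : exp (-q) * exp (-(106 * L * b)) =
      exp (-(3 / 4 * q) - 87 * L * b) * E := by
    rw [← exp_add, ← exp_add]
    congr 1
    ring
  rw [mul_assoc, e]
  have := mul_le_mul_of_nonneg_right h (exp_pos _ : 0 < E).le
  have : 0 < E := exp_pos _
  linarith

theorem norm_testFun_zero_le_zeroWeight {T l u : ℝ} (hL : 9 ≤ log T) (hT : 20 ≤ T)
    (h1 : 2 * T ≤ l) (hu : 106 * log T ≤ u) {i : ZetaZero} (hi : i.val.re ≤ 1 / 2) :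
    ‖testFun l u i.val‖ ≤ 0.01 / T ^ 2 * zeroWeight l i := by
  refine (norm_testFun_zero_le (by linarith) hu i).trans ?_
  rw [zeroWeight_eq (by linarith)]
  have hq := relHeight_nonneg l i
  have h3 := quadratic_le_exp hq
  set q := relHeight l i
  have e : 1 / T ^ 2 = exp (-(2 * log T)) := by
    rw [exp_neg, two_mul, exp_add, Real.exp_log (by linarith), one_div, sq]
  rw [div_eq_mul_one_div, e, mul_one_div, le_div_iff₀ (by positivity)]
  have h4 : exp (-(106 * log T * (1 - i.val.re))) ≤
      exp (-9) * exp (-(2 * log T)) := by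
    rw [← exp_add]
    refine exp_le_exp.mpr ?_
    nlinarith
  have h5 : exp (-9) ≤ 0.001 := by
    rw [exp_neg, inv_le_comm₀ (exp_pos _) (by norm_num)]
    linarith [exp_nine_gt]
  have h6 := (h4.trans (mul_le_mul_of_nonneg_right h5 (exp_pos _).le))
  calc _ = 1.01 * ((1 + q) * (1 + 0.375 * q) * exp (-q)) *
        exp (-(106 * log T * (1 - i.val.re))) := by ring
    _ ≤ 1.01 * (1.12 * exp q * exp (-q)) *
        (0.001 * exp (-(2 * log T))) := by gcongr
    _ = 1.01 * 1.12 * 0.001 * exp (-(2 * log T)) := by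
        rw [mul_assoc 1.12, ← exp_add, add_neg_cancel, exp_zero]
        ring
    _ ≤ _ := by
        gcongr
        norm_num

theorem tsum_testFun_le_of_le_log {T l u : ℝ} (hL : 9 ≤ log T) (hT : 20 ≤ T) (h1 : 2 * T ≤ l)
    (h2 : l ≤ 2 * (T + 1)) (hu : 106 * log T ≤ u) :
    ∑' i : ZetaZero, ‖testFun l u i.val‖ ≤ 0.9 := by
  obtain ⟨hs, hS⟩ := zeroWeight_sum_le hT h1 h2
  obtain ⟨M, hM⟩ := exists_sum_norm_sieveFun_le hL (l := l) (by linarith)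
    (by rw [Real.exp_log (by linarith)]; linarith)
  have hw : ∀ i, 0 ≤ zeroWeight l i := fun i => by
    rw [zeroWeight_eq (by linarith)]
    have := relHeight_nonneg l i
    positivity
  refine tsum_le_of_sum_le (fun i => norm_nonneg _) fun v => ?_
  rw [← Finset.sum_filter_add_sum_filter_not v fun i : ZetaZero => 1 / 2 < i.val.re]
  have hA : ∑ i ∈ v with 1 / 2 < i.val.re, ‖testFun l u i.val‖ ≤ 3.2e-5 * 18900 := by
    have h3 := hM (v.filter fun i => 1 / 2 < i.val.re) fun i hi => (Finset.mem_filter.mp hi).2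
    refine le_trans (Finset.sum_le_sum fun i hi =>
      norm_testFun_zero_le_sieveFun M hL hT h1 h2 hu (Finset.mem_filter.mp hi).2) ?_
    rw [← Finset.mul_sum]
    exact mul_le_mul_of_nonneg_left h3 (by norm_num)
  have hB : ∑ i ∈ v with ¬1 / 2 < i.val.re, ‖testFun l u i.val‖ ≤ 0.1 := by
    refine le_trans (Finset.sum_le_sum fun i hi => norm_testFun_zero_le_zeroWeight hL hT h1 hu
      (not_lt.mp (Finset.mem_filter.mp hi).2)) ?_
    rw [← Finset.mul_sum]
    calc _ ≤ 0.01 / T ^ 2 * (4.25 * T * (log T + 0.36)) := by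
          refine mul_le_mul_of_nonneg_left ?_ (by positivity)
          exact (hs.sum_le_tsum _ fun i _ => hw i).trans hS
      _ ≤ 0.01 / T ^ 2 * (4.25 * T * T) := by
          have := log_le_sub_one_of_pos (show 0 < T by linarith)
          gcongr
          linarith
      _ ≤ _ := by
          field_simp
          norm_num
  linarith

end

/-- Iterated squaring modulo `N`. -/
def iterSqMod (N r m : ℕ) : ℕ := Nat.rec r (fun _ s => Nat.mod (Nat.pow s 2) N) m

theorem iterSqMod_succ (N r m : ℕ) : iterSqMod N r (m + 1) = iterSqMod N r m ^ 2 % N := rfl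

theorem iterSqMod_cast (N r m : ℕ) : (iterSqMod N r m : ZMod N) = (r : ZMod N) ^ 2 ^ m := by
  induction m with
  | zero => simp [iterSqMod]
  | succ m ih =>
    rw [iterSqMod_succ, ZMod.natCast_mod, Nat.cast_pow, ih, ← pow_mul, pow_succ]

/-- Proth's primality criterion with witness `3`. -/
theorem prime_of_proth {k n : ℕ} (hk0 : 0 < k) (hk : k < 2 ^ (n + 1))
    (h : iterSqMod (k * 2 ^ (n + 1) + 1) (3 ^ k % (k * 2 ^ (n + 1) + 1)) n = k * 2 ^ (n + 1)) :
    (k * 2 ^ (n + 1) + 1).Prime := by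
  set N := k * 2 ^ (n + 1) + 1 with hN
  have hN1 : N ≠ 1 := by
    have : 0 < k * 2 ^ (n + 1) := by positivity
    omega
  have h1 : ((3 : ZMod N) ^ k) ^ 2 ^ n = -1 := by
    have h2 := iterSqMod_cast N (3 ^ k % N) n
    rw [h, ZMod.natCast_mod] at h2
    push_cast at h2
    rw [← h2, eq_neg_iff_add_eq_zero]
    have : ((N : ℕ) : ZMod N) = 0 := ZMod.natCast_self N
    rw [hN] at this
    push_cast at this
    exact this
  set q := N.minFac
  have hq : q.Prime := Nat.minFac_prime hN1
  have hqN : q ∣ N := Nat.minFac_dvd N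
  have := Fact.mk hq
  have hq2 : q ≠ 2 := by
    intro h2
    rw [h2, hN] at hqN
    have : 2 ∣ k * 2 ^ (n + 1) := Dvd.dvd.mul_left (dvd_pow_self 2 (Nat.succ_ne_zero n)) k
    omega
  have h3 : ((3 : ZMod q) ^ k) ^ 2 ^ n = -1 := by
    have := congrArg (ZMod.castHom hqN (ZMod q)) h1
    simpa only [map_pow, map_ofNat, map_neg, map_one] using this
  have hne : (-1 : ZMod q) ≠ 1 := by
    have := Fact.mk (lt_of_le_of_ne hq.two_le (Ne.symm hq2))
    exact ZMod.neg_one_ne_one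
  have h4 : orderOf ((3 : ZMod q) ^ k) = 2 ^ (n + 1) := by
    refine orderOf_eq_prime_pow (by rw [h3]; exact hne) ?_
    rw [pow_succ, pow_mul, h3]
    norm_num
  have h5 : (3 : ZMod q) ^ k ≠ 0 := by
    intro h0
    rw [h0, zero_pow (by positivity)] at h3
    exact (neg_ne_zero.mpr one_ne_zero) h3.symm
  have h6 : 2 ^ (n + 1) ∣ q - 1 := by
    rw [← h4]
    exact orderOf_dvd_of_pow_eq_one (ZMod.pow_card_sub_one_eq_one h5)
  have h7 : 2 ^ (n + 1) + 1 ≤ q := by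
    have := Nat.le_of_dvd (by have := hq.two_le; omega) h6
    have := hq.two_le
    omega
  by_contra hnp
  have h8 : q ^ 2 ≤ N := Nat.minFac_sq_le_self (by omega) hnp
  have h9 : N < (2 ^ (n + 1) + 1) ^ 2 := by
    rw [hN]
    nlinarith
  have h10 : (2 ^ (n + 1) + 1) ^ 2 ≤ q ^ 2 := Nat.pow_le_pow_left h7 2
  omega

def prothNumber (k n : ℕ) : ℕ := Nat.succ (Nat.mul k (Nat.pow 2 n))

theorem le_add_rpow_of_pow_le {p q : ℕ} (h : (q - p) ^ 106 ≤ p ^ 105) :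
    (q : ℝ) ≤ p + (p : ℝ) ^ ((105 : ℝ) / 106) := by
  have h1 : ((q - p : ℕ) : ℝ) ≤ (p : ℝ) ^ ((105 : ℝ) / 106) := by
    refine le_of_pow_le_pow_left₀ (n := 106) (by norm_num) (by positivity) ?_
    rw [← Real.rpow_natCast ((p : ℝ) ^ ((105 : ℝ) / 106)), ← Real.rpow_mul (Nat.cast_nonneg p)]
    norm_num
    exact_mod_cast h
  have h2 : q ≤ p + (q - p) := by omega
  have h3 : (q : ℝ) ≤ p + ((q - p : ℕ) : ℝ) := by exact_mod_cast h2
  linarith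

/-- Every interval `[x, x + x ^ (105 / 106)]` with `1 ≤ x ≤ p` contains a prime. -/
def PrimesUpTo (p : ℕ) : Prop := 0 < p ∧ ∀ x : ℝ, 1 ≤ x → x ≤ p →
  ∃ q : ℕ, Nat.Prime q ∧ x ≤ (q : ℝ) ∧ (q : ℝ) ≤ x + x ^ ((105 : ℝ) / 106)

theorem PrimesUpTo.next {p q : ℕ} (hp : PrimesUpTo p) (hq : q.Prime)
    (h : (q - p) ^ 106 ≤ p ^ 105) : PrimesUpTo q := by
  refine ⟨hq.pos, fun x hx hxq => ?_⟩
  rcases le_total x p with h1 | h1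
  · exact hp.2 x hx h1
  · refine ⟨q, hq, hxq, (le_add_rpow_of_pow_le h).trans ?_⟩
    have hp' : (0 : ℝ) < p := by exact_mod_cast hp.1
    gcongr

theorem PrimesUpTo.mono {p q : ℕ} (hq : PrimesUpTo q) (hp : 0 < p) (h : p ≤ q) : PrimesUpTo p :=
  ⟨hp, fun x hx hxp => hq.2 x hx (hxp.trans (by exact_mod_cast h))⟩

/-- Checks that `k * 2 ^ n + 1` is a prime that may follow `p`. -/
def linkCheck (k n p : ℕ) : Bool :=
  and (Nat.ble 1 n) <|
  and (Nat.ble 1 k) <|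
  and (Nat.ble (Nat.succ k) (Nat.pow 2 n)) <|
  and (Nat.beq (iterSqMod (prothNumber k n) (Nat.mod (Nat.pow 3 k) (prothNumber k n)) (Nat.pred n))
    (Nat.mul k (Nat.pow 2 n))) <|
  Nat.ble (Nat.pow (Nat.sub (prothNumber k n) p) 106) (Nat.pow p 105)

theorem PrimesUpTo.of_linkCheck {k n p : ℕ} (hp : PrimesUpTo p) (h : linkCheck k n p = true) :
    PrimesUpTo (prothNumber k n) := by
  unfold linkCheck at h
  simp only [Bool.and_eq_true] at h
  obtain ⟨h1, h2, h3, h4, h5⟩ := h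
  refine hp.next ?_ (Nat.le_of_ble_eq_true h5)
  obtain ⟨m, rfl⟩ := Nat.exists_eq_succ_of_ne_zero (Nat.pos_iff_ne_zero.mp (Nat.le_of_ble_eq_true h1))
  exact prime_of_proth (Nat.le_of_ble_eq_true h2) (Nat.le_of_ble_eq_true h3)
    (Nat.eq_of_beq_eq_true h4)

/-- The multiplier encoded by the last digit of `w` in base `b`, for the exponent `n`. -/
def wordHead (b o n w : ℕ) : ℕ :=
  Nat.add (Nat.mul 3 (Nat.add (Nat.mod w b) o)) (Nat.succ (Nat.mod n 2))

/-- Checks the links with exponent `n` encoded by the base `b` digits of `w`, starting from `p`, and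
passes the last prime to `c`. -/
def wordCheck (b o n : ℕ) (c : ℕ → Bool) (m : ℕ) : ℕ → ℕ → Bool :=
  Nat.rec (fun _ p => c p) (fun _ ih w p => Bool.rec
    (and (linkCheck (wordHead b o n w) n p) (ih (Nat.div w b) (prothNumber (wordHead b o n w) n)))
    (c p) (Nat.beq w 0)) m

theorem PrimesUpTo.of_wordCheck {b o n : ℕ} {c : ℕ → Bool} {m w p : ℕ} (hp : PrimesUpTo p)
    (h : wordCheck b o n c m w p = true) : ∃ q, PrimesUpTo q ∧ c q = true := by
  induction m generalizing w p with
  | zero => exact ⟨p, hp, h⟩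
  | succ m ih =>
    change Bool.rec (and _ (wordCheck b o n c m _ _)) (c p) (Nat.beq w 0) = true at h
    cases hw : Nat.beq w 0 with
    | true =>
      rw [hw] at h
      exact ⟨p, hp, h⟩
    | false =>
      rw [hw] at h
      obtain ⟨h1, h2⟩ := (Bool.and_eq_true _ _).mp h
      exact ih (hp.of_linkCheck h1) h2

/-- Checks a chain from `p` to `t`, one word for each exponent, starting with `n`. -/
def chainCheck (b o t : ℕ) (l : List ℕ) : ℕ → ℕ → Bool :=
  List.rec (fun _ p => Nat.ble t p)
    (fun w _ ih n p => wordCheck b o n (fun q => ih (Nat.succ n) q) 20 w p) l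

theorem PrimesUpTo.of_chainCheck {b o t : ℕ} (ht : 0 < t) {l : List ℕ} {n p : ℕ}
    (hp : PrimesUpTo p) (h : chainCheck b o t l n p = true) : PrimesUpTo t := by
  induction l generalizing n p with
  | nil => exact hp.mono ht (Nat.le_of_ble_eq_true h)
  | cons w l ih =>
    have h' : wordCheck b o n (chainCheck b o t l (n + 1)) 20 w p = true := h
    obtain ⟨q, hq, hq'⟩ := hp.of_wordCheck h'
    exact ih hq hq'

theorem primesUpTo_151 : PrimesUpTo 151 := by
  have h : PrimesUpTo 1 := ⟨one_pos, fun x hx hx' => ⟨2, Nat.prime_two, by norm_num at *; linarith,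
    by rw [le_antisymm (by exact_mod_cast hx') hx]; norm_num⟩⟩
  exact (((((((((h.next (q := 2) (by norm_num) (by norm_num)).next (q := 3) (by norm_num)
    (by norm_num)).next (q := 5) (by norm_num) (by norm_num)).next (q := 7) (by norm_num)
    (by norm_num)).next (q := 13) (by norm_num) (by norm_num)).next (q := 23) (by norm_num)
    (by norm_num)).next (q := 43) (by norm_num) (by norm_num)).next (q := 83) (by norm_num)
    (by norm_num)).next (q := 151) (by norm_num) (by norm_num))

theorem primesUpTo_two_pow_33 : PrimesUpTo (2 ^ 33) :=
  primesUpTo_151.of_chainCheck (b := 10000) (o := 0) (n := 5) (by norm_num) (l := [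
  600040002, 1400080006, 3600200011, 600033, 1060056, 33101810096, 5810310, 9950537, 17090923,
    531828961572, 88834868, 8099, 7356, 6671, 6033]) (by decide +kernel)

set_option maxRecDepth 2000 in
theorem primesUpTo_chain_middle : PrimesUpTo (29939 * 2 ^ 425) :=
  primesUpTo_two_pow_33.of_chainCheck (b := 10000) (o := 9600) (n := 17) (by norm_num) (l := [
  0, 9987, 8036, 6229, 4576, 3071, 1701, 82340448, 6193, 4353, 2693, 93581205, 6996, 4892, 3023,
    94191372, 6834, 4573, 2604, 83620865, 5766, 3521, 94351584, 6568, 4101, 1973, 68290160, 4200,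
    1976, 65840088, 3894, 90441629, 5856, 3191, 77980956, 4713, 2137, 61490028, 3261, 74740884,
    4276, 86341657, 5121, 94702280, 5733, 2711, 61530271, 2979, 63720427, 3093, 62700423, 2952,
    59520277, 96522648, 5495, 88342182, 4799, 78471603, 3975, 67350934, 3034, 54130166, 82181975,
    4062, 64660881, 91782694, 4704, 68651208, 94182919, 4774, 68541276, 91482825, 4524, 62560949,
    81602296, 3687, 51790298, 68121423, 85202608, 3833, 50020297, 63461199, 76442135, 90223093,
    4057, 49720391, 59611046, 69771764, 79712476, 89473172, 98033788, 4433, 50230521, 55970949,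
    60691301, 64981639, 66811777, 70042027, 72432251, 73852357, 75172476, 75682531, 74692489,
    74292455, 72792392, 70532238, 67552081, 64771863, 60681656, 56721349, 52151026, 47500719,
    956642130342, 87283697, 79213058, 70582489, 62291887, 53111231, 957444450623, 83223509,
    71372649, 59691847, 48641015, 863737890223, 71812744, 58111751, 936844630830, 76223217,
    60212009, 944445520908, 74963199, 57651877, 887842360716, 69632771, 52091473, 783734720219,
    58562018, 836639190554, 61562258, 863541930853, 62972476, 863942040881, 61952379, 842740930818,
    59922263, 775136240621, 52091715, 695031020092, 872844391202, 59122346, 750335500486,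
    902947321515, 61172503, 734835490569, 863845401323, 55772194, 669830540193, 778939440899,
    891648151606, 55732197, 647229270148, 704634660591, 753138311056, 809842601329, 861646731677,
    910750731911, 956855102281, 56852540, 599326820083, 9918599126930136, 59182695,
    9818585226850212, 949755412441, 939855642439, 920553492318, 895352752230, 862749672022,
    819946291784, 756441411434, 683736671039, 631132130652, 9569578827690317, 886552752351,
    807546621884, 721239271323, 631732960824, 8754520823530203, 776844581769, 673936381133,
    9118556626820478, 786345651906, 669836321150, 8942554327520437, 747942981741, 9356590631210836,
    774745832020, 9759622434161029, 802348182201, 9673626034181084, 770046522090, 9232589731430928,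
    727843091826, 8586544127730576, 652036731417, 7672466422160151, 8588556729140843, 643336731376,
    7404447020920083, 8369529827420674, 9344611434421217, 684640611808, 7237440321190188,
    7598475324880462, 8167522627740702, 8734570631691059, 8959595834121322, 9178613636061448,
    9359626736961563, 9518643038651725, 9592654439921813, 9619652839641807, 9411636938841844,
    9135620137631663, 8759589834721448, 8512572333071281, 8119534630391112, 7720502327510826,
    7075451324040555, 92346421396219740259, 8511574934861498, 7479497828190963,
    92826689428522420449, 8304560733291496, 98246918446826260913, 8680596337191768,
    7515498428200992, 89266207393919730263, 7841529731211253, 91756461421622300534,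
    7638524531171292, 89086366410121380461, 7437505930091206, 83665880372518300265,
    87706200398222440602, 98377117483628491098, 7524528332961664, 79345520345116890325,
    85496089395920770544, 92266711446925670896, 95837022478728631238, 7438517831891476,
    75905437351917770244, 78185478347318690338, 79415642363119480443, 74545261350318160326,
    991874105214331316100160, 7289508431721598, 972672065069322815670116, 94987154501631111478,
    93056885477729371344, 88266479445326731159, 79495742381421330683, 997374965346345118780439,
    92206847489430601560, 85196303434126061121, 79175782390222120749, 953471735099327417180355,
    85696344437326451150, 984777815661379921490704, 85646396448229141441, 76135538378321700736,
    838462504353269213440143, 936371335151337918510622, 77715724389724161047,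
    830862604400292614440208, 902269004972326817550557, 944672585299368123390934,
    902868594976357323311158, 944673405390368522400938, 74685525382324371084,
    9521746356543932238111940032, 946373685624394424071144, 930072565349389524041095,
    927271575274366322301035, 935372435374370322311004, 933272815403375923111048,
    916871035275374523031028, 888869685242361722300948, 855165874889331419480744,
    768658124151269716610492, 8995698653053709232912230085, 837865054942338020420792,
    769458734234275614620323, 8658679153363782237711370069, 768959704374290015760599,
    8839691452243684233710890005, 767658784298291716490586, 8841695252573733237911390037,
    9625764359354359294418450664, 858567325063361722581073, 8194664750633643234613880457,
    8537671851983798261614040283, 8830702153933919258113710271, 8800706453974009265514540544,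
    8919715654974211293816990589, 98747999640250093607243415660656, 832565764990357922841148,
    8277662750743764254313700307, 8539678352083771248613540286, 8157661450483758254914910418,
    98398013638848833543228612200221, 9395759460354547329920641070, 9027731157214298297618230811,
    8843713955744174290317410668, 8105645550503750254915240503, 85247103556244523137197909040137,
    92397569612347623584241713140331, 8426688453783998280416770657,
    91597440588845453293223612740280, 93597675620048783827260416340657,
    8212659751293909269217610739, 87827236575343873196207111120186,
    85047035562043203110215311050375, 83946862541441433088210512140265,
    985981426628520239222942186810370223, 8323683154244118296319940971,
    998982796738537441663018191509310113, 94807835639051143833281917840845,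
    85316967558443323408242214830774, 901875516178486736762654197110140156,
    84097189583845243391230914060536, 926876746237506838602778174811230217,
    992785537189581846423511243314530571, 89397467604248583803286319010979,
    917178596416515440113004200312780501, 927877446492522440492969201811050344,
    86377234587646383637257315780662, 918376766297501738632806182410140259,
    905175636231501038342836189510410581, 900375656264508940043047210012850488,
    889676116229496938072731192210030434, 860472776017478936422869193711640309,
    890575416243499139312886193310160281, 9662814567585599473538042880191510340243,
    914676996389524943173233244715260703, 882174686243509439782966211612330464,
    878373586055489839402914194811130344, 851372976063487738482824190711190342,
    815468895639447236332803188410040211, 8573722659494848385731392174134105390006,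
    819369195866474636832689176509660214, 99548888749764135228444033942464156507470014,
    909778766668559345363493258817590926, 8601728965045312431435382637181210030459,
    9243789066305533441834112549166309480225, 9558840571355922486538332860207012550459,
    9304814669025701467739543013213214980694, 8811748366925528443336232717185912580489,
    97218710739461745089410831862416173009810309, 9460811568825855474739853062232515090719,
    9464813169315763476837672998219814030632, 9489822769925817473137622929211213390651,
    9220800467915676465536763041219913690621, 8870758364235348433833872585174712640508,
    94178152708660135109418633742524169210070298, 8748753166485529455836012724190812290478,
    97858488727662755303429533492521171109400245, 9022777566595624461837282820209314140774,
    8398733963695424440834992609178210340349, 87717616653954544447362827582059127106040044,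
    87737768660658034804386330002184146007790189, 87427528642857234712383529392175149309130213,
    877175716666581152314304361327622093138107420197, 90727916677458174822391831322303162909160223,
    992386997560652556114746385631012283158010430374, 89377832683757804969443835252749212214470767,
    85287362653155674628374628962261158609220273, 902180867024612951464219335225181889118605780086,
    925681197018599352004406351026851998138609100324, 85427439649454784542379730352307160911080445,
    894279046874585748994081344827031952122107040057,
    9612847673516309531243963708291422771554111906080251,
    88597768680959685016422533712604184511800623, 948983627347629953454429356227531998138907180173,
    9109810870346332543145323702305623521831117305840321,
    9572843273316302538645823779306423021817122106460203,
    881977016716576648784071324124611860145409080274,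
    9127819071586229537444853682303726381939135007180154,
    9213812473446468589850414241350727662076137708040326,
    9484836674446472558748694079328825211878120108280237,
    9521841473806404570850614246353927582118146409400489,
    9964886278586862590851034322352427692053136509720427,
    934684437601663256874834408433142556184912680629,
    8811783168976059514644683682291722411556109605220368,
    99959113805870546308543946083954317525192004134107430154,
    9122818973386490566448924173341326631965173412550718,
    99718869786268886008511743093522288324731877126908990296,
    9527852475416734606751894357358428812231171911690571,
    96998705771968236196538647993988333928632250167410710496,
    98008792776968885975515744874110336926642028138308890433,
    9076814872226344580849934276350727932338168711060539,
    8793780269716078535345333792307923911726115606960233,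
    91538150725663315485467540083465278622601656104606410083,
    86647734706361675320460238773232278221441514101205690230,
    92538291734465725838500642473506280722121684111105670039,
    935783747739696661865387487740963456290322321744113907980352,
    94308443761867485873508345313799308124701836124107880326,
    98208798786569456163537346043902320326552047146208730334, 379]) (by decide +kernel)

theorem primesUpTo_two_pow_459 : PrimesUpTo (2 ^ 459) :=
  primesUpTo_chain_middle.of_chainCheck (b := 100000) (o := 40000) (n := 422) (by norm_num) (l := [
  4902244326, 48925443253999335755317542794924356210591798114959122380950006935,
    48464439083953235443314792773224162208941770514790121380946806940,
    3786734141303182671323234201041703614357115410922206662,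
    36302325122884125266218891881315782129991034307824053660302100972,
    3716533191298132623622821196261713414260114810886106433044840222000063,
    3931435322315092786824400214351834215465126631000407435050080270200597,
    455334119137051332242948325961226721949616507138541112408752063280395801778,
    380493421830484270642365620521174681472112054095460736305014,
    5029945825416233783033911307682719323891210451832915593127801016907896054690316901094,
    418983787034013308032726823953209721805415315125331001707535,
    465334227938429345313085627329239982098817988151681246209864074330517703102,
    42772386823484731142276582444321331183421548212806102770784105524,
    37025333752977926363231012038517776149831252309964078340547903536,
    397623611732589291182580222640196821680914065114580909806702045200253900479,
    3788734224309712757824313212111825915438128071024607954060220402901894,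
    44714408183702933348298162646123273202541735214589119890963907293050040298700929,
    39340356213217128879255982249319490166291404611456089990665904481,
    3727333685302122712023954209581814415468128321043208087057980370301658,
    378943429930827276162463121654188471608213442109810859806351041920230800567, 45830261600639])
  (by decide +kernel)

set_option exponentiation.threshold 1000 in
theorem exists_prime_of_le_exp {x : ℝ} (hx : 1 ≤ x) (hx' : x ≤ Real.exp 318) :
    ∃ p : ℕ, Nat.Prime p ∧ x ≤ (p : ℝ) ∧ (p : ℝ) ≤ x + x ^ ((105 : ℝ) / 106) := by
  refine primesUpTo_two_pow_459.2 x hx (hx'.trans ?_)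
  have h1 : Real.exp 318 = Real.exp 1 ^ 318 := by
    rw [← Real.exp_nat_mul]
    norm_num
  rw [h1]
  refine (pow_le_pow_left₀ (Real.exp_pos 1).le Real.exp_one_lt_d9.le 318).trans ?_
  norm_num

theorem exists_prime_of_exp_le {x : ℝ} (hx : Real.exp 318 ≤ x) :
    ∃ p : ℕ, Nat.Prime p ∧ x ≤ (p : ℝ) ∧ (p : ℝ) ≤ x + x ^ ((105 : ℝ) / 106) := by
  have hx0 : 0 < x := (Real.exp_pos _).trans_le hx
  obtain ⟨T, hT⟩ : ∃ T, T = x ^ ((1 : ℝ) / 106) := ⟨_, rfl⟩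
  have hT0 : 0 < T := hT ▸ Real.rpow_pos_of_pos hx0 _
  have hlog : 106 * Real.log T = Real.log x := by
    rw [hT, Real.log_rpow hx0]
    ring
  have h318 : 318 ≤ Real.log x := (Real.le_log_iff_exp_le hx0).mpr hx
  have h20 : 20 ≤ T := by
    have h := Real.exp_le_exp.mpr (show 3 ≤ Real.log T by linarith)
    rw [Real.exp_log hT0] at h
    linarith [exp_three_gt]
  have hxT : x = T ^ 106 := by
    rw [hT, ← Real.rpow_natCast, ← Real.rpow_mul hx0.le]
    norm_num
  have hdiv : x / T = x ^ ((105 : ℝ) / 106) := by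
    rw [hT, show (105 : ℝ) / 106 = 1 - 1 / 106 by norm_num, Real.rpow_sub hx0, Real.rpow_one]
  have h1 := two_mul_le_width hT0
  have h2 := width_le hT0
  have hu : 106 * Real.log T ≤ Real.log x + 1 / (2 / Real.log (1 + 1 / T)) := by
    rw [hlog, le_add_iff_nonneg_right]
    exact one_div_nonneg.mpr (by linarith)
  rw [← hdiv]
  refine exists_prime_of_sum_zeros h20 hxT rfl ?_
  rcases le_total (Real.log T) 9 with h | h
  · exact tsum_testFun_le_of_log_le (by linarith) h h20 h1 h2 hu
  · exact tsum_testFun_le_of_le_log h h20 h1 h2 hu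

end PrimeGap

/-- For every real `x ≥ 1`, the interval `[x, x + x^(105/106)]` contains a prime. -/
theorem primes_in_short_intervals_106 (x : ℝ) (hx : 1 ≤ x) :
    ∃ p : ℕ, Nat.Prime p ∧ x ≤ (p : ℝ) ∧ (p : ℝ) ≤ x + x ^ ((105 : ℝ) / 106) := by
  rcases le_total x (Real.exp 318) with h | h
  · exact PrimeGap.exists_prime_of_le_exp hx h
  · exact PrimeGap.exists_prime_of_exp_le h
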